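/- Let G be a finite insoluble group such that for some x ∈ G, the set Sol_G(x) is the underlying set of a maximal subgroup of G that is a metacyclic 2-group, and suppose that every minimal normal subgroup of G is abelian. Then there is a Mersenne prime p ≥ 7 (p = 2^n − 1) such that either G is isomorphic to SL(2,p), or G contains a normal subgroup of index 2 isomorphic to SL(2,p) (i.e. G ≅ SL(2,p) ⋊ C₂). -/

import Mathlib

/-- The solubilizer of an element `x` of a group `G`: the set of all `y ∈ G`
such that the subgroup generated by `x` and `y` is soluble. -/
def solubilizer {G : Type*} [Group G] (x : G) : Set G :=
  {y | IsSolvable ↥(Subgroup.closure ({x, y} : Set G))}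

/-- A group is metacyclic if it has a cyclic normal subgroup with cyclic quotient. -/
def IsMetacyclic (Q : Type*) [Group Q] : Prop :=
  ∃ C : Subgroup Q, ∃ _ : C.Normal, IsCyclic C ∧ IsCyclic (Q ⧸ C)

/-- The centralizer of the involution `z` has order `2 * m`, contains the cyclic group `A` of
order `m`, a power of `2`, all its elements outside `A` square to one, all involutions are conjugate
to `z`, and the number of involutions is odd. -/
structure DihedralData {H : Type*} [Group H] (z : H) (A : Subgroup H) (m : ℕ) : Prop where
  two_pow : ∃ a, 2 ≤ a ∧ m = 2 ^ a
  card_eq : Nat.card A = m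
  cyclic : IsCyclic A
  mem : z ∈ A
  ne_one : z ≠ 1
  mul_self : z * z = 1
  comm : ∀ a ∈ A, a * z = z * a
  card_centralizer : Nat.card (Subgroup.centralizer {z}) = 2 * m
  mul_self_of_notMem : ∀ s, s * z = z * s → s ∉ A → s * s = 1
  isConj : ∀ v, v ≠ 1 → v * v = 1 → ∃ g, v = g * z * g⁻¹
  odd_index : Odd (Subgroup.centralizer {z}).index

/-- `v` is an involution. -/
def IsInvolution {H : Type*} [Group H] (v : H) : Prop := v ≠ 1 ∧ v * v = 1

namespace IsInvolution

variable {H : Type*} [Group H] {v w g : H}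

theorem inv_eq (h : IsInvolution v) : v⁻¹ = v := inv_eq_of_mul_eq_one_left h.2

theorem conj (h : IsInvolution v) (g : H) : IsInvolution (g * v * g⁻¹) := by
  refine ⟨fun h1 => h.1 ?_, ?_⟩
  · simpa using h1
  · have := h.2
    calc g * v * g⁻¹ * (g * v * g⁻¹) = g * (v * v) * g⁻¹ := by group
      _ = 1 := by rw [this]; simp

theorem mul_mul_cancel (h : IsInvolution v) (x : H) : v * (v * x) = x := by
  rw [← mul_assoc, h.2, one_mul]

end IsInvolution

theorem IsCyclic.exists_pow_eq_of_mul_self {A : Type*} [Group A] [Finite A] [IsCyclic A] {b : A}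
    (hb : IsInvolution b) {c : A} (hc : IsInvolution c) : b = c := by
  classical
  have := Fintype.ofFinite A
  have h2 := IsCyclic.card_pow_eq_one_le (α := A) (n := 2) (by norm_num)
  by_contra hne
  have h3 : ({1, b, c} : Finset A).card = 3 := by
    rw [Finset.card_eq_three]
    exact ⟨1, b, c, hb.1.symm, hc.1.symm, hne, rfl⟩
  have h4 : ({1, b, c} : Finset A) ⊆ ({a | a ^ 2 = 1} : Finset A) := by
    intro x hx
    simp only [Finset.mem_insert, Finset.mem_singleton] at hx
    simp only [Finset.mem_filter, Finset.mem_univ, true_and]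
    rcases hx with rfl | rfl | rfl
    · simp
    · rw [sq, hb.2]
    · rw [sq, hc.2]
  have := Finset.card_le_card h4
  omega

/-- A nontrivial element of `2`-power order has an involution among its powers. -/
theorem exists_isInvolution_pow {H : Type*} [Group H] {x : H} {n : ℕ} (hx : x ^ 2 ^ n = 1)
    (h1 : x ≠ 1) : ∃ j, IsInvolution (x ^ j) := by
  induction n generalizing x with
  | zero => simp at hx; exact absurd hx h1
  | succ n ih =>
    by_cases h : x * x = 1
    · exact ⟨1, by simpa [IsInvolution] using ⟨h1, h⟩⟩
    · have : (x * x) ^ 2 ^ n = 1 := by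
        rw [← sq, ← pow_mul, ← pow_succ', hx]
      obtain ⟨j, hj⟩ := ih this h
      refine ⟨2 * j, ?_⟩
      rwa [pow_mul, sq]

namespace DihedralData

variable {H : Type*} [Group H] {z : H} {A : Subgroup H} {m : ℕ}

theorem involution (h : DihedralData z A m) : IsInvolution z := ⟨h.ne_one, h.mul_self⟩

theorem conj (h : DihedralData z A m) (g : H) :
    DihedralData (g * z * g⁻¹) (A.map (MulAut.conj g).toMonoidHom) m := by
  have hc : Subgroup.centralizer {g * z * g⁻¹} =
      (Subgroup.centralizer {z}).map (MulAut.conj g).toMonoidHom := by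
    ext x
    simp only [Subgroup.mem_centralizer_singleton_iff, Subgroup.mem_map]
    constructor
    · intro hx
      refine ⟨g⁻¹ * x * g, ?_, by simp [mul_assoc]⟩
      have := congrArg (fun y => g⁻¹ * y * g) hx
      simpa [mul_assoc] using this
    · rintro ⟨y, hy, rfl⟩
      have := congrArg (fun y => g * y * g⁻¹) hy
      simpa [mul_assoc] using this
  have hinj : Function.Injective (MulAut.conj g).toMonoidHom := (MulAut.conj g).injective
  refine ⟨h.two_pow, ?_, ?_, ⟨z, h.mem, by simp⟩, ?_, ?_, ?_, ?_, ?_, ?_, ?_⟩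
  · rw [Subgroup.card_map_of_injective hinj, h.card_eq]
  · have := h.cyclic
    exact isCyclic_of_surjective (A.equivMapOfInjective _ hinj) (MulEquiv.surjective _)
  · intro h1
    exact h.ne_one (by simpa using h1)
  · calc g * z * g⁻¹ * (g * z * g⁻¹) = g * (z * z) * g⁻¹ := by group
      _ = 1 := by rw [h.mul_self]; simp
  · rintro _ ⟨a, ha, rfl⟩
    have := congrArg (fun y => g * y * g⁻¹) (h.comm a ha)
    simpa [mul_assoc] using this
  · rw [hc, Subgroup.card_map_of_injective hinj, h.card_centralizer]
  · intro s hs hsA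
    have h1 : (g⁻¹ * s * g) * (g⁻¹ * s * g) = 1 := by
      apply h.mul_self_of_notMem
      · have := congrArg (fun y => g⁻¹ * y * g) hs
        simpa [mul_assoc] using this
      · intro hA
        exact hsA ⟨_, hA, by simp [mul_assoc]⟩
    have := congrArg (fun y => g * y * g⁻¹) h1
    simpa [mul_assoc] using this
  · intro v h1 h2
    obtain ⟨x, hx⟩ := h.isConj v h1 h2
    exact ⟨x * g⁻¹, by rw [hx]; simp [mul_assoc]⟩
  · rw [hc]
    have := Subgroup.index_map_equiv (Subgroup.centralizer {z}) (MulAut.conj g)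
    have h2 := h.odd_index
    rw [← this] at h2
    exact h2

theorem inverts (h : DihedralData z A m) {s a : H} (hs : s * z = z * s) (hsA : s ∉ A)
    (ha : a ∈ A) : s * a * s⁻¹ = a⁻¹ := by
  have h1 := h.mul_self_of_notMem s hs hsA
  have h2 := h.mul_self_of_notMem (s * a) (by
    rw [mul_assoc, h.comm a ha, ← mul_assoc, hs, mul_assoc]) (by
    intro h3
    exact hsA ((Subgroup.mul_mem_cancel_right _ ha).1 h3))
  rw [inv_eq_of_mul_eq_one_left h1]
  exact eq_inv_of_mul_eq_one_left (by simpa [mul_assoc] using h2)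

theorem four_le (h : DihedralData z A m) : 4 ≤ m := by
  obtain ⟨a, ha, rfl⟩ := h.two_pow
  calc 4 = 2 ^ 2 := rfl
    _ ≤ 2 ^ a := Nat.pow_le_pow_right (by norm_num) ha

theorem card_eq_mul (h : DihedralData z A m) :
    Nat.card H = 2 * m * (Subgroup.centralizer {z}).index := by
  rw [← h.card_centralizer, Subgroup.card_mul_index]

theorem le_centralizer (h : DihedralData z A m) : A ≤ Subgroup.centralizer {z} := fun a ha =>
  Subgroup.mem_centralizer_singleton_iff.2 (h.comm a ha)

theorem exists_of_isInvolution (h : DihedralData z A m) {v : H} (hv : IsInvolution v) :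
    ∃ B : Subgroup H, DihedralData v B m := by
  obtain ⟨g, rfl⟩ := h.isConj v hv.1 hv.2
  exact ⟨_, h.conj g⟩

theorem mul_mem (h : DihedralData z A m) {s s' : H} (hs : s * z = z * s) (hsA : s ∉ A)
    (hs' : s' * z = z * s') (hsA' : s' ∉ A) : s * s' ∈ A := by
  have h4 := h.four_le
  have h1 : (A.subgroupOf (Subgroup.centralizer {z})).index = 2 := by
    have := Subgroup.card_mul_index (A.subgroupOf (Subgroup.centralizer {z}))
    rw [h.card_centralizer, Nat.card_congr (Subgroup.subgroupOfEquivOfLe h.le_centralizer).toEquiv,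
      h.card_eq] at this
    exact Nat.eq_of_mul_eq_mul_left (by omega : 0 < m) (by linarith)
  have := Subgroup.mul_mem_iff_of_index_two h1
    (a := ⟨s, Subgroup.mem_centralizer_singleton_iff.2 hs⟩)
    (b := ⟨s', Subgroup.mem_centralizer_singleton_iff.2 hs'⟩)
  simp only [Subgroup.mem_subgroupOf, MulMemClass.mk_mul_mk] at this
  tauto

variable [Finite H]

theorem eq_of_mem (h : DihedralData z A m) {a : H} (ha : a ∈ A) (hi : IsInvolution a) : a = z := by
  have := h.cyclic
  have h1 : (⟨a, ha⟩ : A) = ⟨z, h.mem⟩ :=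
    IsCyclic.exists_pow_eq_of_mul_self ⟨fun h1 => hi.1 (congrArg Subtype.val h1),
      Subtype.ext hi.2⟩ ⟨fun h1 => h.ne_one (congrArg Subtype.val h1),
      Subtype.ext h.mul_self⟩
  exact congrArg Subtype.val h1

theorem exists_pow_eq (h : DihedralData z A m) {a : H} (ha : a ∈ A) (h1 : a ≠ 1) :
    ∃ j, a ^ j = z := by
  obtain ⟨n, -, hn⟩ := h.two_pow
  have hp : a ^ 2 ^ n = 1 := by
    have : (⟨a, ha⟩ : A) ^ Nat.card A = 1 := pow_card_eq_one'
    rw [h.card_eq, hn] at this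
    exact congrArg Subtype.val this
  obtain ⟨j, hj⟩ := exists_isInvolution_pow hp h1
  exact ⟨j, h.eq_of_mem (pow_mem ha j) hj⟩

theorem commute_of_commute (h : DihedralData z A m) {a g : H} (ha : a ∈ A) (h1 : a ≠ 1)
    (hg : g * a = a * g) : g * z = z * g := by
  obtain ⟨j, rfl⟩ := h.exists_pow_eq ha h1
  exact (Commute.pow_right hg j).eq

theorem commute_of_inverts (h : DihedralData z A m) {a g : H} (ha : a ∈ A) (h1 : a ≠ 1)
    (hg : g * a * g⁻¹ = a⁻¹) : g * z = z * g := by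
  obtain ⟨j, hj⟩ := h.exists_pow_eq ha h1
  have : g * z * g⁻¹ = z := by
    rw [← hj, ← conj_pow, hg, inv_pow, hj, h.involution.inv_eq]
  rwa [mul_inv_eq_iff_eq_mul] at this

theorem exists_pow_isInvolution (h : DihedralData z A m) {v x : H} (hv : IsInvolution v)
    (hx : v * x = x * v) (h1 : x ≠ 1) : ∃ j, IsInvolution (x ^ j) := by
  obtain ⟨B, hB⟩ := h.exists_of_isInvolution hv
  by_cases hxB : x ∈ B
  · obtain ⟨j, hj⟩ := hB.exists_pow_eq hxB h1
    exact ⟨j, hj ▸ hv⟩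
  · exact ⟨1, by simpa using ⟨h1, hB.mul_self_of_notMem x hx.symm hxB⟩⟩

end DihedralData

/-- A nontrivial subgroup inverted by the involution `v`, no nontrivial element of which commutes
with an involution, and which is the centralizer of each of its nontrivial elements. -/
structure IsTorus {H : Type*} [Group H] (T : Subgroup H) (v : H) : Prop where
  ne_bot : T ≠ ⊥
  free : ∀ h ∈ T, h ≠ 1 → ∀ w, IsInvolution w → w * h ≠ h * w
  involution : IsInvolution v
  inverts : ∀ h ∈ T, v * h * v = h⁻¹
  centralizer_eq : ∀ h ∈ T, h ≠ 1 → Subgroup.centralizer {h} = T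

namespace IsInvolution

variable {H : Type*} [Group H] [Finite H] {v w g : H}

/-- An involution acting without fixed points on a finite subgroup inverts it. -/
theorem inverts_of_normalizes (hv : IsInvolution v) {T : Subgroup H}
    (hT : ∀ h ∈ T, v * h * v ∈ T) (hfree : ∀ h ∈ T, h ≠ 1 → v * h ≠ h * v) :
    ∀ h ∈ T, v * h * v = h⁻¹ := by
  let φ : T →* T :=
    { toFun := fun h => ⟨v * h * v, hT h h.2⟩
      map_one' := Subtype.ext (by simpa using hv.2)
      map_mul' := fun a b => Subtype.ext (by
        simp only [Subgroup.coe_mul, mul_assoc, hv.mul_mul_cancel]) }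
  have hφ : MonoidHom.FixedPointFree φ := by
    intro g hg
    by_contra hne
    have h1 : v * g * v = (g : H) := congrArg Subtype.val hg
    apply hfree g g.2 (fun h => hne (Subtype.ext h))
    have := congrArg (fun y => y * v) h1
    simpa [mul_assoc, hv.2] using this
  have h2 : Function.Involutive φ := fun a => Subtype.ext (by
    change v * (v * a * v) * v = a
    simp [mul_assoc, hv.mul_mul_cancel, hv.2])
  intro h hh
  have := congrFun (hφ.coe_eq_inv_of_involutive h2) ⟨h, hh⟩
  exact congrArg Subtype.val this

end IsInvolution

namespace IsTorus

variable {H : Type*} [Group H] {z v : H} {A T : Subgroup H} {m : ℕ}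

open scoped Pointwise

theorem mul_comm (hT : IsTorus T v) {a b : H} (ha : a ∈ T) (hb : b ∈ T) : a * b = b * a := by
  have h1 := hT.inverts _ (T.mul_mem ha hb)
  have h2 : v * a * v * (v * b * v) = v * (a * b) * v := by
    simp only [mul_assoc, hT.involution.mul_mul_cancel]
  rw [hT.inverts a ha, hT.inverts b hb, h1] at h2
  simpa using (congrArg (·⁻¹) h2).symm

theorem notMem_of_isInvolution (hT : IsTorus T v) {w : H} (hw : IsInvolution w) : w ∉ T :=
  fun h => hT.free w h hw.1 w hw rfl

/-- An element conjugating a nontrivial element of `T` into `T` normalizes `T`. -/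
theorem mem_normalizer (hT : IsTorus T v) {x h : H} (hh : h ∈ T) (h1 : h ≠ 1)
    (hx : x * h * x⁻¹ ∈ T) : x ∈ Subgroup.normalizer (T : Set H) := by
  have h2 : x * h * x⁻¹ ≠ 1 := by simpa using h1
  rw [Subgroup.mem_normalizer_iff]
  intro y
  have e : ∀ h ∈ T, h ≠ 1 → ∀ y, y ∈ T ↔ y * h = h * y := fun h hh h1 y => by
    rw [← Subgroup.mem_centralizer_singleton_iff, hT.centralizer_eq h hh h1]
  rw [e h hh h1, e _ hx h2]
  constructor
  · intro hy
    have := congrArg (fun y => x * y * x⁻¹) hy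
    simpa [mul_assoc] using this
  · intro hy
    have := congrArg (fun y => x⁻¹ * y * x) hy
    simpa [mul_assoc] using this

theorem mul_mem (hT : IsTorus T v) {w : H} (hw : IsTorus T w) : v * w ∈ T := by
  obtain ⟨h, hh, h1⟩ := T.bot_or_exists_ne_one.resolve_left hT.ne_bot
  rw [← hT.centralizer_eq h hh h1, Subgroup.mem_centralizer_singleton_iff]
  have h2 : w * h = h⁻¹ * w := by
    rw [← hw.inverts h hh]; simp [mul_assoc, hw.involution.2]
  have h3 : v * h⁻¹ = h * v := by
    rw [← hT.inverts h hh]; simp [mul_assoc, hT.involution.mul_mul_cancel]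
  rw [mul_assoc, h2, ← mul_assoc, h3, mul_assoc]

theorem le_normalizer : T ≤ Subgroup.normalizer (T : Set H) := Subgroup.le_normalizer

theorem mul_eq_inv_mul (hT : IsTorus T v) {h : H} (hh : h ∈ T) : v * h = h⁻¹ * v := by
  rw [← hT.inverts h hh]; simp [mul_assoc, hT.involution.2]

theorem inf_centralizer_eq_bot (hT : IsTorus T v) {x : H} (hx : x ∈ T) (hxv : x * v = v * x) :
    x = 1 := by
  by_contra h1
  exact hT.free x hx h1 v hT.involution hxv.symm

theorem mem_normalizer_self (hT : IsTorus T v) : v ∈ Subgroup.normalizer (T : Set H) := by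
  obtain ⟨h, hh, h1⟩ := T.bot_or_exists_ne_one.resolve_left hT.ne_bot
  refine hT.mem_normalizer hh h1 ?_
  rw [hT.involution.inv_eq, hT.inverts h hh]
  exact T.inv_mem hh

theorem conj_eq (hT : IsTorus T v) {a : H} (ha : a ∈ T) : a * v * a⁻¹ = a * a * v := by
  rw [mul_assoc, hT.mul_eq_inv_mul (T.inv_mem ha), inv_inv, mul_assoc]

theorem eq_of_mul_self_eq (hT : IsTorus T v) {a b : H} (ha : a ∈ T) (hb : b ∈ T)
    (h : a * a = b * b) : a = b := by
  have hab : a * b⁻¹ ∈ T := T.mul_mem ha (T.inv_mem hb)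
  by_contra hne
  refine hT.notMem_of_isInvolution (w := a * b⁻¹) ⟨?_, ?_⟩ hab
  · rwa [Ne, mul_inv_eq_one]
  · calc a * b⁻¹ * (a * b⁻¹) = a * (b⁻¹ * a) * b⁻¹ := by group
      _ = a * (a * b⁻¹) * b⁻¹ := by rw [hT.mul_comm ha (T.inv_mem hb)]
      _ = (a * a) * (b * b)⁻¹ := by group
      _ = 1 := by rw [h]; simp

theorem conj_injective (hT : IsTorus T v) {a b : H} (ha : a ∈ T) (hb : b ∈ T)
    (h : a * v * a⁻¹ = b * v * b⁻¹) : a = b := by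
  rw [hT.conj_eq ha, hT.conj_eq hb] at h
  exact hT.eq_of_mul_self_eq ha hb (mul_right_cancel h)

variable [Finite H]

theorem odd_card (hT : IsTorus T v) : Odd (Nat.card T) := by
  by_contra h
  rw [Nat.not_odd_iff_even, even_iff_two_dvd] at h
  obtain ⟨x, hx⟩ := exists_prime_orderOf_dvd_card' 2 h
  have h1 : (x : H) * x = 1 := by
    have := pow_orderOf_eq_one x
    rw [hx, sq] at this
    exact congrArg Subtype.val this
  refine hT.notMem_of_isInvolution (w := x) ⟨fun h2 => ?_, h1⟩ x.2
  have : x = 1 := Subtype.ext h2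
  simp [this] at hx

theorem of_inverts (hD : DihedralData z A m) {g : H} (hv : IsInvolution v) (h1 : g ≠ 1)
    (hg : v * g * v = g⁻¹) (hfree : ∀ w, IsInvolution w → w * g ≠ g * w) :
    IsTorus (Subgroup.centralizer {g}) v := by
  have key : ∀ g : H, g ≠ 1 → v * g * v = g⁻¹ → (∀ w, IsInvolution w → w * g ≠ g * w) →
      (∀ h ∈ Subgroup.centralizer {g}, h ≠ 1 → ∀ w, IsInvolution w → w * h ≠ h * w) ∧
      ∀ h ∈ Subgroup.centralizer {g}, v * h * v = h⁻¹ := by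
    intro g h1 hg hfree
    have hf : ∀ h ∈ Subgroup.centralizer {g}, h ≠ 1 → ∀ w, IsInvolution w → w * h ≠ h * w := by
      intro h hh hh1 w hw hc
      rw [Subgroup.mem_centralizer_singleton_iff] at hh
      obtain ⟨j, hj⟩ := hD.exists_pow_isInvolution hw hc hh1
      exact hfree _ hj (Commute.pow_left hh j).eq
    refine ⟨hf, hv.inverts_of_normalizes ?_ fun h hh hh1 => hf h hh hh1 v hv⟩
    intro h hh
    rw [Subgroup.mem_centralizer_singleton_iff] at hh ⊢
    have h2 : g = v * g⁻¹ * v := by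
      rw [← hg]
      simp [mul_assoc, hv.mul_mul_cancel, hv.2]
    have h3 : h * g⁻¹ = g⁻¹ * h := (Commute.inv_right hh).eq
    calc v * h * v * g = v * h * v * (v * g⁻¹ * v) := by rw [← h2]
      _ = v * (h * g⁻¹) * v := by simp [mul_assoc, hv.mul_mul_cancel]
      _ = (v * g⁻¹ * v) * (v * h * v) := by rw [h3]; simp [mul_assoc, hv.mul_mul_cancel]
      _ = g * (v * h * v) := by rw [← h2]
  obtain ⟨hf, hi⟩ := key g h1 hg hfree
  have hgm : g ∈ Subgroup.centralizer {g} := Subgroup.mem_centralizer_singleton_iff.2 rfl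
  have hcomm : ∀ (g : H), (∀ h ∈ Subgroup.centralizer {g}, v * h * v = h⁻¹) →
      ∀ a ∈ Subgroup.centralizer {g}, ∀ b ∈ Subgroup.centralizer {g}, a * b = b * a := by
    intro g hi a ha b hb
    have h2 : v * a * v * (v * b * v) = v * (a * b) * v := by
      simp only [mul_assoc, hv.mul_mul_cancel]
    rw [hi a ha, hi b hb, hi _ (Subgroup.mul_mem _ ha hb)] at h2
    simpa using (congrArg (·⁻¹) h2).symm
  refine ⟨fun h => h1 ?_, hf, hv, hi, ?_⟩
  · rw [h] at hgm
    exact hgm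
  · intro h hh hh1
    obtain ⟨-, hi'⟩ := key h hh1 (hi h hh) (hf h hh hh1)
    apply le_antisymm
    · intro x hx
      exact Subgroup.mem_centralizer_singleton_iff.2 (hcomm h hi' x hx g
        (Subgroup.mem_centralizer_singleton_iff.2
          (Subgroup.mem_centralizer_singleton_iff.1 hh).symm))
    · intro x hx
      exact Subgroup.mem_centralizer_singleton_iff.2 (hcomm g hi x hx h hh)

theorem of_mem_normalizer (hT : IsTorus T v) {w : H} (hw : IsInvolution w)
    (hn : w ∈ Subgroup.normalizer (T : Set H)) : IsTorus T w := by
  refine ⟨hT.ne_bot, hT.free, hw, hw.inverts_of_normalizes ?_ fun h hh h1 => hT.free h hh h1 w hw,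
    hT.centralizer_eq⟩
  intro h hh
  have := (Subgroup.mem_normalizer_iff.1 hn h).1 hh
  rwa [hw.inv_eq] at this

/-- An involution inverting a nontrivial element of `T` inverts `T`. -/
theorem of_inverts_mem (hT : IsTorus T v) {w h : H} (hw : IsInvolution w) (hh : h ∈ T)
    (h1 : h ≠ 1) (hwh : w * h * w = h⁻¹) : IsTorus T w :=
  hT.of_mem_normalizer hw (hT.mem_normalizer hh h1 (by
    rw [hw.inv_eq, hwh]; exact T.inv_mem hh))

theorem conj_of_mem_normalizer (hT : IsTorus T v) {x : H}
    (hx : x ∈ Subgroup.normalizer (T : Set H)) : IsTorus T (x * v * x⁻¹) :=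
  hT.of_mem_normalizer (hT.involution.conj x)
    (Subgroup.mul_mem _ (Subgroup.mul_mem _ hx hT.mem_normalizer_self) (Subgroup.inv_mem _ hx))

theorem exists_mul_self_eq (hT : IsTorus T v) {a : H} (ha : a ∈ T) : ∃ b ∈ T, b * b = a := by
  have hinj : Function.Injective (fun b : T => b * b) := fun b c hbc =>
    Subtype.ext (hT.eq_of_mul_self_eq b.2 c.2 (congrArg Subtype.val hbc))
  obtain ⟨b, hb⟩ := Finite.surjective_of_injective hinj ⟨a, ha⟩
  exact ⟨b, b.2, congrArg Subtype.val hb⟩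

/-- The involutions inverting `T` are conjugate under `T`. -/
theorem exists_conj_eq (hT : IsTorus T v) {w : H} (hw : IsTorus T w) :
    ∃ a ∈ T, w = a * v * a⁻¹ := by
  obtain ⟨a, ha, h⟩ := hT.exists_mul_self_eq (hw.mul_mem hT)
  refine ⟨a, ha, ?_⟩
  rw [hT.conj_eq ha, h, mul_assoc, hT.involution.2, mul_one]

theorem card_normalizer (hT : IsTorus T v) : Nat.card (Subgroup.normalizer (T : Set H)) =
    Nat.card T * Nat.card ↥(Subgroup.normalizer (T : Set H) ⊓ Subgroup.centralizer {v}) := by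
  rw [← Nat.card_prod]
  symm
  refine Nat.card_eq_of_bijective
    (fun p : T × ↥(Subgroup.normalizer (T : Set H) ⊓ Subgroup.centralizer {v}) =>
      (⟨p.1 * p.2, Subgroup.mul_mem _ (le_normalizer p.1.2) p.2.2.1⟩ :
        Subgroup.normalizer (T : Set H))) ⟨?_, ?_⟩
  · rintro ⟨a, l⟩ ⟨b, l'⟩ hab
    have h1 : (a : H) * l = b * l' := congrArg Subtype.val hab
    have h2 : (b : H)⁻¹ * a = l' * (l : H)⁻¹ := by
      rw [eq_mul_inv_iff_mul_eq, mul_assoc, h1, inv_mul_cancel_left]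
    have h3 : (b : H)⁻¹ * a = 1 := by
      apply hT.inf_centralizer_eq_bot (T.mul_mem (T.inv_mem b.2) a.2)
      rw [h2]
      exact Subgroup.mem_centralizer_singleton_iff.1
        (Subgroup.mul_mem _ l'.2.2 (Subgroup.inv_mem _ l.2.2))
    have h4 : (a : H) = b := (inv_mul_eq_one.1 h3).symm
    have h5 : (l : H) = l' := by rw [h4] at h1; exact mul_left_cancel h1
    exact Prod.ext (Subtype.ext h4) (Subtype.ext h5)
  · rintro ⟨y, hy⟩
    obtain ⟨a, ha, h⟩ := hT.exists_conj_eq (hT.conj_of_mem_normalizer hy)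
    refine ⟨⟨⟨a, ha⟩, ⟨a⁻¹ * y, ⟨Subgroup.mul_mem _ (le_normalizer (T.inv_mem ha)) hy, ?_⟩⟩⟩, ?_⟩
    · refine Subgroup.mem_centralizer_singleton_iff.2 ?_
      have := congrArg (fun x => a⁻¹ * x * y) h
      simpa [mul_assoc] using this
    · exact Subtype.ext (by simp)

theorem le_of_data (hT : IsTorus T v) (hD : DihedralData v A m) :
    Subgroup.normalizer (T : Set H) ⊓ Subgroup.centralizer {v} ≤ A := by
  rintro s ⟨hs, hsc⟩
  replace hsc := Subgroup.mem_centralizer_singleton_iff.1 hsc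
  by_contra hsA
  have hsi : IsInvolution s :=
    ⟨fun h1 => hsA (h1 ▸ A.one_mem), hD.mul_self_of_notMem s hsc hsA⟩
  have hTs := hT.of_mem_normalizer hsi hs
  have h1 := hT.inf_centralizer_eq_bot (hTs.mul_mem hT) (by rw [hsc, mul_assoc, hsc])
  have : s = v := by
    rw [mul_eq_one_iff_eq_inv, hT.involution.inv_eq] at h1
    exact h1
  exact hsA (this ▸ hD.mem)

/-- Elements of the normalizer outside `T` commute with an involution inverting `T`. -/
theorem exists_commute (hT : IsTorus T v) {y : H} (hy : y ∈ Subgroup.normalizer (T : Set H))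
    (hyT : y ∉ T) : ∃ w, IsTorus T w ∧ y * w = w * y := by
  let φ : T →* T :=
    { toFun := fun h => ⟨y * h * y⁻¹, (Subgroup.mem_normalizer_iff.1 hy h).1 h.2⟩
      map_one' := Subtype.ext (by simp)
      map_mul' := fun a b => Subtype.ext (by simp [mul_assoc]) }
  have hφ : MonoidHom.FixedPointFree φ := by
    intro g hg
    by_contra hne
    have h1 : y * g * y⁻¹ = (g : H) := congrArg Subtype.val hg
    apply hyT
    rw [← hT.centralizer_eq g g.2 (fun h => hne (Subtype.ext h)),
      Subgroup.mem_centralizer_singleton_iff]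
    exact mul_inv_eq_iff_eq_mul.1 h1
  obtain ⟨s, hs⟩ := hφ.commutatorMap_surjective ⟨_, (hT.conj_of_mem_normalizer hy).mul_mem hT⟩
  obtain ⟨a, ha, has⟩ := hT.exists_mul_self_eq s.2
  refine ⟨_, hT.conj_of_mem_normalizer (le_normalizer ha), ?_⟩
  have h1 : (s : H) * (y * s * y⁻¹)⁻¹ = y * v * y⁻¹ * v := by
    have := congrArg Subtype.val hs
    simpa [MonoidHom.commutatorMap, φ, div_eq_mul_inv] using this
  have h2 : (s : H) = y * v * y⁻¹ * v * (y * s * y⁻¹) := by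
    rw [← h1, inv_mul_cancel_right]
  have h3 : y * v * y⁻¹ * v * (y * s * y⁻¹) = (y * s * y⁻¹) * (y * v * y⁻¹ * v) :=
    hT.mul_comm ((hT.conj_of_mem_normalizer hy).mul_mem hT)
      ((Subgroup.mem_normalizer_iff.1 hy s).1 s.2)
  rw [hT.conj_eq ha, has]
  have h4 : (s : H) * v = y * s * v * y⁻¹ := by
    conv_lhs => rw [h2, h3]
    simp [mul_assoc, hT.involution.2]
  conv_rhs => rw [h4]
  simp [mul_assoc]

end IsTorus

/-- The conjugacy class of `z` has as many elements as the index of the centralizer. -/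
theorem ncard_conj_eq_index {H : Type*} [Group H] (z : H) :
    {v : H | ∃ g, v = g * z * g⁻¹}.ncard = (Subgroup.centralizer {z}).index := by
  have h1 : (Subgroup.centralizer {z}).index = (MulAction.stabilizer (ConjAct H) z).index := by
    rw [Subgroup.centralizer_eq_comap_stabilizer]
    exact Subgroup.index_comap_of_surjective _ (ConjAct.toConjAct : H ≃* ConjAct H).surjective
  rw [h1, MulAction.index_stabilizer]
  congr 1
  ext v
  simp only [Set.mem_ofPred_eq, MulAction.mem_orbit_iff]
  constructor
  · rintro ⟨g, rfl⟩
    exact ⟨ConjAct.toConjAct g, by rw [ConjAct.smul_def]; simp⟩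
  · rintro ⟨g, rfl⟩
    exact ⟨ConjAct.ofConjAct g, by rw [ConjAct.smul_def]⟩

namespace DihedralData

variable {H : Type*} [Group H] {z : H} {A : Subgroup H} {m : ℕ}

theorem ncard_isInvolution (h : DihedralData z A m) :
    {v : H | IsInvolution v}.ncard = (Subgroup.centralizer {z}).index := by
  rw [← ncard_conj_eq_index]
  congr 1
  ext v
  constructor
  · intro hv
    exact h.isConj v hv.1 hv.2
  · rintro ⟨g, rfl⟩
    exact h.involution.conj g

variable [Finite H]

theorem ncard_diff (h : DihedralData z A m) :
    {s : H | s * z = z * s ∧ s ∉ A}.ncard = m := by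
  have h1 : {s : H | s * z = z * s ∧ s ∉ A} = (Subgroup.centralizer {z} : Set H) \ A := by
    ext s
    simp [Subgroup.mem_centralizer_singleton_iff]
  have hA : (A : Set H).ncard = m := h.card_eq
  have hC : (Subgroup.centralizer {z} : Set H).ncard = 2 * m := h.card_centralizer
  rw [h1, Set.ncard_sdiff h.le_centralizer, hA, hC]
  omega

/-- An involution commutes with exactly `m + 1` involutions. -/
theorem ncard_commuting (h : DihedralData z A m) :
    {s : H | IsInvolution s ∧ s * z = z * s}.ncard = m + 1 := by
  have h1 : {s : H | IsInvolution s ∧ s * z = z * s} =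
      insert z {s : H | s * z = z * s ∧ s ∉ A} := by
    ext s
    simp only [Set.mem_ofPred_eq, Set.mem_insert_iff]
    constructor
    · rintro ⟨hs, hc⟩
      by_cases hA : s ∈ A
      · exact Or.inl (h.eq_of_mem hA hs)
      · exact Or.inr ⟨hc, hA⟩
    · rintro (rfl | ⟨hc, hA⟩)
      · exact ⟨h.involution, rfl⟩
      · exact ⟨⟨fun h1 => hA (h1 ▸ A.one_mem), h.mul_self_of_notMem s hc hA⟩, hc⟩
  rw [h1, Set.ncard_insert_of_notMem, h.ncard_diff]
  simp [h.mem]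

end DihedralData

namespace IsTorus

variable {H : Type*} [Group H] {z v : H} {A T : Subgroup H} {m : ℕ}

open MulAction in
theorem card_orbit (T : Subgroup H) (hD : DihedralData v A m) :
    Nat.card (orbit (Subgroup.centralizer {v}) ((1 : H) : H ⧸ Subgroup.normalizer (T : Set H))) *
    Nat.card ↥(Subgroup.normalizer (T : Set H) ⊓ Subgroup.centralizer {v}) = 2 * m := by
  rw [← hD.card_centralizer, Nat.card_coe_set_eq, ← index_stabilizer]
  have h1 : stabilizer (Subgroup.centralizer {v})
      ((1 : H) : H ⧸ Subgroup.normalizer (T : Set H)) =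
      (Subgroup.normalizer (T : Set H)).subgroupOf (Subgroup.centralizer {v}) := by
    ext g
    rw [mem_stabilizer_iff, Subgroup.mem_subgroupOf]
    change (((g : H) * 1 : H) : H ⧸ Subgroup.normalizer (T : Set H)) = (1 : H) ↔ _
    rw [mul_one, eq_comm, QuotientGroup.eq, inv_one, one_mul]
  rw [h1]
  have h2 : Nat.card ((Subgroup.normalizer (T : Set H)).subgroupOf (Subgroup.centralizer {v})) =
      Nat.card ↥(Subgroup.normalizer (T : Set H) ⊓ Subgroup.centralizer {v}) := by
    rw [← Subgroup.inf_subgroupOf_right]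
    exact Nat.card_congr (Subgroup.subgroupOfEquivOfLe inf_le_right).toEquiv
  rw [← h2, Subgroup.index_mul_card]

/-- If an involution commutes with two involutions inverting `T`, these agree. -/
theorem eq_of_commute (hT : IsTorus T v) {w u : H} (hw : IsTorus T w) (hu : IsInvolution u)
    (h1 : u * v = v * u) (h2 : u * w = w * u) : v = w := by
  have h3 : v * w = 1 := by
    by_contra hne
    exact hT.free _ (hT.mul_mem hw) hne u hu (by rw [← mul_assoc, h1, mul_assoc, h2, mul_assoc])
  rw [mul_eq_one_iff_eq_inv, hw.involution.inv_eq] at h3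
  exact h3

variable [Finite H]

/-- An involution conjugating one involution inverting `T` to another one inverts `T`. -/
theorem of_conj_eq (hT : IsTorus T v) {w u : H} (hw : IsTorus T w) (hu : IsInvolution u)
    (hne : v ≠ w) (h : u * v * u = w) : IsTorus T u := by
  have h1 : v * w ≠ 1 := fun h3 => hne (by
    rwa [mul_eq_one_iff_eq_inv, hw.involution.inv_eq] at h3)
  refine hT.of_inverts_mem hu (hT.mul_mem hw) h1 ?_
  have h2 : u * w * u = v := by
    rw [← h]; simp [mul_assoc, hu.mul_mul_cancel, hu.2]
  calc u * (v * w) * u = (u * v * u) * (u * w * u) := by simp [mul_assoc, hu.mul_mul_cancel]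
    _ = w * v := by rw [h, h2]
    _ = (v * w)⁻¹ := by simp [hT.involution.inv_eq, hw.involution.inv_eq]

theorem conj_conj_injective (hT : IsTorus T v) :
    Function.Injective (fun p : T × {s : H | IsInvolution s ∧ s * v = v * s} =>
      (p.1 : H) * p.2 * (p.1 : H)⁻¹) := by
  rintro ⟨a, b, hb⟩ ⟨a', b', hb'⟩ h
  simp only at h
  have hc : ∀ (a b : H), b * v = v * b → (a * b * a⁻¹) * (a * v * a⁻¹) =
      (a * v * a⁻¹) * (a * b * a⁻¹) := fun a b hb => by
    have := congrArg (fun y => a * y * a⁻¹) hb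
    simpa [mul_assoc] using this
  have h1 := (hT.conj_of_mem_normalizer (le_normalizer a.2)).eq_of_commute
    (hT.conj_of_mem_normalizer (le_normalizer a'.2)) (hb.1.conj a) (hc _ _ hb.2)
    (by rw [h]; exact hc _ _ hb'.2)
  have h2 := hT.conj_injective a.2 a'.2 h1
  rw [h2] at h
  have h3 : b = b' := mul_left_cancel (mul_right_cancel h)
  exact Prod.ext (Subtype.ext h2) (Subtype.ext h3)

/-- The involutions commuting with an involution that inverts `T`. -/
theorem ncard_range (hD : DihedralData z A m) (hT : IsTorus T v) :
    {u : H | ∃ w, IsTorus T w ∧ IsInvolution u ∧ u * w = w * u}.ncard =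
      Nat.card T * (m + 1) := by
  obtain ⟨B, hB⟩ := hD.exists_of_isInvolution hT.involution
  rw [← hB.ncard_commuting, ← Nat.card_coe_set_eq {s : H | IsInvolution s ∧ s * v = v * s},
    ← Nat.card_prod,
    ← Nat.card_range_of_injective hT.conj_conj_injective, Nat.card_coe_set_eq]
  congr 1
  ext u
  constructor
  · rintro ⟨w, hw, hu, hc⟩
    obtain ⟨a, ha, rfl⟩ := hT.exists_conj_eq hw
    refine ⟨⟨⟨a, ha⟩, ⟨a⁻¹ * u * a, by simpa using hu.conj a⁻¹, ?_⟩⟩, by simp [mul_assoc]⟩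
    have := congrArg (fun y => a⁻¹ * y * a) hc
    simpa [mul_assoc] using this
  · rintro ⟨⟨a, b, hb⟩, rfl⟩
    refine ⟨_, hT.conj_of_mem_normalizer (le_normalizer a.2), hb.1.conj _, ?_⟩
    have := congrArg (fun y => a * y * (a : H)⁻¹) hb.2
    simpa [mul_assoc] using this

theorem card_mul_le (hD : DihedralData z A m) (hT : IsTorus T v) :
    Nat.card T * (m + 1) ≤ (Subgroup.centralizer {z}).index := by
  rw [← ncard_range hD hT, ← hD.ncard_isInvolution]
  exact Set.ncard_le_ncard fun u ⟨_, _, hu, _⟩ => hu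

theorem ncard_compl (hD : DihedralData z A m) (hT : IsTorus T v) :
    {u : H | IsInvolution u ∧ ∀ w, IsTorus T w → u * w ≠ w * u}.ncard + Nat.card T * (m + 1) =
      (Subgroup.centralizer {z}).index := by
  rw [← ncard_range hD hT, ← hD.ncard_isInvolution, ← Set.ncard_union_eq]
  · congr 1
    ext u
    simp only [Set.mem_union, Set.mem_ofPred_eq]
    by_cases h : ∃ w, IsTorus T w ∧ u * w = w * u
    · obtain ⟨w, h1, h2⟩ := h
      exact ⟨fun h => h.elim (·.1) fun ⟨_, _, h, _⟩ => h, fun h => Or.inr ⟨w, h1, h, h2⟩⟩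
    · push Not at h
      exact ⟨fun h => h.elim (·.1) fun ⟨_, _, h, _⟩ => h, fun h' => Or.inl ⟨h', h⟩⟩
  · rw [Set.disjoint_left]
    rintro u ⟨_, h⟩ ⟨w, h1, _, h2⟩
    exact h w h1 h2

open MulAction in
theorem conjugates_bound (hD : DihedralData z A m) (hT : IsTorus T v) {μ : ℕ}
    (hμ : μ * Nat.card ↥(Subgroup.normalizer (T : Set H) ⊓ Subgroup.centralizer {v}) = 2 * m) :
    (Subgroup.centralizer {z}).index + μ * Nat.card T + 1 ≤
      (Subgroup.normalizer (T : Set H)).index + Nat.card T * (m + 2) := by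
  obtain ⟨B, hB⟩ := hD.exists_of_isInvolution hT.involution
  set N := Subgroup.normalizer (T : Set H) with hN
  set O := orbit (Subgroup.centralizer {v}) ((1 : H) : H ⧸ N) with hO
  have hOcard : O.ncard = μ := by
    have h1 := card_orbit T hB
    rw [← hμ, ← hN] at h1
    exact Nat.eq_of_mul_eq_mul_right Nat.card_pos h1
  have hbase : ((1 : H) : H ⧸ N) ∈ O := mem_orbit_self _
  set F : Set (H ⧸ N) := O \ {((1 : H) : H ⧸ N)} with hF
  have hFcard : F.ncard + 1 = μ := by
    rw [hF, Set.ncard_sdiff_singleton_add_one hbase, hOcard]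
  set J : Set H := {u : H | IsInvolution u ∧ ∀ w, IsTorus T w → u * w ≠ w * u} with hJ
  have hmk : ∀ a b : H, ((a : H ⧸ N) = b) ↔ a⁻¹ * b ∈ N := fun a b => QuotientGroup.eq
  have hJT : ∀ u ∈ J, ¬ IsTorus T u := fun u hu h => hu.2 u h rfl
  have hJN : ∀ u ∈ J, u ∉ N := fun u hu h => hJT u hu (hT.of_mem_normalizer hu.1 h)
  have hFrep : ∀ f ∈ F, ∃ s : H, s * v = v * s ∧ (s : H ⧸ N) = f := by
    rintro f ⟨⟨s, rfl⟩, -⟩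
    refine ⟨s, Subgroup.mem_centralizer_singleton_iff.1 s.2, ?_⟩
    change ((s : H) : H ⧸ N) = (((s : H) * 1 : H) : H ⧸ N)
    rw [mul_one]
  let Φ : Option (J ⊕ (T × F)) → H ⧸ N := fun o => match o with
    | none => ((1 : H) : H ⧸ N)
    | some (Sum.inl u) => ((u : H) : H ⧸ N)
    | some (Sum.inr p) => (p.1 : H) • (p.2 : H ⧸ N)
  have hsv : ∀ (a s : H), s * v = v * s → (a * s) * v * (a * s)⁻¹ = a * v * a⁻¹ := fun a s hs => by
    calc (a * s) * v * (a * s)⁻¹ = a * (s * v) * s⁻¹ * a⁻¹ := by group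
      _ = a * v * a⁻¹ := by rw [hs]; group
  have none_inl : ∀ u : J, ((1 : H) : H ⧸ N) ≠ ((u : H) : H ⧸ N) := fun u h => by
    rw [hmk, inv_one, one_mul] at h
    exact hJN u u.2 h
  have none_inr : ∀ (a : T) (f : F), ((1 : H) : H ⧸ N) ≠ (a : H) • (f : H ⧸ N) := fun a f h => by
    obtain ⟨s, hs, hsf⟩ := hFrep f f.2
    rw [← hsf, MulAction.Quotient.smul_coe, smul_eq_mul, hmk, inv_one, one_mul] at h
    apply f.2.2
    rw [← hsf, Set.mem_singleton_iff, eq_comm, hmk, inv_one, one_mul]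
    exact (Subgroup.mul_mem_cancel_left _ (le_normalizer a.2)).1 h
  have inl_inr : ∀ (u : J) (a : T) (f : F), ((u : H) : H ⧸ N) ≠ (a : H) • (f : H ⧸ N) :=
      fun u a f h => by
    obtain ⟨s, hs, hsf⟩ := hFrep f f.2
    rw [← hsf, MulAction.Quotient.smul_coe, smul_eq_mul, hmk, u.2.1.inv_eq] at h
    set n := (u : H) * (a * s) with hn
    have hT1 := hT.conj_of_mem_normalizer (le_normalizer a.2)
    have hT2 := hT.conj_of_mem_normalizer h
    have h3 : (u : H) * ((a : H) * v * (a : H)⁻¹) * u = n * v * n⁻¹ := by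
      rw [hn, ← hsv a s hs, mul_inv_rev _ ((a : H) * s), u.2.1.inv_eq]
      simp [mul_assoc]
    by_cases h4 : (a : H) * v * (a : H)⁻¹ = n * v * n⁻¹
    · rw [← h4] at h3
      apply u.2.2 _ hT1
      conv_rhs => rw [← h3]
      simp [mul_assoc, u.2.1.2]
    · exact hJT u u.2 (hT1.of_conj_eq hT2 u.2.1 h4 h3)
  have inl_inl : ∀ u u' : J, ((u : H) : H ⧸ N) = ((u' : H) : H ⧸ N) → u = u' := fun u u' h => by
    rw [hmk, u.2.1.inv_eq] at h
    by_contra hne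
    have h1 : (u : H) * u' ≠ 1 := fun h1 => hne (Subtype.ext (by
      rwa [mul_eq_one_iff_eq_inv, u'.2.1.inv_eq] at h1))
    have h2 : (u : H) * (u * u') * u = ((u : H) * u')⁻¹ := by
      simp [u.2.1.inv_eq, u'.2.1.inv_eq, u.2.1.mul_mul_cancel]
    by_cases hT' : (u : H) * u' ∈ T
    · exact hJT u u.2 (hT.of_inverts_mem u.2.1 hT' h1 h2)
    · obtain ⟨w, hw, hc⟩ := hT.exists_commute h hT'
      obtain ⟨C, hC⟩ := hD.exists_of_isInvolution hw.involution
      have h3 := hw.le_of_data hC ⟨h, Subgroup.mem_centralizer_singleton_iff.2 hc⟩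
      exact u.2.2 w hw (hC.commute_of_inverts h3 h1 (by rw [u.2.1.inv_eq, h2]))
  have inr_inr : ∀ (a a' : T) (f f' : F), (a : H) • (f : H ⧸ N) = (a' : H) • (f' : H ⧸ N) →
      a = a' ∧ f = f' := fun a a' f f' h => by
    obtain ⟨s, hs, hsf⟩ := hFrep f f.2
    obtain ⟨s', hs', hsf'⟩ := hFrep f' f'.2
    have haa : a = a' := by
      by_contra hne
      have h0 := h
      rw [← hsf, ← hsf', MulAction.Quotient.smul_coe, smul_eq_mul, MulAction.Quotient.smul_coe,
        smul_eq_mul, hmk] at h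
      set n := ((a : H) * s)⁻¹ * (a' * s') with hn
      have hT1 := hT.conj_of_mem_normalizer (le_normalizer a.2)
      have hT2 := hT.conj_of_mem_normalizer (le_normalizer a'.2)
      have hT3 := hT.conj_of_mem_normalizer h
      have hv12 := hT1.mul_mem hT2
      have h12 : ((a : H) * v * (a : H)⁻¹) * (a' * v * (a' : H)⁻¹) ≠ 1 := fun h1 => hne (by
        rw [mul_eq_one_iff_eq_inv, hT2.involution.inv_eq] at h1
        exact Subtype.ext (hT.conj_injective a.2 a'.2 h1))
      have h4 : ((a : H) * s)⁻¹ ∈ N := by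
        refine hT.mem_normalizer hv12 h12 ?_
        have h5 : ((a : H) * s)⁻¹ * (((a : H) * v * (a : H)⁻¹) * (a' * v * (a' : H)⁻¹)) *
            ((a : H) * s)⁻¹⁻¹ = v * (n * v * n⁻¹) := by
          rw [← hsv a s hs, ← hsv a' s' hs', hn]
          group
        rw [h5]
        exact hT.mul_mem hT3
      refine none_inr a f ?_
      rw [← hsf, MulAction.Quotient.smul_coe, smul_eq_mul, hmk, inv_one, one_mul]
      exact (Subgroup.inv_mem_iff _).1 h4
    refine ⟨haa, Subtype.ext ?_⟩
    rw [haa] at h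
    exact MulAction.injective _ h
  have hΦ : Function.Injective Φ := by
    rintro (_ | u | ⟨a, f⟩) (_ | u' | ⟨a', f'⟩) h
    · rfl
    · exact absurd h (none_inl _)
    · exact absurd h (none_inr _ _)
    · exact absurd h.symm (none_inl _)
    · rw [inl_inl u u' h]
    · exact absurd h (inl_inr _ _ _)
    · exact absurd h.symm (none_inr _ _)
    · exact absurd h.symm (inl_inr _ _ _)
    · obtain ⟨h1, h2⟩ := inr_inr a a' f f' h
      rw [h1, h2]
  have hle := Nat.card_le_card_of_injective Φ hΦ
  rw [Finite.card_option, Nat.card_sum, Nat.card_prod, Nat.card_coe_set_eq,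
    Nat.card_coe_set_eq] at hle
  have hc := ncard_compl hD hT
  rw [← hJ] at hc
  change _ ≤ Nat.card (H ⧸ N) + _
  rw [← hFcard, ← hc]
  nlinarith

end IsTorus

theorem ncard_biUnion_const {α β : Type*} [Finite α] [Finite β] {D : Set α} {Y : α → Set β} {c : ℕ}
    (hdisj : ∀ a ∈ D, ∀ a' ∈ D, ∀ y ∈ Y a, y ∈ Y a' → a = a') (hc : ∀ a ∈ D, (Y a).ncard = c) :
    (⋃ a ∈ D, Y a).ncard = D.ncard * c := by
  classical
  have hfin : (⋃ b ∈ D, Y b) = (↑((D.toFinite.toFinset).biUnion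
      fun b => (Y b).toFinite.toFinset) : Set β) := by
    ext v; simp
  rw [hfin, Set.ncard_coe_finset, Finset.card_biUnion]
  · rw [Finset.sum_congr rfl (fun b hb => by
      rw [← Set.ncard_eq_toFinset_card _ (Y b).toFinite, hc b (by simpa using hb)]),
      Finset.sum_const, ← Set.ncard_eq_toFinset_card _ D.toFinite, smul_eq_mul]
  · intro b hb b' hb' hne
    refine Finset.disjoint_left.2 fun v hv hv' => ?_
    exact hne (hdisj b (by simpa using hb) b' (by simpa using hb') v (by simpa using hv)
      (by simpa using hv'))

theorem card_dvd_card_of_free {G X : Type*} [Group G] [MulAction G X]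
    (h : ∀ (g : G) (x : X), g • x = x → g = 1) : Nat.card G ∣ Nat.card X := by
  rw [Nat.card_congr (MulAction.selfEquivOrbitsQuotientProd (G := G) (X := X) fun b =>
    (Subgroup.eq_bot_iff_forall _).2 fun g hg => h g b (MulAction.mem_stabilizer_iff.1 hg)),
    Nat.card_prod]
  exact dvd_mul_left _ _

/-- If conjugation by a subgroup `S` permutes the set `Y` without fixed points, then the order of
`S` divides the number of elements of `Y`. -/
theorem card_dvd_ncard_of_conj {H : Type*} [Group H] (S : Subgroup H) (Y : Set H)
    (hY : ∀ s ∈ S, ∀ y ∈ Y, s * y * s⁻¹ ∈ Y)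
    (hfree : ∀ s ∈ S, ∀ y ∈ Y, s * y = y * s → s = 1) : Nat.card S ∣ Y.ncard := by
  let : MulAction S Y :=
    { smul := fun s y => ⟨s * y * (s : H)⁻¹, hY s s.2 y y.2⟩
      one_smul := fun y => Subtype.ext (by
        change ((1 : S) : H) * y * ((1 : S) : H)⁻¹ = y
        simp)
      mul_smul := fun s t y => Subtype.ext (by
        change ((s * t : S) : H) * y * ((s * t : S) : H)⁻¹ = s * (t * y * (t : H)⁻¹) * (s : H)⁻¹
        simp [mul_assoc]) }
  rw [← Nat.card_coe_set_eq]
  refine card_dvd_card_of_free fun s y h => Subtype.ext (hfree s s.2 y y.2 ?_)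
  have h1 : (s : H) * y * (s : H)⁻¹ = y := congrArg Subtype.val h
  exact mul_inv_eq_iff_eq_mul.1 h1

namespace DihedralData

variable {H : Type*} [Group H] {z : H} {A : Subgroup H} {m : ℕ}

theorem isInvolution_of_notMem (h : DihedralData z A m) {s : H} (hs : s * z = z * s)
    (hsA : s ∉ A) : IsInvolution s :=
  ⟨fun h1 => hsA (h1 ▸ A.one_mem), h.mul_self_of_notMem s hs hsA⟩

theorem index_pos (h : DihedralData z A m) : 0 < (Subgroup.centralizer {z}).index := by
  obtain ⟨k, hk⟩ := h.odd_index
  omega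

variable [Finite H]

/-- The number of involutions is congruent to `m + 1 + m * (m - 2)` modulo `2 * m`. -/
theorem index_modEq (h : DihedralData z A m) :
    ∃ r, (Subgroup.centralizer {z}).index = m + 1 + m * (m - 2) + 2 * m * r := by
  classical
  set Y0 : Set H := {v | IsInvolution v ∧ v * z ≠ z * v ∧
    ∀ b, b * z = z * b → b ∉ A → v * b ≠ b * v} with hY0
  set Y1 : H → Set H := fun b => {v | IsInvolution v ∧ v * z ≠ z * v ∧ v * b = b * v} with hY1
  set Y2 : Set H := {v | IsInvolution v ∧ v * z = z * v} with hY2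
  set D : Set H := {s | s * z = z * s ∧ s ∉ A} with hD
  have hne : ∀ v : H, v * z ≠ z * v → ∀ a ∈ A, v * a = a * v → a = 1 := fun v hv a ha hva => by
    by_contra h1
    exact hv (h.commute_of_commute ha h1 hva)
  have hdisj : ∀ b ∈ D, ∀ b' ∈ D, ∀ v ∈ Y1 b, v ∈ Y1 b' → b = b' := by
    intro b hb b' hb' v hv hv'
    have h1 := hne v hv.2.1 _ (h.mul_mem hb.1 hb.2 hb'.1 hb'.2)
      (by rw [← mul_assoc, hv.2.2, mul_assoc, hv'.2.2, mul_assoc])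
    rwa [mul_eq_one_iff_eq_inv, (h.isInvolution_of_notMem hb'.1 hb'.2).inv_eq] at h1
  have hconj : ∀ s v b : H, s * z = z * s → (s * v * s⁻¹) * b = b * (s * v * s⁻¹) →
      v * (s⁻¹ * b * s) = (s⁻¹ * b * s) * v := fun s v b hs hv => by
    have := congrArg (fun y => s⁻¹ * y * s) hv
    simpa [mul_assoc] using this
  have hzs : ∀ s : H, s * z = z * s → s⁻¹ * z * s = z := fun s hs => by
    rw [mul_assoc, ← hs, inv_mul_cancel_left]
  have h0 : 2 * m ∣ Y0.ncard := by
    rw [← h.card_centralizer]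
    apply card_dvd_ncard_of_conj
    · rintro s hs v ⟨hv, hvz, hvb⟩
      rw [Subgroup.mem_centralizer_singleton_iff] at hs
      refine ⟨hv.conj s, fun hc => hvz ?_, fun b hb hbA hc => ?_⟩
      · have := hconj s v z hs hc
        rwa [hzs s hs] at this
      · refine hvb (s⁻¹ * b * s) ?_ ?_ (hconj s v b hs hc)
        · have := congrArg (fun y => s⁻¹ * y * s) hb
          have e := hzs s hs
          calc s⁻¹ * b * s * z = s⁻¹ * b * (s * z) := by group
            _ = s⁻¹ * (b * z) * s := by rw [hs]; group
            _ = s⁻¹ * z * (b * s) := by rw [hb]; group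
            _ = z * s⁻¹ * (b * s) := by
              rw [show s⁻¹ * z = z * s⁻¹ from (Commute.inv_left hs).eq]
            _ = z * (s⁻¹ * b * s) := by group
        · intro hA
          by_cases hsA : s ∈ A
          · exact hbA (by
              have := A.mul_mem (A.mul_mem hsA hA) (A.inv_mem hsA)
              simpa [mul_assoc] using this)
          · have := h.inverts hs hsA hA
            apply hbA
            have h2 : b = (s⁻¹ * b * s)⁻¹ := by rw [← this]; group
            rw [h2]
            exact A.inv_mem hA
    · rintro s hs v ⟨hv, hvz, hvb⟩ hc
      rw [Subgroup.mem_centralizer_singleton_iff] at hs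
      by_cases hsA : s ∈ A
      · exact hne v hvz s hsA hc.symm
      · exact absurd hc.symm (hvb s hs hsA)
  have h1 : ∀ b ∈ D, (Y1 b).ncard = m - 2 := by
    rintro b ⟨hb, hbA⟩
    have hbi := h.isInvolution_of_notMem hb hbA
    obtain ⟨B, hB⟩ := h.exists_of_isInvolution hbi
    have hbz : b ≠ z := fun h1 => hbA (h1 ▸ h.mem)
    have hbzi : IsInvolution (b * z) := by
      refine ⟨fun h1 => hbz ?_, by rw [mul_assoc, ← mul_assoc z, ← hb, ← mul_assoc, ← mul_assoc,
        hbi.2, one_mul, h.mul_self]⟩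
      rwa [mul_eq_one_iff_eq_inv, h.involution.inv_eq] at h1
    have he : {v | IsInvolution v ∧ v * b = b * v} = Y1 b ∪ {b, z, b * z} := by
      ext v
      simp only [hY1, Set.mem_union, Set.mem_ofPred_eq, Set.mem_insert_iff, Set.mem_singleton_iff]
      constructor
      · rintro ⟨hv, hvb⟩
        by_cases hvz : v * z = z * v
        · right
          by_cases hvA : v ∈ A
          · exact Or.inr (Or.inl (h.eq_of_mem hvA hv))
          · have h3 := h.mul_mem hb hbA hvz hvA
            have h4 : b * v * (b * v) = 1 := by
              rw [mul_assoc, ← mul_assoc v, hvb, mul_assoc, hv.2, mul_one, hbi.2]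
            by_cases h5 : b * v = 1
            · left
              rw [mul_eq_one_iff_inv_eq, hbi.inv_eq] at h5
              exact h5.symm
            · right; right
              rw [← h.eq_of_mem h3 ⟨h5, h4⟩, hbi.mul_mul_cancel]
        · exact Or.inl ⟨hv, hvz, hvb⟩
      · rintro (⟨hv, hvz, hvb⟩ | rfl | rfl | rfl)
        · exact ⟨hv, hvb⟩
        · exact ⟨hbi, rfl⟩
        · exact ⟨h.involution, hb.symm⟩
        · exact ⟨hbzi, by rw [mul_assoc, ← hb, ← mul_assoc]⟩
    have h2 : ({b, z, b * z} : Set H).ncard = 3 := by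
      rw [Set.ncard_eq_three]
      exact ⟨b, z, b * z, hbz, fun h1 => h.ne_one (by simpa using h1.symm),
        fun h1 => hbi.1 (by simpa using h1.symm), rfl⟩
    have h3 := hB.ncard_commuting
    rw [he, Set.ncard_union_eq, h2] at h3
    · omega
    · rw [Set.disjoint_left]
      rintro v ⟨hv, hvz, hvb⟩ (rfl | rfl | rfl)
      · exact hvz hb
      · exact hvz rfl
      · apply hvz
        rw [mul_assoc, h.mul_self, mul_one, ← mul_assoc, ← hb, mul_assoc, h.mul_self, mul_one]
  have h2 : (⋃ b ∈ D, Y1 b).ncard = m * (m - 2) := by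
    rw [ncard_biUnion_const hdisj h1, h.ncard_diff]
  obtain ⟨r, hr⟩ := h0
  refine ⟨r, ?_⟩
  rw [← h.ncard_isInvolution, ← hr, ← h2, ← h.ncard_commuting, ← hY2, ← Set.ncard_union_eq,
    ← Set.ncard_union_eq]
  · congr 1
    ext v
    simp only [Set.mem_union, Set.mem_iUnion, hY0, hY1, hY2, hD, Set.mem_ofPred_eq, exists_prop]
    constructor
    · intro hv
      by_cases hvz : v * z = z * v
      · exact Or.inl (Or.inl ⟨hv, hvz⟩)
      · by_cases hb : ∃ b, (b * z = z * b ∧ b ∉ A) ∧ v * b = b * v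
        · obtain ⟨b, hb, hvb⟩ := hb
          exact Or.inl (Or.inr ⟨b, hb, hv, hvz, hvb⟩)
        · exact Or.inr ⟨hv, hvz, fun b h1 h2 h3 => hb ⟨b, ⟨h1, h2⟩, h3⟩⟩
    · rintro ((⟨hv, -⟩ | ⟨b, -, hv, -⟩) | ⟨hv, -⟩) <;> exact hv
  · rw [Set.disjoint_left]
    rintro v (⟨-, hv⟩ | hv) ⟨-, h3, h4⟩
    · exact h3 hv
    · simp only [Set.mem_iUnion] at hv
      obtain ⟨b, hb, -, -, hvb⟩ := hv
      exact h4 b hb.1 hb.2 hvb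
  · rw [Set.disjoint_left]
    rintro v ⟨-, hv⟩ hv'
    simp only [Set.mem_iUnion] at hv'
    obtain ⟨b, hb, -, h3, -⟩ := hv'
    exact h3 hv

end DihedralData

namespace DihedralData

variable {H : Type*} [Group H] {z : H} {A : Subgroup H} {m : ℕ}

theorem sum_involutions [Fintype H] [DecidableEq H] {R : Type*} [CommSemiring R] (J : Finset H)
    (hJ : ∀ v, v ∈ J ↔ IsInvolution v) (f : H → R) :
    ∑ v ∈ J, ∑ w ∈ J, f (v * w) =
      ∑ g : H, ({v : H | IsInvolution v ∧ IsInvolution (v * g)}.ncard : R) * f g := by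
  have h1 : ∀ v ∈ J, ∑ w ∈ J, f (v * w) = ∑ g : H, if v * g ∈ J then f g else 0 := by
    intro v hv
    rw [← Finset.sum_filter]
    refine Finset.sum_bij (fun w _ => v * w) ?_ ?_ ?_ ?_
    · intro w hw
      simp only [Finset.mem_filter, Finset.mem_univ, true_and]
      rwa [((hJ v).1 hv).mul_mul_cancel]
    · intro a _ b _ hab
      exact mul_left_cancel hab
    · intro g hg
      exact ⟨v * g, (Finset.mem_filter.1 hg).2, ((hJ v).1 hv).mul_mul_cancel g⟩
    · intro _ _; rfl
  rw [Finset.sum_congr rfl h1, Finset.sum_comm]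
  refine Finset.sum_congr rfl fun g _ => ?_
  rw [← Finset.sum_filter, Finset.sum_const, nsmul_eq_mul]
  congr 2
  rw [← Set.ncard_coe_finset]
  congr 1
  ext v
  simp [hJ]

theorem commuting_iff (h : DihedralData z A m) {g : H} :
    (g ≠ 1 ∧ ∃ w, IsInvolution w ∧ w * g = g * w) ↔
      ∃ w B, DihedralData w B m ∧ g ∈ B ∧ g ≠ 1 := by
  constructor
  · rintro ⟨h1, w, hw, hc⟩
    obtain ⟨B, hB⟩ := h.exists_of_isInvolution hw
    by_cases hg : g ∈ B
    · exact ⟨w, B, hB, hg, h1⟩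
    · obtain ⟨C, hC⟩ := h.exists_of_isInvolution (hB.isInvolution_of_notMem hc.symm hg)
      exact ⟨g, C, hC, hC.mem, h1⟩
  · rintro ⟨w, B, hB, hg, h1⟩
    exact ⟨h1, w, hB.involution, (hB.comm g hg).symm⟩

variable [Finite H]

theorem exists_family (h : DihedralData z A m) :
    ∃ B : H → Subgroup H, B z = A ∧ (∀ w, IsInvolution w → DihedralData w (B w) m) ∧
      (∀ w, IsInvolution w → ∀ w', IsInvolution w' → ∀ g, g ≠ 1 → g ∈ B w → g ∈ B w' → w = w') ∧
      ∀ g, (g ≠ 1 ∧ ∃ w, IsInvolution w ∧ w * g = g * w) → ∃ w, IsInvolution w ∧ g ∈ B w := by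
  classical
  have h0 : ∀ w, IsInvolution w → ∃ B, (w = z → B = A) ∧ DihedralData w B m := fun w hw => by
    by_cases hwz : w = z
    · exact ⟨A, fun _ => rfl, hwz ▸ h⟩
    · obtain ⟨B, hB⟩ := h.exists_of_isInvolution hw
      exact ⟨B, fun h => absurd h hwz, hB⟩
  choose! B hBA hB using h0
  refine ⟨B, hBA z h.involution rfl, hB, ?_, ?_⟩
  · intro w hw w' hw' g h1 hg hg'
    obtain ⟨j, rfl⟩ := (hB w hw).exists_pow_eq hg h1
    exact (hB w' hw').eq_of_mem ((B w').pow_mem hg' j) hw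
  · rintro g ⟨h1, w, hw, hc⟩
    by_cases hg : g ∈ B w
    · exact ⟨w, hw, hg⟩
    · have hi := (hB w hw).isInvolution_of_notMem hc.symm hg
      exact ⟨g, hi, (hB g hi).mem⟩

/-- The number of nontrivial elements commuting with an involution. -/
theorem ncard_commuting_involution (h : DihedralData z A m) :
    {g : H | g ≠ 1 ∧ ∃ w, IsInvolution w ∧ w * g = g * w}.ncard =
      (Subgroup.centralizer {z}).index * (m - 1) := by
  obtain ⟨B, -, hB, hdisj, hcov⟩ := h.exists_family
  have h1 : {g : H | g ≠ 1 ∧ ∃ w, IsInvolution w ∧ w * g = g * w} =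
      ⋃ w ∈ {w : H | IsInvolution w}, ((B w : Set H) \ {1}) := by
    ext g
    simp only [Set.mem_iUnion, Set.mem_ofPred_eq, exists_prop, Set.mem_sdiff, SetLike.mem_coe,
      Set.mem_singleton_iff]
    constructor
    · intro hg
      obtain ⟨w, hw, hgw⟩ := hcov g hg
      exact ⟨w, hw, hgw, hg.1⟩
    · rintro ⟨w, hw, hg, h1⟩
      exact ⟨h1, w, hw, ((hB w hw).comm g hg).symm⟩
  rw [h1, ncard_biUnion_const (c := m - 1), h.ncard_isInvolution]
  · rintro w hw w' hw' g ⟨hg, h1⟩ ⟨hg', -⟩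
    exact hdisj w hw w' hw' g h1 hg hg'
  · intro w hw
    have : (B w : Set H).ncard = m := (hB w hw).card_eq
    rw [Set.ncard_sdiff_singleton_of_mem (B w).one_mem, this]

/-- A nontrivial element commuting with an involution is a product of two involutions in `m`
ways. -/
theorem ncard_factorizations (h : DihedralData z A m) {g : H}
    (hg : g ≠ 1 ∧ ∃ w, IsInvolution w ∧ w * g = g * w) :
    {v : H | IsInvolution v ∧ IsInvolution (v * g)}.ncard = m := by
  obtain ⟨w, B, hB, hgB, h1⟩ := h.commuting_iff.1 hg
  rw [← hB.ncard_diff]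
  congr 1
  ext v
  simp only [Set.mem_ofPred_eq]
  constructor
  · rintro ⟨hv, hvg⟩
    refine ⟨hB.commute_of_inverts hgB h1 ?_, fun hvB => ?_⟩
    · rw [hv.inv_eq]
      exact eq_inv_of_mul_eq_one_left (by rw [mul_assoc, hvg.2])
    · have e1 := hB.eq_of_mem hvB hv
      have e2 := hB.eq_of_mem (B.mul_mem hvB hgB) hvg
      rw [← e1] at e2
      exact h1 (by simpa using e2)
  · rintro ⟨hv, hvB⟩
    refine ⟨hB.isInvolution_of_notMem hv hvB, hB.isInvolution_of_notMem ?_ ?_⟩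
    · rw [mul_assoc, hB.comm g hgB, ← mul_assoc, hv, mul_assoc]
    · exact fun h3 => hvB ((Subgroup.mul_mem_cancel_right _ hgB).1 h3)

/-- The torus centralizing a product of two involutions. -/
theorem exists_torus (h : DihedralData z A m) {g v : H} (h1 : g ≠ 1)
    (hg : ¬ ∃ w, IsInvolution w ∧ w * g = g * w) (hv : IsInvolution v)
    (hvg : IsInvolution (v * g)) :
    IsTorus (Subgroup.centralizer {g}) v ∧
      {v : H | IsInvolution v ∧ IsInvolution (v * g)}.ncard ≤
        Nat.card (Subgroup.centralizer {g}) := by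
  have hinv : ∀ v, IsInvolution v → IsInvolution (v * g) → v * g * v = g⁻¹ := fun v hv hvg =>
    eq_inv_of_mul_eq_one_left (by rw [mul_assoc, hvg.2])
  have hT : ∀ v, IsInvolution v → IsInvolution (v * g) → IsTorus (Subgroup.centralizer {g}) v :=
    fun v hv hvg => IsTorus.of_inverts h hv h1 (hinv v hv hvg) fun w hw hc => hg ⟨w, hw, hc⟩
  refine ⟨hT v hv hvg, ?_⟩
  rw [← Nat.card_coe_set_eq]
  refine Nat.card_le_card_of_injective (fun w : {v : H | IsInvolution v ∧ IsInvolution (v * g)} =>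
    (⟨v * w, (hT v hv hvg).mul_mem (hT w w.2.1 w.2.2)⟩ : Subgroup.centralizer {g})) ?_
  intro w w' hw
  exact Subtype.ext (mul_left_cancel (congrArg Subtype.val hw))

theorem exists_large_torus (h : DihedralData z A m) {k : ℕ}
    (hk : (Subgroup.centralizer {z}).index = k) :
    ∃ S : ℕ, k * k = k + m * (k * (m - 1)) + S ∧ (0 < S → ∃ (T : Subgroup H) (v : H), IsTorus T v ∧
      S ≤ Nat.card T * (k * (m + 1) - 1)) := by
  classical
  have := Fintype.ofFinite H
  set Γ : H → ℕ := fun g => {v : H | IsInvolution v ∧ IsInvolution (v * g)}.ncard with hΓ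
  set J : Finset H := Finset.univ.filter IsInvolution with hJdef
  have hJ : ∀ v, v ∈ J ↔ IsInvolution v := fun v => by simp [hJdef]
  have hJcard : J.card = k := by
    rw [← hk, ← h.ncard_isInvolution, ← Set.ncard_coe_finset]
    congr 1
    ext v; simp [hJ]
  set P : H → Prop := fun g => g ≠ 1 ∧ ∃ w, IsInvolution w ∧ w * g = g * w with hP
  set W : Finset H := Finset.univ.filter P with hW
  have hWcard : W.card = k * (m - 1) := by
    rw [← hk, ← h.ncard_commuting_involution, ← Set.ncard_coe_finset]
    congr 1
    ext v; simp [hW, hP]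
  set R : Finset H := (Finset.univ \ {1}) \ W with hR
  have h1W : W ⊆ Finset.univ \ {1} := by
    intro g hg
    simp only [hW, hP, Finset.mem_filter, Finset.mem_univ, true_and] at hg
    simp [hg.1]
  have hRcard : R.card + k * (m - 1) + 1 = 2 * m * k := by
    rw [← hWcard, hR, Finset.card_sdiff_add_card_eq_card h1W]
    have h3 : ({1} : Finset H).card + (Finset.univ \ {1} : Finset H).card = Fintype.card H := by
      rw [add_comm, Finset.card_sdiff_add_card_eq_card (Finset.subset_univ _), Finset.card_univ]
    rw [← hk, ← h.card_eq_mul, Nat.card_eq_fintype_card, ← h3, Finset.card_singleton, add_comm]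
  have hsum := sum_involutions J hJ (fun _ => (1 : ℕ))
  simp only [Finset.sum_const, hJcard, smul_eq_mul, mul_one, Nat.cast_id] at hsum
  have hsplit : ∑ g : H, Γ g = Γ 1 + (∑ g ∈ W, Γ g + ∑ g ∈ R, Γ g) := by
    rw [add_comm (∑ g ∈ W, Γ g), hR, Finset.sum_sdiff h1W, ← Finset.sum_sdiff (Finset.subset_univ {1}), add_comm,
      Finset.sum_singleton]
  have hΓ1 : Γ 1 = k := by
    rw [← hk, ← h.ncard_isInvolution]
    simp [hΓ]
  have hΓW : ∑ g ∈ W, Γ g = m * (k * (m - 1)) := by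
    rw [Finset.sum_congr rfl (fun g hg => h.ncard_factorizations (by simpa [hW, hP] using hg)),
      Finset.sum_const, hWcard, smul_eq_mul, mul_comm]
  refine ⟨∑ g ∈ R, Γ g, ?_, fun hpos => ?_⟩
  · rw [hsum, hsplit, hΓ1, hΓW, add_assoc]
  · have hne : R.Nonempty := by
      by_contra hne
      rw [Finset.not_nonempty_iff_eq_empty] at hne
      simp [hne] at hpos
    obtain ⟨g, hgR, hmax⟩ := Finset.exists_max_image R Γ hne
    have hle : ∑ g ∈ R, Γ g ≤ R.card * Γ g := by
      rw [← smul_eq_mul]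
      exact Finset.sum_le_card_nsmul R Γ (Γ g) hmax
    have hΓg : 0 < Γ g := by
      by_contra h0
      have : Γ g = 0 := by omega
      rw [this] at hle
      omega
    obtain ⟨v, hv, hvg⟩ := (Set.ncard_pos (Set.toFinite _)).1 hΓg
    have hg1 : g ≠ 1 := by
      simp only [hR, Finset.mem_sdiff, Finset.mem_singleton] at hgR
      exact hgR.1.2
    have hgW : ¬ ∃ w, IsInvolution w ∧ w * g = g * w := fun hc => by
      simp only [hR, hW, hP, Finset.mem_sdiff, Finset.mem_filter, Finset.mem_univ, true_and] at hgR
      exact hgR.2 ⟨hg1, hc⟩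
    obtain ⟨hT, hTc⟩ := h.exists_torus hg1 hgW hv hvg
    refine ⟨_, v, hT, hle.trans ?_⟩
    rw [mul_comm]
    refine Nat.mul_le_mul hTc ?_
    have h4 := h.four_le
    have hk1 := h.index_pos
    rw [hk] at hk1
    obtain ⟨m', rfl⟩ : ∃ m', m = m' + 1 := ⟨m - 1, by omega⟩
    simp only [Nat.add_sub_cancel] at hRcard
    have : R.card + 1 = k * (m' + 1 + 1) := by nlinarith
    omega

end DihedralData

namespace IsTorus

variable {H : Type*} [Group H] {v z : H} {A T : Subgroup H} {m : ℕ}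

theorem card_inf_dvd_pred (hT : IsTorus T v) :
    Nat.card ↥(Subgroup.normalizer (T : Set H) ⊓ Subgroup.centralizer {v}) ∣ Nat.card T - 1 := by
  have h1 : ((T : Set H) \ {1}).ncard = Nat.card T - 1 := by
    rw [Set.ncard_sdiff_singleton_of_mem T.one_mem, ← Nat.card_coe_set_eq]; rfl
  rw [← h1]
  apply card_dvd_ncard_of_conj
  · rintro s ⟨hs, -⟩ y ⟨hy, hy1⟩
    refine ⟨(Subgroup.mem_normalizer_iff.1 hs y).1 hy, fun hc => hy1 ?_⟩
    simpa using hc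
  · rintro s ⟨hs, hsc⟩ y ⟨hy, hy1⟩ hsy
    refine hT.inf_centralizer_eq_bot ?_ (Subgroup.mem_centralizer_singleton_iff.1 hsc)
    rw [← hT.centralizer_eq y hy hy1]
    exact Subgroup.mem_centralizer_singleton_iff.2 hsy

variable [Finite H]

/-- Numerical constraints on a torus. -/
theorem exists_params (hD : DihedralData z A m) (hT : IsTorus T v) {k : ℕ}
    (hk : (Subgroup.centralizer {z}).index = k) :
    ∃ μ t', 0 < μ ∧
      μ * Nat.card ↥(Subgroup.normalizer (T : Set H) ⊓ Subgroup.centralizer {v}) = m ∧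
      Nat.card T * t' = k ∧ m + 1 ≤ t' ∧ (Nat.card T ≤ m + 1 ∨
        t' = m + 1 ∧ (2 * μ - 1) * Nat.card T + 1 ≤ 2 * μ * (m + 1)) := by
  obtain ⟨B, hB⟩ := hD.exists_of_isInvolution hT.involution
  set L := Subgroup.normalizer (T : Set H) ⊓ Subgroup.centralizer {v} with hL
  have hdvd : Nat.card L ∣ m := by
    rw [← hB.card_eq]; exact Subgroup.card_dvd_of_le (hT.le_of_data hB)
  obtain ⟨μ, hμ⟩ := hdvd
  have hm := hD.four_le
  have hμ0 : 0 < μ := by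
    rcases Nat.eq_zero_or_pos μ with h | h
    · subst h; omega
    · exact h
  have hL0 : 0 < Nat.card L := Nat.card_pos
  have hT0 : 0 < Nat.card T := Nat.card_pos
  have h1 := hT.card_normalizer
  have h2 := Subgroup.card_mul_index (Subgroup.normalizer (T : Set H))
  rw [hD.card_eq_mul, hk, h1] at h2
  have hmul := card_mul_le hD hT
  have hbd := conjugates_bound hD hT (μ := 2 * μ) (by rw [← hL, mul_assoc, Nat.mul_comm μ, ← hμ])
  rw [hk] at hmul hbd
  have hdk : Nat.card T ∣ k := by
    have h3 : Nat.card T ∣ 2 * m * k := ⟨_, by rw [← h2, mul_assoc]⟩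
    refine Nat.Coprime.dvd_of_dvd_mul_left ?_ h3
    obtain ⟨a, -, ha⟩ := hD.two_pow
    rw [ha, ← pow_succ']
    exact (Nat.coprime_pow_right_iff (by omega) _ _).2 hT.odd_card.coprime_two_right
  obtain ⟨t', ht'⟩ := hdk
  set t := Nat.card T with ht
  set n := (Subgroup.normalizer (T : Set H)).index
  have hn : n = 2 * μ * t' := by
    have : (t * Nat.card L) * n = (t * Nat.card L) * (2 * μ * t') := by
      rw [h2, hμ, ht']; ring
    exact Nat.eq_of_mul_eq_mul_left (by positivity) this
  have h5 : m + 1 ≤ t' := by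
    rw [ht'] at hmul
    exact Nat.le_of_mul_le_mul_left hmul hT0
  refine ⟨μ, t', hμ0, by rw [Nat.mul_comm, ← hμ], ht'.symm, h5, ?_⟩
  rw [hn, ht'] at hbd
  by_cases hc : t ≤ m + 1
  · exact Or.inl hc
  right
  push Not at hc
  have hμm : 2 * μ ≤ m ∨ Nat.card L = 1 := by
    rcases Nat.lt_or_ge (Nat.card L) 2 with h | h
    · right; omega
    · left; rw [hμ]; exact Nat.mul_le_mul_right μ h
  have hL1 : Nat.card L ≠ 1 := by
    intro hc
    rw [Subgroup.card_eq_one] at hc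
    have : v ∈ L := ⟨hT.mem_normalizer_self, Subgroup.mem_centralizer_singleton_iff.2 rfl⟩
    rw [hc, Subgroup.mem_bot] at this
    exact hT.involution.1 this
  replace hμm := hμm.resolve_right hL1
  have h6 : t' = m + 1 := by
    by_contra hne
    have h7 : m + 2 ≤ t' := by omega
    zify at *
    nlinarith [mul_nonneg (show (0:ℤ) ≤ t' - (m + 2) by omega) (show (0:ℤ) ≤ t - 2 * μ by omega),
      mul_nonneg (show (0:ℤ) ≤ μ by omega) (show (0:ℤ) ≤ t - (m + 2) by omega)]
  refine ⟨h6, ?_⟩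
  subst h6
  obtain ⟨c, hc⟩ : ∃ c, 2 * μ = c + 1 := ⟨2 * μ - 1, by omega⟩
  rw [hc] at hbd ⊢
  simp only [Nat.add_sub_cancel]
  nlinarith

end IsTorus

namespace DihedralData

variable {H : Type*} [Group H] [Finite H] {z : H} {A : Subgroup H} {m : ℕ}

theorem index_ne_thirteen (h : DihedralData z A 4) : (Subgroup.centralizer {z}).index ≠ 13 := by
  intro hk
  have hcard : Nat.card H = 104 := by rw [h.card_eq_mul, hk]
  have : Fact (Nat.Prime 13) := ⟨by norm_num⟩
  obtain ⟨P⟩ : Nonempty (Sylow 13 H) := inferInstance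
  have hPcard : Nat.card P = 13 := by
    rw [Sylow.card_eq_multiplicity, hcard]
    have : (104 : ℕ).factorization 13 = 1 := by
      rw [show (104 : ℕ) = 13 * 8 by norm_num,
        Nat.factorization_mul_apply_of_coprime (by norm_num), Nat.Prime.factorization_self (by norm_num),
        Nat.factorization_eq_zero_of_not_dvd (by norm_num)]
    rw [this, pow_one]
  have hn : Nat.card (Sylow 13 H) = 1 := by
    have h1 := card_sylow_modEq_one 13 H
    have h2 := P.card_dvd_index
    have h3 : (P : Subgroup H).index = 8 := by
      have := Subgroup.card_mul_index (P : Subgroup H)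
      rw [hcard, hPcard] at this
      omega
    rw [h3] at h2
    have h4 : Nat.card (Sylow 13 H) ≤ 8 := Nat.le_of_dvd (by norm_num) h2
    unfold Nat.ModEq at h1
    omega
  have hnormal : (P : Subgroup H).Normal := by
    have : Subsingleton (Sylow 13 H) := (Nat.card_eq_one_iff_unique.1 hn).1
    exact Sylow.normal_of_subsingleton P
  have hfree : ∀ g ∈ (P : Subgroup H), g ≠ 1 → ∀ w, IsInvolution w → w * g ≠ g * w := by
    intro g hg h1 w hw hc
    obtain ⟨B, hB⟩ := h.exists_of_isInvolution hw
    have h2 : orderOf g ∣ 8 := by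
      have h5 := Subgroup.orderOf_dvd_natCard (Subgroup.centralizer {w})
        (Subgroup.mem_centralizer_singleton_iff.2 hc.symm)
      rwa [hB.card_centralizer] at h5
    have h3 : orderOf g ∣ 13 := by
      have h5 := Subgroup.orderOf_dvd_natCard (P : Subgroup H) hg
      rwa [hPcard] at h5
    exact h1 (orderOf_eq_one_iff.1 (Nat.eq_one_of_dvd_coprimes (by norm_num) h2 h3))
  obtain ⟨g, hg, h1⟩ := (P : Subgroup H).bot_or_exists_ne_one.resolve_left (by
    intro hc
    have := Subgroup.card_eq_one.2 hc
    rw [hPcard] at this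
    omega)
  have hinv := h.involution.inverts_of_normalizes (T := P) (fun g hg => by
    have := hnormal.conj_mem g hg z
    rwa [h.involution.inv_eq] at this) (fun g hg h1 => hfree g hg h1 z h.involution)
  have hT := IsTorus.of_inverts h h.involution h1 (hinv g hg) (hfree g hg h1)
  have h7 := IsTorus.card_mul_le h hT
  rw [hk] at h7
  have h8 : Nat.card P ≤ Nat.card (Subgroup.centralizer {g}) := by
    refine Subgroup.card_le_of_le fun x hx => Subgroup.mem_centralizer_singleton_iff.2 ?_
    have : IsCyclic P := isCyclic_of_prime_card hPcard
    have := IsCyclic.isMulCommutative.is_comm.comm (⟨x, hx⟩ : P) ⟨g, hg⟩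
    exact congrArg Subtype.val this
  rw [hPcard] at h8
  omega

/-- The two possible configurations: a torus of order `m - 1` with normalizer of order
`2 * (m - 1)`, or a torus of order `2 * m + 1` with normalizer of order `(2 * m + 1) * m`. -/
theorem exists_torus_cases (h : DihedralData z A m) {k : ℕ}
    (hk : (Subgroup.centralizer {z}).index = k)
    (hcases : 8 ≤ m → k = (2 * m - 1) * (m - 1) ∨ k = (2 * m + 1) * (m + 1)) :
    ∃ (T : Subgroup H) (v : H), IsTorus T v ∧
      (k = (2 * m - 1) * (m - 1) ∧ Nat.card T = m - 1 ∧
        Nat.card ↥(Subgroup.normalizer (T : Set H) ⊓ Subgroup.centralizer {v}) = 2 ∨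
      k = (2 * m + 1) * (m + 1) ∧ Nat.card T = 2 * m + 1 ∧
        Nat.card ↥(Subgroup.normalizer (T : Set H) ⊓ Subgroup.centralizer {v}) = m) := by
  have hm := h.four_le
  obtain ⟨r, hr⟩ := h.index_modEq
  rw [hk] at hr
  have hr0 : 0 < r := by
    rcases Nat.eq_zero_or_pos r with h0 | h0
    · exfalso
      subst h0
      by_cases h8 : 8 ≤ m
      · obtain ⟨c, rfl⟩ : ∃ c, m = c + 2 := ⟨m - 2, by omega⟩
        rcases hcases h8 with hc | hc
        · rw [show 2 * (c + 2) - 1 = 2 * c + 3 by omega, show c + 2 - 1 = c + 1 by omega] at hc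
          simp only [Nat.add_sub_cancel] at hr
          nlinarith
        · simp only [Nat.add_sub_cancel] at hr
          nlinarith
      · obtain ⟨a, ha, rfl⟩ := h.two_pow
        have ha3 : a < 3 := by
          by_contra hc
          exact h8 (Nat.pow_le_pow_right (n := 2) (by norm_num) (by omega : 3 ≤ a))
        obtain rfl : a = 2 := by omega
        exact h.index_ne_thirteen (by rw [hk, hr]; norm_num)
    · exact h0
  obtain ⟨S, hS, hST⟩ := h.exists_large_torus hk
  have hSk : S = k * (2 * m * r) := by
    obtain ⟨c, rfl⟩ : ∃ c, m = c + 2 := ⟨m - 2, by omega⟩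
    simp only [Nat.add_sub_cancel] at hr
    rw [show c + 2 - 1 = c + 1 by omega] at hS
    have : k * k = k * (c + 2 + 1 + (c + 2) * c + 2 * (c + 2) * r) := by rw [← hr]
    nlinarith
  have hk0 : 0 < k := by omega
  obtain ⟨T, v, hT, hle⟩ := hST (by rw [hSk]; positivity)
  have hle2 : 2 * m * r < Nat.card T * (m + 1) := by
    have h1 : k * (2 * m * r) < k * (Nat.card T * (m + 1)) := by
      rw [← hSk]
      refine hle.trans_lt ?_
      have : 0 < Nat.card T := Nat.card_pos
      calc Nat.card T * (k * (m + 1) - 1) < Nat.card T * (k * (m + 1)) := by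
            apply Nat.mul_lt_mul_of_pos_left _ this
            have : 0 < k * (m + 1) := by positivity
            omega
        _ = _ := by ring
    exact Nat.lt_of_mul_lt_mul_left h1
  obtain ⟨μ, t', hμ0, hμ, htk, ht', htc⟩ := hT.exists_params h hk
  have hodd := hT.odd_card
  have hdvd := hT.card_inf_dvd_pred
  refine ⟨T, v, hT, ?_⟩
  set ℓ := Nat.card ↥(Subgroup.normalizer (T : Set H) ⊓ Subgroup.centralizer {v}) with hℓ
  have hℓ2 : ℓ ≠ 1 := by
    intro hc
    rw [hℓ, Subgroup.card_eq_one] at hc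
    have : v ∈ Subgroup.normalizer (T : Set H) ⊓ Subgroup.centralizer {v} :=
      ⟨hT.mem_normalizer_self, Subgroup.mem_centralizer_singleton_iff.2 rfl⟩
    rw [hc, Subgroup.mem_bot] at this
    exact hT.involution.1 this
  have ht1 : Nat.card T ≠ 1 := fun hc => hT.ne_bot (Subgroup.card_eq_one.1 hc)
  set t := Nat.card T with ht
  have hℓtwo : t = m - 1 → ℓ = 2 := by
    intro htm
    have h1 : ℓ ∣ 2 := by
      have h2 : ℓ ∣ m := ⟨μ, by rw [← hμ, mul_comm]⟩
      rw [htm] at hdvd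
      have := Nat.dvd_sub h2 hdvd
      rwa [show m - (m - 1 - 1) = 2 by omega] at this
    rcases (Nat.dvd_prime Nat.prime_two).1 h1 with h | h
    · exact absurd h hℓ2
    · exact h
  have hℓm : t = 2 * m + 1 → ℓ = m := by
    intro htm
    have hμ1 : μ = 1 := by
      rcases htc with h1 | ⟨-, h1⟩
      · omega
      · rw [htm] at h1
        obtain ⟨c, rfl⟩ : ∃ c, μ = c + 1 := ⟨μ - 1, by omega⟩
        rw [show 2 * (c + 1) - 1 = 2 * c + 1 by omega] at h1
        by_contra hne
        have : 0 < c := by omega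
        have : 0 < c * m := by positivity
        nlinarith
    rw [hμ1, one_mul] at hμ
    exact hμ
  suffices hsuff : (k = (2 * m - 1) * (m - 1) ∧ t = m - 1) ∨
      (k = (2 * m + 1) * (m + 1) ∧ t = 2 * m + 1) by
    rcases hsuff with ⟨h1, h2⟩ | ⟨h1, h2⟩
    · exact Or.inl ⟨h1, h2, hℓtwo h2⟩
    · exact Or.inr ⟨h1, h2, hℓm h2⟩
  have heven : m % 2 = 0 := by
    obtain ⟨a, ha, rfl⟩ := h.two_pow
    obtain ⟨b, rfl⟩ : ∃ b, a = b + 1 := ⟨a - 1, by omega⟩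
    rw [pow_succ]; omega
  have htodd : t % 2 = 1 := Nat.odd_iff.1 hodd
  by_cases h8 : 8 ≤ m
  · obtain ⟨c, rfl⟩ : ∃ c, m = c + 2 := ⟨m - 2, by omega⟩
    simp only [Nat.add_sub_cancel] at hr
    rcases hcases h8 with hc | hc
    · left
      refine ⟨hc, ?_⟩
      rw [show 2 * (c + 2) - 1 = 2 * c + 3 by omega, show c + 2 - 1 = c + 1 by omega] at hc
      have h1 : c ≤ t := by
        by_contra hlt
        push Not at hlt
        have : (t + 1) * (c + 3) ≤ c * (c + 3) := Nat.mul_le_mul_right _ hlt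
        nlinarith
      have hnd : ¬ (c + 3 ∣ k) := by
        rintro ⟨d, hd⟩
        have : c + 3 ∣ 6 := by
          have h4 : (c + 3) * d + 3 * (c + 3) = 2 * (c + 3) * (c + 1) + 6 := by
            rw [← hd, hc]; ring
          have h5 : c + 3 ∣ 2 * (c + 3) * (c + 1) + 6 := ⟨d + 3, by linarith⟩
          exact (Nat.dvd_add_right ⟨2 * (c + 1), by ring⟩).1 h5
        have := Nat.le_of_dvd (by norm_num) this
        omega
      have h2 : t ≤ c + 3 := by
        rcases htc with h2 | ⟨h2, -⟩
        · omega
        · exact absurd ⟨t, by rw [← htk, h2, mul_comm]⟩ hnd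
      have h3 : t ≠ c + 3 := fun h3 => hnd ⟨t', by rw [← htk, h3]⟩
      omega
    · right
      refine ⟨hc, ?_⟩
      have h1 : c + 5 ≤ t := by
        by_contra hlt
        push Not at hlt
        have : t * (c + 3) ≤ (c + 4) * (c + 3) := Nat.mul_le_mul_right _ (by omega)
        nlinarith
      have h2 : t' = c + 2 + 1 := by
        rcases htc with h2 | ⟨h2, -⟩
        · omega
        · exact h2
      rw [hc, h2] at htk
      exact Nat.eq_of_mul_eq_mul_right (by omega) htk
  · obtain rfl : m = 4 := by
      obtain ⟨a, ha, rfl⟩ := h.two_pow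
      have ha3 : a < 3 := by
        by_contra hc
        exact h8 (Nat.pow_le_pow_right (n := 2) (by norm_num) (by omega : 3 ≤ a))
      obtain rfl : a = 2 := by omega
      rfl
    norm_num at *
    rcases htc with h1 | ⟨h1, h2⟩
    · have : t = 3 ∨ t = 5 := by omega
      rcases this with h3 | h3 <;> rw [h3] at htk hle2 ⊢ <;> omega
    · subst h1
      have : t ≤ 9 := by
        obtain ⟨c, rfl⟩ : ∃ c, μ = c + 1 := ⟨μ - 1, by omega⟩
        rw [show 2 * (c + 1) - 1 = 2 * c + 1 by omega] at h2
        by_contra hc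
        push Not at hc
        nlinarith
      omega

end DihedralData

/-- The irreducible representations of a finite group, from the Wedderburn decomposition of its
complex group algebra. -/
theorem exists_irreps (H : Type*) [Group H] [Fintype H] [DecidableEq H] :
    ∃ (n : ℕ) (d : Fin n → ℕ) (ρ : ∀ i, H →* Matrix (Fin (d i)) (Fin (d i)) ℂ),
      (∀ i, 0 < d i) ∧
      (∀ g, ∑ i, (d i : ℂ) * (ρ i g).trace = if g = 1 then (Fintype.card H : ℂ) else 0) ∧
      ∀ M : ∀ i, Matrix (Fin (d i)) (Fin (d i)) ℂ, ∃ a : H → ℂ, ∀ i, ∑ g, a g • ρ i g = M i := by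
  have : NeZero (Nat.card H : ℂ) := ⟨by exact_mod_cast Nat.card_pos.ne'⟩
  have : FiniteDimensional ℂ (MonoidAlgebra ℂ H) := Module.Basis.finiteDimensional_of_finite
    (MonoidAlgebra.basis H ℂ)
  obtain ⟨n, d, hd, ⟨E⟩⟩ :=
    IsSemisimpleRing.exists_algEquiv_pi_matrix_of_isAlgClosed ℂ (MonoidAlgebra ℂ H)
  let ev : ∀ i, (∀ i, Matrix (Fin (d i)) (Fin (d i)) ℂ) →* Matrix (Fin (d i)) (Fin (d i)) ℂ :=
    fun i => Pi.evalMonoidHom _ i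
  refine ⟨n, d, fun i => ((ev i).comp (E : _ →* _)).comp (MonoidAlgebra.of ℂ H),
    fun i => Nat.pos_of_ne_zero (hd i).ne, ?_, ?_⟩
  · intro g
    set x := MonoidAlgebra.of ℂ H g with hx
    let b1 := (MonoidAlgebra.basis H ℂ).map E.toLinearEquiv
    let b2 := Pi.basis fun i => Matrix.stdBasis ℂ (Fin (d i)) (Fin (d i))
    have h1 := LinearMap.trace_eq_matrix_trace ℂ b1 (LinearMap.mulLeft ℂ (E x))
    have h2 := LinearMap.trace_eq_matrix_trace ℂ b2 (LinearMap.mulLeft ℂ (E x))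
    rw [h1] at h2
    have h3 : Matrix.trace (LinearMap.toMatrix b1 b1 (LinearMap.mulLeft ℂ (E x))) =
        if g = 1 then (Fintype.card H : ℂ) else 0 := by
      simp only [Matrix.trace, Matrix.diag, LinearMap.toMatrix_apply]
      have : ∀ y : H, b1.repr (LinearMap.mulLeft ℂ (E x) (b1 y)) y = if g = 1 then 1 else 0 := by
        intro y
        have e : LinearMap.mulLeft ℂ (E x) (b1 y) = E (MonoidAlgebra.single (g * y) 1) := by
          change E x * E (MonoidAlgebra.basis H ℂ y) = _
          rw [← map_mul, hx, MonoidAlgebra.basis_apply, MonoidAlgebra.of_apply,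
            MonoidAlgebra.single_mul_single, one_mul]
        rw [e]
        change (E.symm (E (MonoidAlgebra.single (g * y) 1))).coeff y = _
        rw [AlgEquiv.symm_apply_apply, MonoidAlgebra.coeff_single, Finsupp.single_apply]
        simp
      rw [Finset.sum_congr rfl fun y _ => this y]
      simp
    have h4 : Matrix.trace (LinearMap.toMatrix b2 b2 (LinearMap.mulLeft ℂ (E x))) =
        ∑ i, (d i : ℂ) * (E x i).trace := by
      simp only [Matrix.trace, Matrix.diag, LinearMap.toMatrix_apply]
      rw [Fintype.sum_sigma]
      refine Finset.sum_congr rfl fun i _ => ?_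
      rw [Fintype.sum_prod_type]
      have : ∀ a b, b2.repr (LinearMap.mulLeft ℂ (E x) (b2 ⟨i, a, b⟩)) ⟨i, a, b⟩ = E x i a a := by
        intro a b
        rw [Pi.basis_repr]
        have e : (LinearMap.mulLeft ℂ (E x) (b2 ⟨i, a, b⟩)) i = E x i * Matrix.single a b 1 := by
          change E x i * b2 ⟨i, a, b⟩ i = _
          simp only [b2, Pi.basis_apply, Pi.single_eq_same, Matrix.stdBasis_eq_single]
        change (Matrix.stdBasis ℂ (Fin (d i)) (Fin (d i))).repr _ (a, b) = _
        rw [e]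
        change (E x i * Matrix.single a b 1 : Matrix _ _ ℂ) a b = _
        simp
      simp only [this, Finset.sum_const, Finset.card_univ, Fintype.card_fin, nsmul_eq_mul,
        Finset.mul_sum]
    rw [← h3, h2, h4]
    rfl
  · intro M
    refine ⟨(E.symm M).coeff, fun i => ?_⟩
    have h1 : ∑ g, (E.symm M).coeff g • E (MonoidAlgebra.of ℂ H g) = M := by
      conv_rhs => rw [← E.apply_symm_apply M, ← MonoidAlgebra.sum_coeff_single (E.symm M),
        Finsupp.sum_fintype _ _ (by simp), map_sum]
      refine Finset.sum_congr rfl fun g _ => ?_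
      rw [← map_smul, MonoidAlgebra.of_apply, MonoidAlgebra.smul_single', mul_one]
    conv_rhs => rw [← h1, Finset.sum_apply]
    rfl

/-- A complete system of irreducible representations. -/
structure IrrepSystem (H : Type*) [Group H] [Fintype H] [DecidableEq H] where
  n : ℕ
  d : Fin n → ℕ
  ρ : ∀ i, H →* Matrix (Fin (d i)) (Fin (d i)) ℂ
  pos : ∀ i, 0 < d i
  reg : ∀ g, ∑ i, (d i : ℂ) * (ρ i g).trace = if g = 1 then (Fintype.card H : ℂ) else 0
  surj : ∀ M : ∀ i, Matrix (Fin (d i)) (Fin (d i)) ℂ, ∃ a : H → ℂ, ∀ i, ∑ g, a g • ρ i g = M i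

namespace IrrepSystem

variable {H : Type*} [Group H] [Fintype H] [DecidableEq H] (X : IrrepSystem H)

instance : Nonempty (IrrepSystem H) := by
  obtain ⟨n, d, ρ, h1, h2, h3⟩ := exists_irreps H
  exact ⟨⟨n, d, ρ, h1, h2, h3⟩⟩

/-- The character of the `i`-th representation. -/
noncomputable def χ (i : Fin X.n) (g : H) : ℂ := (X.ρ i g).trace

theorem χ_one (i : Fin X.n) : X.χ i 1 = X.d i := by simp [χ]

theorem d_ne_zero (i : Fin X.n) : (X.d i : ℂ) ≠ 0 := by
  exact_mod_cast (X.pos i).ne'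

theorem χ_conj (i : Fin X.n) (g h : H) : X.χ i (h * g * h⁻¹) = X.χ i g := by
  rw [χ, map_mul, Matrix.trace_mul_comm, ← map_mul, inv_mul_cancel_left, χ]

theorem card_mul_apply (a : H → ℂ) (h : H) : (Fintype.card H : ℂ) * a h =
    ∑ i, (X.d i : ℂ) * ((∑ g, a g • X.ρ i g) * X.ρ i h⁻¹).trace := by
  have h1 : ∀ i, (X.d i : ℂ) * ((∑ g, a g • X.ρ i g) * X.ρ i h⁻¹).trace =
      ∑ g, a g * ((X.d i : ℂ) * (X.ρ i (g * h⁻¹)).trace) := by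
    intro i
    rw [Finset.sum_mul, Matrix.trace_sum, Finset.mul_sum]
    refine Finset.sum_congr rfl fun g _ => ?_
    rw [Matrix.smul_mul, Matrix.trace_smul, map_mul, smul_eq_mul]
    ring
  rw [Finset.sum_congr rfl fun i _ => h1 i, Finset.sum_comm]
  simp only [← Finset.mul_sum, X.reg, mul_inv_eq_one]
  simp [mul_comm]

theorem trace_sum (a : H → ℂ) (i : Fin X.n) :
    (∑ g, a g • X.ρ i g).trace = ∑ g, a g * X.χ i g := by
  simp [Matrix.trace_sum, χ]

theorem sum_smul_eq (a : H → ℂ) (ha : ∀ g h, a (h * g * h⁻¹) = a g) (i : Fin X.n) :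
    ∑ g, a g • X.ρ i g = ((∑ g, a g * X.χ i g) / X.d i) • (1 : Matrix _ _ ℂ) := by
  have h1 : ∀ h, Commute (X.ρ i h) (∑ g, a g • X.ρ i g) := by
    intro h
    unfold Commute SemiconjBy
    rw [Finset.mul_sum, Finset.sum_mul]
    rw [← Equiv.sum_comp (MulAut.conj h).toEquiv (fun g => a g • X.ρ i g * X.ρ i h)]
    refine Finset.sum_congr rfl fun g _ => ?_
    change _ = a (h * g * h⁻¹) • X.ρ i (h * g * h⁻¹) * X.ρ i h
    rw [ha, smul_mul_assoc, ← map_mul, inv_mul_cancel_right, mul_smul_comm, map_mul]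
  have h2 : ∀ N : Matrix (Fin (X.d i)) (Fin (X.d i)) ℂ, Commute N (∑ g, a g • X.ρ i g) := by
    classical
    intro N
    obtain ⟨b, hb⟩ := X.surj (Pi.single i N)
    have hb' := hb i
    rw [Pi.single_eq_same] at hb'
    rw [← hb']
    exact Commute.sum_left _ _ _ fun g _ => (h1 g).smul_left _
  obtain ⟨ω, hω⟩ := Matrix.mem_range_scalar_of_commute_single (M := ∑ g, a g • X.ρ i g)
    fun i j _ => h2 _
  have h3 := X.trace_sum a i
  rw [← hω] at h3 ⊢
  rw [← h3]
  have := X.d_ne_zero i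
  ext a b
  simp [Matrix.trace, Matrix.scalar_apply, Matrix.diagonal_apply, Matrix.one_apply]
  field_simp

theorem card_mul_eq_sum (a : H → ℂ) (ha : ∀ g h, a (h * g * h⁻¹) = a g) (h : H) :
    (Fintype.card H : ℂ) * a h = ∑ i, (∑ g, a g * X.χ i g) * X.χ i h⁻¹ := by
  rw [X.card_mul_apply]
  refine Finset.sum_congr rfl fun i _ => ?_
  rw [X.sum_smul_eq a ha, Matrix.smul_mul, one_mul, Matrix.trace_smul, smul_eq_mul, χ]
  have := X.d_ne_zero i
  field_simp

theorem sum_χ_mul_χ_inv (i : Fin X.n) : ∑ g, X.χ i g⁻¹ * X.χ i g = Fintype.card H := by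
  classical
  obtain ⟨a, ha⟩ := X.surj (Pi.single i 1)
  have h1 : ∀ g, (Fintype.card H : ℂ) * a g = X.d i * X.χ i g⁻¹ := by
    intro g
    rw [X.card_mul_apply a g, Finset.sum_eq_single i]
    · rw [ha, Pi.single_eq_same, one_mul, χ]
    · intro j _ hj
      rw [ha, Pi.single_eq_of_ne hj, zero_mul, Matrix.trace_zero, mul_zero]
    · simp
  have h2 := X.trace_sum a i
  rw [ha, Pi.single_eq_same, Matrix.trace_one, Fintype.card_fin] at h2
  have h3 := congrArg (fun x => (Fintype.card H : ℂ) * x) h2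
  simp only [Finset.mul_sum, ← mul_assoc, h1] at h3
  simp only [mul_assoc, ← Finset.mul_sum] at h3
  rw [mul_comm] at h3
  exact (mul_left_cancel₀ (X.d_ne_zero i) h3).symm

theorem exists_trivial : ∃ i, X.d i = 1 ∧ ∀ g, X.ρ i g = 1 := by
  classical
  have hex : ∃ i, ∑ g, X.χ i g ≠ 0 := by
    by_contra hc
    push Not at hc
    have := X.card_mul_eq_sum (fun _ => 1) (fun _ _ => rfl) 1
    simp [hc] at this
  obtain ⟨i, hi⟩ := hex
  have h1 := X.sum_smul_eq (fun _ => 1) (fun _ _ => rfl) i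
  simp only [one_smul, one_mul] at h1
  have h2 : ∀ g, X.ρ i g = 1 := by
    intro g
    have h3 : X.ρ i g * ∑ h, X.ρ i h = ∑ h, X.ρ i h := by
      rw [Finset.mul_sum, ← Equiv.sum_comp (Equiv.mulLeft g) fun h => X.ρ i h]
      simp
    rw [h1, mul_smul_comm, mul_one] at h3
    exact smul_right_injective _ (div_ne_zero hi (X.d_ne_zero i)) h3
  refine ⟨i, ?_, h2⟩
  by_contra hd
  have := X.pos i
  obtain ⟨a, ha⟩ := X.surj fun j => if h : 1 < X.d j then Matrix.single ⟨0, by omega⟩ ⟨1, h⟩ 1 else 0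
  have hi2 : 1 < X.d i := by omega
  have h4 := ha i
  simp only [h2, hi2, dite_true, ← Finset.sum_smul] at h4
  have h5 := congrFun (congrFun h4 ⟨0, by omega⟩) ⟨1, hi2⟩
  simp at h5

open scoped ComplexOrder in
theorem χ_inv (i : Fin X.n) (g : H) : X.χ i g⁻¹ = star (X.χ i g) := by
  set P : Matrix (Fin (X.d i)) (Fin (X.d i)) ℂ := ∑ h, (X.ρ i h).conjTranspose * X.ρ i h with hP
  have h1 : P.PosDef := by
    rw [hP, ← Finset.add_sum_erase _ _ (Finset.mem_univ (1 : H))]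
    refine Matrix.PosDef.add_posSemidef (by simpa using Matrix.PosDef.one) ?_
    exact Matrix.posSemidef_sum _ fun h _ => Matrix.posSemidef_conjTranspose_mul_self _
  have h2 : (X.ρ i g).conjTranspose * P * X.ρ i g = P := by
    rw [hP, Finset.mul_sum, Finset.sum_mul,
      ← Equiv.sum_comp (Equiv.mulRight g) fun h => (X.ρ i h).conjTranspose * X.ρ i h]
    refine Finset.sum_congr rfl fun h _ => ?_
    simp [Matrix.conjTranspose_mul, mul_assoc]
  have h3 : (X.ρ i g).conjTranspose * P = P * X.ρ i g⁻¹ := by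
    conv_rhs => rw [← h2, mul_assoc, ← map_mul, mul_inv_cancel, map_one, mul_one]
  have h4 : IsUnit P.det := (Matrix.isUnit_iff_isUnit_det _).1 h1.isUnit
  rw [χ, χ, ← Matrix.trace_conjTranspose]
  calc (X.ρ i g⁻¹).trace = (P⁻¹ * (P * X.ρ i g⁻¹)).trace := by
        rw [← mul_assoc, Matrix.nonsing_inv_mul _ h4, one_mul]
    _ = _ := by
        rw [← h3, Matrix.trace_mul_comm, mul_assoc, Matrix.mul_nonsing_inv _ h4, mul_one]

end IrrepSystem

theorem Matrix.exists_trace_eq_natCast {n : ℕ} {M : Matrix (Fin n) (Fin n) ℂ} (hM : M * M = M) :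
    ∃ r : ℕ, M.trace = r := by
  have h1 : IsIdempotentElem (Matrix.toLin' M) := by
    unfold IsIdempotentElem
    rw [Module.End.mul_eq_comp, ← Matrix.toLin'_mul, hM]
  have h2 := (LinearMap.isProj_range_iff_isIdempotentElem _).2 h1
  exact ⟨_, by rw [← Matrix.trace_toLin'_eq, h2.trace]⟩

namespace DihedralData

variable {H : Type*} [Group H] [Finite H] {z : H} {A : Subgroup H} {m : ℕ}

theorem exists_character (h : DihedralData z A m) (hm : 8 ≤ m) :
    ∃ θ : A →* ℂ, θ ⟨z, h.mem⟩ = 1 ∧ θ * θ ≠ 1 := by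
  have := h.cyclic
  obtain ⟨g, hg⟩ := IsCyclic.exists_generator (α := A)
  have hord : orderOf g = m := by rw [orderOf_eq_card_of_forall_mem_zpowers hg, h.card_eq]
  have h8 : 8 ∣ m := by
    obtain ⟨a, ha, rfl⟩ := h.two_pow
    have : 3 ≤ a := by
      by_contra hc
      have : a = 2 := by omega
      subst this
      norm_num at hm
    exact pow_dvd_pow 2 this
  let u : ℂˣ := Units.mk0 Complex.I Complex.I_ne_zero
  have hu4 : u ^ 4 = 1 := by
    ext
    simp [u]
  have hu : orderOf u ∣ orderOf g := by
    rw [hord]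
    exact (orderOf_dvd_of_pow_eq_one hu4).trans (Dvd.dvd.trans (by norm_num) h8)
  let f := monoidHomOfForallMemZpowers hg hu
  have hf : f g = u := monoidHomOfForallMemZpowers_apply_gen hg hu
  refine ⟨(Units.coeHom ℂ).comp f, ?_, fun hc => ?_⟩
  · obtain ⟨j, hj⟩ := (Submonoid.mem_powers_iff _ _).1
      (mem_powers_iff_mem_zpowers.2 (hg ⟨z, h.mem⟩))
    have h2 : g ^ (2 * j) = 1 := by
      rw [mul_comm, pow_mul, hj]
      exact Subtype.ext (by simpa [sq] using h.mul_self)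
    have h3 := orderOf_dvd_of_pow_eq_one h2
    rw [hord] at h3
    obtain ⟨c, hc⟩ := h8.trans h3
    have h4 : j = 4 * c := by omega
    rw [← hj, MonoidHom.comp_apply, map_pow, hf, h4, pow_mul, hu4, one_pow, map_one]
  · have := DFunLike.congr_fun hc g
    simp [hf, u] at this
    norm_num [Complex.ext_iff] at this

end DihedralData

namespace IrrepSystem

variable {H : Type*} [Group H] [Fintype H] [DecidableEq H] (X : IrrepSystem H)

theorem exists_sum_eq_natCast (i : Fin X.n) (A : Subgroup H) [Fintype A] (θ : A →* ℂ) :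
    ∃ r : ℕ, (∑ a : A, θ a * X.χ i a) = Fintype.card A * r := by
  have hA : (Fintype.card A : ℂ) ≠ 0 := by exact_mod_cast Fintype.card_ne_zero
  set M : Matrix (Fin (X.d i)) (Fin (X.d i)) ℂ := ∑ a : A, θ a • X.ρ i a with hM
  have h1 : ∀ a : A, (θ a • X.ρ i a) * M = M := by
    intro a
    rw [hM, Finset.mul_sum, ← Equiv.sum_comp (Equiv.mulLeft a) fun b => θ b • X.ρ i b]
    refine Finset.sum_congr rfl fun b _ => ?_
    simp [smul_smul, mul_comm (θ b)]
  have h2 : M * M = (Fintype.card A : ℂ) • M := by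
    conv_lhs => enter [1]; rw [hM]
    rw [Finset.sum_mul, Finset.sum_congr rfl fun a _ => h1 a, Finset.sum_const, Finset.card_univ,
      Nat.cast_smul_eq_nsmul]
  obtain ⟨r, hr⟩ := Matrix.exists_trace_eq_natCast (M := (Fintype.card A : ℂ)⁻¹ • M) (by
    rw [smul_mul_smul_comm, h2, smul_smul, mul_assoc, inv_mul_cancel₀ hA, mul_one])
  refine ⟨r, ?_⟩
  rw [← hr, Matrix.trace_smul, smul_eq_mul, mul_inv_cancel_left₀ hA, hM, Matrix.trace_sum]
  simp [χ]

theorem exists_χ_eq_intCast (i : Fin X.n) {z : H} (hz : z * z = 1) :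
    ∃ b : ℤ, X.χ i z = b := by
  obtain ⟨r, hr⟩ := Matrix.exists_trace_eq_natCast (M := (2⁻¹ : ℂ) • (1 + X.ρ i z)) (by
    have : (1 + X.ρ i z) * (1 + X.ρ i z) = (2 : ℂ) • (1 + X.ρ i z) := by
      rw [mul_add, mul_one, add_mul, one_mul, ← map_mul, hz, map_one, two_smul]; abel
    rw [smul_mul_smul_comm, this, smul_smul]; norm_num)
  refine ⟨2 * r - X.d i, ?_⟩
  rw [Matrix.trace_smul, Matrix.trace_add, Matrix.trace_one, Fintype.card_fin, smul_eq_mul] at hr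
  rw [χ]
  push_cast
  rw [← hr]
  ring

/-- Bound coming from row orthogonality. -/
theorem sq_add_le (i : Fin X.n) {J : Finset H} (h1 : (1 : H) ∉ J) {b : ℤ}
    (hb : ∀ v ∈ J, X.χ i v = b) :
    (X.d i : ℤ) ^ 2 + J.card * b ^ 2 ≤ Fintype.card H := by
  have h2 := X.sum_χ_mul_χ_inv i
  have h3 : ∑ g, Complex.normSq (X.χ i g) = Fintype.card H := by
    have : ((∑ g, Complex.normSq (X.χ i g) : ℝ) : ℂ) = (Fintype.card H : ℝ) := by
      push_cast
      rw [← h2]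
      refine Finset.sum_congr rfl fun g _ => ?_
      rw [X.χ_inv, Complex.normSq_eq_conj_mul_self]
      rfl
    exact_mod_cast this
  have h4 : ∑ g ∈ insert 1 J, Complex.normSq (X.χ i g) ≤ ∑ g, Complex.normSq (X.χ i g) :=
    Finset.sum_le_sum_of_subset_of_nonneg (Finset.subset_univ _) fun g _ _ => Complex.normSq_nonneg _
  rw [Finset.sum_insert h1, h3, χ_one, Finset.sum_congr rfl fun v hv => by rw [hb v hv],
    Finset.sum_const, nsmul_eq_mul] at h4
  have h5 : Complex.normSq (X.d i : ℂ) = (X.d i : ℝ) ^ 2 := by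
    rw [Complex.normSq_natCast, sq]
  have h6 : Complex.normSq (b : ℂ) = (b : ℝ) ^ 2 := by
    rw [Complex.normSq_intCast, sq]
  rw [h5, h6] at h4
  exact_mod_cast h4

/-- The square of the class sum of involutions. -/
theorem sum_sum_χ_mul (i : Fin X.n) {J : Finset H} (hJ : ∀ v g, v ∈ J → g * v * g⁻¹ ∈ J) {b : ℂ}
    (hb : ∀ v ∈ J, X.χ i v = b) :
    ∑ v ∈ J, ∑ w ∈ J, X.χ i (v * w) = (J.card * b) ^ 2 / X.d i := by
  have hd := X.d_ne_zero i
  have h1 := X.sum_smul_eq (fun g => if g ∈ J then 1 else 0) (fun g h => by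
    congr 1
    refine propext ⟨fun hc => ?_, hJ g h⟩
    have := hJ _ h⁻¹ hc
    simpa [mul_assoc] using this) i
  simp only [ite_smul, one_smul, zero_smul, ite_mul, one_mul, zero_mul, Finset.sum_ite_mem,
    Finset.univ_inter] at h1
  rw [Finset.sum_congr rfl hb, Finset.sum_const, nsmul_eq_mul] at h1
  have h2 : ((∑ v ∈ J, X.ρ i v) * ∑ v ∈ J, X.ρ i v).trace = ∑ v ∈ J, ∑ w ∈ J, X.χ i (v * w) := by
    rw [Finset.sum_mul, Matrix.trace_sum]
    refine Finset.sum_congr rfl fun v _ => ?_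
    rw [Finset.mul_sum, Matrix.trace_sum]
    refine Finset.sum_congr rfl fun w _ => ?_
    rw [χ, map_mul]
  rw [← h2, h1, smul_mul_smul_comm, mul_one, Matrix.trace_smul, Matrix.trace_one, Fintype.card_fin,
    smul_eq_mul]
  field_simp

end IrrepSystem

/-- The sum of a function over all conjugates of an element. -/
noncomputable def conjSum {H : Type*} [Group H] [Fintype H] (β : H → ℂ) (g : H) : ℂ :=
  ∑ y, β (y⁻¹ * g * y)

section conjSum

variable {H : Type*} [Group H] [Fintype H] (β : H → ℂ)

theorem conjSum_conj (g h : H) : conjSum β (h * g * h⁻¹) = conjSum β g := by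
  rw [conjSum, conjSum, ← Equiv.sum_comp (Equiv.mulLeft h)]
  refine Finset.sum_congr rfl fun y _ => ?_
  congr 1
  simp only [Equiv.coe_mulLeft]
  group

theorem sum_conjSum_mul (F : H → ℂ) (hF : ∀ g h, F (h * g * h⁻¹) = F g) :
    ∑ g, conjSum β g * F g = Fintype.card H * ∑ g, β g * F g := by
  simp only [conjSum, Finset.sum_mul]
  rw [Finset.sum_comm, Finset.sum_congr rfl (g := fun _ => ∑ g, β g * F g), Finset.sum_const,
    Finset.card_univ, nsmul_eq_mul]
  intro y _
  rw [← Equiv.sum_comp (MulAut.conj y).toEquiv]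
  refine Finset.sum_congr rfl fun g _ => ?_
  have h1 : (MulAut.conj y).toEquiv g = y * g * y⁻¹ := rfl
  rw [h1, hF]
  congr 2
  group

end conjSum

namespace DihedralData

variable {H : Type*} [Group H] [Fintype H] {z : H} {A : Subgroup H} {m : ℕ}

theorem conjSum_eq (h : DihedralData z A m) {β : H → ℂ} (hβ : ∀ g, g ∉ A → β g = 0) {a : H}
    (ha : a ∈ A) (h1 : a ≠ 1) : conjSum β a = m * (β a + β a⁻¹) := by
  classical
  have hz : ∀ y, y⁻¹ * a * y ∈ A → y * z = z * y := by
    intro y hy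
    obtain ⟨j, hj⟩ := h.exists_pow_eq ha h1
    have h2 : y⁻¹ * z * y ∈ A := by
      have : y⁻¹ * z * y = (y⁻¹ * a * y) ^ j := by
        have := conj_pow (i := j) (a := y⁻¹) (b := a)
        rw [inv_inv] at this
        rw [this, hj]
      rw [this]
      exact A.pow_mem hy j
    have h3 := h.eq_of_mem h2 (by simpa using h.involution.conj y⁻¹)
    calc y * z = y * (y⁻¹ * z * y) := by rw [h3]
      _ = z * y := by group
  have hcard : ∀ B : Subgroup H, (Finset.univ.filter fun y => y ∈ B).card = Nat.card B := by
    intro B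
    rw [Nat.card_eq_fintype_card, Fintype.card_subtype]
  set C : Finset H := Finset.univ.filter fun y => y ∈ Subgroup.centralizer {z} with hC
  set A' : Finset H := Finset.univ.filter fun y => y ∈ A with hA'
  have hsub : A' ⊆ C := by
    intro y hy
    simp only [hA', hC, Finset.mem_filter, Finset.mem_univ, true_and] at hy ⊢
    exact h.le_centralizer hy
  have hcA : A'.card = m := by rw [hA', hcard, h.card_eq]
  have hcC : (C \ A').card = m := by
    rw [Finset.card_sdiff_of_subset hsub, hC, hcard, h.card_centralizer, hcA]
    omega
  rw [conjSum, ← Finset.sum_subset (Finset.subset_univ C), ← Finset.sum_sdiff hsub,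
    Finset.sum_congr rfl (g := fun _ => β a⁻¹), Finset.sum_congr (s₁ := A') rfl (g := fun _ => β a),
    Finset.sum_const, Finset.sum_const, hcC, hcA, nsmul_eq_mul, nsmul_eq_mul]
  · ring
  · intro y hy
    simp only [hA', Finset.mem_filter, Finset.mem_univ, true_and] at hy
    have := h.cyclic
    have h2 : a * y = y * a :=
      congrArg Subtype.val (IsCyclic.isMulCommutative.is_comm.comm (⟨a, ha⟩ : A) ⟨y, hy⟩)
    rw [mul_assoc, h2, inv_mul_cancel_left]
  · intro y hy
    simp only [hA', hC, Finset.mem_sdiff, Finset.mem_filter, Finset.mem_univ, true_and] at hy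
    have hyz := Subgroup.mem_centralizer_singleton_iff.1 hy.1
    have hy1 : y⁻¹ * z = z * y⁻¹ := by
      rw [inv_mul_eq_iff_eq_mul, ← mul_assoc, hyz, mul_inv_cancel_right]
    have := h.inverts hy1 (fun hc => hy.2 (by simpa using A.inv_mem hc)) ha
    rw [inv_inv] at this
    rw [this]
  · intro y _ hy
    refine hβ _ fun hc => hy ?_
    simp only [hC, Finset.mem_filter, Finset.mem_univ, true_and]
    exact Subgroup.mem_centralizer_singleton_iff.2 (hz y hc)

theorem commuting_of_conjSum_ne_zero (h : DihedralData z A m) {β : H → ℂ}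
    (hβ : ∀ g, g ∉ A → β g = 0) (hβ1 : β 1 = 0) {g : H} (hg : conjSum β g ≠ 0) :
    g ≠ 1 ∧ ∃ w, IsInvolution w ∧ w * g = g * w := by
  refine ⟨?_, ?_⟩
  · rintro rfl
    refine hg ?_
    simp [conjSum, hβ1]
  · obtain ⟨y, -, hy⟩ := Finset.exists_ne_zero_of_sum_ne_zero hg
    have hyA : y⁻¹ * g * y ∈ A := by
      by_contra hc
      exact hy (hβ _ hc)
    refine ⟨y * z * y⁻¹, h.involution.conj y, ?_⟩
    have := h.comm _ hyA
    calc y * z * y⁻¹ * g = y * (z * (y⁻¹ * g * y)) * y⁻¹ := by group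
      _ = y * (y⁻¹ * g * y * z) * y⁻¹ := by rw [this]
      _ = g * (y * z * y⁻¹) := by group

end DihedralData

theorem Finset.exists_of_sum_sq_eq_two {ι : Type*} [DecidableEq ι] {s : Finset ι} {c : ι → ℤ}
    (hs : ∑ i ∈ s, c i ^ 2 = 2) : ∃ i ∈ s, ∃ j ∈ s.erase i, c i ^ 2 = 1 ∧ c j ^ 2 = 1 ∧
      ∀ l ∈ (s.erase i).erase j, c l = 0 := by
  have key : ∀ (s : Finset ι) (n : ℤ), (n = 1 ∨ n = 2) → ∑ i ∈ s, c i ^ 2 = n →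
      ∃ i ∈ s, c i ^ 2 = 1 ∧ ∑ j ∈ s.erase i, c j ^ 2 = n - 1 := by
    intro s n hn h
    obtain ⟨i, hi, h0⟩ := Finset.exists_ne_zero_of_sum_ne_zero (h.trans_ne (by omega))
    have h1 := Finset.add_sum_erase s (fun j => c j ^ 2) hi
    have h2 : 0 ≤ ∑ j ∈ s.erase i, c j ^ 2 := Finset.sum_nonneg fun j _ => sq_nonneg _
    have h3 : c i ^ 2 ≤ 2 := by omega
    have h4 : c i ^ 2 = 1 := by
      have : c i ≠ 0 := fun h => h0 (by rw [h]; rfl)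
      have h5 : c i ≤ 1 := by nlinarith
      have h6 : -1 ≤ c i := by nlinarith
      have : c i = 1 ∨ c i = -1 := by omega
      rcases this with h | h <;> rw [h] <;> norm_num
    exact ⟨i, hi, h4, by omega⟩
  obtain ⟨i, hi, h1, h2⟩ := key s 2 (Or.inr rfl) hs
  obtain ⟨j, hj, h3, h4⟩ := key _ 1 (Or.inl rfl) h2
  refine ⟨i, hi, j, hj, h1, h3, fun l hl => ?_⟩
  have := (Finset.sum_eq_zero_iff_of_nonneg fun j _ => sq_nonneg _).1 h4 l hl
  simpa using this

namespace DihedralData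

variable {H : Type*} [Group H] [Fintype H] [DecidableEq H] {z : H} {A : Subgroup H} {m : ℕ}

theorem exists_coefficients (h : DihedralData z A m) (hm : 8 ≤ m) (X : IrrepSystem H) :
    ∃ (c : Fin X.n → ℤ) (α : H → ℂ),
      (∀ g, α g = ∑ i, c i * X.χ i g) ∧ α 1 = 0 ∧ α z = 0 ∧
      (∀ g, α g ≠ 0 → g ≠ 1 ∧ ∃ w, IsInvolution w ∧ w * g = g * w) ∧
      ∑ g, α g = Fintype.card H ∧ ∑ i, c i ^ 2 = 3 ∧
      ∀ i, X.d i = 1 → (∀ g, X.ρ i g = 1) → c i = 1 := by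
  classical
  obtain ⟨θ, hθz, hθ2⟩ := h.exists_character hm
  have hm0 : (m : ℂ) ≠ 0 := by
    have : m ≠ 0 := by omega
    exact_mod_cast this
  have hH0 : (Fintype.card H : ℂ) ≠ 0 := by exact_mod_cast Fintype.card_ne_zero
  have hAc : Fintype.card A = m := by rw [← Nat.card_eq_fintype_card, h.card_eq]
  have hθ1 : θ ≠ 1 := by
    rintro rfl
    exact hθ2 (one_mul 1)
  let β : H → ℂ := fun g => if hg : g ∈ A then 1 - θ ⟨g, hg⟩ else 0
  have hβ : ∀ g, g ∉ A → β g = 0 := fun g hg => dif_neg hg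
  have hβA : ∀ a : A, β a = 1 - θ a := fun a => dif_pos a.2
  have hβ1 : β 1 = 0 := by
    have := hβA 1
    simpa using this
  have hβsum : ∀ F : H → ℂ, ∑ g, β g * F g = ∑ a : A, (1 - θ a) * F a := by
    intro F
    rw [← Finset.sum_subset (Finset.subset_univ (Finset.univ.filter fun g => g ∈ A))
      (fun g _ hg => by rw [hβ g (by simpa using hg), zero_mul])]
    rw [Finset.sum_subtype (p := fun g => g ∈ A) _ (fun g => by simp)]
    exact Finset.sum_congr rfl fun a _ => by rw [hβA a]
  choose r hr using fun i => X.exists_sum_eq_natCast i A θ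
  choose r' hr' using fun i => X.exists_sum_eq_natCast i A 1
  let c : Fin X.n → ℤ := fun i => r' i - r i
  have hc : ∀ i, ∑ a : A, (1 - θ a) * X.χ i a = m * c i := by
    intro i
    have h1 := hr i
    have h2 := hr' i
    rw [hAc] at h1 h2
    simp only [MonoidHom.one_apply, one_mul] at h2
    simp only [sub_mul, one_mul, Finset.sum_sub_distrib, h1, h2, c]
    push_cast
    ring
  have hexp : ∀ g, conjSum β g⁻¹ = m * ∑ i, c i * X.χ i g := by
    intro g
    have h1 := X.card_mul_eq_sum (conjSum β) (conjSum_conj β) g⁻¹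
    simp only [sum_conjSum_mul β _ (X.χ_conj _), hβsum, hc, inv_inv] at h1
    refine mul_left_cancel₀ hH0 (h1.trans ?_)
    rw [Finset.mul_sum, Finset.mul_sum]
    exact Finset.sum_congr rfl fun i _ => by ring
  have hone : ∑ a : A, θ a = 0 := sum_hom_units_eq_zero θ hθ1
  have hinv : ∑ a : A, θ a⁻¹ = 0 := by
    rw [← hone]
    exact Equiv.sum_comp (Equiv.inv A) fun a => θ a
  have hsq : ∑ a : A, θ a * θ a = 0 := sum_hom_units_eq_zero (θ * θ) hθ2
  refine ⟨c, fun g => ∑ i, c i * X.χ i g, fun g => rfl, ?_, ?_, ?_, ?_, ?_, ?_⟩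
  · have := hexp 1
    simp only [conjSum, inv_one, mul_one, inv_mul_cancel, hβ1, Finset.sum_const_zero] at this
    exact (mul_eq_zero.1 this.symm).resolve_left hm0
  · have := hexp z
    rw [h.involution.inv_eq, h.conjSum_eq hβ h.mem h.ne_one, h.involution.inv_eq,
      hβA ⟨z, h.mem⟩, hθz] at this
    simp only [sub_self, add_zero, mul_zero] at this
    exact (mul_eq_zero.1 this.symm).resolve_left hm0
  · intro g hg
    have h1 : conjSum β g⁻¹ ≠ 0 := by
      rw [hexp]
      exact mul_ne_zero hm0 hg
    obtain ⟨h2, w, hw, h3⟩ := h.commuting_of_conjSum_ne_zero hβ hβ1 h1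
    refine ⟨fun h => h2 (by rw [h, inv_one]), w, hw, ?_⟩
    exact (Commute.inv_right_iff.1 (show Commute w g⁻¹ from h3)).eq
  · refine mul_left_cancel₀ hm0 ?_
    rw [Finset.mul_sum, Finset.sum_congr rfl fun g _ => (hexp g).symm]
    have h1 : ∑ g : H, conjSum β g⁻¹ = ∑ g, conjSum β g * 1 := by
      simp only [mul_one]
      exact Equiv.sum_comp (Equiv.inv H) (conjSum β)
    rw [h1, sum_conjSum_mul β (fun _ => 1) (fun _ _ => rfl), hβsum]
    simp only [mul_one, Finset.sum_sub_distrib, hone, Finset.sum_const, Finset.card_univ, hAc]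
    simp [mul_comm]
  · have h1 : ∑ a : A, (1 - θ a) * conjSum β (a : H)⁻¹ = m * (m * ∑ i, (c i : ℂ) ^ 2) := by
      calc ∑ a : A, (1 - θ a) * conjSum β (a : H)⁻¹
          = ∑ a : A, ∑ i, m * c i * ((1 - θ a) * X.χ i a) := by
            refine Finset.sum_congr rfl fun a _ => ?_
            rw [hexp, Finset.mul_sum, Finset.mul_sum]
            exact Finset.sum_congr rfl fun i _ => by ring
        _ = _ := by
            rw [Finset.sum_comm, Finset.mul_sum, Finset.mul_sum]
            refine Finset.sum_congr rfl fun i _ => ?_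
            rw [← Finset.mul_sum, hc]
            ring
    have h2 : ∑ a : A, (1 - θ a) * conjSum β (a : H)⁻¹ =
        m * ∑ a : A, (3 - 3 * θ a - θ a⁻¹ + θ a * θ a) := by
      rw [Finset.mul_sum]
      refine Finset.sum_congr rfl fun a _ => ?_
      by_cases ha : a = 1
      · subst ha
        simp
      · have h3 : θ a * θ a⁻¹ = 1 := by rw [← map_mul, mul_inv_cancel, map_one]
        rw [h.conjSum_eq hβ (A.inv_mem a.2) (fun hc => ha (Subtype.ext (by simpa using hc))),
          inv_inv, hβA, ← InvMemClass.coe_inv, hβA]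
        linear_combination m * h3
    simp only [Finset.sum_add_distrib, Finset.sum_sub_distrib, ← Finset.mul_sum, hone, hinv, hsq,
      Finset.sum_const, Finset.card_univ, hAc, nsmul_eq_mul] at h2
    rw [h1] at h2
    have h3 : (∑ i, (c i : ℂ) ^ 2) = 3 := by
      refine mul_left_cancel₀ hm0 (mul_left_cancel₀ hm0 ?_)
      rw [h2]
      ring
    exact_mod_cast h3
  · intro i hd hρ
    have h1 : ∀ g, X.χ i g = 1 := by
      intro g
      rw [IrrepSystem.χ, hρ, Matrix.trace_one, Fintype.card_fin, hd, Nat.cast_one]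
    have h2 := hc i
    simp only [h1, mul_one, Finset.sum_sub_distrib, hone, Finset.sum_const, Finset.card_univ, hAc,
      nsmul_eq_mul, sub_zero] at h2
    have h3 : (1 : ℂ) = c i := mul_left_cancel₀ hm0 (by rw [mul_one]; exact h2)
    exact_mod_cast h3.symm

theorem exists_int (h : DihedralData z A m) (hm : 8 ≤ m) {k : ℕ}
    (hk : (Subgroup.centralizer {z}).index = k) :
    ∃ F B : ℤ, F ≠ 0 ∧ F + 1 ≠ 0 ∧ k * (F - B) ^ 2 = 2 * m ^ 2 * (F * (F + 1)) ∧
      F ^ 2 + k * B ^ 2 ≤ 2 * m * k ∧ (F + 1) ^ 2 + k * (B + 1) ^ 2 ≤ 2 * m * k := by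
  classical
  obtain ⟨X⟩ : Nonempty (IrrepSystem H) := inferInstance
  obtain ⟨c, α, hα, hα1, hαz, hαne, hαsum, hc3, hc1⟩ := h.exists_coefficients hm X
  obtain ⟨i₀, hd₀, hρ₀⟩ := X.exists_trivial
  have hm0 : (m : ℂ) ≠ 0 := by
    have : m ≠ 0 := by omega
    exact_mod_cast this
  have hkpos := h.index_pos
  rw [hk] at hkpos
  have hk0 : (k : ℂ) ≠ 0 := by exact_mod_cast hkpos.ne'
  have hcard : Fintype.card H = 2 * m * k := by
    rw [← hk, ← h.card_eq_mul, Nat.card_eq_fintype_card]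
  set J : Finset H := Finset.univ.filter fun v => IsInvolution v with hJdef
  have hJ : ∀ v, v ∈ J ↔ IsInvolution v := fun v => by simp [hJdef]
  have hJcard : J.card = k := by
    rw [← hk, ← h.ncard_isInvolution, Set.ncard_eq_toFinset_card']
    congr 1
    ext v
    simp [hJ]
  have h1J : (1 : H) ∉ J := fun hc => ((hJ 1).1 hc).1 rfl
  choose b hb using fun i => X.exists_χ_eq_intCast i h.mul_self
  have hbJ : ∀ i, ∀ v ∈ J, X.χ i v = b i := by
    intro i v hv
    obtain ⟨g, rfl⟩ := h.isConj v ((hJ v).1 hv).1 ((hJ v).1 hv).2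
    rw [X.χ_conj, hb]
  have hbound : ∀ i, (X.d i : ℤ) ^ 2 + k * b i ^ 2 ≤ 2 * m * k := by
    intro i
    have := X.sq_add_le i h1J (hbJ i)
    rw [hJcard, hcard] at this
    exact_mod_cast this
  have e1 : ∑ i, (c i : ℂ) * X.d i = 0 := by
    rw [← hα1, hα]
    simp [X.χ_one]
  have e2 : ∑ i, (c i : ℂ) * b i = 0 := by
    rw [← hαz, hα]
    simp [hb]
  have e3 : k * ∑ i, (c i : ℂ) * (b i ^ 2 / X.d i) = 2 * m ^ 2 := by
    have h1 : ∑ v ∈ J, ∑ w ∈ J, α (v * w) = k ^ 2 * ∑ i, (c i : ℂ) * (b i ^ 2 / X.d i) := by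
      simp only [hα]
      calc ∑ v ∈ J, ∑ w ∈ J, ∑ i, (c i : ℂ) * X.χ i (v * w)
          = ∑ i, ∑ v ∈ J, ∑ w ∈ J, (c i : ℂ) * X.χ i (v * w) := by
            exact (Finset.sum_congr rfl fun v _ => Finset.sum_comm).trans Finset.sum_comm
        _ = _ := by
            rw [Finset.mul_sum]
            refine Finset.sum_congr rfl fun i _ => ?_
            simp only [← Finset.mul_sum]
            rw [X.sum_sum_χ_mul i (fun v g hv => (hJ _).2 (((hJ v).1 hv).conj g)) (hbJ i), hJcard]
            ring
    have h2 := DihedralData.sum_involutions J hJ α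
    have h3 : ∀ g : H, ({v : H | IsInvolution v ∧ IsInvolution (v * g)}.ncard : ℂ) * α g =
        m * α g := by
      intro g
      by_cases hg : α g = 0
      · rw [hg, mul_zero, mul_zero]
      · rw [h.ncard_factorizations (hαne g hg)]
    rw [Finset.sum_congr rfl fun g _ => h3 g, ← Finset.mul_sum, hαsum, h1, hcard] at h2
    refine mul_left_cancel₀ hk0 ?_
    rw [← mul_assoc, ← sq, h2]
    push_cast
    ring
  have hc0 : c i₀ = 1 := hc1 i₀ hd₀ hρ₀
  have hb0 : b i₀ = 1 := by
    have := hb i₀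
    rw [IrrepSystem.χ, hρ₀, Matrix.trace_one, Fintype.card_fin, hd₀] at this
    exact_mod_cast this.symm
  have hsplit : ∀ f : Fin X.n → ℂ, ∑ i, f i = f i₀ + ∑ i ∈ Finset.univ.erase i₀, f i :=
    fun f => (Finset.add_sum_erase _ f (Finset.mem_univ i₀)).symm
  have hc2 : ∑ i ∈ Finset.univ.erase i₀, c i ^ 2 = 2 := by
    have := Finset.add_sum_erase Finset.univ (fun i => c i ^ 2) (Finset.mem_univ i₀)
    simp only [hc3, hc0] at this
    omega
  obtain ⟨i, hi, j, hj, hci, hcj, hrest⟩ := Finset.exists_of_sum_sq_eq_two hc2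
  have hsum : ∀ f : Fin X.n → ℂ, ∑ l, (c l : ℂ) * f l = f i₀ + (c i * f i + c j * f j) := by
    intro f
    rw [hsplit, ← Finset.add_sum_erase _ _ hi, ← Finset.add_sum_erase _ _ hj,
      Finset.sum_eq_zero (s := ((Finset.univ.erase i₀).erase i).erase j)
        (fun l hl => by rw [hrest l hl]; simp), hc0]
    simp
  rw [hsum] at e1 e2 e3
  rw [hd₀, Nat.cast_one] at e1 e3
  rw [hb0, Int.cast_one] at e2 e3
  have e1' : 1 + (c i * X.d i + c j * X.d j) = 0 := by exact_mod_cast e1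
  have e2' : 1 + (c i * b i + c j * b j) = 0 := by exact_mod_cast e2
  have hdi := X.d_ne_zero i
  have hdj := X.d_ne_zero j
  have hF : c j * X.d j ≠ 0 := by
    refine mul_ne_zero ?_ (by exact_mod_cast hdj)
    intro h0
    rw [h0] at hcj
    norm_num at hcj
  have hF1 : c i * X.d i ≠ 0 := by
    refine mul_ne_zero ?_ (by exact_mod_cast hdi)
    intro h0
    rw [h0] at hci
    norm_num at hci
  refine ⟨c j * X.d j, c j * b j, hF, fun h0 => hF1 (by linarith), ?_, ?_, ?_⟩
  · have hci' : (c i : ℂ) ^ 2 = 1 := by exact_mod_cast hci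
    have hcj' : (c j : ℂ) ^ 2 = 1 := by exact_mod_cast hcj
    have h1 : (c i : ℂ) * (b i ^ 2 / X.d i) = (c i * b i) ^ 2 / (c i * X.d i) := by
      have : (c i : ℂ) ≠ 0 := fun h0 => by rw [h0] at hci'; norm_num at hci'
      field_simp
    have h2 : (c j : ℂ) * (b j ^ 2 / X.d j) = (c j * b j) ^ 2 / (c j * X.d j) := by
      have : (c j : ℂ) ≠ 0 := fun h0 => by rw [h0] at hcj'; norm_num at hcj'
      field_simp
    have hFc : (c j : ℂ) * X.d j ≠ 0 := by exact_mod_cast hF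
    have hFc1 : (c i : ℂ) * X.d i ≠ 0 := by exact_mod_cast hF1
    have e3' : (k : ℂ) * (c j * X.d j - c j * b j) ^ 2 =
        2 * m ^ 2 * (c j * X.d j * (c j * X.d j + 1)) := by
      rw [h1, h2] at e3
      have h3 : (c i : ℂ) * X.d i = -(1 + c j * X.d j) := by linear_combination e1
      have h4 : (c i : ℂ) * b i = -(1 + c j * b j) := by linear_combination e2
      rw [h3] at hFc1
      rw [h3, h4] at e3
      generalize (c j : ℂ) * X.d j = F at *
      generalize (c j : ℂ) * b j = B at *
      have h5 : (1 : ℂ) + F ≠ 0 := fun h0 => hFc1 (by rw [h0, neg_zero])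
      rw [← e3]
      field_simp
      ring
    exact_mod_cast e3'
  · rw [mul_pow, mul_pow, hcj, one_mul, one_mul]
    exact hbound j
  · have h3 : c j * X.d j + 1 = -(c i * X.d i) := by linarith
    have h4 : c j * b j + 1 = -(c i * b i) := by linarith
    rw [h3, h4, neg_sq, neg_sq, mul_pow, mul_pow, hci, one_mul, one_mul]
    exact hbound i

end DihedralData

theorem Int.eq_of_mul_succ_eq {a : ℕ} {e B : ℤ} (he : e ∣ 2 ^ a) (hB : B * (B + 1) = 2 * e ^ 2)
    (h0 : e ≠ 0) : (B = 1 ∨ B = -2) ∧ (e = 1 ∨ e = -1) := by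
  have hdvd : B * (B + 1) ∣ 2 ^ (2 * a + 1) := by
    rw [hB, mul_comm, pow_succ (2 : ℤ) (2 * a), pow_mul']
    exact mul_dvd_mul_right (pow_dvd_pow_of_dvd he 2) 2
  have hodd : ∀ c : ℤ, c ∣ 2 ^ (2 * a + 1) → ¬ 2 ∣ c → c = 1 ∨ c = -1 := by
    intro c hc h2
    have hcop : IsCoprime c (2 ^ (2 * a + 1)) :=
      IsCoprime.pow_right ((Int.prime_two.coprime_iff_not_dvd.2 h2).symm)
    exact Int.isUnit_iff.1 (hcop.isUnit_of_dvd' dvd_rfl hc)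
  have he2 : 0 < e ^ 2 := by positivity
  have hBcases : B = 1 ∨ B = -2 := by
    by_cases h2 : (2 : ℤ) ∣ B
    · rcases hodd (B + 1) ((Dvd.intro_left _ rfl).trans hdvd) (by omega) with h | h
      · have : B = 0 := by omega
        subst this
        omega
      · omega
    · rcases hodd B ((Dvd.intro _ rfl).trans hdvd) h2 with h | h
      · exact Or.inl h
      · subst h
        omega
  refine ⟨hBcases, ?_⟩
  have : e ^ 2 = 1 := by
    rcases hBcases with rfl | rfl <;> omega
  exact sq_eq_one_iff.1 this

theorem index_cases_of_pos {a : ℕ} {m k r F B : ℤ} (hma : m = 2 ^ a) (hm : 8 ≤ m)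
    (hk : k = m ^ 2 - m + 1 + 2 * m * r) (hkpos : 0 < k) (hF : 0 < F)
    (hE : k * (F - B) ^ 2 = 2 * m ^ 2 * (F * (F + 1)))
    (hb : (F + 1) ^ 2 + k * (B + 1) ^ 2 ≤ 2 * m * k) :
    k = 2 * m ^ 2 - 3 * m + 1 ∨ k = 2 * m ^ 2 + 3 * m + 1 := by
  obtain ⟨m', hm'⟩ : (2 : ℤ) ∣ m := by
    rw [hma]
    refine dvd_pow_self 2 ?_
    rintro rfl
    norm_num at hma
    omega
  have hcop : IsCoprime m k := ⟨-(m - 1 + 2 * r), 1, by rw [hk]; ring⟩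
  have h1 : m ∣ F - B := by
    have : m ^ 2 ∣ (F - B) ^ 2 := by
      refine (IsCoprime.pow_left hcop : IsCoprime (m ^ 2) k).dvd_of_dvd_mul_left ?_
      exact ⟨2 * (F * (F + 1)), by rw [hE]; ring⟩
    exact (Int.pow_dvd_pow_iff two_ne_zero).1 this
  obtain ⟨f, hf⟩ := h1
  have h2 : k * f ^ 2 = 2 * (F * (F + 1)) := by
    have : m ^ 2 ≠ 0 := by positivity
    refine mul_left_cancel₀ this ?_
    rw [hf] at hE
    linear_combination hE
  have h3 : Even f := by
    have h4 : Even (k * f ^ 2) := h2 ▸ even_two_mul _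
    have h5 : ¬ Even k := by
      rw [Int.not_even_iff_odd, hk, hm']
      exact ⟨2 * m' ^ 2 - m' + 2 * m' * r, by ring⟩
    exact (Int.even_pow.1 ((Int.even_mul.1 h4).resolve_left h5)).1
  obtain ⟨e, rfl⟩ := h3
  have h4 : F * (F + 1) = 2 * k * e ^ 2 := by linarith
  have hFB : F = B + 2 * m * e := by linarith
  have he0 : e ≠ 0 := by
    rintro rfl
    have : 0 < F * (F + 1) := by positivity
    rw [h4] at this
    simp at this
  have h5 : 2 * e ^ 2 + (B + 1) ^ 2 < 2 * m := by
    refine lt_of_mul_lt_mul_left (a := k) ?_ hkpos.le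
    nlinarith
  have h6 : 4 * m ∣ B * (B + 1) - 2 * e ^ 2 := by
    have h7 : Even (e * (e * (m - 1) - (2 * B + 1))) := by
      rw [Int.even_mul]
      by_cases he : Even e
      · exact Or.inl he
      · right
        rw [Int.not_even_iff_odd] at he
        obtain ⟨e', rfl⟩ := he
        exact ⟨e' * (m - 1) + m' - 1 - B, by rw [hm']; ring⟩
    obtain ⟨t, ht⟩ := h7
    refine ⟨t + r * e ^ 2 - m * e ^ 2, ?_⟩
    rw [hFB, hk] at h4
    linear_combination h4 + 2 * m * ht
  have h7 : B * (B + 1) = 2 * e ^ 2 := by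
    obtain ⟨t, ht⟩ := h6
    have he2 : 0 ≤ e ^ 2 := sq_nonneg e
    have hBB : 0 ≤ B * (B + 1) := by
      rcases le_or_gt 0 B with h | h
      · positivity
      · exact mul_nonneg_of_nonpos_of_nonpos h.le (by omega)
    have hlow : -(2 * m) < B * (B + 1) - 2 * e ^ 2 := by nlinarith [sq_nonneg (B + 1)]
    have hup : B * (B + 1) - 2 * e ^ 2 < 4 * m := by
      rcases le_or_gt 0 B with h | h
      · nlinarith
      · nlinarith [mul_nonneg_of_nonpos_of_nonpos h.le (show B + 1 ≤ 0 by omega)]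
    have : t = 0 := by
      have h8 : t < 1 := by nlinarith
      have h9 : -1 < t := by nlinarith
      omega
    rw [this] at ht
    linarith
  have h8 : m * (2 * B + 1) + 2 * m ^ 2 * e + e = k * e := by
    have : 2 * e ≠ 0 := by simpa using he0
    refine mul_left_cancel₀ this ?_
    rw [hFB] at h4
    linear_combination h4 - h7
  have h9 : e ∣ m := by
    have hcop : IsCoprime e (2 * B + 1) := ⟨-(8 * e), 2 * B + 1, by linear_combination 4 * h7⟩
    refine hcop.dvd_of_dvd_mul_right ⟨k - 1 - 2 * m ^ 2, ?_⟩
    linear_combination h8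
  obtain ⟨hB, he⟩ := Int.eq_of_mul_succ_eq (hma ▸ h9) h7 he0
  rcases hB with rfl | rfl <;> rcases he with rfl | rfl
  · right; linarith
  · left; linarith
  · left; linarith
  · right; linarith

theorem index_cases {a : ℕ} {m k r F B : ℤ} (hma : m = 2 ^ a) (hm : 8 ≤ m)
    (hk : k = m ^ 2 - m + 1 + 2 * m * r) (hkpos : 0 < k) (hF : F ≠ 0) (hF1 : F + 1 ≠ 0)
    (hE : k * (F - B) ^ 2 = 2 * m ^ 2 * (F * (F + 1)))
    (hb : F ^ 2 + k * B ^ 2 ≤ 2 * m * k)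
    (hb1 : (F + 1) ^ 2 + k * (B + 1) ^ 2 ≤ 2 * m * k) :
    k = 2 * m ^ 2 - 3 * m + 1 ∨ k = 2 * m ^ 2 + 3 * m + 1 := by
  rcases lt_or_gt_of_ne hF with h | h
  · refine index_cases_of_pos (F := -(F + 1)) (B := -(B + 1)) hma hm hk hkpos (by omega) ?_ ?_
    · linear_combination hE
    · linarith
  · exact index_cases_of_pos hma hm hk hkpos h hE hb1

namespace DihedralData

variable {H : Type*} [Group H] [Finite H] {z : H} {A : Subgroup H} {m : ℕ}

theorem index_eq (h : DihedralData z A m) {k : ℕ} (hk : (Subgroup.centralizer {z}).index = k)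
    (hm : 8 ≤ m) : k = (2 * m - 1) * (m - 1) ∨ k = (2 * m + 1) * (m + 1) := by
  classical
  have := Fintype.ofFinite H
  obtain ⟨F, B, hF, hF1, hE, hb, hb1⟩ := h.exists_int hm hk
  obtain ⟨r, hr⟩ := h.index_modEq
  obtain ⟨a, -, ha⟩ := h.two_pow
  have hpos := h.index_pos
  rw [hk] at hr hpos
  obtain ⟨n, rfl⟩ : ∃ n, m = n + 2 := ⟨m - 2, by omega⟩
  have h1 := index_cases (a := a) (m := (n + 2 : ℕ)) (k := k) (r := r) (by exact_mod_cast ha)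
    (by exact_mod_cast hm) (by
      rw [hr, Nat.add_sub_cancel]
      push_cast
      ring) (by exact_mod_cast hpos) hF hF1 hE hb hb1
  have e1 : 2 * (n + 2) - 1 = 2 * n + 3 := by omega
  have e2 : n + 2 - 1 = n + 1 := by omega
  rw [e1, e2]
  push_cast at h1
  rcases h1 with h1 | h1
  · left
    zify
    rw [h1]
    ring
  · right
    zify
    rw [h1]
    ring

theorem exists_torus_card (h : DihedralData z A m) {k : ℕ}
    (hk : (Subgroup.centralizer {z}).index = k) :
    ∃ (T : Subgroup H) (v : H), IsTorus T v ∧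
      (k = (2 * m - 1) * (m - 1) ∧ Nat.card T = m - 1 ∧
        Nat.card ↥(Subgroup.normalizer (T : Set H) ⊓ Subgroup.centralizer {v}) = 2 ∨
      k = (2 * m + 1) * (m + 1) ∧ Nat.card T = 2 * m + 1 ∧
        Nat.card ↥(Subgroup.normalizer (T : Set H) ⊓ Subgroup.centralizer {v}) = m) :=
  h.exists_torus_cases hk (h.index_eq hk)

end DihedralData

/-- Unipotent elements `y b`, diagonal elements `h a` and a Weyl element `w` satisfying most of
the relations of `SL(2,p)`. -/
structure BruhatData (p : ℕ) {K : Type*} [Group K] (y h : ZMod p → K) (w : K) : Prop where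
  mod_four : p % 4 = 3
  card_eq : Nat.card K = p * (p - 1) * (p + 1)
  y_add : ∀ a b, y (a + b) = y a * y b
  h_mul : ∀ a b, a ≠ 0 → b ≠ 0 → h (a * b) = h a * h b
  h_y : ∀ a b, a ≠ 0 → h a * y b = y (a ^ 2 * b) * h a
  w_h : ∀ a, a ≠ 0 → w * h a = h a⁻¹ * w
  w_mul_self : w * w = h (-1)
  eq_one : ∀ a b, a ≠ 0 → y b * h a = 1 → b = 0 ∧ a = 1
  w_y_ne : ∀ b c, b ≠ 0 → w * y b ≠ y c * w

namespace BruhatData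

variable {p : ℕ} [hp : Fact p.Prime] {K : Type*} [Group K] {y h : ZMod p → K} {w : K}

theorem y_zero (D : BruhatData p y h w) : y 0 = 1 := by
  have := D.y_add 0 0
  rwa [add_zero, left_eq_mul] at this

theorem y_neg (D : BruhatData p y h w) (b : ZMod p) : y (-b) = (y b)⁻¹ := by
  rw [eq_inv_iff_mul_eq_one, ← D.y_add, neg_add_cancel, D.y_zero]

theorem h_one (D : BruhatData p y h w) : h 1 = 1 := by
  have := D.h_mul 1 1 one_ne_zero one_ne_zero
  rwa [mul_one, left_eq_mul] at this

theorem h_inv (D : BruhatData p y h w) {a : ZMod p} (ha : a ≠ 0) : h a⁻¹ = (h a)⁻¹ := by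
  rw [eq_inv_iff_mul_eq_one, ← D.h_mul _ _ (inv_ne_zero ha) ha, inv_mul_cancel₀ ha, D.h_one]

theorem y_h_inj (D : BruhatData p y h w) {a b a' b' : ZMod p} (ha : a ≠ 0) (ha' : a' ≠ 0)
    (he : y b * h a = y b' * h a') : b = b' ∧ a = a' := by
  obtain ⟨h1, h2⟩ := D.eq_one (a * a'⁻¹) (b - b') (mul_ne_zero ha (inv_ne_zero ha')) (by
    rw [D.h_mul _ _ ha (inv_ne_zero ha'), D.h_inv ha', sub_eq_neg_add, D.y_add, D.y_neg, mul_assoc,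
      ← mul_assoc (y b), he]
    group)
  exact ⟨sub_eq_zero.1 h1, by rwa [mul_inv_eq_one₀ ha'] at h2⟩

theorem h_y_comm (D : BruhatData p y h w) {a b : ZMod p} (ha : a ≠ 0) :
    y b * h a = h a * y (b * (a ^ 2)⁻¹) := by
  rw [D.h_y _ _ ha]
  congr 2
  field_simp

theorem h_y_inj (D : BruhatData p y h w) {a b a' b' : ZMod p} (ha : a ≠ 0) (ha' : a' ≠ 0)
    (he : h a * y b = h a' * y b') : b = b' ∧ a = a' := by
  rw [D.h_y _ _ ha, D.h_y _ _ ha'] at he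
  obtain ⟨h1, rfl⟩ := D.y_h_inj ha ha' he
  exact ⟨mul_left_cancel₀ (pow_ne_zero 2 ha) h1, rfl⟩

theorem neg_one_ne_zero (_ : BruhatData p y h w) : (-1 : ZMod p) ≠ 0 := neg_ne_zero.2 one_ne_zero

theorem w_inv (D : BruhatData p y h w) : w⁻¹ = h (-1) * w := by
  rw [inv_eq_iff_mul_eq_one, ← mul_assoc, D.w_h _ D.neg_one_ne_zero, inv_neg_one, mul_assoc,
    D.w_mul_self, ← D.h_mul _ _ D.neg_one_ne_zero D.neg_one_ne_zero, neg_mul_neg, one_mul, D.h_one]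

theorem h_neg_one_y (D : BruhatData p y h w) (b : ZMod p) : h (-1) * y b = y b * h (-1) := by
  rw [D.h_y _ _ D.neg_one_ne_zero]
  simp

theorem h_neg_one_w (D : BruhatData p y h w) : w * h (-1) = h (-1) * w := by
  rw [D.w_h _ D.neg_one_ne_zero, inv_neg_one]

theorem h_comm (D : BruhatData p y h w) {a b : ZMod p} (ha : a ≠ 0) (hb : b ≠ 0) :
    h a * h b = h b * h a := by
  rw [← D.h_mul _ _ ha hb, mul_comm, D.h_mul _ _ hb ha]

theorem exists_pow (D : BruhatData p y h w) {a : ZMod p} (ha : a ≠ 0) (b : ZMod p) (n : ℕ) :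
    ∃ c, (y b * h a) ^ n = y c * h (a ^ n) := by
  induction n with
  | zero => exact ⟨0, by simp [D.y_zero, D.h_one]⟩
  | succ n ih =>
    obtain ⟨c, hc⟩ := ih
    refine ⟨c + (a ^ n) ^ 2 * b, ?_⟩
    rw [pow_succ, hc, pow_succ a, D.h_mul _ _ (pow_ne_zero n ha) ha, D.y_add, mul_assoc,
      ← mul_assoc (h (a ^ n)), D.h_y _ _ (pow_ne_zero n ha)]
    simp only [mul_assoc]

theorem y_pow (D : BruhatData p y h w) (b : ZMod p) (n : ℕ) : y b ^ n = y (n * b) := by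
  induction n with
  | zero => simp [D.y_zero]
  | succ n ih => rw [pow_succ, ih, ← D.y_add]; push_cast; ring_nf

theorem w_y_w_ne (D : BruhatData p y h w) {b : ZMod p} (hb : b ≠ 0) {a c : ZMod p} (ha : a ≠ 0) :
    w * y b * w ≠ y c * h a := by
  intro he
  have h0 := D.neg_one_ne_zero
  have h1 : w * y b * w⁻¹ = y c * h (a * -1) := by
    rw [D.w_inv, ← D.h_neg_one_w, ← mul_assoc, he, D.h_mul _ _ ha h0, mul_assoc]
  have ha' : a * -1 ≠ 0 := mul_ne_zero ha h0
  obtain ⟨d, hd⟩ := D.exists_pow ha' c p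
  have h2 : y d * h ((a * -1) ^ p) = 1 := by
    rw [← hd, ← h1, conj_pow, D.y_pow, CharP.cast_eq_zero, zero_mul, D.y_zero]
    simp
  rw [ZMod.pow_card] at h2
  rw [(D.eq_one _ _ ha' h2).2, D.h_one, mul_one] at h1
  exact D.w_y_ne b c hb (mul_inv_eq_iff_eq_mul.1 h1)

theorem w_ne (D : BruhatData p y h w) {a c : ZMod p} (ha : a ≠ 0) : w ≠ y c * h a := by
  intro he
  refine D.w_y_w_ne (b := 1) one_ne_zero (a := a * a) (c := c + a ^ 2 * (1 + c)) (mul_ne_zero ha ha) ?_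
  rw [he, D.h_mul _ _ ha ha, D.y_add]
  calc y c * h a * y 1 * (y c * h a) = y c * (h a * (y 1 * y c)) * h a := by group
    _ = _ := by rw [← D.y_add, D.h_y _ _ ha]; group

theorem big_cell_inj (D : BruhatData p y h w) {x e b x' e' b' : ZMod p} (he : e ≠ 0) (he' : e' ≠ 0)
    (heq : y x * w * h e * y b = y x' * w * h e' * y b') : x = x' ∧ e = e' ∧ b = b' := by
  have hx : x = x' := by
    by_contra hne
    have h1 : w⁻¹ * y (-x' + x) * w = h e' * y (b' - b) * h e⁻¹ := by
      rw [D.y_add, D.y_neg, sub_eq_add_neg, D.y_add, D.y_neg, D.h_inv he]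
      calc w⁻¹ * ((y x')⁻¹ * y x) * w
          = w⁻¹ * (y x')⁻¹ * (y x * w * h e * y b) * (y b)⁻¹ * (h e)⁻¹ := by group
        _ = _ := by rw [heq]; group
    have hne' : -1 * e' ≠ 0 := mul_ne_zero D.neg_one_ne_zero he'
    refine D.w_y_w_ne (b := -x' + x) (c := (-1 * e') ^ 2 * (b' - b)) (a := -1 * e' * e⁻¹)
      (fun h0 => hne (neg_add_eq_zero.1 h0).symm) (mul_ne_zero hne' (inv_ne_zero he)) ?_
    calc w * y (-x' + x) * w = w * w * (w⁻¹ * y (-x' + x) * w) := by group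
      _ = h (-1 * e') * y (b' - b) * h e⁻¹ := by
        rw [h1, D.w_mul_self, D.h_mul _ _ D.neg_one_ne_zero he']
        group
      _ = _ := by
        rw [D.h_y _ _ hne', D.h_mul _ _ hne' (inv_ne_zero he)]
        group
  subst hx
  have h2 : h e * y b = h e' * y b' := by
    simpa [mul_assoc] using heq
  obtain ⟨h3, h4⟩ := D.h_y_inj he he' h2
  exact ⟨rfl, h4, h3⟩

end BruhatData

theorem ZMod.isSquare_or_isSquare_neg {p : ℕ} [Fact p.Prime] (hp : p % 4 = 3) (a : ZMod p) :
    IsSquare a ∨ IsSquare (-a) := by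
  by_cases ha : a = 0
  · exact Or.inl (ha ▸ IsSquare.zero)
  rw [ZMod.euler_criterion p ha, ZMod.euler_criterion p (neg_ne_zero.2 ha)]
  have hodd : Odd (p / 2) := by
    rw [Nat.odd_iff]
    omega
  rcases ZMod.pow_div_two_eq_neg_one_or_one p ha with h | h
  · exact Or.inl h
  · right
    rw [hodd.neg_pow, h, neg_neg]

namespace BruhatData

variable {p : ℕ} [hp : Fact p.Prime] {K : Type*} [Group K] {y h : ZMod p → K} {w : K}

theorem exists_form (D : BruhatData p y h w) (g : K) : (∃ a b, a ≠ 0 ∧ g = y b * h a) ∨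
    ∃ x e z, e ≠ 0 ∧ g = y x * w * h e * y z := by
  have hp2 := hp.out.two_le
  have : Finite K := Nat.finite_of_card_ne_zero (by
    rw [D.card_eq]
    exact mul_ne_zero (mul_ne_zero (by omega) (by omega)) (by omega))
  let f : (ZMod p × (ZMod p)ˣ) ⊕ (ZMod p × (ZMod p)ˣ × ZMod p) → K :=
    Sum.elim (fun q => y q.1 * h q.2) fun q => y q.1 * w * h q.2.1 * y q.2.2
  have hne : ∀ (q : ZMod p × (ZMod p)ˣ) (r : ZMod p × (ZMod p)ˣ × ZMod p),
      y q.1 * h q.2 ≠ y r.1 * w * h r.2.1 * y r.2.2 := by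
    rintro ⟨b, a⟩ ⟨x, e, z⟩ heq
    simp only at heq
    have ha := a.ne_zero
    have he := e.ne_zero
    refine D.w_ne (a := a * (e : ZMod p)⁻¹) (c := -x + b + a ^ 2 * -z)
      (mul_ne_zero ha (inv_ne_zero he)) ?_
    calc w = (y x)⁻¹ * (y x * w * h e * y z) * (y z)⁻¹ * (h e)⁻¹ := by group
      _ = y (-x) * y b * (h a * y (-z)) * h (e : ZMod p)⁻¹ := by
        rw [← heq, D.y_neg, D.y_neg, D.h_inv he]; group
      _ = _ := by
        rw [D.h_y _ _ ha, D.h_mul _ _ ha (inv_ne_zero he), D.y_add, D.y_add]; group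
  have hinj : Function.Injective f := by
    rintro (⟨b, a⟩ | ⟨x, e, z⟩) (⟨b', a'⟩ | ⟨x', e', z'⟩) heq
    · obtain ⟨rfl, h2⟩ := D.y_h_inj a.ne_zero a'.ne_zero heq
      rw [Units.ext h2]
    · exact absurd heq (hne _ _)
    · exact absurd heq.symm (hne _ _)
    · obtain ⟨rfl, h2, rfl⟩ := D.big_cell_inj e.ne_zero e'.ne_zero heq
      rw [Units.ext h2]
  have hcard : Nat.card K ≤ Nat.card ((ZMod p × (ZMod p)ˣ) ⊕ (ZMod p × (ZMod p)ˣ × ZMod p)) := by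
    rw [D.card_eq, Nat.card_sum, Nat.card_prod, Nat.card_prod, Nat.card_prod, Nat.card_zmod,
      Nat.card_eq_fintype_card, ZMod.card_units]
    apply le_of_eq
    ring
  obtain ⟨q, rfl⟩ := (hinj.bijective_of_nat_card_le hcard).2 g
  rcases q with ⟨b, a⟩ | ⟨x, e, z⟩
  · exact Or.inl ⟨a, b, a.ne_zero, rfl⟩
  · exact Or.inr ⟨x, e, z, e.ne_zero, rfl⟩

theorem mul_h (D : BruhatData p y h w) {s : ZMod p} (hs : s ≠ 0) :
    BruhatData p y h (w * h s) where
  mod_four := D.mod_four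
  card_eq := D.card_eq
  y_add := D.y_add
  h_mul := D.h_mul
  h_y := D.h_y
  w_h a ha := by rw [mul_assoc, D.h_comm hs ha, ← mul_assoc, D.w_h a ha, mul_assoc]
  w_mul_self := by
    rw [mul_assoc, ← mul_assoc (h s)]
    have := D.w_h _ (inv_ne_zero hs)
    rw [inv_inv] at this
    rw [← this, mul_assoc w, ← D.h_mul _ _ (inv_ne_zero hs) hs, inv_mul_cancel₀ hs, D.h_one,
      mul_one, D.w_mul_self]
  eq_one := D.eq_one
  w_y_ne b c hb heq := by
    rw [mul_assoc, D.h_y _ _ hs, ← mul_assoc, ← mul_assoc] at heq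
    exact D.w_y_ne _ c (mul_ne_zero (pow_ne_zero 2 hs) hb) (mul_right_cancel heq)

/-- The Weyl element sends the point with coordinate `b` to the point with coordinate `c`. -/
def Rel (y h : ZMod p → K) (w : K) (b c : ZMod p) : Prop :=
  ∃ e z, e ≠ 0 ∧ w * y b * w = y c * w * h e * y z

theorem exists_rel (D : BruhatData p y h w) {b : ZMod p} (hb : b ≠ 0) : ∃ c, Rel y h w b c := by
  rcases D.exists_form (w * y b * w) with ⟨a, c, ha, hc⟩ | ⟨x, e, z, he, hx⟩
  · exact absurd hc (D.w_y_w_ne hb ha)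
  · exact ⟨x, e, z, he, hx⟩

theorem Rel.symm (D : BruhatData p y h w) {b c : ZMod p} (hr : Rel y h w b c) :
    Rel y h w c b := by
  obtain ⟨e, z, he, heq⟩ := hr
  have h0 := D.neg_one_ne_zero
  refine ⟨-1 * e⁻¹, e ^ 2 * -z, mul_ne_zero h0 (inv_ne_zero he), ?_⟩
  calc w * y c * w = w * (y c * w * h e * y z) * (y z)⁻¹ * (h e)⁻¹ := by group
    _ = h (-1) * y b * w * y (-z) * h e⁻¹ := by
      rw [← heq, D.y_neg, D.h_inv he, ← D.w_mul_self]; group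
    _ = y b * w * h (-1) * (y (-z) * h e⁻¹) := by
      rw [D.h_neg_one_y, mul_assoc (y b), ← D.h_neg_one_w]; group
    _ = _ := by
      rw [D.h_y_comm (inv_ne_zero he), D.h_mul _ _ h0 (inv_ne_zero he), inv_pow, inv_inv,
        mul_comm (-z)]
      group

theorem Rel.smul (D : BruhatData p y h w) {a b c : ZMod p} (ha : a ≠ 0) (hr : Rel y h w b c) :
    Rel y h w (a ^ 2 * b) ((a ^ 2)⁻¹ * c) := by
  obtain ⟨e, z, he, heq⟩ := hr
  have hi := inv_ne_zero ha
  refine ⟨a * e * a, (a⁻¹) ^ 2 * z, mul_ne_zero (mul_ne_zero ha he) ha, ?_⟩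
  have h1 := D.w_h _ hi
  rw [inv_inv] at h1
  have h2 : y (a ^ 2 * b) = h a * y b * h a⁻¹ := by
    rw [D.h_y _ _ ha, mul_assoc, D.h_inv ha, mul_inv_cancel, mul_one]
  calc w * y (a ^ 2 * b) * w = w * h a * y b * (h a⁻¹ * w) := by rw [h2]; group
    _ = h a⁻¹ * w * y b * (w * h a) := by rw [← D.w_h _ ha]
    _ = h a⁻¹ * (w * y b * w) * h a := by simp only [mul_assoc]
    _ = (h a⁻¹ * y c) * w * h e * (y z * h a) := by rw [heq]; group
    _ = y ((a ^ 2)⁻¹ * c) * (h a⁻¹ * w) * h e * (h a * y ((a⁻¹) ^ 2 * z)) := by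
      rw [D.h_y _ _ hi, D.h_y_comm ha, mul_comm z, inv_pow]; group
    _ = _ := by
      rw [← D.w_h _ ha, D.h_mul _ _ (mul_ne_zero ha he) ha, D.h_mul _ _ ha he]; group

theorem not_rel_self (D : BruhatData p y h w) (b : ZMod p) : ¬ Rel y h w b b := by
  rintro ⟨e, z, he, heq⟩
  have h1 : (h e * y z) * (h e * y z) = h (-1) := by
    have h2 : h e * y z = w⁻¹ * (y b)⁻¹ * w * (y b * w) := by
      calc h e * y z = w⁻¹ * (y b)⁻¹ * (y b * w * h e * y z) := by group
        _ = _ := by rw [← heq]; group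
    calc (h e * y z) * (h e * y z) = w⁻¹ * (y b)⁻¹ * (w * w) * y b * w := by rw [h2]; group
      _ = w⁻¹ * (y b)⁻¹ * y b * w * h (-1) := by
        rw [D.w_mul_self, mul_assoc _ (h (-1)), D.h_neg_one_y, mul_assoc w⁻¹, mul_assoc w⁻¹,
          mul_assoc _ w, D.h_neg_one_w]
        group
      _ = _ := by group
  rw [D.h_y _ _ he, ← sq] at h1
  obtain ⟨c, hc⟩ := D.exists_pow he (e ^ 2 * z) 2
  rw [hc] at h1
  have h3 := (D.y_h_inj (pow_ne_zero 2 he) D.neg_one_ne_zero (b := c) (b' := 0)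
    (by rw [h1, D.y_zero, one_mul])).2
  exact ZMod.exists_sq_eq_neg_one_iff.1 ⟨e, by rw [← h3, sq]⟩ D.mod_four

theorem Rel.ne_zero (D : BruhatData p y h w) {b c : ZMod p} (hr : Rel y h w b c) : b ≠ 0 := by
  rintro rfl
  obtain ⟨e, z, he, heq⟩ := hr
  rw [D.y_zero, mul_one, D.w_mul_self] at heq
  have h0 := D.neg_one_ne_zero
  refine D.w_ne (c := -c + (-1) ^ 2 * -z) (a := -1 * e⁻¹) (mul_ne_zero h0 (inv_ne_zero he)) ?_
  calc w = (y c)⁻¹ * (y c * w * h e * y z) * (y z)⁻¹ * (h e)⁻¹ := by group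
    _ = y (-c) * (h (-1) * y (-z)) * h e⁻¹ := by
      rw [← heq, D.y_neg, D.y_neg, D.h_inv he]; group
    _ = _ := by rw [D.h_y _ _ h0, D.h_mul _ _ h0 (inv_ne_zero he), D.y_add]; group

theorem exists_rel_neg_inv (D : BruhatData p y h w) :
    ∃ s, s ≠ 0 ∧ ∀ b, b ≠ 0 → Rel y h w b (-s ^ 2 * b⁻¹) := by
  obtain ⟨c, hc⟩ := D.exists_rel one_ne_zero
  have hc0 : c ≠ 0 := (hc.symm D).ne_zero D
  have hsq : ¬ IsSquare c := by
    rintro ⟨s, rfl⟩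
    have key : ∀ s, s ≠ 0 → IsSquare s → ¬ Rel y h w 1 (s * s) := by
      rintro s hs ⟨t, rfl⟩ hr
      have ht : t ≠ 0 := fun h => hs (by rw [h, mul_zero])
      have := hr.smul D ht
      rw [mul_one, show (t ^ 2)⁻¹ * (t * t * (t * t)) = t ^ 2 by field_simp] at this
      exact D.not_rel_self _ this
    have hs : s ≠ 0 := fun h => hc0 (by rw [h, mul_zero])
    rcases ZMod.isSquare_or_isSquare_neg D.mod_four s with h | h
    · exact key s hs h hc
    · exact key (-s) (neg_ne_zero.2 hs) h (by rwa [neg_mul_neg])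
  obtain ⟨s, hs⟩ := (ZMod.isSquare_or_isSquare_neg D.mod_four c).resolve_left hsq
  have hs0 : s ≠ 0 := by
    rintro rfl
    exact hc0 (by simpa using hs)
  have hcs : c = -s ^ 2 := by rw [sq, ← hs, neg_neg]
  refine ⟨s, hs0, fun b hb => ?_⟩
  rw [← hcs]
  have key : ∀ t, t ≠ 0 → Rel y h w (t ^ 2) (c * (t ^ 2)⁻¹) := by
    intro t ht
    have := hc.smul D ht
    rwa [mul_one, mul_comm _ c] at this
  rcases ZMod.isSquare_or_isSquare_neg D.mod_four b with ⟨t, ht⟩ | ⟨t, ht⟩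
  · rw [ht, ← sq]
    exact key t fun h => hb (by rw [ht, h, mul_zero])
  · have ht0 : t ≠ 0 := fun h => hb (by simpa [h] using ht)
    have h1 := (key (s * t⁻¹) (mul_ne_zero hs0 (inv_ne_zero ht0))).symm D
    have hb' : b = -(t ^ 2) := by rw [sq, ← ht, neg_neg]
    rw [hcs] at h1 ⊢
    convert h1 using 1
    · rw [hb']; field_simp
    · rw [hb']; field_simp

end BruhatData

namespace BruhatData

variable {p : ℕ} [hp : Fact p.Prime] {K : Type*} [Group K] {y h : ZMod p → K} {w : K}

theorem mul_h_conj (D : BruhatData p y h w) {s : ZMod p} (hs : s ≠ 0) (b : ZMod p) :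
    w * h s * y b * (w * h s) = w * y (s ^ 2 * b) * w := by
  have h1 := D.w_h _ (inv_ne_zero hs)
  rw [inv_inv] at h1
  calc w * h s * y b * (w * h s) = w * (h s * y b) * (w * h s) := by group
    _ = w * y (s ^ 2 * b) * (h s * (w * h s)) := by rw [D.h_y _ _ hs]; group
    _ = _ := by rw [← mul_assoc (h s), ← h1, mul_assoc w (h s⁻¹), D.h_inv hs, inv_mul_cancel, mul_one]

theorem exists_rel_mul_h (D : BruhatData p y h w) :
    ∃ s, s ≠ 0 ∧ ∀ b, b ≠ 0 → Rel y h (w * h s) b (-b⁻¹) := by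
  obtain ⟨s, hs, H⟩ := D.exists_rel_neg_inv
  refine ⟨s, hs, fun b hb => ?_⟩
  obtain ⟨e, z, he, heq⟩ := H (s ^ 2 * b) (mul_ne_zero (pow_ne_zero 2 hs) hb)
  refine ⟨s⁻¹ * e, z, mul_ne_zero (inv_ne_zero hs) he, ?_⟩
  rw [D.mul_h_conj hs, heq, show -s ^ 2 * (s ^ 2 * b)⁻¹ = -b⁻¹ by field_simp,
    D.h_mul _ _ (inv_ne_zero hs) he, D.h_inv hs]
  group

/-- The normalized relation of `SL(2,p)` describing `w * y b * w`. -/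
theorem exists_mul_eq (D : BruhatData p y h w) :
    ∃ w', BruhatData p y h w' ∧
      ∀ b, b ≠ 0 → w' * y b * w' = y (-b⁻¹) * w' * h (-b) * y (-b⁻¹) := by
  obtain ⟨s, hs, H⟩ := D.exists_rel_mul_h
  replace D := D.mul_h hs
  generalize w * h s = w at *
  have h0 := D.neg_one_ne_zero
  choose! κ μ hκ hμ using H
  have hinv : ∀ b, b ≠ 0 → -b⁻¹ = μ b ∧ κ (-b) = -κ b := by
    intro b hb
    have hb' := neg_ne_zero.2 hb
    have hk := hκ b hb
    have h1 : w * y (-b) * w = (w * y b * w)⁻¹ := by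
      calc w * y (-b) * w = h (-1) * w * y (-b) * (h (-1) * w) * (h (-1) * h (-1))⁻¹ := by
            rw [← D.h_neg_one_w]
            have : Commute w (h (-1)) := D.h_neg_one_w
            have h2 : Commute (y (-b)) (h (-1)) := (D.h_neg_one_y _).symm
            calc w * y (-b) * w = w * y (-b) * h (-1) * (h (-1))⁻¹ * w := by group
              _ = w * (h (-1) * y (-b)) * ((h (-1))⁻¹ * w) := by rw [D.h_neg_one_y]; group
              _ = w * h (-1) * y (-b) * (w * (h (-1))⁻¹) := by
                rw [this.inv_right.eq]; group
              _ = _ := by group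
        _ = (w * y b * w)⁻¹ := by
            rw [← D.h_mul _ _ h0 h0, neg_mul_neg, one_mul, D.h_one, inv_one, mul_one, D.y_neg,
              ← D.w_inv]
            group
    rw [hμ _ hb', hμ _ hb] at h1
    have h2 : (y (-b⁻¹) * w * h (κ b) * y (μ b))⁻¹ = y (-μ b) * w * h (κ b * -1) * y b⁻¹ := by
      have h3 : (h (κ b))⁻¹ * w = w * h (κ b) := by rw [D.w_h _ hk, D.h_inv hk]
      calc (y (-b⁻¹) * w * h (κ b) * y (μ b))⁻¹
          = (y (μ b))⁻¹ * (h (κ b))⁻¹ * w⁻¹ * (y (-b⁻¹))⁻¹ := by group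
        _ = (y (μ b))⁻¹ * ((h (κ b))⁻¹ * w) * h (-1) * (y (-b⁻¹))⁻¹ := by
          rw [D.w_inv, ← D.h_neg_one_w]; group
        _ = _ := by
          rw [h3, ← D.y_neg, ← D.y_neg, neg_neg, D.h_mul _ _ hk h0]; group
    rw [h2] at h1
    obtain ⟨h3, h4, -⟩ := D.big_cell_inj (hκ _ hb') (mul_ne_zero hk h0) h1
    refine ⟨?_, by rw [h4, mul_neg_one]⟩
    rw [inv_neg, neg_neg] at h3
    rw [h3, neg_neg]
  have hrel : ∀ b, b ≠ 0 → w * y b * w = y (-b⁻¹) * w * h (κ b) * y (-b⁻¹) := by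
    intro b hb
    rw [hμ b hb, ← (hinv b hb).1]
  have hsmul : ∀ a, a ≠ 0 → κ (a ^ 2) = a ^ 2 * κ 1 := by
    intro a ha
    have hk := hκ 1 one_ne_zero
    have hka := mul_ne_zero ha hk
    have hi := inv_ne_zero ha
    have ha2 := pow_ne_zero 2 ha
    have h2 : y (a ^ 2) = h a * y 1 * h a⁻¹ := by
      rw [D.h_y _ _ ha, mul_assoc, D.h_inv ha, mul_inv_cancel, mul_one, mul_one]
    have h3 : w * y (a ^ 2) * w = y (-(a ^ 2)⁻¹) * w * h (a * κ 1 * a) * y (-(a ^ 2)⁻¹) := by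
      calc w * y (a ^ 2) * w = w * h a * y 1 * (h a⁻¹ * w) := by rw [h2]; group
        _ = h a⁻¹ * w * y 1 * (w * h a) := by rw [← D.w_h _ ha]
        _ = h a⁻¹ * (w * y 1 * w) * h a := by simp only [mul_assoc]
        _ = (h a⁻¹ * y (-1⁻¹)) * w * h (κ 1) * (y (-1⁻¹) * h a) := by
          rw [hrel 1 one_ne_zero]; group
        _ = y (-(a ^ 2)⁻¹) * (h a⁻¹ * w) * h (κ 1) * (h a * y (-(a ^ 2)⁻¹)) := by
          rw [D.h_y _ _ hi, D.h_y_comm ha, inv_pow, inv_one, mul_neg_one, neg_one_mul]; group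
        _ = _ := by
          rw [← D.w_h _ ha, D.h_mul _ _ hka ha, D.h_mul _ _ ha hk]; group
    rw [hrel _ ha2] at h3
    rw [(D.big_cell_inj (hκ _ ha2) (mul_ne_zero hka ha) h3).2.1]
    ring
  have hlin : ∀ b, b ≠ 0 → κ b = κ 1 * b := by
    intro b hb
    rcases ZMod.isSquare_or_isSquare_neg D.mod_four b with ⟨t, ht⟩ | ⟨t, ht⟩
    · have ht0 : t ≠ 0 := fun h => hb (by rw [ht, h, mul_zero])
      rw [ht, ← sq, hsmul t ht0, mul_comm]
    · have ht0 : t ≠ 0 := fun h => hb (by simpa [h] using ht)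
      have hb' : b = -(t ^ 2) := by rw [sq, ← ht, neg_neg]
      rw [hb', (hinv _ (pow_ne_zero 2 ht0)).2, hsmul t ht0]
      ring
  have hk := hκ 1 one_ne_zero
  have hsq : κ 1 = 1 ∨ κ 1 = -1 := by
    have h1 : y 1 * w * h (-κ 1 * κ 1) * y (((κ 1) ^ 2)⁻¹ - 1) = y 1 * w * h (-1) * y 0 := by
      have h2 := hrel (-1) h0
      rw [hlin _ h0, mul_neg_one, inv_neg_one, neg_neg] at h2
      have h3 := hrel 1 one_ne_zero
      rw [inv_one] at h3
      calc y 1 * w * h (-κ 1 * κ 1) * y (((κ 1) ^ 2)⁻¹ - 1)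
          = y 1 * w * h (-κ 1) * (h (κ 1) * y (1 * (κ 1 ^ 2)⁻¹)) * y (-1) := by
            rw [D.h_mul _ _ (neg_ne_zero.2 hk) hk, sub_eq_add_neg, D.y_add, one_mul]; group
        _ = y 1 * w * h (-κ 1) * y 1 * h (κ 1) * y (-1) := by rw [← D.h_y_comm hk]; group
        _ = w * (y (-1) * w * h (κ 1) * y (-1)) := by rw [← h2]; group
        _ = w * w * y 1 * w := by rw [← h3]; group
        _ = _ := by rw [D.w_mul_self, D.h_neg_one_y, mul_assoc, ← D.h_neg_one_w, D.y_zero]; group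
    have h2 := (D.big_cell_inj (mul_ne_zero (neg_ne_zero.2 hk) hk) h0 h1).2.1
    rw [neg_mul, neg_inj, ← sq] at h2
    exact sq_eq_one_iff.1 h2
  rcases hsq with h1 | h1
  · refine ⟨w * h (-1), D.mul_h h0, fun b hb => ?_⟩
    rw [D.mul_h_conj h0, neg_one_sq, one_mul, hrel b hb, hlin b hb, h1, ← mul_assoc (y _),
      mul_assoc (y (-b⁻¹) * w) (h (-1)), ← D.h_mul _ _ h0 (neg_ne_zero.2 hb), neg_mul_neg]
  · refine ⟨w, D, fun b hb => ?_⟩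
    rw [hrel b hb, hlin b hb, h1, neg_one_mul]

end BruhatData

namespace BruhatData

open Matrix

variable {p : ℕ} [hp : Fact p.Prime]

/-- Upper unitriangular matrices. -/
def unipotent (x : ZMod p) : SpecialLinearGroup (Fin 2) (ZMod p) :=
  ⟨!![1, x; 0, 1], by simp [Matrix.det_fin_two]⟩

/-- Diagonal matrices. -/
def torus (e : (ZMod p)ˣ) : SpecialLinearGroup (Fin 2) (ZMod p) :=
  ⟨!![(e : ZMod p), 0; 0, (e : ZMod p)⁻¹], by
    rw [Matrix.det_fin_two_of, mul_zero, sub_zero, mul_inv_cancel₀ e.ne_zero]⟩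

/-- The Weyl element. -/
def weyl : SpecialLinearGroup (Fin 2) (ZMod p) :=
  ⟨!![0, 1; -1, 0], by simp [Matrix.det_fin_two]⟩

theorem coe_unipotent (x : ZMod p) :
    (unipotent x : Matrix (Fin 2) (Fin 2) (ZMod p)) = !![1, x; 0, 1] := rfl

theorem coe_torus (e : (ZMod p)ˣ) : (torus e : Matrix (Fin 2) (Fin 2) (ZMod p)) =
    !![(e : ZMod p), 0; 0, (e : ZMod p)⁻¹] := rfl

theorem coe_weyl : ((weyl : SpecialLinearGroup (Fin 2) (ZMod p)) :
    Matrix (Fin 2) (Fin 2) (ZMod p)) = !![0, 1; -1, 0] := rfl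

theorem eq_mul_of_eq_zero (M : SpecialLinearGroup (Fin 2) (ZMod p)) (e : (ZMod p)ˣ)
    (he : M 0 0 = e) (hc : M 1 0 = 0) : M = unipotent (M 0 0 * M 0 1) * torus e := by
  have hdet := M.det_coe
  rw [Matrix.det_fin_two, hc, mul_zero, sub_zero, he] at hdet
  have h0 := e.ne_zero
  refine Subtype.ext ?_
  change (M : Matrix (Fin 2) (Fin 2) (ZMod p)) =
    !![1, M 0 0 * M 0 1; 0, 1] * !![(e : ZMod p), 0; 0, (e : ZMod p)⁻¹]
  ext i j
  fin_cases i <;> fin_cases j <;>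
    simp [he, hc, -ZMod.inv_coe_unit, Matrix.mul_apply, Fin.sum_univ_two]
  · field_simp
  · exact eq_inv_of_mul_eq_one_right hdet

theorem eq_mul_of_ne_zero (M : SpecialLinearGroup (Fin 2) (ZMod p)) (e : (ZMod p)ˣ)
    (he : -M 1 0 = e) : M = unipotent (M 0 0 * (M 1 0)⁻¹) * weyl * torus e *
      unipotent ((M 1 0)⁻¹ * M 1 1) := by
  have hdet := M.det_coe
  have h0 := e.ne_zero
  rw [← he, neg_ne_zero] at h0
  rw [Matrix.det_fin_two] at hdet
  refine Subtype.ext ?_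
  change (M : Matrix (Fin 2) (Fin 2) (ZMod p)) = !![1, M 0 0 * (M 1 0)⁻¹; 0, 1] * !![0, 1; -1, 0] *
    !![(e : ZMod p), 0; 0, (e : ZMod p)⁻¹] * !![1, (M 1 0)⁻¹ * M 1 1; 0, 1]
  ext i j
  fin_cases i <;> fin_cases j <;> simp [Matrix.mul_apply, Fin.sum_univ_two, ← he]
  · field_simp
  · field_simp
    linear_combination -hdet
  · field_simp

variable {K : Type*} [Group K]

/-- The isomorphism defined by the Bruhat decomposition, as a function. -/
def bruhatMap (y h : ZMod p → K) (w : K) (M : SpecialLinearGroup (Fin 2) (ZMod p)) : K :=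
  if M 1 0 = 0 then y (M 0 0 * M 0 1) * h (M 0 0)
  else y (M 0 0 * (M 1 0)⁻¹) * w * h (-M 1 0) * y ((M 1 0)⁻¹ * M 1 1)

variable {y h : ZMod p → K} {w : K}

theorem bruhatMap_unipotent_mul (D : BruhatData p y h w) (x : ZMod p)
    (M : SpecialLinearGroup (Fin 2) (ZMod p)) :
    bruhatMap y h w (unipotent x * M) = y x * bruhatMap y h w M := by
  have hdet := M.det_coe
  rw [Matrix.det_fin_two] at hdet
  have e10 : (unipotent x * M) 1 0 = M 1 0 := by
    simp [coe_unipotent, -ZMod.inv_coe_unit, Matrix.mul_apply, Fin.sum_univ_two]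
  have e00 : (unipotent x * M) 0 0 = M 0 0 + x * M 1 0 := by
    simp [coe_unipotent, -ZMod.inv_coe_unit, Matrix.mul_apply, Fin.sum_univ_two]
  have e01 : (unipotent x * M) 0 1 = M 0 1 + x * M 1 1 := by
    simp [coe_unipotent, -ZMod.inv_coe_unit, Matrix.mul_apply, Fin.sum_univ_two]
  have e11 : (unipotent x * M) 1 1 = M 1 1 := by
    simp [coe_unipotent, -ZMod.inv_coe_unit, Matrix.mul_apply, Fin.sum_univ_two]
  rw [bruhatMap, bruhatMap, e10, e00, e01, e11]
  by_cases hc : M 1 0 = 0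
  · rw [if_pos hc, if_pos hc, ← mul_assoc, ← D.y_add, hc, mul_zero, add_zero]
    rw [hc] at hdet
    congr 2
    linear_combination x * hdet
  · rw [if_neg hc, if_neg hc, show (M 0 0 + x * M 1 0) * (M 1 0)⁻¹ = x + M 0 0 * (M 1 0)⁻¹ by
      field_simp; ring, D.y_add]
    simp only [mul_assoc]

theorem bruhatMap_torus_mul (D : BruhatData p y h w) (e : (ZMod p)ˣ)
    (M : SpecialLinearGroup (Fin 2) (ZMod p)) :
    bruhatMap y h w (torus e * M) = h e * bruhatMap y h w M := by
  have hdet := M.det_coe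
  rw [Matrix.det_fin_two] at hdet
  have e10 : (torus e * M) 1 0 = (e : ZMod p)⁻¹ * M 1 0 := by
    simp [coe_torus, -ZMod.inv_coe_unit, Matrix.mul_apply, Fin.sum_univ_two]
  have e00 : (torus e * M) 0 0 = e * M 0 0 := by
    simp [coe_torus, -ZMod.inv_coe_unit, Matrix.mul_apply, Fin.sum_univ_two]
  have e01 : (torus e * M) 0 1 = e * M 0 1 := by
    simp [coe_torus, -ZMod.inv_coe_unit, Matrix.mul_apply, Fin.sum_univ_two]
  have e11 : (torus e * M) 1 1 = (e : ZMod p)⁻¹ * M 1 1 := by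
    simp [coe_torus, -ZMod.inv_coe_unit, Matrix.mul_apply, Fin.sum_univ_two]
  have he := e.ne_zero
  rw [bruhatMap, bruhatMap, e10, e00, e01, e11]
  by_cases hc : M 1 0 = 0
  · have ha : M 0 0 ≠ 0 := by
      intro h0
      rw [hc, h0] at hdet
      simp at hdet
    rw [if_pos hc, if_pos (by rw [hc, mul_zero]), ← mul_assoc (h _) (y _), D.h_y _ _ he, D.h_mul _ _ he ha,
      mul_assoc (y _)]
    congr 2
    ring
  · have h1 : -((e : ZMod p)⁻¹ * M 1 0) = (e : ZMod p)⁻¹ * -M 1 0 := by ring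
    have h2 : (e : ZMod p) * M 0 0 * ((e : ZMod p)⁻¹ * M 1 0)⁻¹ =
        (e : ZMod p) ^ 2 * (M 0 0 * (M 1 0)⁻¹) := by field_simp
    have h3 : ((e : ZMod p)⁻¹ * M 1 0)⁻¹ * ((e : ZMod p)⁻¹ * M 1 1) = (M 1 0)⁻¹ * M 1 1 := by
      field_simp
    rw [if_neg hc, if_neg (mul_ne_zero (inv_ne_zero he) hc), h1, h2, h3,
      D.h_mul _ _ (inv_ne_zero he) (neg_ne_zero.2 hc)]
    have h4 := D.w_h _ (inv_ne_zero he)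
    rw [inv_inv] at h4
    calc _ = y ((e : ZMod p) ^ 2 * (M 0 0 * (M 1 0)⁻¹)) * (w * h (e : ZMod p)⁻¹) * h (-M 1 0) *
          y ((M 1 0)⁻¹ * M 1 1) := by group
      _ = _ := by
        rw [h4, ← mul_assoc (y _), ← D.h_y _ _ he]
        group

theorem bruhatMap_weyl_mul (D : BruhatData p y h w)
    (hw : ∀ b, b ≠ 0 → w * y b * w = y (-b⁻¹) * w * h (-b) * y (-b⁻¹))
    (M : SpecialLinearGroup (Fin 2) (ZMod p)) :
    bruhatMap y h w (weyl (p := p) * M) = w * bruhatMap y h w M := by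
  have hdet := M.det_coe
  rw [Matrix.det_fin_two] at hdet
  have e10 : (weyl (p := p) * M) 1 0 = -M 0 0 := by
    simp [coe_weyl, -ZMod.inv_coe_unit, Matrix.mul_apply, Fin.sum_univ_two]
  have e00 : (weyl (p := p) * M) 0 0 = M 1 0 := by
    simp [coe_weyl, -ZMod.inv_coe_unit, Matrix.mul_apply, Fin.sum_univ_two]
  have e01 : (weyl (p := p) * M) 0 1 = M 1 1 := by
    simp [coe_weyl, -ZMod.inv_coe_unit, Matrix.mul_apply, Fin.sum_univ_two]
  have e11 : (weyl (p := p) * M) 1 1 = -M 0 1 := by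
    simp [coe_weyl, -ZMod.inv_coe_unit, Matrix.mul_apply, Fin.sum_univ_two]
  rw [bruhatMap, bruhatMap, e10, e00, e01, e11]
  by_cases hc : M 1 0 = 0
  · have ha : M 0 0 ≠ 0 := by
      intro h0
      rw [hc, h0] at hdet
      simp at hdet
    rw [if_pos hc, if_neg (neg_ne_zero.2 ha), hc, zero_mul, D.y_zero, one_mul, neg_neg,
      D.h_y_comm ha, mul_assoc]
    congr 3
    field_simp
  · by_cases ha : M 0 0 = 0
    · have hc' := neg_ne_zero.2 hc
      rw [if_neg hc, if_pos (by rw [ha, neg_zero]), ha, zero_mul, D.y_zero, one_mul, ← mul_assoc,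
        ← mul_assoc, D.w_mul_self, ← D.h_mul _ _ D.neg_one_ne_zero hc', neg_mul_neg, one_mul,
        D.h_y _ _ hc]
      congr 2
      field_simp
    · have hc' := neg_ne_zero.2 hc
      have hac : M 0 0 * (M 1 0)⁻¹ ≠ 0 := mul_ne_zero ha (inv_ne_zero hc)
      rw [if_neg hc, if_neg (neg_ne_zero.2 ha)]
      have h1 : M 1 0 * (-M 0 0)⁻¹ = -(M 0 0 * (M 1 0)⁻¹)⁻¹ := by field_simp
      have h2 : (-M 0 0)⁻¹ * -M 0 1 =
          -(M 0 0 * (M 1 0)⁻¹)⁻¹ * ((-M 1 0) ^ 2)⁻¹ + (M 1 0)⁻¹ * M 1 1 := by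
        field_simp
        linear_combination -hdet
      have h3 : - -M 0 0 = -(M 0 0 * (M 1 0)⁻¹) * -M 1 0 := by field_simp
      rw [h1, h2, h3, D.h_mul _ _ (neg_ne_zero.2 hac) hc', D.y_add]
      calc _ = y (-(M 0 0 * (M 1 0)⁻¹)⁻¹) * w * h (-(M 0 0 * (M 1 0)⁻¹)) *
            (h (-M 1 0) * y (-(M 0 0 * (M 1 0)⁻¹)⁻¹ * ((-M 1 0) ^ 2)⁻¹)) * y ((M 1 0)⁻¹ * M 1 1) := by
            group
        _ = (w * y (M 0 0 * (M 1 0)⁻¹) * w) * h (-M 1 0) * y ((M 1 0)⁻¹ * M 1 1) := by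
            rw [hw _ hac, ← D.h_y_comm hc']
            group
        _ = _ := by group

theorem nonempty_mulEquiv (D : BruhatData p y h w) :
    Nonempty (K ≃* SpecialLinearGroup (Fin 2) (ZMod p)) := by
  obtain ⟨w, D, hw⟩ := D.exists_mul_eq
  set f := bruhatMap y h w with hf
  have hY : ∀ x M, f (unipotent x * M) = y x * f M := D.bruhatMap_unipotent_mul
  have hT : ∀ (e : (ZMod p)ˣ) M, f (torus e * M) = h e * f M := D.bruhatMap_torus_mul
  have hW : ∀ M, f (weyl (p := p) * M) = w * f M := D.bruhatMap_weyl_mul hw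
  have hone : f 1 = 1 := by
    simp [hf, bruhatMap, D.y_zero, D.h_one]
  have hform : ∀ M : SpecialLinearGroup (Fin 2) (ZMod p),
      (∃ x e, M = unipotent x * torus e) ∨
        ∃ x e z, M = unipotent x * weyl * torus e * unipotent z := by
    intro M
    by_cases hc : M 1 0 = 0
    · have ha : M 0 0 ≠ 0 := by
        intro h0
        have hdet := M.det_coe
        rw [Matrix.det_fin_two, hc, h0] at hdet
        simp at hdet
      exact Or.inl ⟨_, Units.mk0 _ ha, eq_mul_of_eq_zero M _ rfl hc⟩
    · exact Or.inr ⟨_, Units.mk0 _ (neg_ne_zero.2 hc), _, eq_mul_of_ne_zero M _ rfl⟩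
  have hmul : ∀ M N, f (M * N) = f M * f N := by
    intro M N
    rcases hform M with ⟨x, e, rfl⟩ | ⟨x, e, z, rfl⟩
    · have h1 := hT e 1
      rw [mul_one, hone, mul_one] at h1
      rw [mul_assoc, hY, hT, hY, h1, mul_assoc]
    · have h1 := hY z 1
      rw [mul_one, hone, mul_one] at h1
      simp only [mul_assoc, hY, hT, hW, h1]
  let φ : SpecialLinearGroup (Fin 2) (ZMod p) →* K :=
    { toFun := f, map_one' := hone, map_mul' := hmul }
  have hφY : ∀ x, φ (unipotent x) = y x := fun x => by
    have := hY x 1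
    rwa [mul_one, hone, mul_one] at this
  have hφT : ∀ e : (ZMod p)ˣ, φ (torus e) = h e := fun e => by
    have := hT e 1
    rwa [mul_one, hone, mul_one] at this
  have hφW : φ weyl = w := by
    have := hW 1
    rwa [mul_one, hone, mul_one] at this
  refine ⟨(MulEquiv.ofBijective φ ⟨(injective_iff_map_eq_one φ).2 fun M hM => ?_, fun g => ?_⟩).symm⟩
  · rcases hform M with ⟨x, e, rfl⟩ | ⟨x, e, z, rfl⟩
    · rw [map_mul, hφY, hφT] at hM
      obtain ⟨rfl, h2⟩ := D.eq_one _ _ e.ne_zero hM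
      obtain rfl : e = 1 := Units.ext h2
      refine (Eq.trans (eq_mul_of_eq_zero (1 : SpecialLinearGroup (Fin 2) (ZMod p)) 1 (by simp)
        (by simp)) ?_).symm
      congr 2
      simp
    · rw [map_mul, map_mul, map_mul, hφY, hφT, hφY, hφW] at hM
      have he := e.ne_zero
      refine absurd ?_ (D.w_ne (w := w) (c := -x + -z) (inv_ne_zero he))
      calc w = (y x)⁻¹ * (y x * w * h e * y z) * (y z)⁻¹ * (h e)⁻¹ := by group
        _ = _ := by rw [hM, D.y_add, D.y_neg, D.y_neg, D.h_inv he]; group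
  · rcases D.exists_form g with ⟨a, b, ha, rfl⟩ | ⟨x, e, z, he, rfl⟩
    · exact ⟨unipotent b * torus (Units.mk0 a ha), by rw [map_mul, hφY, hφT]; rfl⟩
    · exact ⟨unipotent x * weyl * torus (Units.mk0 e he) * unipotent z, by
        rw [map_mul, map_mul, map_mul, hφY, hφT, hφY, hφW]; rfl⟩

end BruhatData

/-- The number of nontrivial elements conjugate into a trivial intersection subgroup. -/
theorem Subgroup.ncard_conj_mul_card_normalizer {H : Type*} [Group H] [Finite H] (U : Subgroup H)
    (hU : ∀ x h, h ∈ U → h ≠ 1 → x * h * x⁻¹ ∈ U → x ∈ normalizer (U : Set H)) :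
    {g : H | g ≠ 1 ∧ ∃ x, x * g * x⁻¹ ∈ U}.ncard * Nat.card (normalizer (U : Set H)) =
      Nat.card H * (Nat.card U - 1) := by
  have h1 : ((U : Set H) \ {1}).ncard = Nat.card U - 1 := by
    rw [Set.ncard_sdiff_singleton_of_mem U.one_mem]
    rfl
  rw [← h1, ← Nat.card_coe_set_eq, ← Nat.card_coe_set_eq, ← Nat.card_prod, ← Nat.card_prod]
  have h2 : ∀ g : {g : H | g ≠ 1 ∧ ∃ x, x * g * x⁻¹ ∈ U}, ∃ x, x * (g : H) * x⁻¹ ∈ U :=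
    fun g => g.2.2
  choose c hc using h2
  refine Nat.card_eq_of_bijective (fun q => (q.2 * c q.1,
    ⟨q.2 * (c q.1 * q.1 * (c q.1)⁻¹) * (q.2 : H)⁻¹,
      (mem_normalizer_iff.1 q.2.2 _).1 (hc q.1), ?_⟩)) ⟨?_, ?_⟩
  · have := q.1.2.1
    simpa using this
  · rintro ⟨g, x⟩ ⟨g', x'⟩ h
    simp only [Prod.mk.injEq] at h
    obtain ⟨h3, h4⟩ := h
    have h4 := congrArg Subtype.val h4
    simp only at h4
    have h5 : (g : H) = g' := by
      calc (g : H) = (x * c g)⁻¹ * (x * (c g * g * (c g)⁻¹) * (x : H)⁻¹) * (x * c g) := by group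
        _ = _ := by rw [h4, h3]; group
    obtain rfl : g = g' := Subtype.ext h5
    exact Prod.ext rfl (Subtype.ext (mul_right_cancel h3))
  · rintro ⟨x, h, hh, h3⟩
    have h3 : h ≠ 1 := h3
    have h6 : x * (x⁻¹ * h * x) * x⁻¹ = h := by group
    have h8 : x⁻¹ * h * x ≠ 1 := fun h9 => h3 (by rw [← h6, h9, mul_one, mul_inv_cancel])
    set g : {g : H | g ≠ 1 ∧ ∃ x, x * g * x⁻¹ ∈ U} := ⟨x⁻¹ * h * x, h8, x, by rwa [h6]⟩ with hg
    have h7 : x * (c g)⁻¹ ∈ normalizer (U : Set H) := by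
      refine hU _ _ (hc g) ?_ ?_
      · have := g.2.1
        simpa using this
      · have : x * (c g)⁻¹ * (c g * g * (c g)⁻¹) * (x * (c g)⁻¹)⁻¹ = x * g * x⁻¹ := by group
        rw [this, hg]
        rwa [h6]
    refine ⟨(g, ⟨_, h7⟩), Prod.ext (by simp) (Subtype.ext ?_)⟩
    simp only
    calc _ = x * (g : H) * x⁻¹ := by group
      _ = _ := h6

theorem Subgroup.exists_conj_mem_of_prime_orderOf {H : Type*} [Group H] [Finite H]
    (U : Subgroup H) {r : ℕ} (hr : r.Prime) {t : H} (ht : orderOf t = r) (hU : ¬ r ∣ U.index) :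
    ∃ x, x⁻¹ * t * x ∈ U := by
  have : Fact (Nat.Prime r) := ⟨hr⟩
  have hp : IsPGroup r (Subgroup.zpowers t) := IsPGroup.of_card (n := 1) (by
    rw [Nat.card_zpowers, ht, pow_one])
  obtain ⟨x, hx⟩ := hp.nonempty_fixed_point_of_prime_not_dvd_card (H ⧸ U)
    (by rwa [← Subgroup.index_eq_card])
  obtain ⟨x, rfl⟩ := QuotientGroup.mk_surjective x
  have : ((t * x : H) : H ⧸ U) = (x : H ⧸ U) := hx ⟨t, Subgroup.mem_zpowers t⟩
  rw [eq_comm, QuotientGroup.eq] at this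
  exact ⟨x, by rwa [mul_assoc]⟩

namespace DihedralData

variable {H : Type*} [Group H] {z v : H} {A T : Subgroup H} {n : ℕ}

theorem coprime_of_index (h : DihedralData z A (n + 1)) :
    Nat.Coprime n (2 * (n + 1) * (2 * n + 1)) ∧ Odd n := by
  obtain ⟨a, ha, hn⟩ := h.two_pow
  have hodd : Odd n := by
    obtain ⟨b, rfl⟩ : ∃ b, a = b + 1 := ⟨a - 1, by omega⟩
    rw [pow_succ] at hn
    exact ⟨2 ^ b - 1, by omega⟩
  refine ⟨?_, hodd⟩
  have : 2 * (n + 1) * (2 * n + 1) = 2 + n * (4 * n + 6) := by ring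
  rw [this, Nat.coprime_add_mul_left_right]
  exact hodd.coprime_two_right

theorem card_eq_of_index (h : DihedralData z A (n + 1))
    (hk : (Subgroup.centralizer {z}).index = (2 * n + 1) * n) :
    Nat.card H = 2 * (n + 1) * ((2 * n + 1) * n) := by
  rw [h.card_eq_mul, hk]

theorem orderOf_dvd_of_commute_involution (h : DihedralData z A n) {g w : H} (hw : IsInvolution w)
    (hc : w * g = g * w) : orderOf g ∣ 2 * n := by
  obtain ⟨B, hB⟩ := h.exists_of_isInvolution hw
  rw [← hB.card_centralizer]
  exact Subgroup.orderOf_dvd_natCard _ (Subgroup.mem_centralizer_singleton_iff.2 hc.symm)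

variable [Finite H]

/-- The nontrivial elements which neither commute with an involution nor are conjugate into `T`. -/
def exceptional (T : Subgroup H) : Set H :=
  {g | g ≠ 1 ∧ (¬ ∃ w, IsInvolution w ∧ w * g = g * w) ∧ ¬ ∃ x, x * g * x⁻¹ ∈ T}

theorem ncard_exceptional (h : DihedralData z A (n + 1)) (hT : IsTorus T v)
    (hk : (Subgroup.centralizer {z}).index = (2 * n + 1) * n) (hcT : Nat.card T = n)
    (hl : Nat.card ↥(Subgroup.normalizer (T : Set H) ⊓ Subgroup.centralizer {v}) = 2) :
    (exceptional T).ncard = 4 * n * (n + 1) := by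
  have hn : 3 ≤ n := by have := h.four_le; omega
  have h1 := T.ncard_conj_mul_card_normalizer fun x g hg h1 hx => hT.mem_normalizer hg h1 hx
  rw [hT.card_normalizer, hcT, hl, h.card_eq_of_index hk] at h1
  have h2 := h.ncard_commuting_involution
  rw [hk, Nat.add_sub_cancel] at h2
  set X := {g : H | g ≠ 1 ∧ ∃ x, x * g * x⁻¹ ∈ T} with hX
  set Y := {g : H | g ≠ 1 ∧ ∃ w, IsInvolution w ∧ w * g = g * w} with hY
  have h3 : exceptional T = ((Set.univ : Set H) \ (X ∪ Y)) \ {1} := by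
    ext g
    simp only [exceptional, hX, hY, Set.mem_ofPred_eq, Set.mem_sdiff, Set.mem_univ, true_and,
      Set.mem_union, Set.mem_singleton_iff]
    constructor
    · rintro ⟨h1, h2, h3⟩
      exact ⟨fun h => h.elim (fun h => h3 h.2) fun h => h2 h.2, h1⟩
    · rintro ⟨h1, h2⟩
      exact ⟨h2, fun h => h1 (Or.inr ⟨h2, h⟩), fun h => h1 (Or.inl ⟨h2, h⟩)⟩
  have h4 : Disjoint X Y := by
    rw [Set.disjoint_left]
    rintro g ⟨h1, x, hx⟩ ⟨-, w, hw, hc⟩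
    refine hT.free _ hx (by simpa using h1) _ (hw.conj x) ?_
    have := congrArg (fun y => x * y * x⁻¹) hc
    simpa [mul_assoc] using this
  have h5 : X.ncard = (n + 1) * (2 * n + 1) * (n - 1) := by
    have : 0 < n * 2 := by omega
    refine Nat.eq_of_mul_eq_mul_right this ?_
    rw [h1]
    ring
  rw [h3, Set.ncard_sdiff_singleton_of_mem, Set.ncard_sdiff (Set.subset_univ _),
    Set.ncard_univ, h.card_eq_of_index hk, Set.ncard_union_eq h4, h5, h2]
  · obtain ⟨l, rfl⟩ : ∃ l, n = l + 1 := ⟨n - 1, by omega⟩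
    rw [Nat.add_sub_cancel]
    have : 2 * (l + 1 + 1) * ((2 * (l + 1) + 1) * (l + 1)) = 4 * (l + 1) * (l + 1 + 1) + 1 +
      ((l + 1 + 1) * (2 * (l + 1) + 1) * l + (2 * (l + 1) + 1) * (l + 1) * (l + 1)) := by ring
    omega
  · simp [hX, hY]

theorem card_centralizer_exceptional (h : DihedralData z A (n + 1)) (hT : IsTorus T v)
    (hk : (Subgroup.centralizer {z}).index = (2 * n + 1) * n) (hcT : Nat.card T = n)
    (hl : Nat.card ↥(Subgroup.normalizer (T : Set H) ⊓ Subgroup.centralizer {v}) = 2)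
    {g : H} (hg : g ∈ exceptional T) : Nat.card (Subgroup.centralizer {g}) = 2 * n + 1 := by
  obtain ⟨h1, h2, h3⟩ := hg
  obtain ⟨hcop, hodd⟩ := h.coprime_of_index
  have hn : 3 ≤ n := by have := h.four_le; omega
  have hcard := h.card_eq_of_index hk
  set c := Nat.card (Subgroup.centralizer {g}) with hc
  have hcodd : Nat.Coprime c 2 := by
    refine Nat.Coprime.symm ((Nat.Prime.coprime_iff_not_dvd Nat.prime_two).2 fun h2c => ?_)
    have : Fact (Nat.Prime 2) := ⟨Nat.prime_two⟩
    obtain ⟨⟨w, hw⟩, hw2⟩ := exists_prime_orderOf_dvd_card' 2 h2c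
    rw [Subgroup.orderOf_mk] at hw2
    refine h2 ⟨w, ⟨?_, ?_⟩, Subgroup.mem_centralizer_singleton_iff.1 hw⟩
    · rintro rfl
      simp at hw2
    · rw [← sq, ← hw2, pow_orderOf_eq_one]
  have hcn : Nat.Coprime c n := by
    refine Nat.Coprime.symm (Nat.coprime_of_dvd fun r hr hrn hrc => ?_)
    have : Fact (Nat.Prime r) := ⟨hr⟩
    obtain ⟨⟨t, ht⟩, htr⟩ := exists_prime_orderOf_dvd_card' r hrc
    rw [Subgroup.orderOf_mk] at htr
    have hnd : ¬ r ∣ T.index := by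
      have h4 := T.card_mul_index
      rw [hcT, hcard] at h4
      have h5 : T.index = 2 * (n + 1) * (2 * n + 1) := by
        refine Nat.eq_of_mul_eq_mul_left (show 0 < n by omega) ?_
        rw [h4]; ring
      rw [h5]
      intro hd
      have := Nat.dvd_gcd hrn hd
      rw [hcop] at this
      exact hr.one_lt.ne' (Nat.dvd_one.1 this)
    obtain ⟨x, h5⟩ := T.exists_conj_mem_of_prime_orderOf hr htr hnd
    have ht1 : x⁻¹ * t * x ≠ 1 := by
      intro h6
      have : t = 1 := by
        calc t = x * (x⁻¹ * t * x) * x⁻¹ := by group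
          _ = 1 := by rw [h6]; group
      rw [this, orderOf_one] at htr
      exact hr.one_lt.ne htr
    refine h3 ⟨x⁻¹, ?_⟩
    rw [inv_inv, ← hT.centralizer_eq _ h5 ht1, Subgroup.mem_centralizer_singleton_iff]
    have := congrArg (fun y => x⁻¹ * y * x) (Subgroup.mem_centralizer_singleton_iff.1 ht).symm
    simpa [mul_assoc] using this
  have hdvd : c ∣ 2 * n + 1 := by
    obtain ⟨a, -, ha⟩ := h.two_pow
    have h4 : c ∣ 2 * (n + 1) * ((2 * n + 1) * n) := hcard ▸ Subgroup.card_subgroup_dvd_card _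
    refine hcn.dvd_of_dvd_mul_right ?_
    refine Nat.Coprime.dvd_of_dvd_mul_left ?_ h4
    rw [ha]
    exact hcodd.mul_right (hcodd.pow_right a)
  obtain ⟨d, hd⟩ := hdvd
  have h4 : {y : H | ∃ x, y = x * g * x⁻¹}.ncard ≤ (exceptional T).ncard := by
    refine Set.ncard_le_ncard ?_ (Set.toFinite _)
    rintro _ ⟨x, rfl⟩
    refine ⟨by simpa using h1, ?_, ?_⟩
    · rintro ⟨w, hw, hcw⟩
      refine h2 ⟨x⁻¹ * w * x, by simpa using hw.conj x⁻¹, ?_⟩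
      have := congrArg (fun y => x⁻¹ * y * x) hcw
      simpa [mul_assoc] using this
    · rintro ⟨y, hy⟩
      exact h3 ⟨y * x, by simpa [mul_assoc] using hy⟩
  rw [ncard_conj_eq_index, h.ncard_exceptional hT hk hcT hl] at h4
  have h5 := (Subgroup.centralizer {g}).card_mul_index
  rw [← hc, hcard, hd] at h5
  have hc0 : 0 < c := Nat.card_pos
  have h6 : (Subgroup.centralizer {g}).index = 2 * n * (n + 1) * d := by
    refine Nat.eq_of_mul_eq_mul_left hc0 ?_
    rw [h5]; ring
  rw [h6, show 4 * n * (n + 1) = 2 * n * (n + 1) * 2 by ring] at h4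
  have h7 : d ≤ 2 := Nat.le_of_mul_le_mul_left h4 (by positivity)
  have h8 : d = 1 := by
    interval_cases d
    · omega
    · rfl
    · omega
  rw [hd, h8, mul_one]

theorem mem_exceptional_iff (h : DihedralData z A (n + 1)) (hT : IsTorus T v)
    (hk : (Subgroup.centralizer {z}).index = (2 * n + 1) * n) (hcT : Nat.card T = n)
    (hl : Nat.card ↥(Subgroup.normalizer (T : Set H) ⊓ Subgroup.centralizer {v}) = 2) {g : H} :
    g ∈ exceptional T ↔ g ≠ 1 ∧ g ^ (2 * n + 1) = 1 := by
  obtain ⟨hcop, hodd⟩ := h.coprime_of_index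
  constructor
  · intro hg
    refine ⟨hg.1, ?_⟩
    rw [← orderOf_dvd_iff_pow_eq_one, ← h.card_centralizer_exceptional hT hk hcT hl hg]
    exact Subgroup.orderOf_dvd_natCard _ (Subgroup.mem_centralizer_singleton_iff.2 rfl)
  · rintro ⟨h1, h2⟩
    rw [← orderOf_dvd_iff_pow_eq_one] at h2
    refine ⟨h1, ?_, ?_⟩
    · rintro ⟨w, hw, hc⟩
      have h3 := h.orderOf_dvd_of_commute_involution hw hc
      have : Nat.Coprime (2 * n + 1) (2 * (n + 1)) := by
        rw [show 2 * (n + 1) = 2 * n + 1 + 1 by ring, Nat.coprime_self_add_right]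
        exact Nat.coprime_one_right _
      exact h1 (orderOf_eq_one_iff.1 <| Nat.eq_one_of_dvd_coprimes this h2 h3)
    · rintro ⟨x, hx⟩
      have h3 := Subgroup.orderOf_dvd_natCard T hx
      have h4 : orderOf (x * g * x⁻¹) = orderOf g := by
        rw [← MulAut.conj_apply]
        exact orderOf_injective (MulAut.conj x).toMonoidHom (MulAut.conj x).injective g
      rw [h4, hcT] at h3
      exact h1 (orderOf_eq_one_iff.1 <| Nat.eq_one_of_dvd_coprimes hcop h3 (h2.trans (Dvd.intro_left _ rfl)))

end DihedralData

/-- A proper power of an odd number is not of the form `2 ^ k - 1`. -/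
theorem Nat.pow_eq_self_of_add_one_eq {p e k : ℕ} (h2 : Odd p) (hk : 2 ≤ k)
    (h : p ^ e + 1 = 2 ^ k) : p ^ e = p := by
  have h4 : 4 ∣ 2 ^ k := pow_dvd_pow 2 hk
  rcases Nat.even_or_odd' e with ⟨f, rfl | rfl⟩
  · obtain ⟨l, hl⟩ := h2.pow (n := f)
    rw [pow_mul', hl] at h
    rw [← h] at h4
    have : (2 * l + 1) ^ 2 + 1 = 4 * (l ^ 2 + l) + 2 := by ring
    omega
  · have h3 : p + 1 ∣ 2 ^ k := by
      rw [← h]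
      have := Odd.nat_add_dvd_pow_add_pow p 1 (n := 2 * f + 1) ⟨f, rfl⟩
      rwa [one_pow] at this
    obtain ⟨j, hj, hpj⟩ := (Nat.dvd_prime_pow Nat.prime_two).1 h3
    rcases hj.eq_or_lt with rfl | hlt
    · omega
    · obtain ⟨l, hl⟩ := h2
      have h5 : p ^ 2 ≡ 1 [MOD 2 ^ (j + 1)] := by
        have : p ^ 2 = 2 ^ (j + 1) * l + 1 := by
          rw [pow_succ 2 j, ← hpj, hl]; ring
        rw [this]
        simp [Nat.ModEq]
      have h6 : p ^ (2 * f + 1) ≡ p [MOD 2 ^ (j + 1)] := by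
        rw [pow_succ p (2 * f), pow_mul]
        simpa using (h5.pow f).mul_right p
      have h7 : 2 ^ k ≡ 2 ^ j [MOD 2 ^ (j + 1)] := by
        rw [← h, ← hpj]
        exact h6.add_right 1
      have h8 : 2 ^ (j + 1) ∣ 2 ^ j :=
        (Nat.modEq_zero_iff_dvd.1 (h7.symm.trans (Nat.modEq_zero_iff_dvd.2 (pow_dvd_pow 2 hlt))))
      have := Nat.le_of_dvd (by positivity) h8
      rw [pow_succ] at this
      have : 0 < 2 ^ j := by positivity
      omega

namespace DihedralData

variable {H : Type*} [Group H] [Finite H] {z v : H} {A T : Subgroup H} {n : ℕ}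

theorem orderOf_conj {H : Type*} [Group H] (x g : H) : orderOf (x * g * x⁻¹) = orderOf g := by
  rw [← MulAut.conj_apply]
  exact orderOf_injective (MulAut.conj x).toMonoidHom (MulAut.conj x).injective g

theorem not_three_orders (h : DihedralData z A (n + 1)) (hT : IsTorus T v)
    (hk : (Subgroup.centralizer {z}).index = (2 * n + 1) * n) (hcT : Nat.card T = n)
    (hl : Nat.card ↥(Subgroup.normalizer (T : Set H) ⊓ Subgroup.centralizer {v}) = 2)
    {a b c : H} (ha : a ∈ exceptional T) (hb : b ∈ exceptional T) (hc : c ∈ exceptional T)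
    (hab : orderOf a ≠ orderOf b) (hac : orderOf a ≠ orderOf c) (hbc : orderOf b ≠ orderOf c) :
    False := by
  have hcard := h.card_eq_of_index hk
  have h1 : ∀ g ∈ exceptional T, {y : H | ∃ x, y = x * g * x⁻¹}.ncard = 2 * n * (n + 1) := by
    intro g hg
    rw [ncard_conj_eq_index]
    have h5 := (Subgroup.centralizer {g}).card_mul_index
    rw [hcard, h.card_centralizer_exceptional hT hk hcT hl hg] at h5
    refine Nat.eq_of_mul_eq_mul_left (show 0 < 2 * n + 1 by omega) ?_
    rw [h5]; ring
  have h2 : ∀ g ∈ exceptional T, {y : H | ∃ x, y = x * g * x⁻¹} ⊆ exceptional T := by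
    rintro g hg _ ⟨x, rfl⟩
    rw [h.mem_exceptional_iff hT hk hcT hl, ← orderOf_dvd_iff_pow_eq_one] at hg ⊢
    rw [orderOf_conj]
    exact ⟨by simpa using hg.1, hg.2⟩
  have h3 : ∀ g g' : H, orderOf g ≠ orderOf g' →
      Disjoint {y : H | ∃ x, y = x * g * x⁻¹} {y : H | ∃ x, y = x * g' * x⁻¹} := by
    intro g g' hne
    rw [Set.disjoint_left]
    rintro _ ⟨x, rfl⟩ ⟨x', hx⟩
    exact hne (by rw [← orderOf_conj x g, hx, orderOf_conj])
  have h4 := Set.ncard_le_ncard (Set.union_subset (Set.union_subset (h2 a ha) (h2 b hb)) (h2 c hc))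
    (Set.toFinite _)
  rw [Set.ncard_union_eq (Set.disjoint_union_left.2 ⟨h3 _ _ hac, h3 _ _ hbc⟩),
    Set.ncard_union_eq (h3 _ _ hab), h1 a ha, h1 b hb, h1 c hc,
    h.ncard_exceptional hT hk hcT hl] at h4
  have h5 := h.four_le
  have h6 : 0 < n * (n + 1) := Nat.mul_pos (by omega) (by omega)
  nlinarith

theorem prime_of_index (h : DihedralData z A (n + 1)) (hT : IsTorus T v)
    (hk : (Subgroup.centralizer {z}).index = (2 * n + 1) * n) (hcT : Nat.card T = n)
    (hl : Nat.card ↥(Subgroup.normalizer (T : Set H) ⊓ Subgroup.centralizer {v}) = 2) :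
    (2 * n + 1).Prime := by
  have hn := h.four_le
  have hmem : ∀ g : H, g ≠ 1 → orderOf g ∣ 2 * n + 1 → g ∈ exceptional T := fun g h1 h2 =>
    (h.mem_exceptional_iff hT hk hcT hl).2 ⟨h1, orderOf_dvd_iff_pow_eq_one.1 h2⟩
  obtain ⟨g, hg⟩ : (exceptional T).Nonempty := by
    rw [← Set.ncard_pos, h.ncard_exceptional hT hk hcT hl]
    exact Nat.mul_pos (by omega) (by omega)
  have hcauchy : ∀ g ∈ exceptional T, ∀ r : ℕ, r.Prime → r ∣ 2 * n + 1 →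
      ∃ t, orderOf t = r ∧ t * g = g * t ∧ t ∈ exceptional T := by
    intro g hg r hr hd
    have : Fact r.Prime := ⟨hr⟩
    rw [← h.card_centralizer_exceptional hT hk hcT hl hg] at hd
    obtain ⟨⟨t, ht⟩, htr⟩ := exists_prime_orderOf_dvd_card' r hd
    rw [Subgroup.orderOf_mk] at htr
    refine ⟨t, htr, Subgroup.mem_centralizer_singleton_iff.1 ht, hmem t ?_ ?_⟩
    · rintro rfl
      rw [orderOf_one] at htr
      exact hr.one_lt.ne htr
    · rwa [htr, ← h.card_centralizer_exceptional hT hk hcT hl hg]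
  set p := (2 * n + 1).minFac with hp
  have hpp : p.Prime := Nat.minFac_prime (by omega)
  have hpd : p ∣ 2 * n + 1 := Nat.minFac_dvd _
  have huniq : ∀ {r : ℕ}, r.Prime → r ∣ 2 * n + 1 → r = p := by
    intro r hr hd
    by_contra hne
    obtain ⟨a, ha, -, ha'⟩ := hcauchy g hg p hpp hpd
    obtain ⟨b, hb, hba, hb'⟩ := hcauchy a ha' r hr hd
    have hcop : Nat.Coprime r p := (Nat.coprime_primes hr hpp).2 hne
    have h1 : orderOf (b * a) = r * p := by
      rw [Commute.orderOf_mul_eq_mul_orderOf_of_coprime hba (by rw [ha, hb]; exact hcop), ha, hb]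
    have h2 : b * a ∈ exceptional T := by
      refine hmem _ (fun h3 => ?_) ?_
      · rw [h3, orderOf_one] at h1
        have := Nat.eq_one_of_mul_eq_one_right h1.symm
        exact hr.one_lt.ne' this
      · rw [h1]
        exact hcop.mul_dvd_of_dvd_of_dvd hd hpd
    refine h.not_three_orders hT hk hcT hl ha' hb' h2 (by rw [ha, hb]; exact Ne.symm hne) ?_ ?_
    · rw [ha, h1]
      intro h4
      have := Nat.eq_of_mul_eq_mul_right hpp.pos ((one_mul p).trans h4)
      exact hr.one_lt.ne this
    · rw [hb, h1]
      intro h4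
      have := Nat.eq_of_mul_eq_mul_left hr.pos ((mul_one r).trans h4)
      exact hpp.one_lt.ne this
  have h1 := Nat.eq_prime_pow_of_unique_prime_dvd (show 2 * n + 1 ≠ 0 by omega) huniq
  obtain ⟨a, ha, hna⟩ := h.two_pow
  have hodd : Odd p := (show Odd (2 * n + 1) from ⟨n, rfl⟩).of_dvd_nat hpd
  have h2 := Nat.pow_eq_self_of_add_one_eq hodd (k := a + 1) (by omega)
    (e := (2 * n + 1).primeFactorsList.length) (by rw [← h1, pow_succ, ← hna]; ring)
  rw [h1, h2]
  exact hpp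

end DihedralData

namespace DihedralData

variable {H : Type*} [Group H] [Finite H] {z v : H} {A T : Subgroup H} {n : ℕ}

/-- A Sylow subgroup of order `2 * n + 1` with a complement in its normalizer, and an involution
inverting the complement. -/
theorem exists_borel (h : DihedralData z A (n + 1)) (hT : IsTorus T v)
    (hk : (Subgroup.centralizer {z}).index = (2 * n + 1) * n) (hcT : Nat.card T = n)
    (hl : Nat.card ↥(Subgroup.normalizer (T : Set H) ⊓ Subgroup.centralizer {v}) = 2) :
    ∃ (y t w : H) (s : ℕ), orderOf y = 2 * n + 1 ∧ orderOf t = n ∧ t * y * t⁻¹ = y ^ s ∧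
      orderOf (s : ZMod (2 * n + 1)) = n ∧ IsInvolution w ∧ w * t * w = t⁻¹ ∧
      w * y * w⁻¹ ∉ Subgroup.zpowers y := by
  have hprime := h.prime_of_index hT hk hcT hl
  have hn := h.four_le
  obtain ⟨hcop, hodd⟩ := h.coprime_of_index
  have hcard := h.card_eq_of_index hk
  have hmem := fun g => h.mem_exceptional_iff hT hk hcT hl (g := g)
  have : Fact (2 * n + 1).Prime := ⟨hprime⟩
  obtain ⟨y, hy⟩ : (exceptional T).Nonempty := by
    rw [← Set.ncard_pos, h.ncard_exceptional hT hk hcT hl]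
    exact Nat.mul_pos (by omega) (by omega)
  have hord : ∀ g ∈ exceptional T, orderOf g = 2 * n + 1 := fun g hg =>
    orderOf_eq_prime ((hmem g).1 hg).2 hg.1
  have hcent : ∀ g ∈ exceptional T, Subgroup.zpowers g = Subgroup.centralizer {g} := by
    intro g hg
    refine Subgroup.eq_of_le_of_card_ge ?_ ?_
    · rw [Subgroup.zpowers_le]
      exact Subgroup.mem_centralizer_singleton_iff.2 rfl
    · rw [h.card_centralizer_exceptional hT hk hcT hl hg, Nat.card_zpowers, hord g hg]
  have hpow : ∀ g ∈ Subgroup.zpowers y, g ≠ 1 → g ∈ exceptional T := by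
    rintro g hg h1
    refine (hmem g).2 ⟨h1, ?_⟩
    rw [← orderOf_dvd_iff_pow_eq_one, ← hord y hy, ← Nat.card_zpowers y]
    exact Subgroup.orderOf_dvd_natCard _ hg
  have hgen : ∀ g ∈ Subgroup.zpowers y, g ≠ 1 → Subgroup.zpowers g = Subgroup.zpowers y := by
    intro g hg h1
    refine Subgroup.eq_of_le_of_card_ge (Subgroup.zpowers_le.2 hg) ?_
    rw [Nat.card_zpowers, Nat.card_zpowers, hord y hy, hord g (hpow g hg h1)]
  set Y := Subgroup.zpowers y with hY
  have hmemY : ∀ x, x ∈ Y ↔ x * y = y * x := fun x => by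
    rw [hY, hcent y hy, Subgroup.mem_centralizer_singleton_iff]
  have hcY : Nat.card Y = 2 * n + 1 := by rw [Nat.card_zpowers, hord y hy]
  have hnorm : ∀ x g, g ∈ Y → g ≠ 1 → x * g * x⁻¹ ∈ Y →
      x ∈ Subgroup.normalizer (Y : Set H) := by
    intro x g hg h1 hx
    have h2 : x * g * x⁻¹ ≠ 1 := by simpa using h1
    have h3 : Y.map (MulAut.conj x).toMonoidHom = Y := by
      conv_lhs => rw [← hgen g hg h1, MonoidHom.map_zpowers]
      exact hgen _ hx h2
    rw [Subgroup.mem_normalizer_iff]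
    intro a
    conv_rhs => rw [← h3]
    constructor
    · intro ha
      exact ⟨a, ha, rfl⟩
    · rintro ⟨b, hb, hab⟩
      have : b = a := (MulAut.conj x).injective hab
      rwa [← this]
  have hindex : ¬ (2 * n + 1) ∣ Y.index := by
    have h4 := Y.card_mul_index
    rw [hcY, hcard] at h4
    have h5 : Y.index = 2 * (n + 1) * n := by
      refine Nat.eq_of_mul_eq_mul_left (show 0 < 2 * n + 1 by omega) ?_
      rw [h4]; ring
    rw [h5]
    intro hd
    rcases hprime.dvd_mul.1 hd with hd | hd
    · rcases hprime.dvd_mul.1 hd with hd | hd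
      · have := Nat.le_of_dvd (by omega) hd
        omega
      · have := Nat.le_of_dvd (by omega) hd
        omega
    · have := Nat.le_of_dvd (by omega) hd
      omega
  have hN : Nat.card (Subgroup.normalizer (Y : Set H)) = (2 * n + 1) * n := by
    have h1 := Y.ncard_conj_mul_card_normalizer hnorm
    have h2 : {g : H | g ≠ 1 ∧ ∃ x, x * g * x⁻¹ ∈ Y} = exceptional T := by
      ext g
      constructor
      · rintro ⟨h1, x, hx⟩
        refine (hmem g).2 ⟨h1, ?_⟩
        have h3 := hpow _ hx (by simpa using h1)
        rw [← orderOf_dvd_iff_pow_eq_one, ← orderOf_conj x, hord _ h3]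
      · intro hg
        obtain ⟨x, hx⟩ := Y.exists_conj_mem_of_prime_orderOf hprime (hord g hg) hindex
        exact ⟨hg.1, x⁻¹, by rwa [inv_inv]⟩
    rw [h2, h.ncard_exceptional hT hk hcT hl, hcard, hcY, Nat.add_sub_cancel] at h1
    refine Nat.eq_of_mul_eq_mul_left (show 0 < 4 * n * (n + 1) from
      Nat.mul_pos (by omega) (by omega)) ?_
    rw [h1]; ring
  have hfact : Fact (Nat.card Y).Prime := ⟨hcY ▸ hprime⟩
  have hcyc : IsCyclic (MulAut Y) := isCyclic_of_injective
    (IsCyclic.mulAutMulEquiv Y).toMonoidHom (IsCyclic.mulAutMulEquiv Y).injective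
  set φ := Y.normalizerMonoidHom with hφ
  have hker : ∀ x, φ x = 1 ↔ (x : H) ∈ Y := by
    intro x
    rw [← MonoidHom.mem_ker, hφ, Subgroup.normalizerMonoidHom_ker, Subgroup.mem_subgroupOf,
      Subgroup.mem_centralizer_iff]
    constructor
    · intro hx
      exact (hmemY _).2 (hx y (Subgroup.mem_zpowers y)).symm
    · intro hx a ha
      have := IsCyclic.isMulCommutative (α := Y)
      exact congrArg Subtype.val (this.is_comm.comm (⟨a, ha⟩ : Y) ⟨x, hx⟩)
  have hkc : Nat.card φ.ker = 2 * n + 1 := by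
    have : φ.ker = Y.subgroupOf (Subgroup.normalizer (Y : Set H)) := by
      ext x
      rw [MonoidHom.mem_ker, hker, Subgroup.mem_subgroupOf]
    rw [this, ← hcY]
    exact Nat.card_congr (Subgroup.subgroupOfEquivOfLe Subgroup.le_normalizer).toEquiv
  have hrange : Nat.card φ.range = n := by
    have h1 := φ.ker.card_mul_index
    rw [Subgroup.index_ker, hkc, hN] at h1
    exact Nat.eq_of_mul_eq_mul_left (by omega) h1
  obtain ⟨⟨_, t, rfl⟩, ht⟩ := IsCyclic.exists_ofOrder_eq_natCard (α := φ.range)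
  replace ht : orderOf (φ t) = n := by rw [← hrange, ← ht, ← Subgroup.orderOf_coe]
  have hty : (t : H) * y * (t : H)⁻¹ ∈ Y :=
    (Subgroup.mem_normalizer_iff.1 t.2 y).1 (Subgroup.mem_zpowers y)
  obtain ⟨s, hs⟩ := (mem_powers_iff_mem_zpowers.2 hty)
  have hs : y ^ s = (t : H) * y * (t : H)⁻¹ := hs
  have hcomm : ∀ j : ℕ, (t : H) ^ j * y * ((t : H) ^ j)⁻¹ = y ^ s ^ j := by
    intro j
    induction j with
    | zero => simp
    | succ j ih =>
      rw [pow_succ' s, pow_mul, hs, conj_pow, ← ih, pow_succ']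
      group
  have hsord : orderOf (s : ZMod (2 * n + 1)) = n := by
    refine Eq.trans (orderOf_eq_orderOf_iff.2 fun j => ?_) ht
    have h1 : (s : ZMod (2 * n + 1)) ^ j = 1 ↔ s ^ j ≡ 1 [MOD orderOf y] := by
      rw [hord y hy]
      simpa using ZMod.natCast_eq_natCast_iff (s ^ j) 1 (2 * n + 1)
    rw [← map_pow, hker, hmemY, h1, ← pow_eq_pow_iff_modEq, ← hcomm, pow_one,
      mul_inv_eq_iff_eq_mul]
    rfl
  have htn : (t : H) ^ n = 1 := by
    by_contra h1
    have h2 : (t : H) ^ n ∈ Y := by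
      have : φ (t ^ n) = 1 := by rw [map_pow, ← ht, pow_orderOf_eq_one]
      exact (hker _).1 this
    have h4 : (t : H) ∈ Subgroup.zpowers ((t : H) ^ n) := by
      rw [hcent _ (hpow _ h2 h1), Subgroup.mem_centralizer_singleton_iff]
      exact ((Commute.refl (t : H)).pow_right n).eq
    have h3 : (t : H) ∈ Y := (hgen _ h2 h1).le h4
    rw [(hker t).2 h3, orderOf_one] at ht
    omega
  have htord : orderOf (t : H) = n := by
    refine Nat.dvd_antisymm (orderOf_dvd_of_pow_eq_one htn) ?_
    conv_lhs => rw [← ht]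
    rw [Subgroup.orderOf_coe]
    exact orderOf_map_dvd φ t
  have htT : ∃ x, x * (t : H) * x⁻¹ ∈ T := by
    by_contra hnot
    have ht1 : (t : H) ≠ 1 := by
      intro h1
      rw [h1, orderOf_one] at htord
      omega
    by_cases hw : ∃ w, IsInvolution w ∧ w * (t : H) = t * w
    · obtain ⟨w, hw, hc⟩ := hw
      have h3 := h.orderOf_dvd_of_commute_involution hw hc
      rw [htord] at h3
      have := Nat.eq_one_of_dvd_coprimes hcop dvd_rfl (h3.trans (Dvd.intro _ rfl))
      omega
    · have h3 := hord _ ⟨ht1, hw, hnot⟩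
      omega
  obtain ⟨x, hx⟩ := htT
  have hinv := hT.inverts _ hx
  have hw : IsInvolution (x⁻¹ * v * x) := by simpa using hT.involution.conj x⁻¹
  refine ⟨y, t, x⁻¹ * v * x, s, hord y hy, htord, hs.symm, hsord, hw, ?_, ?_⟩
  · calc x⁻¹ * v * x * t * (x⁻¹ * v * x) = x⁻¹ * (v * (x * t * x⁻¹) * v) * x := by group
      _ = _ := by rw [hinv]; group
  · intro hwy
    have h1 := hnorm _ y (Subgroup.mem_zpowers y) hy.1 hwy
    have h2 := Subgroup.orderOf_dvd_natCard _ h1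
    rw [hN, orderOf_eq_prime (p := 2) (by rw [sq, hw.2]) hw.1] at h2
    have h3 : Odd ((2 * n + 1) * n) := Nat.odd_mul.2 ⟨⟨n, rfl⟩, hodd⟩
    exact (Nat.not_even_iff_odd.2 h3) (even_iff_two_dvd.2 h2)

end DihedralData

theorem exists_unit_generator {n : ℕ} [hp : Fact (2 * n + 1).Prime] (hn : Odd n) {s : ZMod (2 * n + 1)}
    (hs : orderOf s = n) : ∃ g : (ZMod (2 * n + 1))ˣ, orderOf g = 2 * n ∧ (g : ZMod (2 * n + 1)) ^ 2 = s ∧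
      g ^ n = -1 ∧ ∀ a, a ∈ Subgroup.zpowers g := by
  obtain ⟨k, hk⟩ := hn
  have hs0 : s ≠ 0 := by
    rintro rfl
    have h1 := pow_orderOf_eq_one (0 : ZMod (2 * n + 1))
    rw [hs, zero_pow (by omega)] at h1
    exact zero_ne_one h1
  obtain ⟨s, rfl⟩ := hs0.isUnit
  rw [orderOf_units] at hs
  have hsn : s ^ n = 1 := orderOf_dvd_iff_pow_eq_one.1 hs.dvd
  set r := s ^ (k + 1) with hr
  have hr2 : r ^ 2 = s := by
    rw [hr, ← pow_mul, show (k + 1) * 2 = n + 1 by omega, pow_succ, hsn, one_mul]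
  have hrn : r ^ n = 1 := by rw [hr, pow_right_comm, hsn, one_pow]
  have hro : orderOf r = n := by
    refine Nat.dvd_antisymm (orderOf_dvd_of_pow_eq_one hrn) ?_
    conv_lhs => rw [← hs, ← hr2]
    exact orderOf_pow_dvd 2
  have hneg : (-1 : (ZMod (2 * n + 1))ˣ) ≠ 1 := by
    intro h1
    have h2 : (-1 : ZMod (2 * n + 1)) = 1 := by simpa using congrArg Units.val h1
    have : Fact (2 < 2 * n + 1) := ⟨by have := hp.out.two_le; omega⟩
    exact ZMod.neg_one_ne_one h2
  have hno : orderOf (-1 : (ZMod (2 * n + 1))ˣ) = 2 := orderOf_eq_prime (by simp) hneg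
  have hg : orderOf (-1 * r) = 2 * n := by
    rw [(Commute.all _ _).orderOf_mul_eq_mul_orderOf_of_coprime, hno, hro]
    rw [hno, hro, Nat.coprime_two_left]
    exact ⟨k, hk⟩
  refine ⟨-1 * r, hg, ?_, ?_, fun a => ?_⟩
  · rw [← Units.val_pow_eq_pow_val, ← hr2]
    congr 1
    rw [mul_pow]
    simp
  · rw [mul_pow, hrn, mul_one, Odd.neg_one_pow ⟨k, hk⟩]
  · have h1 : Subgroup.zpowers (-1 * r) = ⊤ := by
      refine Subgroup.eq_top_of_card_eq _ ?_
      rw [Nat.card_zpowers, hg, Nat.card_eq_fintype_card, ZMod.card_units_eq_totient,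
        Nat.totient_prime hp.out]
      omega
    rw [h1]
    trivial

theorem exists_bruhatData {n : ℕ} [hp : Fact (2 * n + 1).Prime] (hn : Odd n) {K : Type*} [Group K]
    [Finite K] {y t w u : K} {s : ℕ} (hcard : Nat.card K = 2 * (2 * (n + 1) * ((2 * n + 1) * n)))
    (hy : orderOf y = 2 * n + 1) (ht : orderOf t = n) (hty : t * y * t⁻¹ = y ^ s)
    (hs : orderOf (s : ZMod (2 * n + 1)) = n) (hu : u ≠ 1) (huu : u * u = 1)
    (hcu : ∀ g, u * g = g * u) (hw : w * w = u) (hwt : w * t * w⁻¹ = t⁻¹)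
    (hwy : w * y * w⁻¹ ∉ Subgroup.zpowers y) :
    ∃ (y h : ZMod (2 * n + 1) → K) (w : K), BruhatData (2 * n + 1) y h w := by
  obtain ⟨g, hg, hgs, hgn, hgen⟩ := exists_unit_generator hn hs
  have huo : orderOf u = 2 := orderOf_eq_prime (by rw [sq, huu]) hu
  have hcut : Commute u t := hcu t
  have htn : t ^ n = 1 := by rw [← ht, pow_orderOf_eq_one]
  have ho : orderOf (u * t) = 2 * n := by
    rw [hcut.orderOf_mul_eq_mul_orderOf_of_coprime, huo, ht]
    rwa [huo, ht, Nat.coprime_two_left]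
  set η := monoidHomOfForallMemZpowers hgen (g' := u * t) (by rw [ho, hg]) with hη
  have hηg : η g = u * t := monoidHomOfForallMemZpowers_apply_gen hgen (by rw [ho, hg])
  have hpow : ∀ a : (ZMod (2 * n + 1))ˣ, ∃ j : ℕ, g ^ j = a := fun a =>
    mem_powers_iff_mem_zpowers.2 (hgen a)
  have hymod : ∀ j : ℕ, y ^ (j % (2 * n + 1)) = y ^ j := fun j => by
    simpa only [hy] using pow_mod_orderOf y j
  have hyadd : ∀ a b : ZMod (2 * n + 1), y ^ (a + b).val = y ^ a.val * y ^ b.val := by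
    intro a b
    rw [← pow_add, ZMod.val_add, hymod]
  have hycast : ∀ j : ℕ, y ^ (j : ZMod (2 * n + 1)).val = y ^ j := by
    intro j
    rw [ZMod.val_natCast, hymod]
  have hηy : ∀ (a : (ZMod (2 * n + 1))ˣ) (b : ZMod (2 * n + 1)),
      η a * y ^ b.val = y ^ ((a : ZMod (2 * n + 1)) ^ 2 * b).val * η a := by
    intro a
    obtain ⟨j, rfl⟩ := hpow a
    induction j with
    | zero => simp
    | succ j ih =>
      intro b
      have h1 : ∀ b : ZMod (2 * n + 1), t * y ^ b.val = y ^ (s * b).val * t := by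
        intro b
        rw [← mul_inv_eq_iff_eq_mul, ← conj_pow, hty, ← pow_mul, ← hycast, Nat.cast_mul,
          ZMod.natCast_zmod_val]
      rw [pow_succ', map_mul, mul_assoc, ih, hηg, mul_assoc, ← mul_assoc t, h1, ← mul_assoc u,
        ← mul_assoc u, hcu, mul_assoc, mul_assoc, mul_assoc, ← hgs, Units.val_mul, mul_pow, mul_assoc]
  have hwη : ∀ a, w * η a = η a⁻¹ * w := by
    intro a
    obtain ⟨j, rfl⟩ := hpow a
    rw [map_inv, map_pow, hηg, ← mul_inv_eq_iff_eq_mul, ← conj_pow, ← mul_assoc w u, ← hcu w,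
      mul_assoc u w, mul_assoc u, hwt, ← inv_pow, mul_inv_rev, hcu,
      inv_eq_of_mul_eq_one_left huu]
  have hinj : ∀ a, η a = 1 → a = 1 := by
    intro a ha
    obtain ⟨j, rfl⟩ := hpow a
    rwa [map_pow, hηg, ← orderOf_dvd_iff_pow_eq_one, ho, ← hg, orderOf_dvd_iff_pow_eq_one] at ha
  refine ⟨fun b => y ^ b.val, fun a => if ha : a = 0 then 1 else η (Units.mk0 a ha), w, ?_⟩
  constructor
  · obtain ⟨k, rfl⟩ := hn
    omega
  · rw [hcard, Nat.add_sub_cancel]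
    ring
  · exact hyadd
  · intro a b ha hb
    simp only [ha, hb, mul_ne_zero ha hb, dite_false]
    rw [← map_mul]
    congr 1
    ext
    rfl
  · intro a b ha
    simp only [ha, dite_false]
    exact hηy _ _
  · intro a ha
    simp only [ha, inv_eq_zero, dite_false]
    rw [hwη]
    congr 2
    ext
    simp
  · have h1 : (-1 : ZMod (2 * n + 1)) ≠ 0 := neg_ne_zero.2 one_ne_zero
    simp only [h1, dite_false]
    have h2 : Units.mk0 (-1) h1 = g ^ n := by
      rw [hgn]
      ext
      simp
    obtain ⟨k, rfl⟩ := hn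
    rw [hw, h2, map_pow, hηg, hcut.mul_pow, htn, mul_one, pow_succ, pow_mul, sq, huu, one_pow,
      one_mul]
  · intro a b ha hab
    simp only [ha, dite_false] at hab
    have h1 : orderOf (y ^ b.val) ∣ 2 * n + 1 := (orderOf_pow_dvd _).trans hy.dvd
    have h2 : orderOf (y ^ b.val) ∣ 2 * n := by
      rw [eq_inv_of_mul_eq_one_left hab, orderOf_inv]
      exact (orderOf_map_dvd _ _).trans ((orderOf_dvd_of_mem_zpowers (hgen _)).trans hg.dvd)
    have h3 : y ^ b.val = 1 := by
      rw [← orderOf_eq_one_iff, ← Nat.dvd_one]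
      exact (Nat.dvd_add_right h2).1 h1
    rw [h3, one_mul] at hab
    refine ⟨?_, by simpa using congrArg Units.val (hinj _ hab)⟩
    rw [← orderOf_dvd_iff_pow_eq_one, hy] at h3
    rw [← ZMod.val_eq_zero]
    exact Nat.eq_zero_of_dvd_of_lt h3 (ZMod.val_lt b)
  · intro b c hb he
    apply hwy
    have h1 : y = (y ^ b.val) ^ (b⁻¹).val := by
      rw [← pow_mul, ← hycast, Nat.cast_mul, ZMod.natCast_zmod_val, ZMod.natCast_zmod_val,
        mul_inv_cancel₀ hb]
      simpa using (hycast 1).symm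
    rw [h1, ← conj_pow, mul_inv_eq_of_eq_mul he]
    rw [← h1]
    exact pow_mem (pow_mem (Subgroup.mem_zpowers y) _) _

theorem exists_lift_of_odd_pow {K H : Type*} [Group K] [Group H] {π : K →* H}
    (hπ : Function.Surjective π) {u : K} (hcu : ∀ g, u * g = g * u) (huu : u * u = 1)
    (hker : ∀ g, π g = 1 ↔ g = 1 ∨ g = u) {j : ℕ} (hj : Odd j) {a : H} (ha : a ^ j = 1) :
    ∃ b, π b = a ∧ b ^ j = 1 := by
  obtain ⟨b, rfl⟩ := hπ a
  obtain ⟨k, rfl⟩ := hj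
  rw [← map_pow, hker] at ha
  rcases ha with ha | ha
  · exact ⟨b, rfl, ha⟩
  · refine ⟨u * b, ?_, ?_⟩
    · rw [map_mul, (hker u).2 (Or.inr rfl), one_mul]
    · rw [(show Commute u b from hcu b).mul_pow, ha, pow_succ, pow_mul, sq, huu, one_pow, one_mul, huu]

theorem eq_of_map_eq_of_odd_pow {K H : Type*} [Group K] [Group H] {π : K →* H} {u : K} (hu : u ≠ 1)
    (hcu : ∀ g, u * g = g * u) (huu : u * u = 1) (hker : ∀ g, π g = 1 ↔ g = 1 ∨ g = u) {j : ℕ}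
    (hj : Odd j) {a b : K} (hab : π a = π b) (ha : a ^ j = 1) (hb : b ^ j = 1) : a = b := by
  rw [← mul_inv_eq_one, ← map_inv, ← map_mul, hker, mul_inv_eq_one, mul_inv_eq_iff_eq_mul] at hab
  rcases hab with hab | rfl
  · exact hab
  · obtain ⟨k, rfl⟩ := hj
    rw [(show Commute u b from hcu b).mul_pow, hb, pow_succ, pow_mul, sq, huu, one_pow, one_mul,
      mul_one] at ha
    exact absurd ha hu

/-- A double cover of a group as in `DihedralData.exists_borel` whose involutions lift to
elements of order four is `SL(2,p)`. -/
theorem DihedralData.exists_nonempty_mulEquiv {K H : Type*} [Group K] [Finite K] [Group H] [Finite H]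
    {z v : H} {A T : Subgroup H} {n : ℕ} {π : K →* H} (hπ : Function.Surjective π) {u : K}
    (hu : u ≠ 1) (hcu : ∀ g, u * g = g * u) (huu : u * u = 1)
    (hker : ∀ g, π g = 1 ↔ g = 1 ∨ g = u) (hsq : ∀ g, IsInvolution (π g) → g * g = u)
    (h : DihedralData z A (n + 1)) (hT : IsTorus T v)
    (hk : (Subgroup.centralizer {z}).index = (2 * n + 1) * n) (hcT : Nat.card T = n)
    (hl : Nat.card ↥(Subgroup.normalizer (T : Set H) ⊓ Subgroup.centralizer {v}) = 2) :
    ∃ p : ℕ, p.Prime ∧ (∃ a, p = 2 ^ a - 1) ∧ 7 ≤ p ∧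
      Nonempty (K ≃* Matrix.SpecialLinearGroup (Fin 2) (ZMod p)) := by
  have hp := h.prime_of_index hT hk hcT hl
  have : Fact (2 * n + 1).Prime := ⟨hp⟩
  have hn := h.four_le
  obtain ⟨hcop, hodd⟩ := h.coprime_of_index
  have hcard := h.card_eq_of_index hk
  have hpo : Odd (2 * n + 1) := ⟨n, rfl⟩
  obtain ⟨y, t, w, s, hy, ht, hty, hs, hw, hwt, hwy⟩ := h.exists_borel hT hk hcT hl
  obtain ⟨y, rfl, hy1⟩ := exists_lift_of_odd_pow hπ hcu huu hker hpo
    (show y ^ (2 * n + 1) = 1 by rw [← hy, pow_orderOf_eq_one])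
  obtain ⟨t, rfl, ht1⟩ := exists_lift_of_odd_pow hπ hcu huu hker hodd
    (show t ^ n = 1 by rw [← ht, pow_orderOf_eq_one])
  obtain ⟨w, rfl⟩ := hπ w
  have hcK : Nat.card K = 2 * (2 * (n + 1) * ((2 * n + 1) * n)) := by
    have h1 := π.ker.card_mul_index
    rw [Subgroup.index_ker, MonoidHom.range_eq_top.2 hπ, Subgroup.card_top, hcard] at h1
    rw [← h1]
    congr 1
    have h2 : (π.ker : Set K) = {1, u} := by
      ext g
      simp [MonoidHom.mem_ker, hker]
    exact (Nat.card_coe_set_eq _).trans (h2 ▸ Set.ncard_pair hu.symm)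
  have hy' : orderOf y = 2 * n + 1 := Nat.dvd_antisymm (orderOf_dvd_of_pow_eq_one hy1)
    (hy ▸ orderOf_map_dvd π y)
  have ht' : orderOf t = n := Nat.dvd_antisymm (orderOf_dvd_of_pow_eq_one ht1)
    (ht ▸ orderOf_map_dvd π t)
  have hty' : t * y * t⁻¹ = y ^ s := by
    refine eq_of_map_eq_of_odd_pow hu hcu huu hker hpo ?_ ?_ ?_
    · rw [map_mul, map_mul, map_inv, hty, map_pow]
    · rw [conj_pow, hy1]
      simp
    · rw [pow_right_comm, hy1, one_pow]
  have hwt' : w * t * w⁻¹ = t⁻¹ := by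
    refine eq_of_map_eq_of_odd_pow hu hcu huu hker hodd ?_ ?_ ?_
    · rw [map_mul, map_mul, map_inv, hw.inv_eq, hwt, map_inv]
    · rw [conj_pow, ht1]
      simp
    · rw [inv_pow, ht1, inv_one]
  have hwy' : w * y * w⁻¹ ∉ Subgroup.zpowers y := by
    intro h1
    apply hwy
    have h2 := Subgroup.mem_map_of_mem π h1
    rwa [MonoidHom.map_zpowers, map_mul, map_mul, map_inv] at h2
  obtain ⟨y, η, w, D⟩ := exists_bruhatData hodd hcK hy' ht' hty' hs hu huu hcu (hsq w hw) hwt' hwy'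
  obtain ⟨a, -, ha⟩ := h.two_pow
  refine ⟨2 * n + 1, hp, ⟨a + 1, ?_⟩, ?_, D.nonempty_mulEquiv⟩
  · rw [pow_succ, ← ha]
    omega
  · omega

section

open scoped Pointwise

theorem Subgroup.conj_smul_eq_self_iff {H : Type*} [Group H] [Finite H] {T : Subgroup H} {x : H} :
    MulAut.conj x • T = T ↔ x ∈ Subgroup.normalizer (T : Set H) := by
  have key : ∀ y ∈ Subgroup.normalizer (T : Set H), MulAut.conj y • T ≤ T := by
    rintro y hy _ ⟨a, ha, rfl⟩
    exact (Subgroup.mem_normalizer_iff.1 hy a).1 ha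
  constructor
  · intro hx
    rw [Subgroup.mem_normalizer_iff]
    intro a
    constructor
    · intro ha
      rw [← hx]
      exact ⟨a, ha, rfl⟩
    · intro ha
      rw [← hx] at ha
      obtain ⟨c, hc, hca⟩ := ha
      rwa [← (MulAut.conj x).injective hca]
  · intro hx
    refine le_antisymm (key x hx) ?_
    have h1 := key x⁻¹ (inv_mem hx)
    rwa [map_inv, Subgroup.pointwise_smul_subset_iff, inv_inv] at h1

theorem MulAut.mul_conj {H : Type*} [Group H] (τ : MulAut H) (g : H) :
    τ * MulAut.conj g = MulAut.conj (τ g) * τ := by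
  ext x
  simp

namespace IsTorus

variable {H : Type*} [Group H] {z v v' : H} {A T T' : Subgroup H} {m : ℕ}

theorem _root_.IsInvolution.mulAut_apply {w : H} (hw : IsInvolution w) (τ : MulAut H) :
    IsInvolution (τ w) :=
  ⟨by simpa using hw.1, by rw [← map_mul, hw.2, map_one]⟩

theorem card_smul (τ : MulAut H) (T : Subgroup H) : Nat.card ↥(τ • T) = Nat.card T :=
  (Nat.card_congr (Subgroup.equivSMul τ T).toEquiv).symm

theorem eq_of_mem (hT : IsTorus T v) (hT' : IsTorus T' v') {a : H} (h1 : a ≠ 1) (ha : a ∈ T)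
    (ha' : a ∈ T') : T = T' := by
  rw [← hT.centralizer_eq a ha h1, hT'.centralizer_eq a ha' h1]

theorem smul (hT : IsTorus T v) (τ : MulAut H) : IsTorus (τ • T) (τ v) where
  ne_bot h := hT.ne_bot (by
    have := congrArg (τ⁻¹ • ·) h
    simpa using this)
  free := by
    rintro _ ⟨a, ha, rfl⟩ h1 w hw he
    have h2 : a ≠ 1 := by
      rintro rfl
      simp at h1
    refine hT.free a ha h2 (τ⁻¹ w) (hw.mulAut_apply _) (τ.injective ?_)
    rw [map_mul, map_mul, MulAut.apply_inv_self]
    exact he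
  involution := hT.involution.mulAut_apply τ
  inverts := by
    rintro _ ⟨a, ha, rfl⟩
    change τ v * τ a * τ v = (τ a)⁻¹
    rw [← map_mul, ← map_mul, hT.inverts a ha, map_inv]
  centralizer_eq := by
    rintro _ ⟨a, ha, rfl⟩ h1
    have h2 : a ≠ 1 := by
      rintro rfl
      simp at h1
    ext x
    rw [Subgroup.mem_pointwise_smul_iff_inv_smul_mem, ← hT.centralizer_eq a ha h2,
      Subgroup.mem_centralizer_singleton_iff, Subgroup.mem_centralizer_singleton_iff]
    change x * τ a = τ a * x ↔ τ⁻¹ x * a = a * τ⁻¹ x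
    rw [← τ.injective.eq_iff (a := τ⁻¹ x * a), map_mul, map_mul, MulAut.apply_inv_self]

variable [Finite H]

theorem eq_of_mem_of_mem_normalizer (hT : IsTorus T v) (hT' : IsTorus T' v') {a : H} (h1 : a ≠ 1)
    (ha : a ∈ T) (ha' : a ∈ Subgroup.normalizer (T' : Set H)) : T = T' := by
  refine hT.eq_of_mem hT' h1 ha ?_
  by_contra h2
  obtain ⟨w, hw, hc⟩ := hT'.exists_commute ha' h2
  exact hT.free a ha h1 w hw.involution hc.symm

theorem exists_conj_smul_eq (hD : DihedralData z A m)
    (hk : (Subgroup.centralizer {z}).index = (2 * m + 1) * (m + 1)) (hT : IsTorus T v)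
    (hT' : IsTorus T' v') (hcT : Nat.card T = 2 * m + 1) (hcT' : Nat.card T' = 2 * m + 1) :
    ∃ g : H, MulAut.conj g • T = T' := by
  have hm := hD.four_le
  have hr := Nat.minFac_prime (show 2 * m + 1 ≠ 1 by omega)
  have hrd := Nat.minFac_dvd (2 * m + 1)
  set r := Nat.minFac (2 * m + 1)
  have : Fact r.Prime := ⟨hr⟩
  have hindex : T.index = 2 * m * (m + 1) := by
    have h1 := T.card_mul_index
    rw [hD.card_eq_mul, hk, hcT] at h1
    refine Nat.eq_of_mul_eq_mul_left (show 0 < 2 * m + 1 by omega) ?_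
    rw [h1]
    ring
  have hri : ¬ r ∣ T.index := by
    rw [hindex]
    intro hd
    have hr1 : ¬ r ∣ 1 := fun h => hr.one_lt.ne' (Nat.dvd_one.1 h)
    rcases hr.dvd_mul.1 hd with hd | hd
    · exact hr1 ((Nat.dvd_add_right hd).1 hrd)
    · refine hr1 ((Nat.dvd_add_right hrd).1 ?_)
      rw [show 2 * m + 1 + 1 = 2 * (m + 1) by ring]
      exact hd.mul_left 2
  obtain ⟨⟨t, ht⟩, hto⟩ := exists_prime_orderOf_dvd_card' (G := T') r (hcT'.symm ▸ hrd)
  rw [Subgroup.orderOf_mk] at hto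
  obtain ⟨x, hx⟩ := T.exists_conj_mem_of_prime_orderOf hr hto hri
  have ht1 : t ≠ 1 := by
    rintro rfl
    rw [orderOf_one] at hto
    exact hr.one_lt.ne hto
  refine ⟨x, (hT.smul (MulAut.conj x)).eq_of_mem hT' ht1 ?_ ht⟩
  refine ⟨_, hx, ?_⟩
  change x * (x⁻¹ * t * x) * x⁻¹ = t
  group

theorem eq_or_eq_conj_smul (hD : DihedralData z A m)
    (hk : (Subgroup.centralizer {z}).index = (2 * m + 1) * (m + 1)) (hT : IsTorus T z)
    (hA : A ≤ Subgroup.normalizer (T : Set H))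
    (hT' : IsTorus T' v') (hcT : Nat.card T = 2 * m + 1) (hcT' : Nat.card T' = 2 * m + 1)
    (hz : z ∈ Subgroup.normalizer (T' : Set H))
    {b : H} (hb : b * z = z * b) (hbA : b ∉ A) : T' = T ∨ T' = MulAut.conj b • T := by
  obtain ⟨g, rfl⟩ := hT.exists_conj_smul_eq hD hk hT' hcT hcT'
  have h1 := (hT.smul (MulAut.conj g)).of_mem_normalizer hD.involution hz
  have h2 : IsTorus T (g⁻¹ * z * g) := by simpa [← mul_smul, ← map_mul] using h1.smul (MulAut.conj g⁻¹)
  obtain ⟨a, ha, hza⟩ := hT.exists_conj_eq h2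
  have h3 : MulAut.conj g • T = MulAut.conj (g * a) • T := by
    rw [map_mul, mul_smul, Subgroup.conj_smul_eq_self_iff.2 (IsTorus.le_normalizer ha)]
  have h4 : g * a * z = z * (g * a) := by
    rw [mul_assoc, mul_inv_eq_iff_eq_mul.1 hza.symm]
    group
  rw [h3]
  by_cases h5 : g * a ∈ A
  · exact Or.inl (Subgroup.conj_smul_eq_self_iff.2 (hA h5))
  · right
    have h6 := hD.mul_mem hb hbA h4 h5
    have h7 : g * a = b * (b * (g * a)) := ((hD.isInvolution_of_notMem hb hbA).mul_mul_cancel _).symm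
    rw [h7, map_mul, mul_smul, Subgroup.conj_smul_eq_self_iff.2 (hA h6)]

theorem exists_isTorus_centralizes (hD : DihedralData z A m) (hT : IsTorus T v)
    (hl : Nat.card ↥(Subgroup.normalizer (T : Set H) ⊓ Subgroup.centralizer {v}) = m) :
    ∃ T' : Subgroup H, Nat.card T' = Nat.card T ∧ IsTorus T' z ∧
      A ≤ Subgroup.normalizer (T' : Set H) := by
  obtain ⟨g, rfl⟩ := hD.isConj v hT.involution.1 hT.involution.2
  have h1 := hT.le_of_data (hD.conj g)
  have h2 := Subgroup.eq_of_le_of_card_ge h1 (by rw [hl, (hD.conj g).card_eq])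
  refine ⟨MulAut.conj g⁻¹ • T, card_smul _ _, ?_, fun a ha => ?_⟩
  · simpa [mul_assoc] using hT.smul (MulAut.conj g⁻¹)
  · have h3 : g * a * g⁻¹ ∈ A.map (MulAut.conj g).toMonoidHom := ⟨a, ha, rfl⟩
    rw [← h2] at h3
    rw [← Subgroup.conj_smul_eq_self_iff, ← mul_smul, ← map_mul]
    have h4 := Subgroup.conj_smul_eq_self_iff.2 h3.1
    conv_rhs => rw [← h4, ← mul_smul, ← map_mul]
    congr 2
    group

end IsTorus

theorem Nat.eq_four_of_two_mul_add_one_eq_mul_self {a c : ℕ} (h : 2 * 2 ^ a + 1 = c * c) :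
    2 ^ a = 4 ∧ c = 3 := by
  have hc : Odd (c * c) := ⟨2 ^ a, h.symm⟩
  obtain ⟨d, rfl⟩ := (Nat.odd_mul.1 hc).1
  have h1 : 2 ^ a = 2 * d * (d + 1) := by linarith
  have h2 : d ∣ 2 ^ a := h1 ▸ (dvd_mul_left d 2).mul_right _
  have h3 : d + 1 ∣ 2 ^ a := h1 ▸ dvd_mul_left _ _
  obtain ⟨i, -, hi⟩ := (Nat.dvd_prime_pow Nat.prime_two).1 h2
  obtain ⟨j, -, hj⟩ := (Nat.dvd_prime_pow Nat.prime_two).1 h3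
  have h4 : 2 ^ a ≠ 0 := by positivity
  rcases Nat.eq_zero_or_pos i with rfl | hi0
  · rw [pow_zero] at hi
    subst hi
    exact ⟨by omega, rfl⟩
  · rcases Nat.eq_zero_or_pos j with rfl | hj0
    · rw [pow_zero] at hj
      have : d = 0 := by omega
      simp [this] at h1
    · have h5 : 2 ∣ d := hi ▸ dvd_pow_self 2 hi0.ne'
      have h6 : 2 ∣ d + 1 := hj ▸ dvd_pow_self 2 hj0.ne'
      omega

theorem IsTorus.exists_card_eq_mul_self {H : Type*} [Group H] [Finite H] {z a : H} {T : Subgroup H}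
    (hT : IsTorus T z) {ν : MulAut H} (hν : ν * ν = 1) (hνT : ν • T = T)
    (ha : a ∈ Subgroup.normalizer (T : Set H)) (haz : a * a = z) (hνa : ν a = a⁻¹) :
    ∃ F ≤ T, (∀ t ∈ F, ν t = t) ∧ Nat.card T = Nat.card F * Nat.card F := by
  have hνt : ∀ t ∈ T, ν t ∈ T := fun t ht => by
    rw [← hνT]
    exact ⟨t, ht, rfl⟩
  have hνν : ∀ t, ν (ν t) = t := fun t => by
    rw [← MulAut.mul_apply, hν, MulAut.one_apply]
  let f : T →* H :=
    { toFun := fun t => t * ν t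
      map_one' := by simp
      map_mul' := fun s t => by
        have h1 := hT.mul_comm (hνt _ s.2) t.2
        rw [Subgroup.coe_mul, map_mul, mul_assoc, mul_assoc, ← mul_assoc (ν s), h1, mul_assoc] }
  let F : Subgroup H :=
    { carrier := {t | t ∈ T ∧ ν t = t}
      one_mem' := ⟨one_mem _, map_one _⟩
      mul_mem' := fun {s t} hs ht => ⟨T.mul_mem hs.1 ht.1, by rw [map_mul, hs.2, ht.2]⟩
      inv_mem' := fun {t} ht => ⟨inv_mem ht.1, by rw [map_inv, ht.2]⟩ }
  have hF : ∀ t, t ∈ F ↔ t ∈ T ∧ ν t = t := fun t => Iff.rfl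
  have hrange : f.range = F := by
    ext t
    rw [hF]
    constructor
    · rintro ⟨s, rfl⟩
      refine ⟨T.mul_mem s.2 (hνt _ s.2), ?_⟩
      change ν (s * ν s) = s * ν s
      rw [map_mul, hνν, hT.mul_comm s.2 (hνt _ s.2)]
    · rintro ⟨h1, h2⟩
      obtain ⟨s, hs, rfl⟩ := hT.exists_mul_self_eq h1
      refine ⟨⟨s, hs⟩, ?_⟩
      have h3 : ν s = s := hT.eq_of_mul_self_eq (hνt s hs) hs (by rw [← map_mul, h2])
      change s * ν s = s * s
      rw [h3]
  have hker : Nat.card f.ker = Nat.card F := by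
    have h1 : f.ker.map T.subtype = MulAut.conj a • F := by
      ext x
      rw [Subgroup.mem_pointwise_smul_iff_inv_smul_mem, hF]
      have e1 : (MulAut.conj a)⁻¹ • x = a⁻¹ * x * a := by
        rw [← map_inv]
        simp
      have e2 : a⁻¹ * x * a ∈ T ↔ x ∈ T := by
        rw [Subgroup.mem_normalizer_iff.1 ha (a⁻¹ * x * a)]
        group
      have haz' : a⁻¹ * a⁻¹ = z := by rw [← mul_inv_rev, haz, hT.involution.inv_eq]
      rw [e1, e2]
      have e3 : x ∈ f.ker.map T.subtype ↔ x ∈ T ∧ x * ν x = 1 := by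
        constructor
        · rintro ⟨t, ht, rfl⟩
          exact ⟨t.2, ht⟩
        · rintro ⟨h1, h2⟩
          exact ⟨⟨x, h1⟩, h2, rfl⟩
      rw [e3]
      refine and_congr_right fun hx => ?_
      have e4 : x⁻¹ = a⁻¹ * (a⁻¹ * x * a) * a := by
        rw [← hT.inverts x hx]
        nth_rw 1 [← haz']
        rw [← haz]
        group
      rw [mul_eq_one_iff_inv_eq, map_mul, map_mul, map_inv, hνa, inv_inv, e4]
      constructor
      · intro h2
        rw [← h2]
        group
      · intro h2
        rw [← h2]
        group
    rw [← IsTorus.card_smul (MulAut.conj a) F, ← h1]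
    exact (Subgroup.card_map_of_injective T.subtype_injective).symm
  refine ⟨F, fun t ht => ht.1, fun t ht => ht.2, ?_⟩
  rw [← f.ker.card_mul_index, Subgroup.index_ker, hker, hrange]

namespace Equiv.Perm

variable {X : Type*} [Fintype X] [DecidableEq X]

theorem sign_eq_one_of_pow_eight {σ : Perm X} (hX : Fintype.card X = 10) (h8 : σ ^ 8 = 1)
    (h4 : σ ^ 4 ≠ 1) (hσ : ∀ x, σ x ≠ x) : sign σ = 1 := by
  have hsupp : σ.cycleType.sum = 10 := by
    rw [sum_cycleType, ← hX, ← Finset.card_univ]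
    congr 1
    ext x
    simp [hσ x]
  have hdvd : ∀ d ∈ σ.cycleType, d = 2 ∨ d = 4 ∨ d = 8 := by
    intro d hd
    have h1 := two_le_of_mem_cycleType hd
    have h2 : d ∣ 2 ^ 3 := (dvd_of_mem_cycleType hd).trans (orderOf_dvd_of_pow_eq_one h8)
    obtain ⟨i, hi, rfl⟩ := (Nat.dvd_prime_pow Nat.prime_two).1 h2
    interval_cases i <;> simp_all
  have hex : 8 ∈ σ.cycleType := by
    by_contra hn
    apply h4
    rw [← orderOf_dvd_iff_pow_eq_one, ← lcm_cycleType, Multiset.lcm_dvd]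
    intro d hd
    rcases hdvd d hd with rfl | rfl | rfl
    · norm_num
    · norm_num
    · exact absurd hd hn
  obtain ⟨M, hM⟩ := Multiset.exists_cons_of_mem hex
  have hMs : M.sum = 2 := by
    rw [hM, Multiset.sum_cons] at hsupp
    omega
  have hM2 : ∀ d ∈ M, 2 ≤ d := fun d hd =>
    two_le_of_mem_cycleType (hM ▸ Multiset.mem_cons_of_mem hd)
  have hMc : Multiset.card M = 1 := by
    have h1 : Multiset.card M • 2 ≤ M.sum := Multiset.card_nsmul_le_sum hM2
    have h2 : Multiset.card M ≠ 0 := by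
      intro h
      rw [Multiset.card_eq_zero.1 h] at hMs
      simp at hMs
    rw [hMs, smul_eq_mul] at h1
    omega
  rw [sign_of_cycleType, hsupp, hM, Multiset.card_cons, hMc]
  rfl

end Equiv.Perm

namespace IsTorus

variable {H : Type*} [Group H] [Finite H] {z b : H} {A T : Subgroup H} {m : ℕ}

/-- The set of tori of a given order, with the action of the automorphism group. -/
def ofCard (H : Type*) [Group H] [Finite H] (c : ℕ) : SubMulAction (MulAut H) (Subgroup H) where
  carrier := {T | (∃ v, IsTorus T v) ∧ Nat.card T = c}
  smul_mem' := by
    rintro τ T ⟨⟨v, hv⟩, hc⟩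
    exact ⟨⟨τ v, hv.smul τ⟩, (card_smul τ T).trans hc⟩

theorem card_ofCard (hD : DihedralData z A m)
    (hk : (Subgroup.centralizer {z}).index = (2 * m + 1) * (m + 1)) (hT : IsTorus T z)
    (hcT : Nat.card T = 2 * m + 1) (hA : A ≤ Subgroup.normalizer (T : Set H)) :
    Nat.card (ofCard H (2 * m + 1)) = 2 * (m + 1) := by
  have hm := hD.four_le
  have hl : Subgroup.normalizer (T : Set H) ⊓ Subgroup.centralizer {z} = A :=
    le_antisymm (hT.le_of_data hD) (le_inf hA hD.le_centralizer)
  let inst : MulAction H (ofCard H (2 * m + 1)) := MulAction.compHom _ (MulAut.conj (G := H))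
  have hs : ∀ (g : H) (x : ofCard H (2 * m + 1)), ((g • x : ofCard H (2 * m + 1)) : Subgroup H) =
    MulAut.conj g • (x : Subgroup H) := fun _ _ => rfl
  let x₀ : ofCard H (2 * m + 1) := ⟨T, ⟨z, hT⟩, hcT⟩
  have hstab : MulAction.stabilizer H x₀ = Subgroup.normalizer (T : Set H) := by
    ext g
    rw [MulAction.mem_stabilizer_iff, ← Subgroup.conj_smul_eq_self_iff, ← Subtype.coe_inj, hs]
  have : MulAction.IsPretransitive H (ofCard H (2 * m + 1)) := by
    refine MulAction.IsPretransitive.mk fun ⟨S, ⟨v, hS⟩, hcS⟩ ⟨S', ⟨v', hS'⟩, hcS'⟩ => ?_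
    obtain ⟨g, hg⟩ := hS.exists_conj_smul_eq hD hk hS' hcS hcS'
    exact ⟨g, Subtype.ext hg⟩
  rw [← MulAction.index_stabilizer_of_transitive H x₀, hstab]
  have h1 := (Subgroup.normalizer (T : Set H)).card_mul_index
  rw [hT.card_normalizer, hl, hD.card_eq_mul, hk, hD.card_eq, hcT] at h1
  refine Nat.eq_of_mul_eq_mul_left (show 0 < (2 * m + 1) * m from Nat.mul_pos (by omega) (by omega)) ?_
  rw [h1]
  ring

open Classical in
theorem exists_smul_eq_self (hD : DihedralData z A m)
    (hk : (Subgroup.centralizer {z}).index = (2 * m + 1) * (m + 1)) (hT : IsTorus T z)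
    (hcT : Nat.card T = 2 * m + 1) (hA : A ≤ Subgroup.normalizer (T : Set H))
    (hperf : commutator H = ⊤) (hb : b * z = z * b) (hbA : b ∉ A) {τ : MulAut H} {α : H}
    (hα : Subgroup.zpowers α = A) (hτ : τ * τ = MulAut.conj α) (hτA : ∀ a ∈ A, τ a = a)
    (hτb : τ b = α * b) : ∃ (T' : Subgroup H) (v' : H), IsTorus T' v' ∧ τ • T' = T' := by
  by_contra! hcon
  have hm := hD.four_le
  obtain ⟨e, he, hme⟩ := hD.two_pow
  have hαA : α ∈ A := hα ▸ Subgroup.mem_zpowers α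
  have hαo : orderOf α = m := by rw [← Nat.card_zpowers, hα, hD.card_eq]
  have hbI := hD.isInvolution_of_notMem hb hbA
  have hbinv : ∀ a ∈ A, b * a * b = a⁻¹ := fun a ha => by
    conv_lhs => rw [← hbI.inv_eq, hbI.inv_eq]
    have := hD.inverts hb hbA ha
    rwa [hbI.inv_eq] at this
  have hor : ∀ {T' : Subgroup H} {v' : H}, IsTorus T' v' → Nat.card T' = 2 * m + 1 →
      MulAut.conj z • T' = T' → T' = T ∨ T' = MulAut.conj b • T := fun h1 h2 h3 =>
    hT.eq_or_eq_conj_smul hD hk hA h1 hcT h2 (Subgroup.conj_smul_eq_self_iff.1 h3) hb hbA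
  have hτT : τ • T = MulAut.conj b • T := by
    refine (hor (hT.smul τ) ((card_smul _ _).trans hcT) ?_).resolve_left (hcon T z hT)
    have h1 : MulAut.conj z * τ = τ * MulAut.conj z := by
      rw [MulAut.mul_conj, hτA z hD.mem]
    rw [← mul_smul, h1, mul_smul, Subgroup.conj_smul_eq_self_iff.2 (hA hD.mem)]
  set ν := MulAut.conj b * τ with hν
  have hνa : ∀ a ∈ A, ν a = a⁻¹ := by
    intro a ha
    rw [hν, MulAut.mul_apply, hτA a ha, MulAut.conj_apply, hbI.inv_eq, hbinv a ha]
  have hνν : ν * ν = 1 := by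
    calc ν * ν = MulAut.conj b * (τ * MulAut.conj b) * τ := by rw [hν]; group
      _ = MulAut.conj b * MulAut.conj (α * b) * (τ * τ) := by
        rw [MulAut.mul_conj, hτb]
        group
      _ = MulAut.conj (b * α * b * α) := by
        rw [hτ, ← map_mul, ← map_mul, ← mul_assoc]
      _ = 1 := by rw [hbinv α hαA, inv_mul_cancel, map_one]
  have hνT : ν • T = T := by
    rw [hν, mul_smul, hτT, ← mul_smul, ← map_mul, hbI.2, map_one, one_smul]
  obtain ⟨a, haA, haz⟩ : ∃ a ∈ A, a * a = z := by
    obtain ⟨j, hj⟩ := hD.exists_pow_eq hαA (by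
      rintro rfl
      rw [orderOf_one] at hαo
      omega)
    have h1 : 4 ∣ 2 * j := by
      have h2 : m ∣ 2 * j := by
        rw [← hαo, orderOf_dvd_iff_pow_eq_one, Nat.mul_comm, pow_mul, hj, sq, hD.mul_self]
      exact (hme ▸ pow_dvd_pow 2 he : 2 ^ 2 ∣ m).trans h2
    obtain ⟨i, rfl⟩ : 2 ∣ j := by omega
    refine ⟨α ^ i, pow_mem hαA i, ?_⟩
    rw [← pow_add, ← hj]
    congr 1
    omega
  obtain ⟨F, hFT, hF, hcF⟩ := hT.exists_card_eq_mul_self hνν hνT (hA haA) haz (hνa a haA)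
  rw [hcT, hme] at hcF
  obtain ⟨hm4, hF3⟩ := Nat.eq_four_of_two_mul_add_one_eq_mul_self hcF
  rw [← hme] at hm4
  subst hm4
  let X := ofCard H (2 * 4 + 1)
  let fX : Fintype X := Fintype.ofFinite X
  have hX : Fintype.card X = 10 := by
    rw [← Nat.card_eq_fintype_card]
    exact card_ofCard hD hk hT hcT hA
  let ρ : MulAut H →* Equiv.Perm X := MulAction.toPermHom (MulAut H) X
  have hρ : ∀ (f : MulAut H) (x : X), ((ρ f x : X) : Subgroup H) = f • (x : Subgroup H) :=
    fun _ _ => rfl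
  have hρi : ∀ (f : MulAut H) (x : X), ρ f x = x ↔ f • (x : Subgroup H) = x := fun f x => by
    rw [← Subtype.coe_inj, hρ]
  have hρz : ρ (MulAut.conj z) ≠ 1 := by
    intro h1
    have h2 : ∀ x : X, (x : Subgroup H) ∈ ({T, MulAut.conj b • T} : Finset (Subgroup H)) := by
      rintro ⟨T', ⟨v', hT'⟩, hc⟩
      rw [Finset.mem_insert, Finset.mem_singleton]
      exact hor hT' hc ((hρi _ ⟨T', ⟨v', hT'⟩, hc⟩).1 (by rw [h1]; rfl))
    have h3 := Finset.card_le_card_of_injOn (s := (Finset.univ : Finset X)) (fun x => (x : Subgroup H))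
      (fun x _ => h2 x) (Subtype.val_injective.injOn)
    rw [Finset.card_univ, hX] at h3
    have := Finset.card_le_two (a := T) (b := MulAut.conj b • T)
    omega
  have hz2 : α ^ 2 = z := by
    refine hD.eq_of_mem (pow_mem hαA 2) ⟨fun h1 => ?_, ?_⟩
    · have := Nat.le_of_dvd (by omega) (orderOf_dvd_of_pow_eq_one h1)
      omega
    · rw [← pow_add, ← orderOf_dvd_iff_pow_eq_one, hαo]
  have hτ4 : τ ^ 4 = MulAut.conj z := by
    rw [show 4 = 2 * 2 from rfl, pow_mul, sq τ, hτ, ← map_pow, hz2]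
  have hsτ : Equiv.Perm.sign (ρ τ) = 1 := by
    refine Equiv.Perm.sign_eq_one_of_pow_eight hX ?_ ?_ ?_
    · rw [← map_pow, show 8 = 4 * 2 from rfl, pow_mul, hτ4, ← map_pow, sq, hD.mul_self, map_one,
        map_one]
    · rwa [← map_pow, hτ4]
    · rintro ⟨T', ⟨v', hT'⟩, hc⟩
      rw [Ne, hρi]
      exact hcon T' v' hT'
  have hsH : ∀ g : H, Equiv.Perm.sign (ρ (MulAut.conj g)) = 1 := by
    intro g
    have h1 := Abelianization.commutator_subset_ker
      ((Equiv.Perm.sign.comp ρ).comp (MulAut.conj (G := H)))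
    rw [hperf] at h1
    exact h1 (Subgroup.mem_top g)
  have hsν : Equiv.Perm.sign (ρ ν) = 1 := by
    rw [hν, map_mul, map_mul, hsτ, hsH, one_mul]
  have hρν : ρ ν ^ 2 = 1 := by rw [← map_pow, sq, hνν, map_one]
  have hρ1 : ρ ν ≠ 1 := by
    intro h1
    have h2 : MulAut.conj z = MulAut.conj a * ν * (MulAut.conj a)⁻¹ * ν⁻¹ := by
      rw [← map_inv, mul_assoc _ ν, MulAut.mul_conj, map_inv, hνa a haA, inv_inv, ← mul_assoc,
        mul_inv_cancel_right, ← map_mul, haz]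
    apply hρz
    rw [h2, map_mul, map_mul, map_mul, map_inv, map_inv, h1]
    simp
  have hmod2 := Equiv.Perm.card_fixedPoints_modEq (f := (ρ ν : X → X)) (p := 2) (n := 1)
    (funext fun x => congrArg (fun σ : Equiv.Perm X => σ x) hρν)
  obtain ⟨⟨t, htF⟩, ht3⟩ := exists_prime_orderOf_dvd_card' (G := F) 3 (hF3 ▸ dvd_rfl)
  rw [Subgroup.orderOf_mk] at ht3
  have ht1 : t ≠ 1 := by
    rintro rfl
    rw [orderOf_one] at ht3
    omega
  have htν : MulAut.conj t * ν = ν * MulAut.conj t := by rw [MulAut.mul_conj, hF t htF]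
  have hmaps : ∀ x ∈ Function.fixedPoints (ρ ν), ρ (MulAut.conj t) x ∈ Function.fixedPoints (ρ ν) := by
    intro x hx
    change ρ ν (ρ (MulAut.conj t) x) = ρ (MulAut.conj t) x
    rw [← Equiv.Perm.mul_apply, ← map_mul, ← htν, map_mul, Equiv.Perm.mul_apply, hx]
  let g : Function.End (Function.fixedPoints (ρ ν)) := fun x => ⟨ρ (MulAut.conj t) x, hmaps x x.2⟩
  have hg : g ^ 3 ^ 1 = 1 := by
    refine funext fun x => Subtype.ext ?_
    change (ρ (MulAut.conj t) ^ 3) x = x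
    rw [← map_pow, ← map_pow, ← ht3, pow_orderOf_eq_one]
    simp
  have hmod3 := Equiv.Perm.card_fixedPoints_modEq (p := 3) hg
  let x₀ : X := ⟨T, ⟨z, hT⟩, hcT⟩
  have hfix : Fintype.card (Function.fixedPoints g) = 1 := by
    rw [Fintype.card_eq_one_iff]
    refine ⟨⟨⟨x₀, (hρi ν x₀).2 hνT⟩, Subtype.ext ((hρi _ x₀).2 ?_)⟩, ?_⟩
    · exact Subgroup.conj_smul_eq_self_iff.2 (IsTorus.le_normalizer (hFT htF))
    · rintro ⟨⟨⟨T', ⟨v', hT'⟩, hc⟩, hx⟩, hx'⟩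
      have h1 := (hρi _ (⟨T', ⟨v', hT'⟩, hc⟩ : X)).1 (congrArg Subtype.val hx')
      refine Subtype.ext (Subtype.ext (Subtype.ext ?_))
      exact (hT.eq_of_mem_of_mem_normalizer hT' ht1 (hFT htF)
        (Subgroup.conj_smul_eq_self_iff.1 h1)).symm
  rw [hfix] at hmod3
  have hle : Fintype.card (Function.fixedPoints (ρ ν)) ≤ 10 := hX ▸ set_fintype_card_le_univ _
  have hne : Fintype.card (Function.fixedPoints (ρ ν)) ≠ 10 := by
    intro h1
    apply hρ1
    have h2 := (set_fintype_card_eq_univ_iff _).1 (h1.trans hX.symm)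
    ext1 x
    exact h2.ge (Set.mem_univ x)
  have hsign := Equiv.Perm.sign_of_pow_two_eq_one hρν
  rw [hX] at hmod2 hsign
  have h4 : Fintype.card (Function.fixedPoints (ρ ν)) = 4 := by
    rw [Nat.ModEq] at hmod2 hmod3
    omega
  rw [hsν, h4] at hsign
  exact absurd hsign (by decide)

end IsTorus

theorem Subgroup.isSolvable_of_le {G : Type*} [Group G] {A B : Subgroup G} (h : A ≤ B)
    (hB : Group.IsSolvable B) : Group.IsSolvable A :=
  Group.isSolvable_of_isSolvable_injective (f := Subgroup.inclusion h) (Subgroup.inclusion_injective h)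

theorem Subgroup.isSolvable_closure_pair {G : Type*} [Group G] {B : Subgroup G} (hB : Group.IsSolvable B)
    {x y : G} (hx : x ∈ normalizer (B : Set G)) (hy : y ∈ B) : Group.IsSolvable (closure {x, y}) := by
  let N := normalizer (B : Set G)
  let π := QuotientGroup.mk' (B.subgroupOf N)
  let P : Subgroup N := (zpowers (π ⟨x, hx⟩)).comap π
  have hBN : B ≤ N := le_normalizer
  have hP : Group.IsSolvable P := by
    have h1 : B.subgroupOf N ≤ P := fun b hb => by
      have h2 : π b = 1 := (QuotientGroup.eq_one_iff b).2 hb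
      rw [mem_comap, h2]
      exact one_mem _
    have h3 : Group.IsSolvable (B.subgroupOf N) := Group.isSolvable_of_isSolvable_injective
      (f := (subgroupOfEquivOfLe hBN).toMonoidHom) (subgroupOfEquivOfLe hBN).injective
    have h4 : Group.IsSolvable (zpowers (π ⟨x, hx⟩)) := Group.isSolvable_of_comm fun a b => by
      obtain ⟨_, i, rfl⟩ := a
      obtain ⟨_, j, rfl⟩ := b
      exact Subtype.ext ((Commute.refl _).zpow_zpow i j)
    refine Group.isSolvable_of_ker_le_range (inclusion h1)
      ((π.comp P.subtype).codRestrict (zpowers (π ⟨x, hx⟩)) fun a => a.2) ?_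
    intro a ha
    have h5 : π a = 1 := congrArg Subtype.val (MonoidHom.mem_ker.1 ha)
    exact ⟨⟨a, (QuotientGroup.eq_one_iff _).1 h5⟩, rfl⟩
  have hS : Group.IsSolvable (P.map N.subtype) := Group.isSolvable_of_surjective
    (f := N.subtype.subgroupMap P) (N.subtype.subgroupMap_surjective P)
  refine isSolvable_of_le ?_ hS
  rw [closure_le, Set.insert_subset_iff, Set.singleton_subset_iff]
  refine ⟨⟨⟨x, hx⟩, mem_zpowers _, rfl⟩, ⟨⟨y, hBN hy⟩, ?_, rfl⟩⟩
  have h2 : π ⟨y, hBN hy⟩ = 1 := (QuotientGroup.eq_one_iff _).2 hy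
  rw [SetLike.mem_coe, mem_comap, h2]
  exact one_mem _

namespace IsTorus

variable {G H : Type*} [Group G] [Finite G] [Group H] [Finite H] {K Q : Subgroup G} [K.Normal]
  {u x : G} {π : K →* H} {θ : G →* MulAut H}

/-- An element all of whose soluble extensions lie in a fixed `2`-group normalizes no torus of a
section by a central subgroup of order two. -/
theorem smul_ne_self (hQ : ∀ y, Group.IsSolvable (Subgroup.closure {x, y}) → y ∈ Q)
    (h2 : ∃ n, Nat.card Q = 2 ^ n) (hπ : Function.Surjective π)
    (hker : ∀ g : K, π g = 1 → ∀ h : K, g * h = h * g)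
    (hθ : ∀ (g : G) (k : K), θ g (π k) = π (MulAut.conjNormal g k)) {T : Subgroup H} {v : H}
    (hT : IsTorus T v) : θ x • T ≠ T := by
  intro hx
  let B : Subgroup G := (T.comap π).map K.subtype
  have hB : Group.IsSolvable B := by
    have hT' : Group.IsSolvable T := Group.isSolvable_of_comm fun a b =>
      Subtype.ext (hT.mul_comm a.2 b.2)
    have hk : Group.IsSolvable π.ker := Group.isSolvable_of_comm fun a b => Subtype.ext (hker a a.2 b)
    have h1 : π.ker ≤ T.comap π := fun a ha => by
      rw [Subgroup.mem_comap, MonoidHom.mem_ker.1 ha]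
      exact one_mem _
    have h3 : Group.IsSolvable (T.comap π) := by
      refine Group.isSolvable_of_ker_le_range (Subgroup.inclusion h1)
        ((π.comp (T.comap π).subtype).codRestrict T fun a => a.2) ?_
      intro a ha
      have h5 : π a = 1 := congrArg Subtype.val (MonoidHom.mem_ker.1 ha)
      exact ⟨⟨a, h5⟩, rfl⟩
    exact Group.isSolvable_of_surjective (f := K.subtype.subgroupMap _)
      (K.subtype.subgroupMap_surjective _)
  have hxB : x ∈ Subgroup.normalizer (B : Set G) := by
    rw [← Subgroup.conj_smul_eq_self_iff]
    refine Subgroup.eq_of_le_of_card_ge ?_ (card_smul _ _).ge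
    rintro _ ⟨_, ⟨k, hk, rfl⟩, rfl⟩
    refine ⟨MulAut.conjNormal x k, ?_, rfl⟩
    rw [SetLike.mem_coe, Subgroup.mem_comap, ← hθ, ← hx]
    exact ⟨π k, hk, rfl⟩
  have hBQ : B ≤ Q := fun y hy => hQ y (Subgroup.isSolvable_closure_pair hB hxB hy)
  obtain ⟨n, hn⟩ := h2
  have hd : Nat.card T ∣ 2 ^ n := by
    rw [← hn]
    refine dvd_trans ?_ (Subgroup.card_dvd_of_le hBQ)
    have h1 : Nat.card B = Nat.card (T.comap π) :=
      Subgroup.card_map_of_injective K.subtype_injective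
    rw [h1]
    have h2 : (T.comap π).map π = T := Subgroup.map_comap_eq_self_of_surjective hπ T
    conv_lhs => rw [← h2]
    exact Subgroup.card_map_dvd _ _
  have h1 : Nat.card T = 1 :=
    Nat.Coprime.eq_one_of_dvd (hT.odd_card.coprime_two_right.pow_right n) hd
  exact hT.ne_bot (Subgroup.card_eq_one.1 h1)

end IsTorus

end

namespace DihedralData

variable {G H : Type*} [Group G] [Finite G] [Group H] [Finite H] {K Q : Subgroup G} [K.Normal]
  {x : G} {π : K →* H} {θ : G →* MulAut H} {z : H} {A : Subgroup H} {m : ℕ}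

theorem index_ne (hD : DihedralData z A m)
    (hQ : ∀ y, Group.IsSolvable (Subgroup.closure {x, y}) → y ∈ Q)
    (h2 : ∃ n, Nat.card Q = 2 ^ n) (hπ : Function.Surjective π)
    (hker : ∀ g : K, π g = 1 → ∀ h : K, g * h = h * g)
    (hθ : ∀ (g : G) (k : K), θ g (π k) = π (MulAut.conjNormal g k)) (hperf : commutator H = ⊤)
    (hx : (∃ a ∈ A, θ x = MulAut.conj a) ∨ ∃ α b : H, Subgroup.zpowers α = A ∧
      θ x * θ x = MulAut.conj α ∧ (∀ a ∈ A, θ x a = a) ∧ b * z = z * b ∧ b ∉ A ∧ θ x b = α * b)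
    {T : Subgroup H} {v : H} (hT : IsTorus T v) (hcT : Nat.card T = 2 * m + 1)
    (hl : Nat.card ↥(Subgroup.normalizer (T : Set H) ⊓ Subgroup.centralizer {v}) = m) :
    (Subgroup.centralizer {z}).index ≠ (2 * m + 1) * (m + 1) := by
  intro hk
  obtain ⟨S, hcS, hS, hAS⟩ := hT.exists_isTorus_centralizes hD hl
  obtain ⟨a, ha, hxa⟩ | ⟨α, b, hα, hτ, hτA, hb, hbA, hτb⟩ := hx
  · refine hS.smul_ne_self hQ h2 hπ hker hθ ?_
    rw [hxa, Subgroup.conj_smul_eq_self_iff]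
    exact hAS ha
  · obtain ⟨S', v', hS', h⟩ :=
      hS.exists_smul_eq_self hD hk (hcS.trans hcT) hAS hperf hb hbA hα hτ hτA hτb
    exact hS'.smul_ne_self hQ h2 hπ hker hθ h

end DihedralData

theorem Equiv.Perm.isSolvable_fin_three : Group.IsSolvable (Equiv.Perm (Fin 3)) := by
  have h : ∀ a b : Equiv.Perm (Fin 3), Equiv.Perm.sign a = 1 → Equiv.Perm.sign b = 1 →
      a * b = b * a := by decide
  have : Group.IsSolvable (Equiv.Perm.sign (α := Fin 3)).ker :=
    Group.isSolvable_of_comm fun a b => Subtype.ext (h a b a.2 b.2)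
  exact Group.isSolvable_of_ker_le_range (Subgroup.subtype _) (Equiv.Perm.sign (α := Fin 3))
    (Subgroup.range_subtype _).ge

theorem Subgroup.isSolvable_of_index_le_three {G : Type*} [Group G] [Finite G] {Q : Subgroup G}
    (hQ : Group.IsSolvable Q) (h : Q.index ≤ 3) : Group.IsSolvable G := by
  have hf : Finite (G ⧸ Q) := inferInstance
  obtain ⟨e⟩ : Nonempty ((G ⧸ Q) ↪ Fin 3) := by
    have := Fintype.ofFinite (G ⧸ Q)
    refine Function.Embedding.nonempty_of_card_le ?_
    rwa [Fintype.card_fin, ← Nat.card_eq_fintype_card]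
  have := Equiv.Perm.isSolvable_fin_three
  have : Group.IsSolvable (Equiv.Perm (G ⧸ Q)) := Group.isSolvable_of_isSolvable_injective
    (Equiv.Perm.viaEmbeddingHom_injective e)
  have h1 : Group.IsSolvable (MulAction.toPermHom G (G ⧸ Q)).ker := by
    rw [← Subgroup.normalCore_eq_ker]
    exact isSolvable_of_le Q.normalCore_le hQ
  exact Group.isSolvable_of_ker_le_range (Subgroup.subtype _) (MulAction.toPermHom G (G ⧸ Q))
    (Subgroup.range_subtype _).ge

theorem Subgroup.isSolvable_of_commutator {G : Type*} [Group G] {K : Subgroup G}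
    (h : Group.IsSolvable ↥⁅K, K⁆) : Group.IsSolvable K := by
  refine Group.isSolvable_of_ker_le_range (inclusion (commutator_le_self K))
    (Abelianization.of (G := K)) fun a ha => ?_
  rw [Abelianization.ker_of] at ha
  have h1 : (a : G) ∈ ⁅K, K⁆ := by
    rw [← map_subtype_commutator]
    exact ⟨a, ha, rfl⟩
  exact ⟨⟨a, h1⟩, rfl⟩

theorem Group.exists_perfect_normal {G : Type*} [Group G] [Finite G] (hG : ¬ Group.IsSolvable G) :
    ∃ K : Subgroup G, K.Normal ∧ ⁅K, K⁆ = K ∧ ¬ Group.IsSolvable K := by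
  have h1 : (⊤ : Subgroup G).Normal ∧ ¬ Group.IsSolvable (⊤ : Subgroup G) :=
    ⟨inferInstance, fun h => hG (Group.isSolvable_of_isSolvable_injective
      (f := (Subgroup.topEquiv (G := G)).symm.toMonoidHom) (Subgroup.topEquiv (G := G)).symm.injective)⟩
  obtain ⟨K, -, hK⟩ := exists_minimal_le_of_wellFoundedLT
    (fun K : Subgroup G => K.Normal ∧ ¬ Group.IsSolvable K) ⊤ h1
  have := hK.prop.1
  have hle : ⁅K, K⁆ ≤ K := Subgroup.commutator_le_self K
  exact ⟨K, hK.prop.1, hle.antisymm (hK.le_of_le ⟨inferInstance,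
    fun h => hK.prop.2 (Subgroup.isSolvable_of_commutator h)⟩ hle), hK.prop.2⟩

theorem IsMetacyclic.exists_generators {G : Type*} [Group G] {Q : Subgroup G}
    (h : IsMetacyclic ↥Q) {X : Subgroup G} (hX : X ≤ Q) : ∃ c ∈ X, ∃ d ∈ X,
    (∀ y ∈ X, y * c * y⁻¹ ∈ Subgroup.zpowers c) ∧ ∀ y ∈ X, ∃ i j : ℤ, y = c ^ i * d ^ j := by
  obtain ⟨C, hC, hcC, hcQ⟩ := h
  let Y := X.subgroupOf Q
  have h1 : IsCyclic ↥(C ⊓ Y) := isCyclic_of_injective (Subgroup.inclusion inf_le_left)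
    (Subgroup.inclusion_injective _)
  obtain ⟨⟨c, hc⟩, hcg⟩ := h1.exists_generator
  have h2 : IsCyclic (Y.map (QuotientGroup.mk' C)) := inferInstance
  obtain ⟨⟨_, d, hdY, rfl⟩, hdg⟩ := h2.exists_generator
  have hgen : ∀ y ∈ X, ∀ hy : y ∈ Q, (⟨y, hy⟩ : Q) ∈ C → y ∈ Subgroup.zpowers (c : G) := by
    intro y hyX hy hyC
    obtain ⟨i, hi⟩ := hcg ⟨⟨y, hy⟩, hyC, hyX⟩
    exact ⟨i, congrArg (fun a : ↥(C ⊓ Y) => ((a : Q) : G)) hi⟩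
  refine ⟨c, hc.2, d, hdY, fun y hy => hgen _ ?_ (Q.mul_mem (Q.mul_mem (hX hy) c.2)
    (Q.inv_mem (hX hy))) ?_, fun y hy => ?_⟩
  · exact X.mul_mem (X.mul_mem hy hc.2) (X.inv_mem hy)
  · exact hC.conj_mem c hc.1 ⟨y, hX hy⟩
  · obtain ⟨j, hj⟩ := hdg ⟨QuotientGroup.mk' C ⟨y, hX hy⟩, ⟨y, hX hy⟩, hy, rfl⟩
    have hj' : QuotientGroup.mk' C (d ^ j) = QuotientGroup.mk' C ⟨y, hX hy⟩ := by
      rw [map_zpow]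
      exact congrArg Subtype.val hj
    obtain ⟨i, hi⟩ := hgen (y * (d : G) ^ (-j)) (X.mul_mem hy (X.zpow_mem hdY _))
      (Q.mul_mem (hX hy) (Q.zpow_mem d.2 _)) (by
        rw [← QuotientGroup.eq_one_iff]
        have h3 : (⟨y * (d : G) ^ (-j), Q.mul_mem (hX hy) (Q.zpow_mem d.2 _)⟩ : Q) =
          ⟨y, hX hy⟩ * (d ^ j)⁻¹ := Subtype.ext (by simp)
        rw [h3]
        change QuotientGroup.mk' C (_ * _) = 1
        rw [map_mul, map_inv, hj', mul_inv_cancel])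
    refine ⟨i, j, ?_⟩
    change (c : G) ^ i = _ at hi
    rw [hi, zpow_neg, inv_mul_cancel_right]

theorem Subgroup.index_centralizer_le {G : Type*} [Group G] [Finite G] {u : G} {s : Finset G}
    (h : ∀ g, g * u * g⁻¹ ∈ s) : (centralizer {u}).index ≤ s.card := by
  rw [index, ← Nat.card_eq_finsetCard]
  refine Nat.card_le_card_of_injective
    (fun a : G ⧸ centralizer {u} => (⟨a.out * u * a.out⁻¹, h _⟩ : s)) fun a b hab => ?_
  have h1 : a.out * u * a.out⁻¹ = b.out * u * b.out⁻¹ := congrArg Subtype.val hab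
  rw [← a.out_eq', ← b.out_eq']
  refine QuotientGroup.eq.2 (mem_centralizer_singleton_iff.2 ?_)
  calc a.out⁻¹ * b.out * u = a.out⁻¹ * (b.out * u * b.out⁻¹) * b.out := by group
    _ = u * (a.out⁻¹ * b.out) := by rw [← h1]; group

theorem exists_central_involution {G : Type*} [Group G] [Finite G] {K Q : Subgroup G}
    (hG : ¬ Group.IsSolvable G) (hmax : IsCoatom Q) (hmeta : IsMetacyclic ↥Q)
    (h2 : ∃ n : ℕ, Nat.card Q = 2 ^ n)
    (habelian : ∀ N : Subgroup G, N.Normal → N ≠ ⊥ →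
      (∀ M : Subgroup G, M.Normal → M < N → M = ⊥) → ∀ a b : ↥N, a * b = b * a)
    (hK : K.Normal) (hK1 : K ≠ ⊥)
    (hsol : ∀ R : Subgroup G, R.Normal → Group.IsSolvable R → R ≤ Q) :
    ∃ u ∈ K, u ≠ 1 ∧ u * u = 1 ∧ ∀ g, u * g = g * u := by
  classical
  obtain ⟨N, hNK, hN⟩ := exists_minimal_le_of_wellFoundedLT
    (fun N : Subgroup G => N.Normal ∧ N ≠ ⊥) K ⟨hK, hK1⟩
  have hNn := hN.prop.1
  have hmin : ∀ M : Subgroup G, M.Normal → M ≤ N → M = ⊥ ∨ M = N := fun M hM hMN => by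
    by_cases h : M = ⊥
    · exact Or.inl h
    · exact Or.inr (hMN.antisymm (hN.le_of_le ⟨hM, h⟩ hMN))
  have hcomm := habelian N hNn hN.prop.2 fun M hM hMN => (hmin M hM hMN.le).resolve_right hMN.ne
  have hcomm' : ∀ a ∈ N, ∀ b ∈ N, a * b = b * a := fun a ha b hb =>
    congrArg Subtype.val (hcomm ⟨a, ha⟩ ⟨b, hb⟩)
  have hNQ : N ≤ Q := hsol N hNn (Group.isSolvable_of_comm hcomm)
  obtain ⟨n, hn⟩ := h2
  have : Fact (Nat.Prime 2) := ⟨Nat.prime_two⟩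
  have hQp : IsPGroup 2 Q := IsPGroup.of_card hn
  have h2N : 2 ∣ Nat.card N := by
    obtain ⟨k, -, hk⟩ := (Nat.dvd_prime_pow Nat.prime_two).1 (hn ▸ Subgroup.card_dvd_of_le hNQ)
    rw [hk]
    refine dvd_pow_self 2 ?_
    rintro rfl
    exact hN.prop.2 (Subgroup.card_eq_one.1 hk)
  have hsq : ∀ a ∈ N, a * a = 1 := by
    let M : Subgroup G :=
      { carrier := {a | a ∈ N ∧ a * a = 1}
        one_mem' := ⟨one_mem N, mul_one 1⟩
        mul_mem' := fun {a b} ha hb => ⟨mul_mem ha.1 hb.1, by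
          rw [mul_assoc, ← mul_assoc b, hcomm' b hb.1 a ha.1, mul_assoc a, hb.2, mul_one, ha.2]⟩
        inv_mem' := fun {a} ha => ⟨inv_mem ha.1, by rw [← mul_inv_rev, ha.2, inv_one]⟩ }
    have hM : M.Normal := ⟨fun a ha g => ⟨hNn.conj_mem a ha.1 g, by
      calc g * a * g⁻¹ * (g * a * g⁻¹) = g * (a * a) * g⁻¹ := by group
        _ = 1 := by rw [ha.2, mul_one, mul_inv_cancel]⟩⟩
    rcases hmin M hM fun a ha => ha.1 with h | h
    · obtain ⟨a, ha⟩ := exists_prime_orderOf_dvd_card' (G := N) 2 h2N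
      have h3 : (a : G) ∈ M := ⟨a.2, by
        have := pow_orderOf_eq_one a
        rw [ha, sq] at this
        exact congrArg Subtype.val this⟩
      rw [h, Subgroup.mem_bot] at h3
      rw [Subtype.ext h3 (a2 := (1 : N)), orderOf_one] at ha
      omega
    · intro a ha
      rw [← h] at ha
      exact ha.2
  let inst : MulAction Q N := MulAction.compHom N
    ((MulAut.conjNormal (H := N)).comp Q.subtype)
  obtain ⟨⟨u, huN⟩, hu, hu1⟩ := hQp.exists_fixed_point_of_prime_dvd_card_of_fixed_point N h2N
    (a := 1) (fun q => map_one (MulAut.conjNormal (q : G)))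
  have huQ : ∀ q ∈ Q, u * q = q * u := fun q hq => by
    have := congrArg Subtype.val (hu ⟨q, hq⟩)
    change q * u * q⁻¹ = u at this
    rw [mul_inv_eq_iff_eq_mul] at this
    exact this.symm
  refine ⟨u, hNK huN, fun h => hu1 (Subtype.ext h.symm), hsq u huN, fun g => ?_⟩
  have hle : Q ≤ Subgroup.centralizer {u} := fun q hq =>
    Subgroup.mem_centralizer_singleton_iff.2 (huQ q hq).symm
  rcases hmax.le_iff.1 hle with h | h
  · exact (Subgroup.mem_centralizer_singleton_iff.1 (h ▸ Subgroup.mem_top g)).symm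
  · exfalso
    obtain ⟨c, hc, d, hd, -, hcd⟩ := hmeta.exists_generators hNQ
    have hz : ∀ a : G, a * a = 1 → ∀ i : ℤ, a ^ i = 1 ∨ a ^ i = a := by
      intro a ha i
      rcases Int.even_or_odd' i with ⟨k, rfl | rfl⟩
      · left
        rw [zpow_mul, zpow_two, ha, one_zpow]
      · right
        rw [zpow_add, zpow_mul, zpow_two, ha, one_zpow, one_mul, zpow_one]
    have hu3 : (Subgroup.centralizer {u}).index ≤ ({c, d, c * d} : Finset G).card := by
      refine Subgroup.index_centralizer_le fun g => ?_
      obtain ⟨i, j, hij⟩ := hcd _ (hNn.conj_mem u huN g)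
      have hne : g * u * g⁻¹ ≠ 1 := fun h1 => hu1 (Subtype.ext (conj_eq_one_iff.1 h1).symm)
      rw [hij] at hne ⊢
      rcases hz c (hsq c hc) i with h1 | h1 <;> rcases hz d (hsq d hd) j with h2 | h2 <;>
        simp_all
    rw [h] at hu3
    have hQs : Group.IsSolvable Q := by
      have := hQp.isNilpotent
      infer_instance
    exact hG (Subgroup.isSolvable_of_index_le_three hQs (hu3.trans Finset.card_le_three))

section

open scoped Pointwise commutatorElement

/-- A condition as in Frobenius' criterion: elements of order prime to `p` normalizing a
`p`-subgroup centralize it. -/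
def CentralizesLocally (K : Type*) [Group K] (p : ℕ) : Prop :=
  ∀ D : Subgroup K, IsPGroup p D → ∀ g ∈ Subgroup.normalizer (D : Set K), (orderOf g).Coprime p →
    ∀ d ∈ D, g * d = d * g

namespace CentralizesLocally

variable {K : Type*} [Group K] [Finite K] {p : ℕ} [Fact p.Prime]

theorem exists_mul_eq (h : CentralizesLocally K p) {D : Subgroup K} (hD : IsPGroup p D)
    (S : Sylow p (Subgroup.normalizer (D : Set K))) (n : Subgroup.normalizer (D : Set K)) :
    ∃ c : Subgroup.normalizer (D : Set K), (∀ d ∈ D, (c : K) * d = d * c) ∧ ∃ s ∈ S, n = c * s := by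
  let C := (Subgroup.normalizerMonoidHom D).ker
  have hC : ∀ c : Subgroup.normalizer (D : Set K), c ∈ C ↔ ∀ d ∈ D, (c : K) * d = d * c := by
    intro c
    rw [MonoidHom.mem_ker, MulEquiv.ext_iff]
    constructor
    · intro h1 d hd
      have := congrArg Subtype.val (h1 ⟨d, hd⟩)
      exact mul_inv_eq_iff_eq_mul.1 this
    · rintro h1 ⟨d, hd⟩
      exact Subtype.ext (mul_inv_eq_iff_eq_mul.2 (h1 d hd))
  have hq : IsPGroup p (_ ⧸ C) := by
    intro q
    obtain ⟨n, rfl⟩ := QuotientGroup.mk_surjective q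
    have hn := orderOf_pos n
    obtain ⟨k, r, hr, hkr⟩ := Nat.exists_eq_pow_mul_and_not_dvd hn.ne' p (Fact.out : p.Prime).ne_one
    refine ⟨k, (QuotientGroup.eq_one_iff (n ^ p ^ k)).2 ((hC _).2 ?_)⟩
    refine h D hD _ (n ^ p ^ k).2 ?_
    rw [Subgroup.orderOf_coe, orderOf_pow, hkr, Nat.gcd_eq_right (dvd_mul_right _ _),
      Nat.mul_div_cancel_left _ (pow_pos (Fact.out : p.Prime).pos k)]
    exact ((Fact.out : p.Prime).coprime_iff_not_dvd.2 hr).symm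
  obtain ⟨k, hk⟩ := IsPGroup.iff_card.1 hq
  have htop : C ⊔ (S : Subgroup _) = ⊤ := by
    rw [← Subgroup.index_eq_one]
    have hk' : (C ⊔ (S : Subgroup _)).index ∣ p ^ k := by
      rw [← hk]
      exact Subgroup.index_dvd_of_le le_sup_left
    refine Nat.Coprime.eq_one_of_dvd ?_ hk'
    refine Nat.Coprime.pow_right k (Nat.Coprime.symm ?_)
    rw [(Fact.out : p.Prime).coprime_iff_not_dvd]
    exact fun h2 => S.not_dvd_index (h2.trans (Subgroup.index_dvd_of_le le_sup_right))
  have hn : n ∈ C ⊔ (S : Subgroup _) := htop ▸ Subgroup.mem_top n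
  obtain ⟨c, hc, s, hs, hcs⟩ := Subgroup.mem_sup_of_normal_left.1 hn
  exact ⟨c, (hC c).1 hc, s, hs, hcs.symm⟩

theorem _root_.IsPGroup.exists_mem_normalizer {S D : Subgroup K} (hS : IsPGroup p S) (hD : D < S) :
    ∃ y ∈ S, y ∉ D ∧ y ∈ Subgroup.normalizer (D : Set K) := by
  have := hS.isNilpotent
  have h1 : D.subgroupOf S < ⊤ := by
    rw [lt_top_iff_ne_top, Ne, Subgroup.subgroupOf_eq_top]
    exact hD.not_ge
  obtain ⟨y, hy, hyD⟩ := SetLike.exists_of_lt (Group.normalizerCondition_of_isNilpotent _ h1)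
  refine ⟨y, y.2, hyD, ?_⟩
  rw [Subgroup.mem_normalizer_iff] at hy ⊢
  intro a
  constructor
  · intro ha
    exact (hy ⟨a, hD.le ha⟩).1 ha
  · intro ha
    have haS : a ∈ S := by
      have := S.mul_mem (S.mul_mem (S.inv_mem y.2) (hD.le ha)) y.2
      simpa [mul_assoc] using this
    exact (hy ⟨a, haS⟩).2 ha

theorem exists_smul_eq (h : CentralizesLocally K p) {x : K} (S T : Sylow p K) (hS : x ∈ S)
    (hT : x ∈ T) : ∃ c : K, c * x = x * c ∧ c • S = T := by
  have hcard : ∀ S T : Sylow p K, Nat.card (S : Subgroup K) = Nat.card (T : Subgroup K) :=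
    fun S T => by rw [S.card_eq_multiplicity, T.card_eq_multiplicity]
  suffices H : ∀ k : ℕ, ∀ S T : Sylow p K, x ∈ S → x ∈ T →
      Nat.card (S : Subgroup K) ≤ Nat.card ↥((S : Subgroup K) ⊓ T) + k →
      ∃ c : K, c * x = x * c ∧ c • S = T from H _ S T hS hT (Nat.le_add_left _ _)
  intro k
  induction k with
  | zero =>
    intro S T hS hT hk
    have h1 := Subgroup.eq_of_le_of_card_ge (inf_le_left : (S : Subgroup K) ⊓ T ≤ S) hk
    have h2 := Subgroup.eq_of_le_of_card_ge (inf_eq_left.1 h1) (hcard T S).le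
    exact ⟨1, by simp, by rw [one_smul]; exact Sylow.ext h2⟩
  | succ k ih =>
    intro S T hS hT hk
    by_cases hST : S = T
    · exact ⟨1, by simp, by rw [one_smul]; exact hST⟩
    set D : Subgroup K := (S : Subgroup K) ⊓ T with hDdef
    have hDp : IsPGroup p D := S.isPGroup'.to_le inf_le_left
    have hDS : D < S := lt_of_le_of_ne inf_le_left fun h1 =>
      hST (Sylow.ext (Subgroup.eq_of_le_of_card_ge (inf_eq_left.1 h1) (hcard T S).le))
    have hDT : D < T := lt_of_le_of_ne inf_le_right fun h1 =>
      hST (Sylow.ext (Subgroup.eq_of_le_of_card_ge (inf_eq_right.1 h1) (hcard S T).le)).symm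
    let N := Subgroup.normalizer (D : Set K)
    have hloc : ∀ R : Sylow p K, D < R → ∃ R' : Sylow p N, ∃ y : N, y ∈ R' ∧ (y : K) ∈ R ∧
        (y : K) ∉ D ∧ ∀ d : N, (d : K) ∈ D → d ∈ R' := by
      intro R hDR
      obtain ⟨y, hyR, hyD, hyN⟩ := R.isPGroup'.exists_mem_normalizer hDR
      have hp : IsPGroup p ((R : Subgroup K).subgroupOf N) :=
        R.isPGroup'.comap_of_injective _ N.subtype_injective
      obtain ⟨R', hR'⟩ := hp.exists_le_sylow
      exact ⟨R', ⟨y, hyN⟩, hR' hyR, hyR, hyD, fun d hd => hR' (hDR.le hd)⟩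
    obtain ⟨S₁, y, hyS₁, hyS, hyD, hDS₁⟩ := hloc S hDS
    obtain ⟨T₁, y', hyT₁, hyT, hyD', hDT₁⟩ := hloc T hDT
    obtain ⟨n, hn⟩ := MulAction.exists_smul_eq N S₁ T₁
    obtain ⟨c, hc, s, hs, rfl⟩ := h.exists_mul_eq hDp S₁ n
    have hcS : c • S₁ = T₁ := by
      rw [← hn, mul_smul, Sylow.smul_eq_iff_mem_normalizer.2 (Subgroup.le_normalizer hs)]
    obtain ⟨S₂, hS₂⟩ := (S₁.isPGroup'.map N.subtype).exists_le_sylow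
    have hcT : ∀ a : N, a ∈ T₁ → (a : K) ∈ ((c : K) • S₂ : Sylow p K) := by
      intro a ha
      rw [← hcS] at ha
      obtain ⟨b, hb, rfl⟩ := ha
      exact ⟨b, hS₂ ⟨b, hb, rfl⟩, rfl⟩
    have hDN : D ≤ N := Subgroup.le_normalizer
    have hxD : x ∈ D := ⟨hS, hT⟩
    have hcardlt : ∀ {R U : Sylow p K} {y : K}, D ≤ R → D ≤ U → y ∈ R → y ∈ U → y ∉ D →
        Nat.card D < Nat.card ↥((R : Subgroup K) ⊓ U) := by
      intro R U y h1 h2 h3 h4 h5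
      by_contra! hle
      have := Subgroup.eq_of_le_of_card_ge (le_inf h1 h2) hle
      exact h5 (this ▸ ⟨h3, h4⟩)
    have hDS₂ : D ≤ S₂ := fun d hd => hS₂ ⟨⟨d, hDN hd⟩, hDS₁ _ hd, rfl⟩
    have hDS₃ : D ≤ ((c : K) • S₂ : Sylow p K) := fun d hd => hcT ⟨d, hDN hd⟩ (hDT₁ _ hd)
    have h1 := hcardlt hDS.le hDS₂ hyS (hS₂ ⟨y, hyS₁, rfl⟩) hyD
    have h2 := hcardlt hDS₃ hDT.le (hcT y' hyT₁) hyT hyD'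
    obtain ⟨c₁, hc₁, hS₁⟩ := ih S S₂ hS (hDS₂ hxD) (by omega)
    obtain ⟨c₂, hc₂, hT₁⟩ := ih ((c : K) • S₂) T (hDS₃ hxD) hT (by
      rw [hcard _ S]
      omega)
    refine ⟨c₂ * (c * c₁), ?_, ?_⟩
    · exact (Commute.mul_left hc₂ (Commute.mul_left (hc x hxD) hc₁))
    · rw [mul_smul, mul_smul, hS₁, hT₁]

theorem commutator_ne_top (h : CentralizesLocally K p) (hp : p ∣ Nat.card K) :
    commutator K ≠ ⊤ := by
  intro hK
  obtain ⟨P⟩ : Nonempty (Sylow p K) := inferInstance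
  have hP : Nontrivial P := (Subgroup.nontrivial_iff_ne_bot _).2 (P.ne_bot_of_dvd_card hp)
  have hloc : (P : Subgroup K) ≤ ⁅(P : Subgroup K), (P : Subgroup K)⁆ := by
    have h1 := Subgroup.commutator_inf_eq_focalSubgroup P
    rw [hK, top_inf_eq] at h1
    conv_lhs => rw [h1, Subgroup.focalSubgroup_def]
    rw [Subgroup.closure_le]
    rintro _ ⟨hg, x, hx, g, rfl⟩
    have hy : g * x⁻¹ * g⁻¹ ∈ (P : Subgroup K) := by
      have := P.mul_mem (P.inv_mem hx) hg
      rwa [commutatorElement_def, mul_assoc, mul_assoc, inv_mul_cancel_left, ← mul_assoc] at this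
    obtain ⟨c, hcx, hc⟩ := h.exists_smul_eq P (g⁻¹ • P) (P.inv_mem hx)
      ⟨g * x⁻¹ * g⁻¹, hy, by simp [mul_assoc]⟩
    have hN : g * c ∈ Subgroup.normalizer ((P : Subgroup K) : Set K) := by
      exact Sylow.smul_eq_iff_mem_normalizer.1 (by rw [mul_smul, hc, smul_inv_smul])
    obtain ⟨⟨c', hcN⟩, hc', ⟨s, hsN⟩, hs, hcs⟩ := h.exists_mul_eq P.isPGroup'
      (P.subtype Subgroup.le_normalizer) ⟨g * c, hN⟩
    have hcs' : g * c = c' * s := congrArg Subtype.val hcs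
    have hsP : s ∈ P := hs
    have h2 : g * x⁻¹ * g⁻¹ = s * x⁻¹ * s⁻¹ := by
      have h3 : g = c' * s * c⁻¹ := eq_mul_inv_of_mul_eq hcs'
      have h4 := hc' _ (P.mul_mem (P.mul_mem hsP (P.inv_mem hx)) (P.inv_mem hsP))
      calc g * x⁻¹ * g⁻¹ = c' * s * c⁻¹ * (x⁻¹ * c) * s⁻¹ * c'⁻¹ := by
            rw [h3]
            group
        _ = c' * (s * x⁻¹ * s⁻¹) * c'⁻¹ := by
            rw [← hcx]
            group
        _ = _ := by
            rw [h4, mul_inv_cancel_right]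
    have h5 : ⁅x, g⁆ = ⁅x, s⁆ := by
      rw [commutatorElement_def, commutatorElement_def, mul_assoc, mul_assoc, ← mul_assoc g, h2]
      group
    rw [h5]
    exact Subgroup.commutator_mem_commutator hx hsP
  have := P.isPGroup'.isNilpotent
  refine (Group.IsSolvable.commutator_lt_top_of_nontrivial P).ne (top_le_iff.1 fun a _ => ?_)
  have h6 := hloc a.2
  rw [← Subgroup.map_subtype_commutator] at h6
  obtain ⟨b, hb, hba⟩ := h6
  rwa [← Subtype.ext hba]

end CentralizesLocally

end

theorem IsMetacyclic.mem_or_mem {G : Type*} [Group G] {Q X E : Subgroup G}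
    (hQ : IsMetacyclic ↥Q) (hX : X ≤ Q) (hE : ∀ y ∈ X, y * y ∈ E) {e f : G} (he : e ∈ X)
    (hf : f ∈ X) (heE : e ∉ E) (hfE : f ∉ E) (hef : e * f ∉ E) {y : G} (hy : y ∈ X) :
    y ∈ E ∨ e * y ∈ E ∨ f * y ∈ E ∨ e * f * y ∈ E := by
  obtain ⟨c, hc, d, hd, -, hcd⟩ := hQ.exists_generators hX
  have hn : (E.subgroupOf X).Normal := by
    refine ⟨fun t ht y => ?_⟩
    have h1 := E.mul_mem (E.mul_mem (hE _ (y * t).2) (E.inv_mem ht)) (E.inv_mem (hE _ y.2))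
    rw [Subgroup.mem_subgroupOf]
    convert h1 using 1
    simp [mul_assoc]
  let φ := QuotientGroup.mk' (E.subgroupOf X)
  have hφ : ∀ w (hw : w ∈ X), φ ⟨w, hw⟩ = 1 ↔ w ∈ E := fun w hw => QuotientGroup.eq_one_iff _
  have hsq : ∀ v : X ⧸ E.subgroupOf X, v * v = 1 := by
    intro v
    obtain ⟨w, rfl⟩ := QuotientGroup.mk_surjective v
    exact (hφ _ _).2 (hE _ w.2)
  have hcomm : ∀ v w : X ⧸ E.subgroupOf X, v * w = w * v := by
    intro v w
    rw [← inv_eq_of_mul_eq_one_left (hsq (w * v)), mul_inv_rev,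
      inv_eq_of_mul_eq_one_left (hsq w), inv_eq_of_mul_eq_one_left (hsq v)]
  have hpow : ∀ (v : X ⧸ E.subgroupOf X) (k : ℤ), v ^ k = 1 ∨ v ^ k = v := by
    intro v k
    obtain ⟨l, rfl | rfl⟩ := k.even_or_odd'
    · left; rw [zpow_mul, zpow_two, hsq, one_zpow]
    · right; rw [zpow_add_one, zpow_mul, zpow_two, hsq, one_zpow, one_mul]
  have h4 : ∀ w (hw : w ∈ X), φ ⟨w, hw⟩ = 1 ∨ φ ⟨w, hw⟩ = φ ⟨c, hc⟩ ∨ φ ⟨w, hw⟩ = φ ⟨d, hd⟩ ∨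
      φ ⟨w, hw⟩ = φ ⟨c, hc⟩ * φ ⟨d, hd⟩ := by
    intro w hw
    obtain ⟨k, l, hkl⟩ := hcd w hw
    have : (⟨w, hw⟩ : X) = ⟨c, hc⟩ ^ k * ⟨d, hd⟩ ^ l := Subtype.ext (by simpa using hkl)
    rw [this, map_mul, map_zpow, map_zpow]
    rcases hpow (φ ⟨c, hc⟩) k with h | h <;> rcases hpow (φ ⟨d, hd⟩) l with h' | h' <;>
      simp [h, h']
  rw [← hφ _ he] at heE
  rw [← hφ _ hf] at hfE
  rw [← hφ _ (X.mul_mem he hf)] at hef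
  rw [← hφ _ hy, ← hφ _ (X.mul_mem he hy), ← hφ _ (X.mul_mem hf hy),
    ← hφ _ (X.mul_mem (X.mul_mem he hf) hy)]
  have hm : ∀ a (ha : a ∈ X) b (hb : b ∈ X),
    φ ⟨a * b, X.mul_mem ha hb⟩ = φ ⟨a, ha⟩ * φ ⟨b, hb⟩ := fun _ _ _ _ => rfl
  rw [hm _ he _ hf] at hef
  rw [hm _ he _ hy, hm _ hf _ hy, hm _ (X.mul_mem he hf) _ hy, hm _ he _ hf]
  have e1 := h4 e he
  have e2 := h4 f hf
  have e3 := h4 y hy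
  generalize φ ⟨e, he⟩ = a at *
  generalize φ ⟨f, hf⟩ = b at *
  generalize φ ⟨y, hy⟩ = w at *
  generalize φ ⟨c, hc⟩ = p at *
  generalize φ ⟨d, hd⟩ = q at *
  let : CommGroup (X ⧸ E.subgroupOf X) := { (inferInstance : Group _) with mul_comm := hcomm }
  have hl : ∀ v w : X ⧸ E.subgroupOf X, v * (v * w) = w := fun v w => by
    rw [← mul_assoc, hsq, one_mul]
  rcases e1 with rfl | rfl | rfl | rfl <;> rcases e2 with rfl | rfl | rfl | rfl <;>
  rcases e3 with rfl | rfl | rfl | rfl <;>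
    simp_all [mul_comm, mul_left_comm]

theorem IsMetacyclic.exists_mul_self_eq {G : Type*} [Group G] [Finite G] {Q D : Subgroup G}
    (hQ : IsMetacyclic ↥Q) (h2 : IsPGroup 2 Q) (hD : D ≤ Q) {g u : G} (hu : u ∈ Q) (hu1 : u ≠ 1)
    (huu : u * u = 1) (hcu : ∀ y, u * y = y * u) (hgD : g ∈ Subgroup.normalizer (D : Set G))
    (hg : Odd (orderOf g))
    (hmin : ∀ E < D, g ∈ Subgroup.normalizer (E : Set G) → ∀ d ∈ E, g * d = d * g)
    (hne : ∃ d ∈ D, g * d ≠ d * g) :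
    ∃ i ∈ D, ∃ j ∈ D, i * i = u ∧ j * j = u ∧ j * i * j⁻¹ = i⁻¹ := by
  have hgD' := Subgroup.mem_normalizer_iff.1 hgD
  let E := Subgroup.closure {y | ∃ d ∈ D, y = d * d}
  have hsq : ∀ d ∈ D, d * d ∈ E := fun d hd => Subgroup.subset_closure ⟨d, hd, rfl⟩
  have hED : E ≤ D := by
    rw [Subgroup.closure_le]
    rintro _ ⟨d, hd, rfl⟩
    exact D.mul_mem hd hd
  have hD2 : IsPGroup 2 D := h2.to_le hD
  have hED' : E < D := by
    refine lt_of_le_of_ne hED fun h => ?_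
    obtain ⟨k, hk⟩ := IsPGroup.iff_card.1 hD2
    cases k with
    | zero =>
      obtain ⟨d, hd, hne⟩ := hne
      rw [Subgroup.card_eq_one.1 (hk.trans (pow_zero 2)), Subgroup.mem_bot] at hd
      simp [hd] at hne
    | succ k =>
      have : Fact (Nat.Prime 2) := ⟨Nat.prime_two⟩
      obtain ⟨M, hM⟩ := Sylow.exists_subgroup_card_pow_prime 2 (G := D) (n := k)
        (hk ▸ pow_dvd_pow 2 k.le_succ)
      have hM2 : M.index = 2 := by
        have := M.card_mul_index
        rw [hM, hk, pow_succ] at this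
        exact Nat.eq_of_mul_eq_mul_left (by positivity) this
      have h1 : D ≤ M.map D.subtype := by
        conv_lhs => rw [← h]
        rw [Subgroup.closure_le]
        rintro _ ⟨d, hd, rfl⟩
        exact ⟨⟨d, hd⟩ * ⟨d, hd⟩, Subgroup.mul_self_mem_of_index_two hM2 _, rfl⟩
      have h2 := Subgroup.card_le_of_le h1
      rw [Subgroup.card_map_of_injective D.subtype_injective, hM, hk] at h2
      exact absurd h2 (not_le.2 (Nat.pow_lt_pow_right one_lt_two k.lt_succ_self))
  have hgE : g ∈ Subgroup.normalizer (E : Set G) := by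
    have hm : E.map (MulAut.conj g).toMonoidHom = E := by
      rw [MonoidHom.map_closure]
      congr 1
      ext y
      constructor
      · rintro ⟨_, ⟨d, hd, rfl⟩, rfl⟩
        exact ⟨g * d * g⁻¹, (hgD' d).1 hd, by simp⟩
      · rintro ⟨d, hd, rfl⟩
        refine ⟨_, ⟨g⁻¹ * d * g, (hgD' _).2 (by simpa [mul_assoc] using hd), rfl⟩, ?_⟩
        simp [mul_assoc]
    rw [Subgroup.mem_normalizer_iff]
    intro y
    constructor
    · intro hy
      have := Subgroup.mem_map_of_mem (MulAut.conj g).toMonoidHom hy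
      rw [hm] at this
      exact this
    · intro hy
      change g * y * g⁻¹ ∈ E at hy
      rw [← hm] at hy
      obtain ⟨w, hw, hwy⟩ := hy
      rwa [← (MulAut.conj g).injective hwy]
  have hcE : ∀ t ∈ E, g * t = t * g := hmin E hED' hgE
  have hgE' := Subgroup.mem_normalizer_iff.1 hgE
  have hcg : ∀ t ∈ E, g * t * g⁻¹ = t := fun t ht => mul_inv_eq_of_eq_mul (hcE t ht)
  -- coprime action on a coset
  have hcop : ∀ k : G, k * g = g * k → (∀ t ∈ E, k * t = t * k) → Odd (orderOf k) → ∀ e ∈ D,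
      e⁻¹ * (k * e * k⁻¹) ∈ E → k * e = e * k := by
    intro k _ hk hko e he ht
    set t := e⁻¹ * (k * e * k⁻¹) with htd
    have h1 : k * e = e * t * k := by rw [htd]; group
    have h3 : ∀ n : ℕ, k ^ n * e = e * t ^ n * k ^ n := by
      intro n
      induction n with
      | zero => simp
      | succ n ih =>
        have h4 : k * t ^ n = t ^ n * k := (show Commute k t from hk t ht).pow_right n
        calc k ^ (n + 1) * e = k * (k ^ n * e) := by rw [pow_succ', mul_assoc]
          _ = k * e * t ^ n * k ^ n := by rw [ih]; simp only [mul_assoc]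
          _ = e * t * (k * t ^ n) * k ^ n := by rw [h1]; simp only [mul_assoc]
          _ = e * (t * t ^ n) * (k * k ^ n) := by rw [h4]; simp only [mul_assoc]
          _ = _ := by rw [← pow_succ', ← pow_succ']
    have h4 := h3 (orderOf k)
    rw [pow_orderOf_eq_one, one_mul, mul_one, left_eq_mul] at h4
    obtain ⟨l, hl⟩ := hD2 ⟨t, hED ht⟩
    have hl' : t ^ 2 ^ l = 1 := congrArg Subtype.val hl
    have h5 : t = 1 := by
      have := Nat.dvd_gcd (orderOf_dvd_of_pow_eq_one h4) (orderOf_dvd_of_pow_eq_one hl')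
      rw [((Nat.coprime_two_right.2 hko).pow_right l).gcd_eq_one, Nat.dvd_one, orderOf_eq_one_iff]
        at this
      exact this
    rw [h1, h5, mul_one]
  have hkey : ∀ e ∈ D, g * e ≠ e * g → e ∉ E ∧ g * e * g⁻¹ ∉ E ∧ e * (g * e * g⁻¹) ∉ E ∧
      e * (g * e * g⁻¹) * (g * (g * e * g⁻¹) * g⁻¹) ∈ E := by
    intro e he hge
    have heE : e ∉ E := fun h => hge (hcE e h)
    have hfE : g * e * g⁻¹ ∉ E := fun h => heE ((hgE' e).2 h)
    have hfD := (hgD' e).1 he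
    have hconv : ∀ f ∈ D, e * f ∈ E → e⁻¹ * f ∈ E := by
      intro f hf h
      have := E.mul_mem (E.inv_mem (hsq e he)) h
      simpa [mul_assoc] using this
    have hefE : e * (g * e * g⁻¹) ∉ E := fun h => hge (hcop g rfl hcE hg e he (hconv _ hfD h))
    refine ⟨heE, hfE, hefE, ?_⟩
    have hhD := (hgD' _).1 hfD
    rcases hQ.mem_or_mem hD hsq he hfD heE hfE hefE hhD with h | h | h | h
    · exact absurd ((hgE' _).2 h) hfE
    · refine absurd ?_ hge
      have h1 : Commute (g * g) e := by
        refine hcop (g * g) (mul_assoc _ _ _) (fun t ht => ?_) ?_ e he ?_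
        · rw [mul_assoc, hcE t ht, ← mul_assoc, hcE t ht, mul_assoc]
        · rw [← pow_two]
          exact hg.of_dvd_nat (orderOf_pow_dvd 2)
        · have := hconv _ hhD h
          simpa [mul_assoc] using this
      obtain ⟨l, hl⟩ := hg
      have h2 : (g * g) ^ (l + 1) = g := by
        rw [← pow_two, ← pow_mul, show 2 * (l + 1) = (2 * l + 1) + 1 by ring, pow_succ, ← hl,
          pow_orderOf_eq_one, one_mul]
      have := h1.pow_left (l + 1)
      rwa [h2] at this
    · refine absurd ((hgE' _).2 ?_) hefE
      simpa [mul_assoc] using h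
    · exact h
  have hmoved : ∀ y ∈ D, y ∉ E → g * y ≠ y * g := by
    intro y hy hyE hgy
    obtain ⟨e, he, hge⟩ := hne
    obtain ⟨h1, h3, h4, h5⟩ := hkey e he hge
    have hfD := (hgD' e).1 he
    have hfix : ∀ w, g * w * g⁻¹ = w → g * w = w * g := fun w h => mul_inv_eq_iff_eq_mul.1 h
    have hunfix : ∀ w, g * (w * y) = (w * y) * g → g * w = w * g := by
      intro w h
      have h6 : Commute g (w * y * y⁻¹) :=
        (show Commute g (w * y) from h).mul_right (show Commute g y from hgy).inv_right
      rwa [mul_inv_cancel_right] at h6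
    have hf' : ∀ w, g * (g * w * g⁻¹) = g * w * g⁻¹ * g → g * w = w * g := by
      intro w h
      have h6 : g * w * g⁻¹ = w := by
        have := congrArg (fun z => g⁻¹ * z) h
        simpa [mul_assoc] using this
      exact hfix w h6
    rcases hQ.mem_or_mem hD hsq he hfD h1 h3 h4 hy with h | h | h | h
    · exact hyE h
    · exact hge (hunfix _ (hcE _ h))
    · exact hge (hf' _ (hunfix _ (hcE _ h)))
    · have h6 : Commute g (e * (g * e * g⁻¹)) := hunfix _ (hcE _ h)
      have h7 : Commute g (e * (g * e * g⁻¹) * (g * (g * e * g⁻¹) * g⁻¹)) := hcE _ h5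
      have h8 := h6.inv_right.mul_right h7
      rw [inv_mul_cancel_left] at h8
      exact hge (hf' _ (hf' _ h8))
  obtain ⟨c, hc, d, hd, hcn, hcd⟩ := hQ.exists_generators hD
  have hcn' : ∀ y ∈ D, ∀ k : ℤ, y * c ^ k * y⁻¹ ∈ Subgroup.zpowers c := by
    intro y hy k
    rw [← conj_zpow]
    exact Subgroup.zpow_mem _ (hcn y hy) k
  have heven : ∀ w ∈ D, ∀ k : ℤ, Even k → w ^ k ∈ E := by
    rintro w hw k ⟨l, rfl⟩
    rw [zpow_add]
    exact hsq _ (D.zpow_mem hw l)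
  have hcE' : c ∉ E := by
    intro hcE'
    obtain ⟨e, he, hge⟩ := hne
    obtain ⟨h1, h3, h4, h5⟩ := hkey e he hge
    obtain ⟨k, l, hkl⟩ := hcd e he
    obtain ⟨k', l', hkl'⟩ := hcd _ ((hgD' e).1 he)
    rw [hkl'] at h3 h4
    have hz : Subgroup.zpowers c ≤ E := by rwa [Subgroup.zpowers_le]
    have hl : Odd l := by
      rw [← Int.not_even_iff_odd]
      intro h
      rw [hkl] at h1
      exact h1 (E.mul_mem (E.zpow_mem hcE' k) (heven d hd l h))
    have hl' : Odd l' := by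
      rw [← Int.not_even_iff_odd]
      intro h
      exact h3 (E.mul_mem (E.zpow_mem hcE' k') (heven d hd l' h))
    refine h4 ?_
    have : e * (c ^ k' * d ^ l') = c ^ k * (d ^ l * c ^ k' * (d ^ l)⁻¹) * d ^ (l + l') := by
      rw [hkl, zpow_add]
      group
    rw [this]
    exact E.mul_mem (E.mul_mem (E.zpow_mem hcE' k) (hz (hcn' _ (D.zpow_mem hd l) k')))
      (heven d hd _ (hl.add_odd hl'))
  obtain ⟨-, hfE, hcfE, hcfhE⟩ := hkey c hc (hmoved c hc hcE')
  have hgc := hmoved c hc hcE'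
  have hfD : g * c * g⁻¹ ∈ D := (hgD' c).1 hc
  have hvg : ∀ n : ℕ, g ^ n * (c * c) * (g ^ n)⁻¹ = c * c := fun n =>
    mul_inv_eq_of_eq_mul ((show Commute g (c * c) from hcE _ (hsq c hc)).pow_left n)
  -- the conjugates of `c` under powers of `g` generate `D`
  have hgen : D = Subgroup.closure (Set.range fun n : ℕ => g ^ n * c * (g ^ n)⁻¹) := by
    set D' := Subgroup.closure (Set.range fun n : ℕ => g ^ n * c * (g ^ n)⁻¹) with hD'
    have hle : D' ≤ D := by
      rw [hD', Subgroup.closure_le]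
      rintro _ ⟨n, rfl⟩
      exact (Subgroup.mem_normalizer_iff.1 (Subgroup.pow_mem _ hgD n) c).1 hc
    have hm : D'.map (MulAut.conj g).toMonoidHom ≤ D' := by
      rw [hD', MonoidHom.map_closure, Subgroup.closure_le]
      rintro _ ⟨_, ⟨n, rfl⟩, rfl⟩
      refine Subgroup.subset_closure ⟨n + 1, ?_⟩
      simp [pow_succ', mul_assoc]
    by_contra h
    refine hgc (hmin D' (lt_of_le_of_ne hle fun h' => h h'.symm) ?_ c
      (Subgroup.subset_closure ⟨0, by simp⟩))
    have hm' : D'.map (MulAut.conj g).toMonoidHom = D' := by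
      refine Subgroup.eq_of_le_of_card_ge hm ?_
      rw [Subgroup.card_map_of_injective (MulAut.conj g).injective]
    rw [Subgroup.mem_normalizer_iff]
    intro y
    refine ⟨fun hy => hm (Subgroup.mem_map_of_mem _ hy), fun hy => ?_⟩
    change g * y * g⁻¹ ∈ D' at hy
    rw [← hm'] at hy
    obtain ⟨w, hw, hwy⟩ := hy
    rwa [← (MulAut.conj g).injective hwy]
  have hv : ∀ y ∈ D, Commute (c * c) y := by
    intro y hy
    rw [hgen] at hy
    induction hy using Subgroup.closure_induction with
    | mem y hy =>
      obtain ⟨n, rfl⟩ := hy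
      have : c * c = (g ^ n * c * (g ^ n)⁻¹) * (g ^ n * c * (g ^ n)⁻¹) := by
        rw [← hvg n]
        group
      nth_rewrite 1 [this]
      exact (Commute.refl _).mul_left (Commute.refl _)
    | one => exact Commute.one_right _
    | mul y w _ _ h1 h2 => exact h1.mul_right h2
    | inv y _ h => exact h.inv_right
  have hff : (g * c * g⁻¹) * (g * c * g⁻¹) = c * c := by
    have := hvg 1
    rw [pow_one] at this
    rw [← this]
    group
  set f := g * c * g⁻¹ with hf
  have hhh : (g * f * g⁻¹) * (g * f * g⁻¹) = c * c := by
    have := hcg _ (hsq f hfD)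
    rw [hff] at this
    rw [← this, ← hff]
    group
  obtain ⟨r, hr⟩ := Subgroup.mem_zpowers_iff.1 (hcn f hfD)
  have hffE : f * f ∈ E := hsq f hfD
  have hro : Odd r := by
    rw [← Int.not_even_iff_odd]
    intro h
    have h1 : f * c * f⁻¹ ∈ E := hr ▸ heven c hc r h
    have h3 := E.mul_mem (E.mul_mem (E.inv_mem (hsq _ (D.mul_mem hfD hc))) h1) hffE
    have h4 : (f * c * (f * c))⁻¹ * (f * c * f⁻¹) * (f * f) = c⁻¹ := by group
    rw [h4] at h3
    exact hcE' (E.inv_mem_iff.1 h3)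
  have hfc : ∀ n : ℤ, f * c ^ n * f⁻¹ = c ^ (r * n) := fun n => by
    rw [← conj_zpow, ← hr, zpow_mul]
  have hc2 : ∀ n : ℤ, Odd n → ∀ y ∈ D, ∃ s : ℤ, y = (y ^ n) ^ s := by
    intro n hn y hy
    obtain ⟨l, hl⟩ := hD2 ⟨y, hy⟩
    have hl' : y ^ 2 ^ l = 1 := congrArg Subtype.val hl
    have h1 : IsCoprime n ((2 : ℤ) ^ l) := by
      obtain ⟨k, hk⟩ := hn
      exact (IsCoprime.pow_right ⟨1, -k, by rw [hk]; ring⟩)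
    obtain ⟨s, b, hsb⟩ := h1
    refine ⟨s, ?_⟩
    have h3 : y ^ ((2 : ℤ) ^ l) = 1 := by exact_mod_cast hl'
    rw [← zpow_mul]
    nth_rewrite 1 [← zpow_one y]
    rw [← hsb, zpow_add, mul_comm b, zpow_mul y (2 ^ l), h3, one_zpow, mul_one, mul_comm]
  have hdic : ∀ y ∈ D, ∃ n : ℤ, y = c ^ n ∨ y = c ^ n * f := by
    obtain ⟨k, l, hkl⟩ := hcd f hfD
    have hlo : Odd l := by
      rw [← Int.not_even_iff_odd]
      intro h
      rcases Int.even_or_odd k with hk | hk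
      · exact hfE (hkl ▸ E.mul_mem (heven c hc k hk) (heven d hd l h))
      · refine hcfE ?_
        rw [hkl, ← mul_assoc, ← zpow_one_add]
        exact E.mul_mem (heven c hc _ (odd_one.add_odd hk)) (heven d hd l h)
    obtain ⟨s, hs⟩ := hc2 l hlo d hd
    have hdl : d ^ l = c ^ (-k) * f := by rw [hkl]; group
    intro y hy
    obtain ⟨a, b, hab⟩ := hcd y hy
    rw [hs, ← zpow_mul, hdl] at hab
    have hw : (c ^ (-k) * f) * (c ^ (-k) * f) = c ^ (-k + r * (-k) + 2) := by
      calc (c ^ (-k) * f) * (c ^ (-k) * f) = c ^ (-k) * (f * c ^ (-k) * f⁻¹) * (f * f) := by group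
        _ = _ := by rw [hfc, hff, zpow_add, zpow_add, zpow_two]
    obtain ⟨q, hq | hq⟩ := (s * b).even_or_odd'
    · rw [hq, zpow_mul, zpow_two, hw, ← zpow_mul, ← zpow_add] at hab
      exact ⟨_, Or.inl hab⟩
    · rw [hq, zpow_add_one, zpow_mul, zpow_two, hw, ← mul_assoc, ← mul_assoc, ← zpow_mul,
        ← zpow_add, ← zpow_add] at hab
      exact ⟨_, Or.inr hab⟩
  have hEv : ∀ t ∈ E, ∃ k : ℤ, t = (c * c) ^ k := by
    have : E ≤ Subgroup.zpowers (c * c) := by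
      rw [Subgroup.closure_le]
      rintro _ ⟨y, hy, rfl⟩
      obtain ⟨n, rfl | rfl⟩ := hdic y hy
      · refine ⟨n, ?_⟩
        change (c * c) ^ n = c ^ n * c ^ n
        exact (Commute.refl c).mul_zpow n
      · obtain ⟨q, hq⟩ := odd_one.add_odd hro
        refine ⟨q * n + 1, ?_⟩
        change (c * c) ^ (q * n + 1) = _
        have h1 : c ^ n * f * (c ^ n * f) = c ^ n * (f * c ^ n * f⁻¹) * (f * f) := by group
        rw [h1, hfc, hff, ← zpow_two, ← zpow_mul, ← zpow_add, ← zpow_add]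
        congr 1
        linear_combination (-n) * hq
    exact fun t ht => (this ht).imp fun k hk => hk.symm
  obtain ⟨k, hk⟩ := hEv _ hcfhE
  have hc8 : c ^ (r + 1) = c ^ (4 * k - 4) := by
    have h1 : g * f * g⁻¹ = (c * f)⁻¹ * (c * c) ^ k := by rw [← hk]; group
    have hvw : Commute ((c * c) ^ k) (c * f)⁻¹ :=
      ((hv _ (D.mul_mem hc hfD)).zpow_left k).inv_right
    rw [h1] at hhh
    have h3 : (c * f) * (c * f) = (c * c) ^ k * (c * c) ^ k * (c * c)⁻¹ := by
      rw [← mul_assoc, mul_assoc _ ((c * c) ^ k), hvw.eq] at hhh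
      calc (c * f) * (c * f) = (c * f) * (c * f) * ((c * f)⁻¹ * ((c * f)⁻¹ * (c * c) ^ k) *
          (c * c) ^ k) * (c * c)⁻¹ := by rw [hhh]; group
        _ = _ := by group
    have h4 : (c * f) * (c * f) = c * (f * c ^ (1 : ℤ) * f⁻¹) * (f * f) := by
      rw [zpow_one]; group
    rw [h4, hfc, hff] at h3
    rw [mul_one] at h3
    have h5 : c * c ^ r * (c * c) = c ^ (r + 1) * c ^ (2 : ℤ) := by
      rw [zpow_two, add_comm r 1, zpow_one_add]
    have h6 : (c * c) ^ k * (c * c) ^ k * (c * c)⁻¹ = c ^ (4 * k - 4) * c ^ (2 : ℤ) := by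
      rw [← zpow_two c, ← zpow_mul, ← zpow_neg, ← zpow_add, ← zpow_add, ← zpow_add]
      congr 1
      ring
    rw [h5, h6] at h3
    exact mul_right_cancel h3
  have hr' : c ^ r = c ^ (4 * k - 5) := by
    rw [zpow_add_one] at hc8
    rw [eq_mul_inv_of_mul_eq hc8, ← zpow_sub_one]
    congr 1
    ring
  have hc4 : c ^ (4 : ℤ) = 1 := by
    have h1 := hfc 2
    have h3 : f * c ^ (2 : ℤ) * f⁻¹ = c ^ (2 : ℤ) := by
      rw [zpow_two]
      exact mul_inv_eq_of_eq_mul (hv f hfD).eq.symm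
    rw [h3, zpow_mul, hr', ← zpow_mul] at h1
    obtain ⟨s, hs⟩ := hc2 (2 * k - 3) ⟨k - 2, by ring⟩ (c ^ (4 : ℤ)) (D.zpow_mem hc 4)
    have h4 : (c ^ (4 : ℤ)) ^ (2 * k - 3) = 1 := by
      rw [← zpow_mul, show (4 : ℤ) * (2 * k - 3) = (4 * k - 5) * 2 + (-2) by ring, zpow_add, ← h1,
        ← zpow_add]
      simp
    rw [hs, h4, one_zpow]
  have hinv : f * c * f⁻¹ = c⁻¹ := by
    rw [← hr, hr', show 4 * k - 5 = 4 * (k - 1) + (-1) by ring, zpow_add, zpow_mul, hc4, one_zpow,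
      one_mul, zpow_neg_one]
  have hvv : (c * c) * (c * c) = 1 := by
    rw [← hc4, ← zpow_two, ← zpow_two, ← zpow_mul]
    rfl
  suffices hvu : c * c = u from ⟨c, hc, f, hfD, hvu, hff.trans hvu, hinv⟩
  by_contra hvu
  have huE : u ∉ E := by
    intro h
    obtain ⟨k, hk⟩ := hEv u h
    obtain ⟨q, rfl | rfl⟩ := k.even_or_odd'
    · rw [zpow_mul, zpow_two, hvv, one_zpow] at hk
      exact hu1 hk
    · rw [zpow_add_one, zpow_mul, zpow_two, hvv, one_zpow, one_mul] at hk
      exact hvu hk.symm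
  have huD : u ∉ D := fun h => hmoved u h huE (hcu g).symm
  have hun : (Subgroup.zpowers u).Normal := by
    refine ⟨fun y hy w => ?_⟩
    obtain ⟨k, rfl⟩ := hy
    change w * u ^ k * w⁻¹ ∈ _
    rw [((show Commute u w from hcu w).zpow_left k).symm.eq, mul_inv_cancel_right]
    exact Subgroup.zpow_mem _ (Subgroup.mem_zpowers u) k
  have hX : D ⊔ Subgroup.zpowers u ≤ Q := sup_le hD (by rwa [Subgroup.zpowers_le])
  have hsqX : ∀ y ∈ D ⊔ Subgroup.zpowers u, y * y ∈ E := by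
    intro y hy
    obtain ⟨w, hw, _, ⟨k, rfl⟩, rfl⟩ := Subgroup.mem_sup_of_normal_right.1 hy
    change w * u ^ k * (w * u ^ k) ∈ E
    have h1 : Commute (u ^ k) w := (show Commute u w from hcu w).zpow_left k
    rw [mul_assoc, ← mul_assoc (u ^ k), h1.eq, mul_assoc, ← (Commute.refl u).mul_zpow, huu,
      one_zpow, mul_one]
    exact hsq w hw
  have hmem : ∀ w ∈ D, w * u ∉ E := fun w hw h => huD ((D.mul_mem_cancel_left hw).1 (hED h))
  have hle : D ≤ D ⊔ Subgroup.zpowers u := le_sup_left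
  rcases hQ.mem_or_mem hX hsqX (hle hc) (hle hfD) hcE' hfE hcfE
    (Subgroup.mem_sup_right (Subgroup.mem_zpowers u)) with h | h | h | h
  · exact huE h
  · exact hmem _ hc h
  · exact hmem _ hfD h
  · exact hmem _ (D.mul_mem hc hfD) h

section

open scoped Pointwise

theorem exists_sylow_eq {G : Type*} [Group G] [Finite G] {Q : Subgroup G}
    (hG : ¬ Group.IsSolvable G) (hmax : IsCoatom Q) (h2 : IsPGroup 2 Q) :
    ∃ S : Sylow 2 G, (S : Subgroup G) = Q := by
  obtain ⟨S, hS⟩ := h2.exists_le_sylow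
  refine ⟨S, ?_⟩
  rcases hmax.le_iff.1 hS with h | h
  · have : Fact (Nat.Prime 2) := ⟨Nat.prime_two⟩
    have := S.isPGroup'.isNilpotent
    have h3 : Group.IsSolvable S := inferInstance
    have h4 : Group.IsSolvable (⊤ : Subgroup G) := h ▸ h3
    exact absurd (Group.isSolvable_of_surjective (f := (⊤ : Subgroup G).subtype)
      fun a => ⟨⟨a, trivial⟩, rfl⟩) hG
  · exact h

theorem exists_quaternion {G : Type*} [Group G] [Finite G] {Q K : Subgroup G}
    (hQ : IsMetacyclic ↥Q) {S : Sylow 2 G} (hS : (S : Subgroup G) = Q)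
    (hK : K.Normal) (hKK : ⁅K, K⁆ = K) {u : G} (hu : u ∈ K) (hu1 : u ≠ 1)
    (huu : u * u = 1) (hcu : ∀ y, u * y = y * u) :
    ∃ D ≤ Q ⊓ K, ∃ g ∈ K, g ∈ Subgroup.normalizer (D : Set G) ∧ Odd (orderOf g) ∧
      (∃ d ∈ D, g * d ≠ d * g) ∧
      ∃ i ∈ D, ∃ j ∈ D, i * i = u ∧ j * j = u ∧ j * i * j⁻¹ = i⁻¹ := by
  have : Fact (Nat.Prime 2) := ⟨Nat.prime_two⟩
  have hperf : commutator K = ⊤ := by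
    refine Subgroup.map_injective K.subtype_injective ?_
    rw [Subgroup.map_subtype_commutator, hKK, ← MonoidHom.range_eq_map, Subgroup.range_subtype]
  have h2K : 2 ∣ Nat.card K := by
    rw [← orderOf_eq_prime (show u ^ 2 = 1 by rw [pow_two, huu]) hu1]
    exact Subgroup.orderOf_dvd_natCard K hu
  have hloc : ¬ CentralizesLocally K 2 := fun h => h.commutator_ne_top h2K hperf
  obtain ⟨D, hDK, hD2, g, hgK, hgD, hgo, hgd⟩ : ∃ D ≤ K, IsPGroup 2 D ∧ ∃ g ∈ K,
      g ∈ Subgroup.normalizer (D : Set G) ∧ Odd (orderOf g) ∧ ∃ d ∈ D, g * d ≠ d * g := by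
    unfold CentralizesLocally at hloc
    push Not at hloc
    obtain ⟨D, hD, g, hg, hgo, d, hd, hgd⟩ := hloc
    refine ⟨D.map K.subtype, Subgroup.map_subtype_le D, hD.map _, g, g.2, ?_, ?_, d,
      ⟨d, hd, rfl⟩, fun h => hgd (Subtype.ext h)⟩
    · rw [Subgroup.mem_normalizer_iff] at hg ⊢
      intro y
      constructor
      · rintro ⟨w, hw, rfl⟩
        exact ⟨g * w * g⁻¹, (hg w).1 hw, rfl⟩
      · rintro ⟨w, hw, hwy⟩
        refine ⟨g⁻¹ * w * g, (hg _).2 (by simpa [mul_assoc] using hw), ?_⟩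
        change (w : G) = _ at hwy
        simp [hwy, mul_assoc]
    · rwa [Subgroup.orderOf_coe, ← Nat.coprime_two_right]
  obtain ⟨S', hS'⟩ := hD2.exists_le_sylow
  obtain ⟨a, ha⟩ := MulAction.exists_smul_eq G S' S
  let σ := MulAut.conj a
  obtain ⟨E, hE, hEm⟩ := exists_minimal_le_of_wellFoundedLT
    (fun E : Subgroup G => σ g ∈ Subgroup.normalizer (E : Set G) ∧ ∃ d ∈ E, σ g * d ≠ d * σ g)
    (D.map σ.toMonoidHom) (by
      obtain ⟨d, hd, hgd⟩ := hgd
      refine ⟨?_, σ d, ⟨d, hd, rfl⟩, fun h => hgd (σ.injective (by rw [map_mul, map_mul, h]))⟩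
      rw [Subgroup.mem_normalizer_iff] at hgD ⊢
      intro y
      obtain ⟨w, rfl⟩ := σ.surjective y
      rw [← map_inv, ← map_mul, ← map_mul]
      have : ∀ v, σ v ∈ D.map σ.toMonoidHom ↔ v ∈ D := fun v =>
        Subgroup.mem_map_iff_mem σ.injective
      rw [this, this]
      exact hgD w)
  have hEQ : E ≤ Q := by
    refine hE.trans ?_
    rw [← hS, ← ha]
    rintro _ ⟨d, hd, rfl⟩
    exact Subgroup.smul_mem_pointwise_smul _ σ _ (hS' hd)
  have hEK : E ≤ K := by
    refine hE.trans ?_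
    rintro _ ⟨d, hd, rfl⟩
    exact hK.conj_mem d (hDK hd) a
  have h2Q : IsPGroup 2 Q := hS ▸ S.isPGroup'
  have huQ : u ∈ Q := by
    have h1 : IsPGroup 2 (Subgroup.zpowers u) :=
      IsPGroup.of_card (n := 1) (by
        rw [Nat.card_zpowers, orderOf_eq_prime (show u ^ 2 = 1 by rw [pow_two, huu]) hu1, pow_one])
    obtain ⟨S₁, hS₁⟩ := h1.exists_le_sylow
    obtain ⟨b, hb⟩ := MulAction.exists_smul_eq G S₁ S
    rw [← hS, ← hb]
    have := Subgroup.smul_mem_pointwise_smul _ (MulAut.conj b) _ (hS₁ (Subgroup.mem_zpowers u))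
    rw [MulAut.smul_def, MulAut.conj_apply, ← hcu, mul_inv_cancel_right] at this
    exact this
  have ho : orderOf (σ g) = orderOf g := MulEquiv.orderOf_eq σ g
  refine ⟨E, le_inf hEQ hEK, σ g, hK.conj_mem g hgK a, hEm.prop.1, ho ▸ hgo, hEm.prop.2,
    hQ.exists_mul_self_eq h2Q hEQ huQ hu1 huu hcu hEm.prop.1 (ho ▸ hgo) ?_ hEm.prop.2⟩
  intro F hF hgF
  by_contra h
  push Not at h
  exact hEm.not_prop_of_lt hF ⟨hgF, h⟩

end

theorem eq_one_or_eq_of_isCyclic {Q : Type*} [Group Q] [Finite Q] {C : Subgroup Q}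
    (hC : IsCyclic C) {u : Q} (hu : u ∈ C) (hu1 : u ≠ 1) (huu : u * u = 1) {a : Q} (ha : a ∈ C)
    (haa : a * a = 1) : a = 1 ∨ a = u := by
  by_cases h : a = 1
  · exact Or.inl h
  · right
    have := IsCyclic.exists_pow_eq_of_mul_self (A := C) (b := ⟨a, ha⟩) (c := ⟨u, hu⟩)
      ⟨fun h' => h (congrArg Subtype.val h'), Subtype.ext haa⟩
      ⟨fun h' => hu1 (congrArg Subtype.val h'), Subtype.ext huu⟩
    exact congrArg Subtype.val this

theorem isCyclic_index_two {Q : Type*} [Group Q] [Finite Q] (h2 : IsPGroup 2 Q)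
    {C : Subgroup Q} [C.Normal] (hC : IsCyclic C) (hQC : IsCyclic (Q ⧸ C)) {u i j : Q}
    (hu1 : u ≠ 1) (huu : u * u = 1) (hcu : ∀ y, u * y = y * u) (hii : i * i = u)
    (hjj : j * j = u) (hji : j * i * j⁻¹ = i⁻¹) (hi : i ∈ C) :
    j ∉ C ∧ (∀ y, y ∈ C ∨ y * j ∈ C) ∧
      (∀ c ∈ C, j * c * j⁻¹ = c⁻¹ ∨ j * c * j⁻¹ = u * c⁻¹) ∧
      (∀ y, y * i * y⁻¹ = i ∨ y * i * y⁻¹ = i⁻¹) ∧ ∀ y ∉ C, y * y = 1 ∨ y * y = u := by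
  have hu : u ∈ C := hii ▸ C.mul_mem hi hi
  have hinv : ∀ a ∈ C, a * a = 1 → a = 1 ∨ a = u := fun a ha =>
    eq_one_or_eq_of_isCyclic hC hu hu1 huu ha
  have hcomm : ∀ a ∈ C, ∀ b ∈ C, a * b = b * a := by
    intro a ha b hb
    let := IsCyclic.commGroup (α := C)
    exact congrArg Subtype.val (mul_comm (⟨a, ha⟩ : C) ⟨b, hb⟩)
  have huinv : u⁻¹ = u := inv_eq_of_mul_eq_one_left huu
  have hiinv : i⁻¹ = i * u := by
    rw [inv_eq_iff_mul_eq_one, ← mul_assoc, hii, huu]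
  have hni : j * i ≠ i * j := by
    intro h
    rw [h, mul_inv_cancel_right, hiinv, left_eq_mul] at hji
    exact hu1 hji
  have hjC : j ∉ C := fun h => hni (hcomm j h i hi)
  have hroot : ∀ y ∈ C, y * y = u → y = i ∨ y = i⁻¹ := by
    intro y hy hyy
    have h1 : (y * i⁻¹) * (y * i⁻¹) = 1 := by
      rw [mul_assoc, ← mul_assoc i⁻¹, hcomm i⁻¹ (C.inv_mem hi) y hy, mul_assoc y, ← mul_inv_rev,
        hii, ← mul_assoc, hyy, mul_inv_cancel]
    rcases hinv _ (C.mul_mem hy (C.inv_mem hi)) h1 with h | h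
    · exact Or.inl (mul_inv_eq_one.1 h)
    · right
      rw [mul_inv_eq_iff_eq_mul.1 h, hiinv, hcu]
  have hni' : ∀ y, y * i * y⁻¹ = i ∨ y * i * y⁻¹ = i⁻¹ := by
    intro y
    refine hroot _ (Subgroup.Normal.conj_mem inferInstance i hi y) ?_
    have : y * i * y⁻¹ * (y * i * y⁻¹) = y * (i * i) * y⁻¹ := by group
    rw [this, hii, ← hcu, mul_inv_cancel_right]
  have hcov : ∀ y, y ∈ C ∨ y * j ∈ C := by
    obtain ⟨d, hd⟩ := hQC.exists_generator
    obtain ⟨d, rfl⟩ := QuotientGroup.mk_surjective d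
    obtain ⟨k, hk⟩ := hd (QuotientGroup.mk j)
    have hk' : (QuotientGroup.mk (d ^ k) : Q ⧸ C) = QuotientGroup.mk j := hk
    have hko : Odd k := by
      rw [← Int.not_even_iff_odd]
      rintro ⟨l, rfl⟩
      have h1 : (d ^ (l + l))⁻¹ * j ∈ C := QuotientGroup.eq.1 hk'
      have h3 : Commute (d ^ (l + l)) i := by
        rw [zpow_add]
        have h4 : ∀ y : Q, y * y * i * (y * y)⁻¹ = i := by
          intro y
          have : y * y * i * (y * y)⁻¹ = y * (y * i * y⁻¹) * y⁻¹ := by group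
          rw [this]
          rcases hni' y with h | h
          · rw [h, h]
          · rw [h, ← conj_inv, h, inv_inv]
        exact mul_inv_eq_iff_eq_mul.1 (h4 _)
      have h4 : Commute ((d ^ (l + l))⁻¹ * j) i := hcomm _ h1 i hi
      have h5 := h3.mul_left h4
      rw [mul_inv_cancel_left] at h5
      exact hni h5
    have hj2 : ((QuotientGroup.mk d : Q ⧸ C) ^ k) * QuotientGroup.mk d ^ k = 1 := by
      have : (QuotientGroup.mk (j * j) : Q ⧸ C) = 1 := (QuotientGroup.eq_one_iff _).2 (hjj ▸ hu)
      rw [← this, QuotientGroup.mk_mul, ← hk]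
    have hd2 : (QuotientGroup.mk d : Q ⧸ C) ^ (2 : ℤ) = 1 := by
      obtain ⟨n, hn⟩ := h2 d
      have h3 : (QuotientGroup.mk d : Q ⧸ C) ^ ((2 : ℤ) ^ n) = 1 := by
        have : (QuotientGroup.mk (d ^ 2 ^ n) : Q ⧸ C) = 1 := by rw [hn]; rfl
        exact_mod_cast this
      obtain ⟨q, hq⟩ := hko
      obtain ⟨a, b, hab⟩ : IsCoprime k ((2 : ℤ) ^ n) :=
        IsCoprime.pow_right ⟨1, -q, by rw [hq]; ring⟩
      rw [← zpow_add] at hj2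
      rw [show (2 : ℤ) = (k + k) * a + 2 ^ n * (2 * b) by linear_combination (-2) * hab, zpow_add,
        zpow_mul, hj2, one_zpow, zpow_mul, h3, one_zpow, one_mul]
    have hdj : (QuotientGroup.mk d : Q ⧸ C) = QuotientGroup.mk j := by
      obtain ⟨q, hq⟩ := hko
      rw [← hk]
      change _ = (QuotientGroup.mk d : Q ⧸ C) ^ k
      rw [hq, zpow_add_one, zpow_mul, hd2, one_zpow, one_mul]
    intro y
    obtain ⟨l, hl⟩ := hd (QuotientGroup.mk y)
    change (QuotientGroup.mk d : Q ⧸ C) ^ l = _ at hl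
    obtain ⟨q, rfl | rfl⟩ := l.even_or_odd'
    · left
      rw [zpow_mul, hd2, one_zpow] at hl
      exact (QuotientGroup.eq_one_iff y).1 hl.symm
    · right
      rw [zpow_add_one, zpow_mul, hd2, one_zpow, one_mul] at hl
      rw [← QuotientGroup.eq_one_iff, QuotientGroup.mk_mul, ← hl, ← hdj, ← zpow_two, hd2]
  have hinvert : ∀ c ∈ C, j * c * j⁻¹ = c⁻¹ ∨ j * c * j⁻¹ = u * c⁻¹ := by
    intro c hc
    have hjc : j * c * j⁻¹ ∈ C := Subgroup.Normal.conj_mem inferInstance c hc j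
    have hw : j * c * j⁻¹ * c ∈ C := C.mul_mem hjc hc
    set w := j * c * j⁻¹ * c with hwd
    have hjw : Commute j w := by
      refine mul_inv_eq_iff_eq_mul.1 ?_
      calc j * w * j⁻¹ = (j * j) * c * (j * j)⁻¹ * (j * c * j⁻¹) := by rw [hwd]; group
        _ = c * (j * c * j⁻¹) := by rw [hjj, hcu, mul_inv_cancel_right]
        _ = w := hcomm _ hc _ hjc
    have hww : w * w = 1 := by
      by_contra h
      obtain ⟨n, hn⟩ := h2 (w * w)
      obtain ⟨k, hk1, hk2⟩ := exists_isInvolution_pow hn h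
      have hku : w ^ k * w ^ k = u := by
        rw [(Commute.refl w).mul_pow] at hk1 hk2
        exact (hinv _ (C.mul_mem (C.pow_mem hw k) (C.pow_mem hw k)) hk2).resolve_left hk1
      have hjk : Commute j (w ^ k) := hjw.pow_right k
      rcases hroot _ (C.pow_mem hw k) hku with h3 | h3
      · exact hni (h3 ▸ hjk).eq
      · rw [h3] at hjk
        exact hni (Commute.inv_right_iff.1 hjk).eq
    rcases hinv w hw hww with h | h
    · exact Or.inl (eq_inv_of_mul_eq_one_left h)
    · exact Or.inr (eq_mul_inv_of_mul_eq h)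
  refine ⟨hjC, hcov, hinvert, hni', fun y hy => ?_⟩
  have hc := (hcov y).resolve_left hy
  have h1 : y * y * (j * j) = (y * j) * (j⁻¹ * (y * j)⁻¹ * j)⁻¹ := by
    simp [mul_assoc]
  rw [hjj] at h1
  rcases hinvert _ hc with h | h
  · right
    rw [← h, inv_eq_iff_mul_eq_one.2 (show j⁻¹ * (j * (y * j) * j⁻¹) * j * (y * j)⁻¹ = 1 by group),
      mul_inv_cancel] at h1
    rw [eq_inv_of_mul_eq_one_left h1, huinv]
  · left
    have h3 : (y * j)⁻¹ = u * (j * (y * j) * j⁻¹) := by rw [h, ← mul_assoc, huu, one_mul]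
    have h4 : (j⁻¹ * (u * (j * (y * j) * j⁻¹)) * j)⁻¹ = (y * j)⁻¹ * u := by
      rw [← mul_assoc j⁻¹, ← hcu j⁻¹, inv_eq_iff_mul_eq_one]
      have : u * j⁻¹ * (j * (y * j) * j⁻¹) * j * ((y * j)⁻¹ * u) = u * u := by group
      rw [this, huu]
    rw [h3, h4, mul_inv_cancel_left] at h1
    exact mul_eq_right.1 h1

/-- In a metacyclic `2`-group with a quaternion subgroup on `i`, `j` whose involution is central,
there is a cyclic normal subgroup of index two. -/
theorem IsMetacyclic.exists_isCyclic {Q : Type*} [Group Q] [Finite Q] (hQ : IsMetacyclic Q)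
    (h2 : IsPGroup 2 Q) {u i j : Q} (hu1 : u ≠ 1) (huu : u * u = 1) (hcu : ∀ y, u * y = y * u)
    (hii : i * i = u) (hjj : j * j = u) (hji : j * i * j⁻¹ = i⁻¹) {D : Subgroup Q} (hiD : i ∈ D)
    (hjD : j ∈ D) : ∃ C : Subgroup Q, C.Normal ∧ IsCyclic C ∧ ∃ i ∈ D, i ∈ C ∧ ∃ j ∈ D,
      i * i = u ∧ j * j = u ∧ j * i * j⁻¹ = i⁻¹ ∧ j ∉ C ∧ (∀ y, y ∈ C ∨ y * j ∈ C) ∧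
      (∀ c ∈ C, j * c * j⁻¹ = c⁻¹ ∨ j * c * j⁻¹ = u * c⁻¹) ∧
      (∀ y, y * i * y⁻¹ = i ∨ y * i * y⁻¹ = i⁻¹) ∧ ∀ y ∉ C, y * y = 1 ∨ y * y = u := by
  obtain ⟨C, hC, hcC, hcQ⟩ := hQ
  suffices h : ∃ i ∈ D, i ∈ C ∧ ∃ j ∈ D, i * i = u ∧ j * j = u ∧ j * i * j⁻¹ = i⁻¹ by
    obtain ⟨i, hiD, hi, j, hjD, hii, hjj, hji⟩ := h
    exact ⟨C, hC, hcC, i, hiD, hi, j, hjD, hii, hjj, hji,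
      isCyclic_index_two h2 hcC hcQ hu1 huu hcu hii hjj hji hi⟩
  have hiinv : i⁻¹ = u * i := by
    rw [inv_eq_iff_mul_eq_one, hcu, ← mul_assoc, hii, huu]
  have hjinv : j⁻¹ = u * j := by
    rw [inv_eq_iff_mul_eq_one, hcu, ← mul_assoc, hjj, huu]
  have hj' : j * i = u * (i * j) := by
    rw [mul_inv_eq_iff_eq_mul.1 hji, hiinv, mul_assoc]
  let := IsCyclic.commGroup (α := Q ⧸ C)
  have hu : (QuotientGroup.mk u : Q ⧸ C) = 1 := by
    have h1 := congrArg (QuotientGroup.mk : Q → Q ⧸ C) hj'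
    rw [QuotientGroup.mk_mul, QuotientGroup.mk_mul, QuotientGroup.mk_mul, mul_comm] at h1
    exact right_eq_mul.1 h1
  by_cases hi : i ∈ C
  · exact ⟨i, hiD, hi, j, hjD, hii, hjj, hji⟩
  by_cases hj : j ∈ C
  · refine ⟨j, hjD, hj, i, hiD, hjj, hii, ?_⟩
    rw [mul_inv_eq_iff_eq_mul, hjinv, mul_assoc, hj', ← mul_assoc, huu, one_mul]
  · have hij : i * j ∈ C := by
      have h1 := IsCyclic.exists_pow_eq_of_mul_self (A := Q ⧸ C) (b := QuotientGroup.mk i)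
        (c := QuotientGroup.mk j)
        ⟨fun h => hi ((QuotientGroup.eq_one_iff i).1 h), by rw [← QuotientGroup.mk_mul, hii, hu]⟩
        ⟨fun h => hj ((QuotientGroup.eq_one_iff j).1 h), by rw [← QuotientGroup.mk_mul, hjj, hu]⟩
      rw [← QuotientGroup.eq_one_iff, QuotientGroup.mk_mul, h1, ← QuotientGroup.mk_mul, hjj, hu]
    have h3 : i * j * (i * j) = u := by
      rw [mul_assoc, ← mul_assoc j, hj', mul_assoc u, mul_assoc i, hjj, ← hcu i,
        ← mul_assoc u, huu, one_mul, hii]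
    refine ⟨i * j, D.mul_mem hiD hjD, hij, j, hjD, h3, hjj, ?_⟩
    rw [← mul_assoc, mul_inv_cancel_right, hj', eq_inv_iff_mul_eq_one, mul_assoc, h3, huu]

theorem exists_conj_eq_of_commutator_eq_top {H : Type*} [Group H] [Finite H]
    (hH : commutator H = ⊤) {z v : H} {A : Subgroup H} {k : ℕ} (hA : A.index = 2 * k) (hk : Odd k)
    (hz : ∀ a ∈ A, a ≠ 1 → a * a = 1 → a = z) (hv : v ≠ 1) (hvv : v * v = 1) :
    ∃ g, v = g * z * g⁻¹ := by
  classical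
  have := Fintype.ofFinite (H ⧸ A)
  let σ : Equiv.Perm (H ⧸ A) := MulAction.toPermHom H (H ⧸ A) v
  have hσ : σ ^ 2 = 1 := by
    rw [← map_pow, pow_two, hvv, map_one]
  have hsign : Equiv.Perm.sign σ = 1 := by
    let f : H →* ℤˣ := Equiv.Perm.sign.comp (MulAction.toPermHom H (H ⧸ A))
    have h1 : v ∈ f.ker := Abelianization.commutator_subset_ker f (hH ▸ Subgroup.mem_top v)
    exact h1
  by_contra hne
  have hfix : IsEmpty (Function.fixedPoints σ) := by
    refine ⟨fun ⟨q, hq⟩ => hne ?_⟩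
    obtain ⟨g, rfl⟩ := QuotientGroup.mk_surjective q
    have h1 : (QuotientGroup.mk (v * g) : H ⧸ A) = QuotientGroup.mk g := hq
    have h3 : g⁻¹ * v * g ∈ A := by
      rw [mul_assoc]
      exact QuotientGroup.eq.1 h1.symm
    refine ⟨g, ?_⟩
    rw [← hz _ h3 ?_ ?_]
    · group
    · intro h
      refine hv ?_
      have : v = g * (g⁻¹ * v * g) * g⁻¹ := by group
      rw [this, h, mul_one, mul_inv_cancel]
    · calc g⁻¹ * v * g * (g⁻¹ * v * g) = g⁻¹ * (v * v) * g := by group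
        _ = 1 := by rw [hvv, mul_one, inv_mul_cancel]
  rw [Equiv.Perm.sign_of_pow_two_eq_one hσ,
    Fintype.card_eq_zero (α := Function.fixedPoints σ), Nat.sub_zero,
    ← Nat.card_eq_fintype_card] at hsign
  change (-1 : ℤˣ) ^ (A.index / 2) = 1 at hsign
  rw [hA, Nat.mul_div_cancel_left _ two_pos, hk.neg_one_pow] at hsign
  exact absurd hsign (by decide)

theorem Subgroup.card_eq_two_mul_card_map {K H : Type*} [Group K] [Finite K] [Group H]
    {π : K →* H} {u : K} (hu1 : u ≠ 1) (hker : ∀ g, π g = 1 ↔ g = 1 ∨ g = u) {B : Subgroup K}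
    (hu : u ∈ B) : Nat.card B = 2 * Nat.card (B.map π) := by
  have h1 := (π.domRestrict B).ker.card_mul_index
  rw [Subgroup.index_ker, MonoidHom.domRestrict_range] at h1
  rw [← h1]
  congr 1
  rw [Nat.card_eq_two_iff]
  refine ⟨⟨1, Subgroup.one_mem _⟩, ⟨⟨u, hu⟩, (hker u).2 (Or.inr rfl)⟩,
    fun h => hu1 (Subtype.ext_iff.1 (Subtype.ext_iff.1 h)).symm, ?_⟩
  ext ⟨⟨b, hb⟩, hb1⟩
  have hb2 : π b = 1 := hb1
  refine ⟨fun _ => trivial, fun _ => ?_⟩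
  rcases (hker b).1 hb2 with rfl | rfl
  · exact Or.inl rfl
  · exact Or.inr rfl

theorem DihedralData.of_quaternion {K H : Type*} [Group K] [Finite K] [Group H] [Finite H]
    {π : K →* H} (hπ : Function.Surjective π) (hK : commutator K = ⊤) {u i j : K} (hu1 : u ≠ 1)
    (huu : u * u = 1) (hcu : ∀ y, u * y = y * u) (hker : ∀ g, π g = 1 ↔ g = 1 ∨ g = u)
    {P A : Subgroup K} (hA : IsCyclic A) (hAP : A ≤ P) (hiA : i ∈ A) (hii : i * i = u)
    (hjP : j ∈ P) (hjA : j ∉ A) (hcov : ∀ y ∈ P, y ∈ A ∨ y * j ∈ A)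
    (hP : ∀ g, g * i * g⁻¹ = i ∨ g * i * g⁻¹ = i⁻¹ ↔ g ∈ P)
    (hsq : ∀ y ∈ P, y ∉ A → y * y = 1 ∨ y * y = u) {m : ℕ} (hm : ∃ a, 2 ≤ a ∧ m = 2 ^ a)
    (hcard : Nat.card A = 2 * m) (hodd : Odd P.index) : DihedralData (π i) (A.map π) m := by
  have huA : u ∈ A := hii ▸ A.mul_mem hiA hiA
  have hiinv : i⁻¹ = u * i := by
    rw [inv_eq_iff_mul_eq_one, hcu, ← mul_assoc, hii, huu]
  have hcent : Subgroup.centralizer {π i} = P.map π := by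
    ext y
    obtain ⟨g, rfl⟩ := hπ y
    have h1 : π g * π i = π i * π g ↔ g ∈ P := by
      rw [← hP, hiinv, ← map_mul, ← map_mul, ← mul_inv_eq_one, ← map_inv, ← map_mul, hker,
        mul_inv_eq_one, mul_inv_eq_iff_eq_mul, mul_inv_eq_iff_eq_mul, mul_inv_eq_iff_eq_mul,
        mul_assoc]
    rw [Subgroup.mem_centralizer_singleton_iff, h1]
    constructor
    · exact fun h => ⟨g, h, rfl⟩
    · rintro ⟨g', hg', hgg⟩
      have h3 : π (g'⁻¹ * g) = 1 := by rw [map_mul, map_inv, hgg, inv_mul_cancel]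
      have h4 : g'⁻¹ * g ∈ P := by
        rcases (hker _).1 h3 with h | h
        · rw [h]; exact P.one_mem
        · rw [h]; exact hAP huA
      exact (P.mul_mem_cancel_left (P.inv_mem hg')).1 h4
  have hmapA : ∀ g, π g ∈ A.map π → g ∈ A := by
    rintro g ⟨g', hg', hgg⟩
    have h3 : π (g'⁻¹ * g) = 1 := by rw [map_mul, map_inv, hgg, inv_mul_cancel]
    have h4 : g'⁻¹ * g ∈ A := by
      rcases (hker _).1 h3 with h | h
      · rw [h]; exact A.one_mem
      · rw [h]; exact huA
    exact (A.mul_mem_cancel_left (A.inv_mem hg')).1 h4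
  have hcA : Nat.card (A.map π) = m := by
    have := Subgroup.card_eq_two_mul_card_map hu1 hker huA
    omega
  have hcP : Nat.card P = 2 * Nat.card A := by
    have h1 : A.relIndex P = 2 := by
      rw [Subgroup.relIndex_eq_two_iff]
      refine ⟨j, hjP, fun b hb => ?_⟩
      rcases hcov b hb with h | h
      · exact Or.inr ⟨h, fun h' => hjA ((A.mul_mem_cancel_left h).1 h')⟩
      · refine Or.inl ⟨h, fun h' => hjA ((A.mul_mem_cancel_left h').1 h)⟩
    rw [← h1, mul_comm]
    simpa using (Subgroup.relIndex_mul_relIndex ⊥ A P bot_le hAP).symm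
  have hcC : Nat.card (Subgroup.centralizer {π i}) = 2 * m := by
    have := Subgroup.card_eq_two_mul_card_map hu1 hker (hAP huA)
    rw [hcent]
    omega
  have hcycl : IsCyclic (A.map π) :=
    isCyclic_of_surjective (π.subgroupMap A) (π.subgroupMap_surjective A)
  have hi1 : π i ≠ 1 := by
    intro h
    rcases (hker i).1 h with h' | h'
    · rw [h', mul_one] at hii
      exact hu1 hii.symm
    · rw [h', huu] at hii
      exact hu1 hii.symm
  have hi2 : π i * π i = 1 := by
    rw [← map_mul, hii, hker]
    exact Or.inr rfl
  have hidx : Odd (Subgroup.centralizer {π i}).index := by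
    rw [hcent, Subgroup.index_map_eq _ hπ]
    · exact hodd
    · intro g hg
      rcases (hker g).1 hg with h | h
      · rw [h]; exact P.one_mem
      · rw [h]; exact hAP huA
  have hH : commutator H = ⊤ := by
    rw [commutator_def, ← Subgroup.map_top_of_surjective π hπ, ← Subgroup.map_commutator,
      ← commutator_def, hK]
  have hAi : (A.map π).index = 2 * (Subgroup.centralizer {π i}).index := by
    have h1 := (A.map π).card_mul_index
    rw [← (Subgroup.centralizer {π i}).card_mul_index, hcA, hcC] at h1
    obtain ⟨a, -, ha⟩ := hm
    have hm0 : 0 < m := by rw [ha]; positivity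
    refine Nat.eq_of_mul_eq_mul_left hm0 ?_
    rw [h1]
    ring
  refine ⟨hm, hcA, hcycl, ⟨i, hiA, rfl⟩, hi1, hi2, ?_, hcC, ?_, fun v hv hvv => ?_, hidx⟩
  · rintro _ ⟨a, ha, rfl⟩
    have := (Subgroup.mem_centralizer_singleton_iff (g := π i)).1
      (hcent ▸ Subgroup.mem_map_of_mem π (hAP ha))
    exact this
  · intro s hs hsA
    rw [← Subgroup.mem_centralizer_singleton_iff, hcent] at hs
    obtain ⟨g, hg, rfl⟩ := hs
    rw [← map_mul, hker]
    exact hsq g hg fun h => hsA ⟨g, h, rfl⟩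
  · refine exists_conj_eq_of_commutator_eq_top hH hAi hidx ?_ hv hvv
    intro a ha ha1 haa
    exact (eq_one_or_eq_of_isCyclic hcycl ⟨i, hiA, rfl⟩ hi1 hi2 ha haa).resolve_left ha1

theorem mul_self_eq_of_isInvolution_map {K H : Type*} [Group K] [Group H] {π : K →* H}
    (hπ : Function.Surjective π) {u i : K} (huu : u * u = 1) (hcu : ∀ y, u * y = y * u)
    (hker : ∀ g, π g = 1 ↔ g = 1 ∨ g = u) (hii : i * i = u)
    (hconj : ∀ v, v ≠ 1 → v * v = 1 → ∃ g, v = g * π i * g⁻¹) {g : K}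
    (hg : IsInvolution (π g)) : g * g = u := by
  obtain ⟨w, hw⟩ := hconj _ hg.1 hg.2
  obtain ⟨k, rfl⟩ := hπ w
  rw [← map_inv, ← map_mul, ← map_mul, ← mul_inv_eq_one, ← map_inv, ← map_mul, hker,
    mul_inv_eq_one, mul_inv_eq_iff_eq_mul] at hw
  have h1 : k * i * k⁻¹ * (k * i * k⁻¹) = u := by
    calc k * i * k⁻¹ * (k * i * k⁻¹) = k * (i * i) * k⁻¹ := by group
      _ = u := by rw [hii, ← hcu, mul_inv_cancel_right]
  rcases hw with rfl | rfl
  · exact h1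
  · rw [mul_assoc u, ← mul_assoc _ u, ← hcu, mul_assoc u, h1, ← mul_assoc, huu, one_mul]

/-- A maximal subgroup `Q` which is a `2`-group, a perfect normal subgroup `K`, a cyclic subgroup
`C` of index two in `Q` with an element `i` of order four, and a quaternion subgroup `⟨i, j⟩` of a
subgroup `D` of `Q ⊓ K` on which an element `g` of odd order acts nontrivially. The involution `u`
of `C` is central. -/
structure QuaternionData {G : Type*} [Group G] (Q K C D : Subgroup G) (u i j g : G) : Prop where
  isCoatom : IsCoatom Q
  isPGroup : IsPGroup 2 Q
  normal : K.Normal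
  commutator_eq : ⁅K, K⁆ = K
  not_isSolvable : ¬ Group.IsSolvable K
  ne_one : u ≠ 1
  mul_self : u * u = 1
  comm : ∀ y, u * y = y * u
  le : C ≤ Q
  isCyclic : IsCyclic C
  le_inf : D ≤ Q ⊓ K
  left_mem : i ∈ D
  left_mem_cyclic : i ∈ C
  right_mem : j ∈ D
  right_notMem : j ∉ C
  left_mul_self : i * i = u
  right_mul_self : j * j = u
  inverts : j * i * j⁻¹ = i⁻¹
  mem_or_mem : ∀ y ∈ Q, y ∈ C ∨ y * j ∈ C
  conj_right : ∀ c ∈ C, j * c * j⁻¹ = c⁻¹ ∨ j * c * j⁻¹ = u * c⁻¹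
  conj_left : ∀ y ∈ Q, y * i * y⁻¹ = i ∨ y * i * y⁻¹ = i⁻¹
  mul_self_of_notMem : ∀ y ∈ Q, y ∉ C → y * y = 1 ∨ y * y = u
  mem_normalizer : g ∈ Subgroup.normalizer (D : Set G)
  odd_orderOf : Odd (orderOf g)
  not_commute : ∃ d ∈ D, g * d ≠ d * g

theorem exists_quaternionData {G : Type*} [Group G] [Finite G] {Q K : Subgroup G}
    (hG : ¬ Group.IsSolvable G) (hmax : IsCoatom Q) (h2 : IsPGroup 2 Q)
    (hQ : IsMetacyclic ↥Q) (hK : K.Normal) (hKK : ⁅K, K⁆ = K) (hKs : ¬ Group.IsSolvable K) {u : G}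
    (hu : u ∈ K) (hu1 : u ≠ 1) (huu : u * u = 1) (hcu : ∀ y, u * y = y * u) :
    ∃ C D i j g, QuaternionData Q K C D u i j g := by
  obtain ⟨S, hS⟩ := exists_sylow_eq hG hmax h2
  obtain ⟨D, hD, g, -, hgD, hgo, hgd, i, hi, j, hj, hii, hjj, hji⟩ :=
    exists_quaternion hQ hS hK hKK hu hu1 huu hcu
  have huQ : u ∈ Q := hii ▸ Q.mul_mem (hD hi).1 (hD hi).1
  obtain ⟨C, hC, hCc, ⟨i, hiQ⟩, hiD, hiC, ⟨j, hjQ⟩, hjD, hii, hjj, hji, hjC, hcov, hinv, hconj,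
    hsq⟩ := hQ.exists_isCyclic h2 (u := ⟨u, huQ⟩) (i := ⟨i, (hD hi).1⟩) (j := ⟨j, (hD hj).1⟩)
    (fun h => hu1 (congrArg Subtype.val h)) (Subtype.ext huu) (fun y => Subtype.ext (hcu y))
    (Subtype.ext hii) (Subtype.ext hjj) (Subtype.ext hji) (D := D.subgroupOf Q) hi hj
  have hmem : ∀ y (hy : y ∈ Q), y ∈ C.map Q.subtype ↔ ⟨y, hy⟩ ∈ C := by
    intro y hy
    constructor
    · rintro ⟨w, hw, rfl⟩
      exact hw
    · exact fun h => ⟨_, h, rfl⟩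
  refine ⟨C.map Q.subtype, D, i, j, g, hmax, h2, hK, hKK, hKs, hu1, huu, hcu,
    Subgroup.map_subtype_le C, ?_, hD, hiD, (hmem i hiQ).2 hiC, hjD,
    fun h => hjC ((hmem j hjQ).1 h), congrArg Subtype.val hii, congrArg Subtype.val hjj,
    congrArg Subtype.val hji, fun y hy => ?_, ?_, fun y hy => ?_, fun y hy hyC => ?_, hgD, hgo, hgd⟩
  · exact isCyclic_of_surjective (Q.subtype.subgroupMap C) (Q.subtype.subgroupMap_surjective C)
  · rw [hmem y hy, hmem _ (Q.mul_mem hy hjQ)]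
    exact hcov ⟨y, hy⟩
  · rintro _ ⟨c, hc, rfl⟩
    exact (hinv c hc).imp (congrArg Subtype.val) (congrArg Subtype.val)
  · exact (hconj ⟨y, hy⟩).imp (congrArg Subtype.val) (congrArg Subtype.val)
  · exact (hsq ⟨y, hy⟩ fun h => hyC ((hmem y hy).2 h)).imp (congrArg Subtype.val)
      (congrArg Subtype.val)

namespace QuaternionData

variable {G : Type*} [Group G] {Q K C D : Subgroup G} {u i j g : G}

theorem left_inv (h : QuaternionData Q K C D u i j g) : i⁻¹ = u * i := by
  rw [inv_eq_iff_mul_eq_one, h.comm, ← mul_assoc, h.left_mul_self, h.mul_self]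

theorem mem_of_conj (h : QuaternionData Q K C D u i j g) {y : G}
    (hy : y * i * y⁻¹ = i ∨ y * i * y⁻¹ = i⁻¹) : y ∈ Q := by
  have hconj : ∀ a b : G, (a * i * a⁻¹ = i ∨ a * i * a⁻¹ = i⁻¹) →
      (b * i * b⁻¹ = i ∨ b * i * b⁻¹ = i⁻¹) → (a * b * i * (a * b)⁻¹ = i ∨
        a * b * i * (a * b)⁻¹ = i⁻¹) := by
    intro a b ha hb
    have h1 : a * b * i * (a * b)⁻¹ = a * (b * i * b⁻¹) * a⁻¹ := by group
    rw [h1]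
    rcases hb with hb | hb
    · rwa [hb]
    · rw [hb, ← conj_inv]
      rcases ha with ha | ha
      · exact Or.inr (congrArg _ ha)
      · exact Or.inl (by rw [ha, inv_inv])
  have hinv : ∀ a : G, (a * i * a⁻¹ = i ∨ a * i * a⁻¹ = i⁻¹) →
      (a⁻¹ * i * a⁻¹⁻¹ = i ∨ a⁻¹ * i * a⁻¹⁻¹ = i⁻¹) := by
    intro a ha
    have h1 : a⁻¹ * (a * i * a⁻¹) * a⁻¹⁻¹ = i := by group
    rcases ha with ha | ha
    · rw [ha] at h1
      exact Or.inl h1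
    · rw [ha, ← conj_inv, inv_eq_iff_eq_inv] at h1
      exact Or.inr h1
  let T : Subgroup G :=
    { carrier := {a | a * i * a⁻¹ = i ∨ a * i * a⁻¹ = i⁻¹}
      mul_mem' := fun {a b} => hconj a b
      one_mem' := Or.inl (by simp)
      inv_mem' := fun {a} => hinv a }
  have hT : ∀ a, a ∈ T ↔ a * i * a⁻¹ = i ∨ a * i * a⁻¹ = i⁻¹ := fun a => Iff.rfl
  have hQT : Q ≤ T := fun a ha => (hT a).2 (h.conj_left a ha)
  rcases h.isCoatom.le_iff.1 hQT with hT' | hT'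
  · exfalso
    have hall : ∀ a, a * i * a⁻¹ = i ∨ a * i * a⁻¹ = i⁻¹ := fun a =>
      (hT a).1 (hT' ▸ Subgroup.mem_top a)
    have hK : K ≤ Subgroup.centralizer {i} := by
      rw [← h.commutator_eq, Subgroup.commutator_le]
      intro a _ b _
      rw [Subgroup.mem_centralizer_singleton_iff, ← mul_inv_eq_iff_eq_mul, commutatorElement_def]
      have key : ∀ a, (a * i * a⁻¹ = i ∧ a⁻¹ * i * a⁻¹⁻¹ = i) ∨
          (a * i * a⁻¹ = i⁻¹ ∧ a⁻¹ * i * a⁻¹⁻¹ = i⁻¹) := by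
        intro a
        have h1 : a⁻¹ * (a * i * a⁻¹) * a⁻¹⁻¹ = i := by group
        rcases hall a with ha | ha
        · rw [ha] at h1
          exact Or.inl ⟨ha, h1⟩
        · rw [ha, ← conj_inv, inv_eq_iff_eq_inv] at h1
          exact Or.inr ⟨ha, h1⟩
      have h2 : a * b * a⁻¹ * b⁻¹ * i * (a * b * a⁻¹ * b⁻¹)⁻¹ =
          a * (b * (a⁻¹ * (b⁻¹ * i * b⁻¹⁻¹) * a⁻¹⁻¹) * b⁻¹) * a⁻¹ := by group
      rw [h2]
      rcases key a with ⟨ha, ha'⟩ | ⟨ha, ha'⟩ <;> rcases key b with ⟨hb, hb'⟩ | ⟨hb, hb'⟩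
      · rw [hb', ha', hb, ha]
      · rw [hb', ← conj_inv, ha', ← conj_inv, hb, inv_inv, ha]
      · rw [hb', ha', ← conj_inv, hb, ← conj_inv, ha, inv_inv]
      · rw [hb', ← conj_inv, ha', inv_inv, hb, ← conj_inv, ha, inv_inv]
    have := (Subgroup.mem_centralizer_singleton_iff).1 (hK (h.le_inf h.right_mem).2)
    have h1 := h.inverts
    rw [this, mul_inv_cancel_right, h.left_inv, right_eq_mul] at h1
    exact h.ne_one h1
  · rw [← hT']
    exact hy

end QuaternionData

namespace QuaternionData

variable {G : Type*} [Group G] {Q K C D : Subgroup G} {u i j g : G}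

theorem center_mem (h : QuaternionData Q K C D u i j g) : u ∈ C ⊓ K := by
  have h1 := (h.le_inf h.left_mem).2
  rw [← h.left_mul_self]
  exact ⟨C.mul_mem h.left_mem_cyclic h.left_mem_cyclic, K.mul_mem h1 h1⟩

theorem left_mem_inf (h : QuaternionData Q K C D u i j g) : i ∈ C ⊓ K :=
  ⟨h.left_mem_cyclic, (h.le_inf h.left_mem).2⟩

theorem right_mem_inf (h : QuaternionData Q K C D u i j g) : j ∈ Q ⊓ K :=
  h.le_inf h.right_mem

theorem left_mul_self_ne_one (h : QuaternionData Q K C D u i j g) : i * i ≠ 1 := by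
  rw [h.left_mul_self]
  exact h.ne_one

theorem right_inv (h : QuaternionData Q K C D u i j g) : j⁻¹ = u * j := by
  rw [inv_eq_iff_mul_eq_one, h.comm, ← mul_assoc, h.right_mul_self, h.mul_self]

theorem mul_self_mem (h : QuaternionData Q K C D u i j g) {c : G} (hc : c ∈ C) : c * c ∈ K := by
  have hj := h.right_mem_inf.2
  have h1 : j * c * j⁻¹ * c⁻¹ ∈ K := by
    have := K.mul_mem hj (h.normal.conj_mem _ (K.inv_mem hj) c)
    convert this using 1
    group
  rcases h.conj_right c hc with hc' | hc' <;> rw [hc'] at h1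
  · rwa [← mul_inv_rev, K.inv_mem_iff] at h1
  · rwa [mul_assoc, K.mul_mem_cancel_left h.center_mem.2, ← mul_inv_rev, K.inv_mem_iff] at h1

theorem mem_inf_or_mul_mem_inf (h : QuaternionData Q K C D u i j g) {y : G} (hy : y ∈ Q ⊓ K) :
    y ∈ C ⊓ K ∨ y * j ∈ C ⊓ K :=
  (h.mem_or_mem y hy.1).imp (⟨·, hy.2⟩) (⟨·, K.mul_mem hy.2 h.right_mem_inf.2⟩)

theorem orderOf_left (h : QuaternionData Q K C D u i j g) : orderOf i = 4 := by
  refine orderOf_eq_prime_pow (p := 2) (n := 1) ?_ ?_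
  · rw [pow_one, pow_two]
    exact h.left_mul_self_ne_one
  · rw [pow_succ, pow_one, pow_mul, pow_two, pow_two, h.left_mul_self, h.mul_self]

theorem mul_mem_of_mem_cyclic (h : QuaternionData Q K C D u i j g) {a b : G} (ha : a ∈ C)
    (hb : b ∈ C) (haK : a ∉ K) (hbK : b ∉ K) : a * b ∈ K := by
  have := h.normal
  obtain ⟨⟨c, hcC⟩, hc⟩ := h.isCyclic
  have hcc := h.mul_self_mem hcC
  have key : ∀ e : ℤ, c ^ e ∉ K → ∃ k ∈ K, c ^ e = c * k := by
    intro e he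
    rcases Int.even_or_odd' e with ⟨f, rfl | rfl⟩
    · refine absurd ?_ he
      rw [zpow_mul, zpow_two]
      exact K.zpow_mem hcc f
    · refine ⟨(c * c) ^ f, K.zpow_mem hcc f, ?_⟩
      rw [zpow_add, zpow_mul, zpow_two, zpow_one]
      exact ((Commute.refl c).mul_left (Commute.refl c)).zpow_left f
  obtain ⟨e, he⟩ := hc ⟨a, ha⟩
  obtain ⟨f, hf⟩ := hc ⟨b, hb⟩
  have he' : c ^ e = a := congrArg Subtype.val he
  have hf' : c ^ f = b := congrArg Subtype.val hf
  subst he' hf'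
  obtain ⟨k, hk, hek⟩ := key e haK
  obtain ⟨l, hl, hfl⟩ := key f hbK
  rw [hek, hfl]
  have h1 : c * k * (c * l) = c * c * (c⁻¹ * k * c⁻¹⁻¹) * l := by group
  rw [h1]
  exact K.mul_mem (K.mul_mem hcc (h.normal.conj_mem k hk c⁻¹)) hl

variable [Finite G]

theorem isSolvable (h : QuaternionData Q K C D u i j g) : Group.IsSolvable Q := by
  have := h.isPGroup.isNilpotent
  infer_instance

theorem sup_eq_top (h : QuaternionData Q K C D u i j g) : Q ⊔ K = ⊤ := by
  refine h.isCoatom.lt_iff.1 (lt_of_le_of_ne le_sup_left fun hQ => h.not_isSolvable ?_)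
  exact Subgroup.isSolvable_of_le (le_sup_right.trans hQ.ge) h.isSolvable

theorem exists_mul (h : QuaternionData Q K C D u i j g) (y : G) : ∃ c ∈ C, ∃ k ∈ K, y = c * k := by
  have := h.normal
  have hy : y ∈ Q ⊔ K := h.sup_eq_top ▸ Subgroup.mem_top y
  obtain ⟨q, hq, k, hk, rfl⟩ := Subgroup.mem_sup_of_normal_right.1 hy
  rcases h.mem_or_mem q hq with hq | hq
  · exact ⟨q, hq, k, hk, rfl⟩
  · exact ⟨q * j, hq, j⁻¹ * k, K.mul_mem (K.inv_mem h.right_mem_inf.2) hk, by group⟩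

theorem index_eq (h : QuaternionData Q K C D u i j g) : K = ⊤ ∨ K.index = 2 := by
  have := h.normal
  by_cases hC : C ≤ K
  · left
    rw [eq_top_iff]
    intro y _
    obtain ⟨c, hc, k, hk, rfl⟩ := h.exists_mul y
    exact K.mul_mem (hC hc) hk
  · right
    obtain ⟨a, ha, haK⟩ := SetLike.not_le_iff_exists.1 hC
    rw [Subgroup.index_eq_two_iff]
    refine ⟨a, fun y => ?_⟩
    obtain ⟨c, hc, k, hk, rfl⟩ := h.exists_mul y
    have h1 : c * k * a = c * a * (a⁻¹ * k * a⁻¹⁻¹) := by group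
    rw [h1, K.mul_mem_cancel_right (h.normal.conj_mem k hk a⁻¹), K.mul_mem_cancel_right hk]
    by_cases hcK : c ∈ K
    · exact Or.inr ⟨hcK, fun hca => haK ((K.mul_mem_cancel_left hcK).1 hca)⟩
    · exact Or.inl ⟨h.mul_mem_of_mem_cyclic hc ha hcK haK, hcK⟩

theorem index_centralizer_lt (h : QuaternionData Q K C D u i j g) (hG : ¬ Group.IsSolvable G) :
    6 < (Subgroup.centralizer {i}).index := by
  by_contra! hle
  have h1 : Subgroup.centralizer {i} ≤ Q := fun y hy =>
    h.mem_of_conj (Or.inl (by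
      rw [Subgroup.mem_centralizer_singleton_iff.1 hy, mul_inv_cancel_right]))
  have h2 := Subgroup.relIndex_mul_index h1
  have h3 : (Subgroup.centralizer {i}).relIndex Q ≠ 1 := by
    rw [Ne, Subgroup.relIndex_eq_one]
    intro hQ
    have h4 := Subgroup.mem_centralizer_singleton_iff.1 (hQ h.right_mem_inf.1)
    have h5 := h.inverts
    rw [h4, mul_inv_cancel_right, h.left_inv, right_eq_mul] at h5
    exact h.ne_one h5
  have h4 : (Subgroup.centralizer {i}).relIndex Q ≠ 0 := Subgroup.index_ne_zero_of_finite
  refine hG (Subgroup.isSolvable_of_index_le_three h.isSolvable ?_)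
  have h5 : 2 ≤ (Subgroup.centralizer {i}).relIndex Q := by omega
  nlinarith

theorem zpowers_left_ne (h : QuaternionData Q K C D u i j g) (hG : ¬ Group.IsSolvable G) :
    Subgroup.zpowers i ≠ C ⊓ K := by
  intro hi
  have hnK := h.normal
  have hiD : Subgroup.zpowers i ≤ D := by simpa using h.left_mem
  have hD : D = Q ⊓ K := by
    refine le_antisymm h.le_inf fun y hy => ?_
    rcases h.mem_inf_or_mul_mem_inf hy with hy | hy <;> rw [← hi] at hy
    · exact hiD hy
    · exact (D.mul_mem_cancel_right h.right_mem).1 (hiD hy)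
  have hQ : Q ≤ Subgroup.normalizer (D : Set G) := by
    intro q hq
    rw [Subgroup.mem_normalizer_iff]
    intro y
    rw [hD]
    have h1 : y ∈ Q ↔ q * y * q⁻¹ ∈ Q := by
      rw [Q.mul_mem_cancel_right (Q.inv_mem hq), Q.mul_mem_cancel_left hq]
    have h2 : y ∈ K ↔ q * y * q⁻¹ ∈ K := by
      rw [hnK.mem_comm_iff, inv_mul_cancel_left]
    exact and_congr h1 h2
  rcases h.isCoatom.le_iff.1 hQ with hN | hN
  · classical
    have hnD : D.Normal := Subgroup.normalizer_eq_top_iff.1 hN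
    have hpow : ∀ y ∈ Subgroup.zpowers i, y = 1 ∨ y = i ∨ y = u ∨ y = u * i := by
      intro y hy
      obtain ⟨n, hn, rfl⟩ := (mem_zpowers_iff_mem_range_orderOf.1 hy) |> Finset.mem_image.1
      rw [h.orderOf_left, Finset.mem_range] at hn
      interval_cases n
      · exact Or.inl (pow_zero i)
      · exact Or.inr (Or.inl (pow_one i))
      · exact Or.inr (Or.inr (Or.inl (by rw [pow_two, h.left_mul_self])))
      · exact Or.inr (Or.inr (Or.inr (by rw [pow_succ, pow_two, h.left_mul_self])))
    have hs : ∀ y, y * i * y⁻¹ ∈ ({i, u * i, j, u * j, i * j, u * (i * j)} : Finset G) := by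
      intro y
      have hne : y * i * y⁻¹ * (y * i * y⁻¹) ≠ 1 := by
        rw [conj_mul, h.left_mul_self, ← h.comm, mul_inv_cancel_right]
        exact h.ne_one
      have hmem : y * i * y⁻¹ ∈ Q ⊓ K := hD ▸ hnD.conj_mem i h.left_mem y
      simp only [Finset.mem_insert, Finset.mem_singleton]
      generalize y * i * y⁻¹ = w at hne hmem
      rcases h.mem_inf_or_mul_mem_inf hmem with hw | hw <;> rw [← hi] at hw <;>
        rcases hpow _ hw with hw | hw | hw | hw
      · exact absurd (by rw [hw, one_mul]) hne
      · exact Or.inl hw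
      · exact absurd (by rw [hw, h.mul_self]) hne
      · exact Or.inr (Or.inl hw)
      all_goals rw [← eq_mul_inv_iff_mul_eq, h.right_inv] at hw
      · exact Or.inr (Or.inr (Or.inr (Or.inl (by rw [hw, one_mul]))))
      · exact Or.inr (Or.inr (Or.inr (Or.inr (Or.inr (by
          rw [hw, ← mul_assoc, ← h.comm, mul_assoc])))))
      · exact Or.inr (Or.inr (Or.inl (by rw [hw, ← mul_assoc, h.mul_self, one_mul])))
      · exact Or.inr (Or.inr (Or.inr (Or.inr (Or.inl (by
          rw [hw, h.comm i, mul_assoc, ← mul_assoc u u, h.mul_self, one_mul])))))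
    exact absurd ((Subgroup.index_centralizer_le hs).trans Finset.card_le_six)
      (h.index_centralizer_lt hG).not_ge
  · have hgQ : g ∈ Q := hN ▸ h.mem_normalizer
    obtain ⟨k, hk⟩ := (h.isPGroup.to_le (Subgroup.zpowers_le.2 hgQ)).exists_card_eq
    rw [Nat.card_zpowers] at hk
    have hg1 : orderOf g = 1 := by
      have := h.odd_orderOf
      rw [hk] at this ⊢
      rcases k with _ | k
      · rfl
      · exact absurd this (by simp [pow_succ])
    rw [orderOf_eq_one_iff] at hg1
    obtain ⟨d, -, hd⟩ := h.not_commute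
    exact hd (by rw [hg1, one_mul, mul_one])

theorem exists_card (h : QuaternionData Q K C D u i j g) (hG : ¬ Group.IsSolvable G) :
    ∃ m, (∃ a, 2 ≤ a ∧ m = 2 ^ a) ∧ Nat.card ↥(C ⊓ K) = 2 * m := by
  obtain ⟨n, hn⟩ := (h.isPGroup.to_le (inf_le_left.trans h.le : C ⊓ K ≤ Q)).exists_card_eq
  have hle : Subgroup.zpowers i ≤ C ⊓ K := Subgroup.zpowers_le.2 h.left_mem_inf
  have hlt : Nat.card (Subgroup.zpowers i) < Nat.card ↥(C ⊓ K) :=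
    lt_of_le_of_ne (Subgroup.card_le_of_le hle) fun hc =>
      h.zpowers_left_ne hG (Subgroup.eq_of_le_of_card_ge hle hc.ge)
  rw [Nat.card_zpowers, h.orderOf_left, hn, show (4 : ℕ) = 2 ^ 2 from rfl,
    Nat.pow_lt_pow_iff_right one_lt_two] at hlt
  refine ⟨2 ^ (n - 1), ⟨n - 1, by omega, rfl⟩, ?_⟩
  rw [hn, ← pow_succ']
  congr 1
  omega

theorem odd_index (h : QuaternionData Q K C D u i j g) (hG : ¬ Group.IsSolvable G) :
    Odd (Q.subgroupOf K).index := by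
  have := h.normal
  obtain ⟨S, hS⟩ := exists_sylow_eq hG h.isCoatom h.isPGroup
  have hodd : Odd Q.index := by
    rw [← Nat.not_even_iff_odd, even_iff_two_dvd, ← hS]
    exact S.not_dvd_index
  convert hodd using 1
  have h1 : K.relIndex Q = K.index := by
    rw [← Subgroup.relIndex_sup_right, h.sup_eq_top, Subgroup.relIndex_top_right]
  have h2 := Subgroup.relIndex_mul_relIndex (Q ⊓ K) K ⊤ inf_le_right le_top
  have h3 := Subgroup.relIndex_mul_relIndex (Q ⊓ K) Q ⊤ inf_le_left le_top
  rw [← h3, Subgroup.inf_relIndex_right, Subgroup.inf_relIndex_left, h1,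
    Subgroup.relIndex_top_right, Subgroup.relIndex_top_right, mul_comm] at h2
  exact Nat.eq_of_mul_eq_mul_left (Nat.pos_of_ne_zero Subgroup.index_ne_zero_of_finite) h2

end QuaternionData

theorem Subgroup.le_of_isSolvable {G : Type*} [Group G] {Q R : Subgroup G} {x : G}
    (hQ : ∀ y, Group.IsSolvable (closure {x, y}) → y ∈ Q) (hR : R.Normal)
    (hs : Group.IsSolvable R) : R ≤ Q := fun _ hy =>
  hQ _ (isSolvable_closure_pair hs (normalizer_eq_top_iff.2 hR ▸ mem_top x) hy)

namespace QuaternionData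

variable {G : Type*} [Group G] [Finite G] {Q K C D : Subgroup G} {u i j g : G}

theorem mem_cyclic (h : QuaternionData Q K C D u i j g) {x : G} (hxQ : x ∈ Q)
    (hQ : ∀ y, Group.IsSolvable (Subgroup.closure {x, y}) → y ∈ Q) : x ∈ C := by
  by_contra hxC
  have hcx : ∀ y, y * (x * x) * y⁻¹ = x * x := by
    intro y
    rcases h.mul_self_of_notMem x hxQ hxC with hx | hx <;> rw [hx]
    · group
    · rw [← h.comm, mul_inv_cancel_right]
  have hx4 : (x * x) * (x * x) = 1 := by
    rcases h.mul_self_of_notMem x hxQ hxC with hx | hx <;> rw [hx]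
    · rw [one_mul]
    · exact h.mul_self
  have hconj : ∀ y, y * x * y⁻¹ ∈ Q := by
    intro a
    have hy := hcx a
    rw [← conj_mul] at hy
    generalize a * x * a⁻¹ = y at hy ⊢
    have hxw : x * (x * y) * x⁻¹ = (x * y)⁻¹ := by
      rw [eq_inv_iff_mul_eq_one]
      have h1 : x * (x * y) * x⁻¹ * (x * y) = x * x * (y * y) := by group
      rw [h1, hy, hx4]
    have hxN : x ∈ Subgroup.normalizer (Subgroup.zpowers (x * y) : Set G) := by
      refine Subgroup.mem_normalizer_fintype fun n hn => ?_
      obtain ⟨e, rfl⟩ := Subgroup.mem_zpowers_iff.1 hn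
      rw [← conj_zpow, hxw]
      exact Subgroup.zpow_mem _ (Subgroup.inv_mem _ (Subgroup.mem_zpowers _)) e
    refine hQ y ?_
    have h2 := Subgroup.isSolvable_closure_pair (B := Subgroup.zpowers (x * y))
      (Group.isSolvable_of_comm (G := Subgroup.zpowers (x * y)) mul_comm') hxN (Subgroup.mem_zpowers _)
    refine Subgroup.isSolvable_of_le ?_ h2
    rw [Subgroup.closure_le]
    have hx' : x ∈ Subgroup.closure {x, x * y} := Subgroup.subset_closure (by simp)
    have hw' : x * y ∈ Subgroup.closure {x, x * y} := Subgroup.subset_closure (by simp)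
    rintro b (rfl | rfl)
    · exact hx'
    · exact (Subgroup.mul_mem_cancel_left _ hx').1 hw'
  have hR : Subgroup.normalClosure {x} ≤ Q := by
    rw [Subgroup.normalClosure, Subgroup.closure_le]
    intro y hy
    obtain ⟨_, rfl, hb⟩ := Group.mem_conjugatesOfSet_iff.1 hy
    obtain ⟨b, rfl⟩ := isConj_iff.1 hb
    exact hconj b
  have hRs := Subgroup.isSolvable_of_le hR h.isSolvable
  refine h.isCoatom.1 (eq_top_iff.2 fun y _ => hQ y ?_)
  rw [Set.pair_comm]
  exact Subgroup.isSolvable_closure_pair hRs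
    ((Subgroup.normalizer_eq_top_iff (H := Subgroup.normalClosure {x})).2
      Subgroup.normalClosure_normal ▸ Subgroup.mem_top y)
    (Subgroup.subset_normalClosure rfl)

end QuaternionData

namespace QuaternionData

variable {G : Type*} [Group G] {Q K C D : Subgroup G} {u i j g : G}

theorem commutator_eq_top (h : QuaternionData Q K C D u i j g) : commutator K = ⊤ := by
  refine Subgroup.map_injective K.subtype_injective ?_
  rw [Subgroup.map_subtype_commutator, h.commutator_eq, ← MonoidHom.range_eq_map,
    Subgroup.range_subtype]

theorem map_eq (h : QuaternionData Q K C D u i j g) {H : Type*} [Group H] {π : K →* H}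
    (hker : ∀ k : K, π k = 1 ↔ k = 1 ∨ k = ⟨u, h.center_mem.2⟩) {a b : K} :
    π a = π b ↔ (a : G) = b ∨ (a : G) = u * b := by
  rw [← mul_inv_eq_one, ← map_inv, ← map_mul, hker, mul_inv_eq_one, mul_inv_eq_iff_eq_mul]
  simp only [Subtype.ext_iff, Subgroup.coe_mul]

variable [Finite G]

theorem dihedralData (h : QuaternionData Q K C D u i j g) (hG : ¬ Group.IsSolvable G) {H : Type*}
    [Group H] [Finite H] {π : K →* H} (hπ : Function.Surjective π)
    (hker : ∀ k : K, π k = 1 ↔ k = 1 ∨ k = ⟨u, h.center_mem.2⟩) {m : ℕ}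
    (hm : ∃ a, 2 ≤ a ∧ m = 2 ^ a) (hcard : Nat.card ↥(C ⊓ K) = 2 * m) :
    DihedralData (π ⟨i, h.left_mem_inf.2⟩) ((C.subgroupOf K).map π) m := by
  have := h.isCyclic
  have hcard' : Nat.card (C.subgroupOf K) = 2 * m := by
    rw [← hcard, ← Subgroup.inf_subgroupOf_right]
    exact Nat.card_congr (Subgroup.subgroupOfEquivOfLe inf_le_right).toEquiv
  refine DihedralData.of_quaternion hπ h.commutator_eq_top (u := ⟨u, h.center_mem.2⟩)
    (j := ⟨j, h.right_mem_inf.2⟩) (P := Q.subgroupOf K)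
    (fun hu => h.ne_one (congrArg Subtype.val hu)) (Subtype.ext h.mul_self)
    (fun y => Subtype.ext (h.comm y)) hker ?_ (fun y hy => h.le hy) h.left_mem_inf.1
    (Subtype.ext h.left_mul_self) h.right_mem_inf.1 h.right_notMem (fun y hy => h.mem_or_mem y hy)
    (fun y => ?_) (fun y hy hyC => ?_) hm hcard' (h.odd_index hG)
  · refine isCyclic_of_injective ((K.subtype.domRestrict (C.subgroupOf K)).codRestrict C
      fun y => y.2) fun a b hab => Subtype.ext (Subtype.ext ?_)
    exact congrArg (fun c : C => (c : G)) hab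
  · simp only [Subtype.ext_iff, Subgroup.coe_mul, Subgroup.coe_inv]
    exact ⟨h.mem_of_conj, h.conj_left y⟩
  · exact (h.mul_self_of_notMem y hy hyC).imp (Subtype.ext ·) (Subtype.ext ·)

theorem exists_pow_eq (h : QuaternionData Q K C D u i j g) {x : G} (hxC : x ∈ C) (hxK : x ∉ K)
    {c : G} (hc : c ∈ C ⊓ K) : ∃ n : ℕ, c = (x * x) ^ n := by
  obtain ⟨⟨a, haC⟩, ha⟩ := h.isCyclic
  classical
  have hpow : ∀ c ∈ C, ∃ n : ℕ, a ^ n = c := by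
    intro c hc
    obtain ⟨n, -, hn⟩ := Finset.mem_image.1 (mem_zpowers_iff_mem_range_orderOf.1 (ha ⟨c, hc⟩))
    exact ⟨n, congrArg Subtype.val hn⟩
  have heven : ∀ y ∈ C, y ∉ K → ∀ n : ℕ, y ^ n ∈ K → Even n := by
    intro y hyC hyK n hn
    by_contra hodd
    obtain ⟨l, rfl⟩ := Nat.not_even_iff_odd.1 hodd
    rw [pow_succ, pow_mul, pow_two,
      K.mul_mem_cancel_left (K.pow_mem (h.mul_self_mem hyC) l)] at hn
    exact hyK hn
  obtain ⟨e, rfl⟩ := hpow x hxC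
  have he : Odd e := by
    rw [← Nat.not_even_iff_odd]
    rintro ⟨l, rfl⟩
    rw [← two_mul, pow_mul, pow_two] at hxK
    exact hxK (K.pow_mem (h.mul_self_mem haC) l)
  obtain ⟨k, hk⟩ := (h.isPGroup.to_le (Subgroup.zpowers_le.2 (h.le haC))).exists_card_eq
  rw [Nat.card_zpowers] at hk
  obtain ⟨f, hf⟩ := exists_pow_eq_self_of_coprime (x := a) (n := e)
    (hk ▸ (Nat.coprime_two_right.2 he).pow_right k)
  obtain ⟨s, hs⟩ := hpow c hc.1
  rw [← hf, ← pow_mul] at hs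
  obtain ⟨n, hn⟩ := heven _ hxC hxK (f * s) (hs ▸ hc.2)
  refine ⟨n, ?_⟩
  rw [← hs, hn, ← two_mul, pow_mul, pow_two]

theorem action_cases (h : QuaternionData Q K C D u i j g) {H : Type*} [Group H] {π : K →* H}
    (hπ : Function.Surjective π) (hker : ∀ k : K, π k = 1 ↔ k = 1 ∨ k = ⟨u, h.center_mem.2⟩)
    [K.Normal] {θ : G →* MulAut H} (hθ : ∀ (g : G) (k : K), θ g (π k) = π (MulAut.conjNormal g k))
    {x : G} (hx : x ∈ C) :
    (∃ a ∈ (C.subgroupOf K).map π, θ x = MulAut.conj a) ∨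
      ∃ α b : H, Subgroup.zpowers α = (C.subgroupOf K).map π ∧ θ x * θ x = MulAut.conj α ∧
        (∀ a ∈ (C.subgroupOf K).map π, θ x a = a) ∧
        b * π ⟨i, h.left_mem_inf.2⟩ = π ⟨i, h.left_mem_inf.2⟩ * b ∧
        b ∉ (C.subgroupOf K).map π ∧ θ x b = α * b := by
  have hconj : ∀ y (hy : y ∈ K), θ y = MulAut.conj (π ⟨y, hy⟩) := by
    intro y hy
    ext b
    obtain ⟨k, rfl⟩ := hπ b
    rw [hθ, MulAut.conj_apply, ← map_inv, ← map_mul, ← map_mul]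
    exact congrArg π (Subtype.ext (MulAut.conjNormal_apply y k))
  by_cases hxK : x ∈ K
  · exact Or.inl ⟨_, ⟨⟨x, hxK⟩, hx, rfl⟩, hconj x hxK⟩
  have hxx := h.mul_self_mem hx
  refine Or.inr ⟨π ⟨x * x, hxx⟩, π ⟨j, h.right_mem_inf.2⟩, ?_, ?_, ?_, ?_, ?_, ?_⟩
  · refine le_antisymm (Subgroup.zpowers_le.2 ⟨_, C.mul_mem hx hx, rfl⟩) ?_
    rintro _ ⟨⟨c, hcK⟩, hc, rfl⟩
    obtain ⟨n, hn⟩ := h.exists_pow_eq hx hxK ⟨hc, hcK⟩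
    refine ⟨n, ?_⟩
    refine (zpow_natCast _ n).trans ?_
    rw [← map_pow]
    exact congrArg π (Subtype.ext hn.symm)
  · rw [← map_mul, hconj _ hxx]
  · rintro _ ⟨⟨c, hcK⟩, hc, rfl⟩
    rw [hθ]
    refine congrArg π (Subtype.ext ?_)
    have := h.isCyclic
    have hcx : x * c = c * x := congrArg Subtype.val (mul_comm' (⟨x, hx⟩ : C) ⟨c, hc⟩)
    rw [MulAut.conjNormal_apply, hcx, mul_inv_cancel_right]
  · rw [← map_mul, ← map_mul, h.map_eq hker]
    right
    simp only [Subgroup.coe_mul]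
    rw [← mul_assoc, ← h.left_inv, ← h.inverts, inv_mul_cancel_right]
  · rintro ⟨⟨c, hcK⟩, hc, hcj⟩
    have hc' : c ∈ C := hc
    rcases (h.map_eq hker).1 hcj with hcj | hcj
    · change c = j at hcj
      exact h.right_notMem (hcj ▸ hc')
    · refine h.right_notMem ((C.mul_mem_cancel_left h.center_mem.1).1 ?_)
      change c = u * j at hcj
      exact hcj ▸ hc'
  · rw [hθ, ← map_mul, h.map_eq hker]
    simp only [MulAut.conjNormal_apply, Subgroup.coe_mul]
    refine (h.conj_right x⁻¹ (C.inv_mem hx)).imp (fun h1 => ?_) fun h1 => ?_ <;>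
      rw [inv_inv, mul_inv_eq_iff_eq_mul] at h1 <;> rw [mul_assoc, h1, mul_assoc]
    rw [← mul_assoc, ← h.comm, mul_assoc, mul_assoc]

end QuaternionData

theorem QuaternionData.exists_nonempty_mulEquiv {G : Type*} [Group G] [Finite G]
    {Q K C D : Subgroup G} {u i j g : G} (h : QuaternionData Q K C D u i j g)
    (hG : ¬ Group.IsSolvable G) (h2 : ∃ n, Nat.card Q = 2 ^ n) {x : G} (hx : x ∈ Q)
    (hQ : ∀ y, Group.IsSolvable (Subgroup.closure {x, y}) → y ∈ Q) :
    ∃ p : ℕ, p.Prime ∧ (∃ n : ℕ, p = 2 ^ n - 1) ∧ 7 ≤ p ∧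
      Nonempty (K ≃* Matrix.SpecialLinearGroup (Fin 2) (ZMod p)) := by
  have := h.normal
  have hUn : (Subgroup.zpowers u).Normal := by
    have hle : Subgroup.zpowers u ≤ Subgroup.center G :=
      Subgroup.zpowers_le.2 (Subgroup.mem_center_iff.2 fun y => (h.comm y).symm)
    refine ⟨fun a ha y => ?_⟩
    rwa [Subgroup.mem_center_iff.1 (hle ha) y, mul_inv_cancel_right]
  let q := QuotientGroup.mk' (Subgroup.zpowers u)
  have hmapn : (K.map q).Normal := h.normal.map q (QuotientGroup.mk'_surjective _)
  let π := q.subgroupMap K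
  have hπ : Function.Surjective π := q.subgroupMap_surjective K
  let θ : G →* MulAut (K.map q) := MulAut.conjNormal.comp q
  have hθ : ∀ (g : G) (k : K), θ g (π k) = π (MulAut.conjNormal g k) := fun g k =>
    Subtype.ext (by simp [θ, π])
  have hker : ∀ k : K, π k = 1 ↔ k = 1 ∨ k = ⟨u, h.center_mem.2⟩ := by
    intro k
    rw [Subtype.ext_iff, Subtype.ext_iff, Subtype.ext_iff]
    change q k = 1 ↔ (k : G) = 1 ∨ (k : G) = u
    rw [QuotientGroup.mk'_apply, QuotientGroup.eq_one_iff]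
    constructor
    · rintro ⟨n, hn⟩
      change u ^ n = k at hn
      rcases Int.even_or_odd' n with ⟨l, rfl | rfl⟩
      · rw [zpow_mul, zpow_two, h.mul_self, one_zpow] at hn
        exact Or.inl hn.symm
      · rw [zpow_add, zpow_mul, zpow_two, h.mul_self, one_zpow, one_mul, zpow_one] at hn
        exact Or.inr hn.symm
    · rintro (hk | hk) <;> rw [hk]
      · exact one_mem _
      · exact Subgroup.mem_zpowers u
  have hcu : ∀ y : K, (⟨u, h.center_mem.2⟩ : K) * y = y * ⟨u, h.center_mem.2⟩ := fun y =>
    Subtype.ext (h.comm y)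
  have huu : (⟨u, h.center_mem.2⟩ : K) * ⟨u, h.center_mem.2⟩ = 1 := Subtype.ext h.mul_self
  have hu1 : (⟨u, h.center_mem.2⟩ : K) ≠ 1 := fun hu => h.ne_one (congrArg Subtype.val hu)
  obtain ⟨m, hm, hcard⟩ := h.exists_card hG
  have hD := h.dihedralData hG hπ hker hm hcard
  have hperf : commutator (K.map q) = ⊤ := by
    have h1 := congrArg (Subgroup.map π) h.commutator_eq_top
    rwa [commutator_def, Subgroup.map_commutator, Subgroup.map_top_of_surjective π hπ,
      ← commutator_def] at h1
  obtain ⟨T, v, hT, ⟨hk, hcT, hl⟩ | ⟨hk, hcT, hl⟩⟩ := hD.exists_torus_card rfl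
  · obtain ⟨n, rfl⟩ : ∃ n, m = n + 1 := by
      obtain ⟨a, -, rfl⟩ := hm
      exact ⟨2 ^ a - 1, (Nat.sub_add_cancel Nat.one_le_two_pow).symm⟩
    rw [Nat.add_sub_cancel, show 2 * (n + 1) - 1 = 2 * n + 1 by omega] at hk
    exact DihedralData.exists_nonempty_mulEquiv hπ hu1 hcu huu hker
      (fun y => mul_self_eq_of_isInvolution_map hπ huu hcu hker (i := ⟨i, h.left_mem_inf.2⟩)
        (Subtype.ext h.left_mul_self) hD.isConj) hD hT hk hcT hl
  · refine absurd hk (hD.index_ne hQ h2 hπ (fun y hy k => ?_) hθ hperf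
      (h.action_cases hπ hker hθ (h.mem_cyclic hx hQ)) hT hcT hl)
    rcases (hker y).1 hy with rfl | rfl
    · rw [one_mul, mul_one]
    · exact hcu k

theorem stmt_19 {G : Type*} [Group G] [Finite G] (hG : ¬ IsSolvable G)
    (x : G) (Q : Subgroup G) (hQ : (Q : Set G) = solubilizer x)
    (hmax : IsCoatom Q) (hmeta : IsMetacyclic ↥Q)
    (h2 : ∃ n : ℕ, Nat.card Q = 2 ^ n)
    (habelian : ∀ N : Subgroup G, N.Normal → N ≠ ⊥ →
      (∀ M : Subgroup G, M.Normal → M < N → M = ⊥) → ∀ a b : ↥N, a * b = b * a) :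
    ∃ p : ℕ, p.Prime ∧ (∃ n : ℕ, p = 2 ^ n - 1) ∧ 7 ≤ p ∧
      (Nonempty (G ≃* Matrix.SpecialLinearGroup (Fin 2) (ZMod p)) ∨
        ∃ H : Subgroup G, H.Normal ∧ H.index = 2 ∧
          Nonempty (↥H ≃* Matrix.SpecialLinearGroup (Fin 2) (ZMod p))) := by
  have hmem : ∀ y, y ∈ Q ↔ Group.IsSolvable (Subgroup.closure {x, y}) := fun y => by
    rw [← SetLike.mem_coe, hQ]
    rfl
  have hxQ : x ∈ Q := by
    rw [hmem, Set.pair_eq_singleton, ← Subgroup.zpowers_eq_closure]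
    exact Group.isSolvable_of_comm (G := Subgroup.zpowers x) mul_comm'
  obtain ⟨n, hn⟩ := h2
  have hp : IsPGroup 2 Q := IsPGroup.of_card hn
  obtain ⟨K, hK, hKK, hKs⟩ := Group.exists_perfect_normal hG
  have hK1 : K ≠ ⊥ := by
    rintro rfl
    exact hKs inferInstance
  obtain ⟨u, huK, hu1, huu, hcu⟩ := exists_central_involution hG hmax hmeta ⟨n, hn⟩ habelian hK hK1
    fun R hR hRs => Subgroup.le_of_isSolvable (fun y => (hmem y).2) hR hRs
  obtain ⟨C, D, i, j, g, h⟩ := exists_quaternionData hG hmax hp hmeta hK hKK hKs huK hu1 huu hcu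
  obtain ⟨p, hpp, hpn, hp7, ⟨e⟩⟩ :=
    h.exists_nonempty_mulEquiv hG ⟨n, hn⟩ hxQ fun y => (hmem y).2
  refine ⟨p, hpp, hpn, hp7, ?_⟩
  rcases h.index_eq with rfl | hi
  · exact Or.inl ⟨Subgroup.topEquiv.symm.trans e⟩
  · exact Or.inr ⟨K, hK, hi, ⟨e⟩⟩
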